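/- For every integer n ≥ 0, writing N_i = N(i,11,11n+8) and M_i = M(i,11,11n+8), the following hold: N_0 + 2N_2 + 3N_4 + 5M_0 ≥ 3N_1 + 3N_5 + 5M_1; 2N_1 + 4N_3 + 2N_5 + 3M_1 ≥ N_0 + 2N_2 + 5N_4 + 3M_0; 2N_1 + 5N_2 + 2N_5 + M_1 ≥ 3N_0 + 5N_3 + N_4 + M_0; 7N_0 + 4N_1 + 5N_4 + 4N_5 ≥ 8N_2 + N_3 + 4M_0 + 7M_1; and 5N_0 + 6N_1 + 4N_3 + 2N_4 ≥ N_2 + 5N_5 + 6M_0 + 5M_1. -/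

import Mathlib

/-- `p n`: the number of partitions of `n`. -/
def partitionCount (n : ℕ) : ℕ := Fintype.card (Nat.Partition n)

/-- The rank of a partition: its largest part minus its number of parts
(the empty partition has rank 0). -/
def partitionRank {n : ℕ} (π : Nat.Partition n) : ℤ :=
  (π.parts.sup : ℤ) - (Multiset.card π.parts : ℤ)

/-- The crank of a partition `π`: if `π` has no parts equal to 1, it is the largest part;
otherwise it is (number of parts larger than the number of ones) − (number of ones). -/
def partitionCrank {n : ℕ} (π : Nat.Partition n) : ℤ :=
  if π.parts.count 1 = 0 then (π.parts.sup : ℤ)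
  else ((π.parts.filter fun x => π.parts.count 1 < x).card : ℤ) - (π.parts.count 1 : ℤ)

/-- `rankCount a r n` = `N(a,r,n)`: the number of partitions of `n` whose rank is
congruent to `a` modulo `r`. -/
def rankCount (a r : ℤ) (n : ℕ) : ℕ :=
  (Finset.univ.filter fun π : Nat.Partition n => partitionRank π % r = a % r).card

/-- `crankCount a n` = `M(a,11,n)`: for `n ≠ 1`, the number of partitions of `n` whose crank
is congruent to `a` modulo 11; at `n = 1` the standard convention `M(0,11,1) = −1`,
`M(1,11,1) = M(10,11,1) = 1`, and `M(a,11,1) = 0` otherwise. -/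
def crankCount (a : ℤ) (n : ℕ) : ℤ :=
  if n = 1 then
    if a % 11 = 0 then -1
    else if a % 11 = 1 ∨ a % 11 = 10 then 1
    else 0
  else ((Finset.univ.filter fun π : Nat.Partition n => partitionCrank π % 11 = a % 11).card : ℤ)

open Filter Topology

/-- Finite `q`-Pochhammer product `(w;Q)_n`. -/
noncomputable def qP (Q w : ℝ) (n : ℕ) : ℝ := ∏ i ∈ Finset.range n, (1 - w * Q ^ i)

/-- Infinite `q`-Pochhammer product `(w;Q)_∞`. -/
noncomputable def qI (Q w : ℝ) : ℝ := ∏' i : ℕ, (1 - w * Q ^ i)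

section qProducts
variable {Q : ℝ}

lemma qP_zero (Q w : ℝ) : qP Q w 0 = 1 := by simp [qP]

lemma qP_succ (Q w : ℝ) (n : ℕ) : qP Q w (n + 1) = qP Q w n * (1 - w * Q ^ n) := by
  simp [qP, Finset.prod_range_succ]

lemma qP_succ' (Q w : ℝ) (n : ℕ) : qP Q w (n + 1) = (1 - w) * qP Q (w * Q) n := by
  simp only [qP, Finset.prod_range_succ']
  rw [mul_comm]; congr 1
  · simp
  · exact Finset.prod_congr rfl fun i _ => by ring

lemma summable_abs_qfactor (hQ : 0 < Q) (hQ1 : Q < 1) (w : ℝ) :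
    Summable fun i : ℕ => ‖-(w * Q ^ i)‖ := by
  have : Summable fun i : ℕ => |w| * Q ^ i :=
    (summable_geometric_of_lt_one hQ.le hQ1).mul_left _
  refine this.congr fun i => ?_
  rw [norm_neg, norm_mul, norm_pow, Real.norm_eq_abs, Real.norm_of_nonneg hQ.le]

lemma multipliable_qI (hQ : 0 < Q) (hQ1 : Q < 1) (w : ℝ) :
    Multipliable fun i : ℕ => (1 - w * Q ^ i) := by
  simpa [sub_eq_add_neg] using multipliable_one_add_of_summable (summable_abs_qfactor hQ hQ1 w)

lemma qP_tendsto (hQ : 0 < Q) (hQ1 : Q < 1) (w : ℝ) :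
    Tendsto (qP Q w) atTop (𝓝 (qI Q w)) :=
  (multipliable_qI hQ hQ1 w).hasProd.tendsto_prod_nat

lemma qI_succ (hQ : 0 < Q) (hQ1 : Q < 1) (w : ℝ) : qI Q w = (1 - w) * qI Q (w * Q) := by
  refine tendsto_nhds_unique ((tendsto_add_atTop_iff_nat 1).2 (qP_tendsto hQ hQ1 w)) ?_
  simp only [qP_succ']
  exact (qP_tendsto hQ hQ1 _).const_mul _

lemma qI_ne_zero (hQ : 0 < Q) (hQ1 : Q < 1) {w : ℝ} (hw : ∀ i : ℕ, w * Q ^ i ≠ 1) :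
    qI Q w ≠ 0 := by
  have := tprod_one_add_ne_zero_of_summable (f := fun i : ℕ => -(w * Q ^ i))
    (fun i => by have := hw i; intro h; apply this; linarith) (summable_abs_qfactor hQ hQ1 w)
  simpa [qI, sub_eq_add_neg] using this

lemma qP_ne_zero {w : ℝ} (hw : ∀ i : ℕ, w * Q ^ i ≠ 1) (n : ℕ) : qP Q w n ≠ 0 :=
  Finset.prod_ne_zero_iff.2 fun i _ h => hw i (by linarith)

lemma bounded_of_tendsto {f : ℕ → ℝ} {a : ℝ} (h : Tendsto f atTop (𝓝 a)) :
    ∃ C : ℝ, 0 < C ∧ ∀ n, |f n| ≤ C := by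
  obtain ⟨C, hC⟩ := (Metric.isBounded_range_of_tendsto f h).exists_norm_le
  refine ⟨max C 1, by positivity, fun n => (hC _ ⟨n, rfl⟩).trans (le_max_left _ _)⟩

lemma qP_bounded (hQ : 0 < Q) (hQ1 : Q < 1) (w : ℝ) : ∃ C : ℝ, 0 < C ∧ ∀ n, |qP Q w n| ≤ C :=
  bounded_of_tendsto (qP_tendsto hQ hQ1 w)

lemma qP_inv_bounded (hQ : 0 < Q) (hQ1 : Q < 1) {w : ℝ} (hw : ∀ i : ℕ, w * Q ^ i ≠ 1) :
    ∃ C : ℝ, 0 < C ∧ ∀ n, |(qP Q w n)⁻¹| ≤ C :=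
  bounded_of_tendsto ((qP_tendsto hQ hQ1 w).inv₀ (qI_ne_zero hQ hQ1 hw))

lemma self_mul_pow_ne_one (hQ : 0 < Q) (hQ1 : Q < 1) (i : ℕ) : Q * Q ^ i ≠ 1 := by
  rw [← pow_succ']; exact (pow_lt_one₀ hQ.le hQ1 (by simp)).ne

lemma qI_self_ne_zero (hQ : 0 < Q) (hQ1 : Q < 1) : qI Q Q ≠ 0 :=
  qI_ne_zero hQ hQ1 (self_mul_pow_ne_one hQ hQ1)

/-- `1/(Q;Q)_m`, extended by zero to negative integers. -/
noncomputable def uZ (Q : ℝ) (m : ℤ) : ℝ := if 0 ≤ m then (qP Q Q m.toNat)⁻¹ else 0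

lemma uZ_neg (Q : ℝ) {m : ℤ} (h : m < 0) : uZ Q m = 0 := by simp [uZ, h]

lemma uZ_zero (Q : ℝ) : uZ Q 0 = 1 := by simp [uZ, qP_zero]

lemma uZ_sub_one (hQ : 0 < Q) (hQ1 : Q < 1) (m : ℤ) :
    uZ Q (m - 1) = (1 - Q ^ m) * uZ Q m := by
  rcases lt_trichotomy m 0 with h | h | h
  · rw [uZ_neg Q h, uZ_neg Q (by linarith)]; simp
  · subst h; rw [uZ_neg Q (by norm_num)]; simp
  · obtain ⟨n, rfl⟩ : ∃ n : ℕ, m = n + 1 := ⟨(m - 1).toNat, by omega⟩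
    have h1 : ((n : ℤ) + 1 - 1) = n := by ring
    have h3 := self_mul_pow_ne_one hQ hQ1 n
    have h5 : (1 - Q * Q ^ n) ≠ 0 := fun h => h3 (by linarith)
    have h2 : (0:ℤ) ≤ (n : ℤ) + 1 := by positivity
    rw [h1, uZ, uZ, if_pos h2, if_pos (by positivity), Int.toNat_natCast,
      show ((n : ℤ) + 1).toNat = n + 1 from rfl, qP_succ,
      show (Q : ℝ) ^ ((n : ℤ) + 1) = Q * Q ^ n by
        rw [← pow_succ']; exact_mod_cast zpow_natCast Q (n + 1), mul_inv]
    field_simp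

lemma uZ_bounded (hQ : 0 < Q) (hQ1 : Q < 1) : ∃ C : ℝ, 0 < C ∧ ∀ n, |uZ Q n| ≤ C := by
  obtain ⟨C, hC, h⟩ := qP_inv_bounded hQ hQ1 (self_mul_pow_ne_one hQ hQ1)
  refine ⟨C, hC, fun n => ?_⟩
  unfold uZ; split_ifs
  · exact h _
  · simpa using hC.le

lemma uZ_tendsto_add (hQ : 0 < Q) (hQ1 : Q < 1) (k : ℤ) :
    Tendsto (fun N : ℕ => uZ Q (N + k)) atTop (𝓝 (qI Q Q)⁻¹) := by
  have h1 : Tendsto (fun N : ℕ => ((N : ℤ) + k).toNat) atTop atTop := by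
    refine tendsto_atTop.2 fun b => ?_
    filter_upwards [eventually_ge_atTop (b + k.natAbs)] with N hN
    omega
  have := ((qP_tendsto hQ hQ1 Q).inv₀ (qI_self_ne_zero hQ hQ1)).comp h1
  refine this.congr' ?_
  filter_upwards [eventually_ge_atTop k.natAbs] with N hN
  simp only [Function.comp, uZ]
  rw [if_pos (by omega)]

lemma summable_rpow_abs (hQ : 0 < Q) (hQ1 : Q < 1) :
    Summable fun k : ℤ => Q ^ |(k : ℝ)| := by
  have h := summable_geometric_of_lt_one hQ.le hQ1
  refine Summable.of_nat_of_neg ?_ ?_ <;>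
  · refine h.congr fun n => ?_
    simp

lemma summable_quad (hQ : 0 < Q) (hQ1 : Q < 1) {c : ℝ} (hc : 0 < c) (d e : ℝ) :
    Summable fun k : ℤ => Q ^ (c * k ^ 2 + d * k + e) := by
  have h := (summable_rpow_abs hQ hQ1).mul_left (Q ^ (-(1 + |d|) ^ 2 / (4 * c) + e))
  refine Summable.of_nonneg_of_le (fun k => by positivity) (fun k => ?_) h
  rw [← Real.rpow_add hQ]
  apply Real.rpow_le_rpow_of_exponent_ge hQ hQ1.le
  have h1 : -(|d| * |(k : ℝ)|) ≤ d * k := by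
    rw [← abs_mul]; exact neg_abs_le _
  have h2 : (1 + |d|) * |(k:ℝ)| ≤ c * k ^ 2 + (1 + |d|) ^ 2 / (4 * c) := by
    have h3 : c * (k:ℝ) ^ 2 + (1 + |d|) ^ 2 / (4 * c) - (1 + |d|) * |(k:ℝ)|
      = c * (|(k:ℝ)| - (1 + |d|) / (2 * c)) ^ 2 := by
      rw [← sq_abs (k:ℝ)]; field_simp; ring
    have : 0 ≤ c * (|(k:ℝ)| - (1 + |d|) / (2 * c)) ^ 2 := by positivity
    linarith
  have h4 : -(1 + |d|) ^ 2 / (4 * c) = -((1 + |d|) ^ 2 / (4 * c)) := by ring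
  rw [h4]; nlinarith

lemma abs_eq_rpow (hQ : 0 < Q) (hQ1 : Q < 1) {w : ℝ} (hw : w ≠ 0) : ∃ d : ℝ, |w| = Q ^ d :=
  ⟨Real.logb Q |w|, (Real.rpow_logb hQ hQ1.ne (abs_pos.2 hw)).symm⟩

lemma abs_zpow_eq {w d : ℝ} (hQ : 0 < Q) (h : |w| = Q ^ d) (k : ℤ) : |w ^ k| = Q ^ (d * k) := by
  rw [abs_zpow, h, Real.rpow_mul hQ.le, Real.rpow_intCast]

lemma summable_quad_zpow (hQ : 0 < Q) (hQ1 : Q < 1) {c : ℝ} (hc : 0 < c) (d e : ℝ)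
    {w : ℝ} (hw : w ≠ 0) :
    Summable fun k : ℤ => |Q ^ (c * k ^ 2 + d * k + e) * w ^ k| := by
  obtain ⟨d', hd⟩ := abs_eq_rpow hQ hQ1 hw
  refine (summable_quad hQ hQ1 hc (d + d') e).congr fun k => ?_
  rw [abs_mul, abs_zpow_eq hQ hd, abs_of_pos (by positivity), ← Real.rpow_add hQ]
  congr 1; ring

lemma HasSum.congr_eq {ι : Type*} {f g : ι → ℝ} {a b : ℝ} (h : HasSum f a)
    (hf : ∀ k, g k = f k) (hab : b = a) : HasSum g b := by
  rw [hab, funext hf]; exact h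

lemma jtp_finite (hQ : 0 < Q) (hQ1 : Q < 1) {w : ℝ} (hw : w ≠ 0) (N : ℕ) :
    HasSum (fun k : ℤ => Q ^ ((k : ℝ) * (k - 1) / 2) * (-w) ^ k * (uZ Q (N - k) * uZ Q (N + k)))
      (qP Q w N * qP Q (Q / w) N * (qP Q Q (2 * N))⁻¹) := by
  induction N with
  | zero =>
    convert hasSum_single (0 : ℤ) ?_ using 1
    · simp [qP_zero, uZ_zero]
    · intro k hk
      rcases lt_or_gt_of_ne hk with h | h
      · rw [show uZ Q ((0:ℕ) + k) = 0 from uZ_neg Q (by simpa using h)]; simp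
      · rw [show uZ Q ((0:ℕ) - k) = 0 from uZ_neg Q (by simpa using h)]; simp
  | succ N ih =>
    have h1 := (Equiv.addRight (-1 : ℤ)).hasSum_iff.2 ih
    have h2 := (Equiv.addRight (1 : ℤ)).hasSum_iff.2 ih
    have hA : (1 - Q * Q ^ (2 * N)) ≠ 0 := fun h => self_mul_pow_ne_one hQ hQ1 (2 * N) (by linarith)
    have hB : (1 - Q * Q ^ (2 * N + 1)) ≠ 0 :=
      fun h => self_mul_pow_ne_one hQ hQ1 (2 * N + 1) (by linarith)
    have h3 := (((ih.mul_left (1 + Q ^ (2 * N + 1))).sub (h1.mul_left (w * Q ^ N))).sub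
      (h2.mul_left (Q ^ (N + 1) / w))).mul_left ((1 - Q * Q ^ (2 * N))⁻¹ * (1 - Q * Q ^ (2 * N + 1))⁻¹)
    refine h3.congr_eq (fun k => ?_) ?_
    · simp only [Function.comp, Equiv.coe_addRight]
      rw [show (((N + 1 : ℕ) : ℤ) - k) = (N - k) + 1 by push_cast; ring,
        show (((N + 1 : ℕ) : ℤ) + k) = (N + k) + 1 by push_cast; ring]
      have e1 : uZ Q (N - (k + -1)) = uZ Q (N - k + 1) := by congr 1; ring
      have e2 : uZ Q (N + (k + 1)) = uZ Q (N + k + 1) := by congr 1; ring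
      have e3 : uZ Q (N - k) = (1 - Q ^ ((N:ℤ) - k + 1)) * uZ Q (N - k + 1) := by
        rw [← uZ_sub_one hQ hQ1]; congr 1; ring
      have e4 : uZ Q (N + k) = (1 - Q ^ ((N:ℤ) + k + 1)) * uZ Q (N + k + 1) := by
        rw [← uZ_sub_one hQ hQ1]; congr 1; ring
      have e5 : uZ Q (N - (k + 1)) = (1 - Q ^ ((N:ℤ) - k)) * uZ Q (N - k) := by
        rw [← uZ_sub_one hQ hQ1]; congr 1; ring
      have e6 : uZ Q (N + (k + -1)) = (1 - Q ^ ((N:ℤ) + k)) * uZ Q (N + k) := by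
        rw [← uZ_sub_one hQ hQ1]; congr 1; ring
      rw [e1, e2, e5, e6, e3, e4]
      have r1 : Q ^ ((((k + -1 : ℤ) : ℝ)) * (((k + -1 : ℤ) : ℝ) - 1) / 2)
          = Q ^ ((k : ℝ) * (k - 1) / 2) * (Q * (Q ^ k)⁻¹) := by
        rw [← Real.rpow_intCast, ← Real.rpow_neg hQ.le]
        nth_rw 3 [← Real.rpow_one Q]
        rw [← Real.rpow_add hQ, ← Real.rpow_add hQ]; congr 1; push_cast; ring
      have r2 : Q ^ ((((k + 1 : ℤ) : ℝ)) * (((k + 1 : ℤ) : ℝ) - 1) / 2)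
          = Q ^ ((k : ℝ) * (k - 1) / 2) * (Q ^ k) := by
        rw [← Real.rpow_intCast, ← Real.rpow_add hQ]; congr 1; push_cast; ring
      rw [r1, r2, zpow_add₀ (neg_ne_zero.2 hw), zpow_add₀ (neg_ne_zero.2 hw),
        zpow_add₀ hQ.ne', zpow_add₀ hQ.ne', zpow_sub₀ hQ.ne', zpow_add₀ hQ.ne']
      simp only [zpow_natCast, zpow_one, zpow_neg]
      have hk : Q ^ k ≠ 0 := zpow_ne_zero _ hQ.ne'
      have hA' : 1 - Q * (Q ^ N) ^ 2 ≠ 0 := by rwa [← pow_mul, mul_comm N 2]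
      have hB' : 1 - Q ^ 2 * (Q ^ N) ^ 2 ≠ 0 := by
        intro h; apply hB; rw [← h]; ring
      rw [show Q ^ (2 * N + 1) = Q * (Q ^ N) ^ 2 by ring, show Q ^ (2 * N) = (Q ^ N) ^ 2 by ring,
        show Q * (Q * (Q ^ N) ^ 2) = Q ^ 2 * (Q ^ N) ^ 2 by ring, pow_succ Q N]
      generalize Q ^ k = K at *
      generalize Q ^ N = M at *
      field_simp
      ring
    · rw [show 2 * (N + 1) = 2 * N + 1 + 1 by ring, qP_succ, qP_succ, qP_succ, qP_succ, mul_inv,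
        mul_inv]
      have : qP Q Q (2 * N) ≠ 0 := qP_ne_zero (self_mul_pow_ne_one hQ hQ1) _
      field_simp
      ring

/-- Jacobi's triple product identity. -/
theorem jtp (hQ : 0 < Q) (hQ1 : Q < 1) {w : ℝ} (hw : w ≠ 0) :
    HasSum (fun k : ℤ => Q ^ ((k : ℝ) * (k - 1) / 2) * (-w) ^ k)
      (qI Q w * qI Q (Q / w) * qI Q Q) := by
  obtain ⟨C, hC, hb⟩ := uZ_bounded hQ hQ1
  have hs : Summable fun k : ℤ => |Q ^ ((k : ℝ) * (k - 1) / 2) * (-w) ^ k| := by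
    refine (summable_quad_zpow hQ hQ1 (c := 1/2) (by norm_num) (-1/2) 0 (neg_ne_zero.2 hw)).congr
      fun k => ?_
    congr 3; ring
  have hne := qI_self_ne_zero hQ hQ1
  have key := tendsto_tsum_of_dominated_convergence (𝓕 := atTop)
    (f := fun (N : ℕ) (k : ℤ) =>
      Q ^ ((k : ℝ) * (k - 1) / 2) * (-w) ^ k * (uZ Q (N - k) * uZ Q (N + k)))
    (g := fun k : ℤ => Q ^ ((k : ℝ) * (k - 1) / 2) * (-w) ^ k * ((qI Q Q)⁻¹ * (qI Q Q)⁻¹))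
    (hs.mul_right (C * C))
    (fun k => ((uZ_tendsto_add hQ hQ1 (-k)).mul (uZ_tendsto_add hQ hQ1 k)).const_mul _)
    (Eventually.of_forall fun N k => by
      rw [Real.norm_eq_abs, abs_mul, abs_mul (uZ _ _)]
      gcongr <;> exact hb _)
  have key2 := (((qP_tendsto hQ hQ1 w).mul (qP_tendsto hQ hQ1 (Q / w))).mul
    (((qP_tendsto hQ hQ1 Q).inv₀ hne).comp (tendsto_id.const_mul_atTop' (r := 2) two_pos)))
  have h3 := tendsto_nhds_unique (key.congr fun N => (jtp_finite hQ hQ1 hw N).tsum_eq) key2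
  rw [tsum_mul_right] at h3
  have h4 : ∑' k : ℤ, Q ^ ((k : ℝ) * (k - 1) / 2) * (-w) ^ k
      = qI Q w * qI Q (Q / w) * qI Q Q := by
    field_simp at h3
    linarith
  rw [← h4]
  exact hs.of_abs.hasSum

end qProducts

section partialFractions
variable {Q : ℝ}

/-- `j(w;Q) = (w;Q)_∞ (Q/w;Q)_∞`. -/
noncomputable def jj (Q w : ℝ) : ℝ := qI Q w * qI Q (Q / w)

lemma prod_Icc_erase {n : ℤ} {N : ℕ} (h1 : -(N : ℤ) ≤ n) (h2 : n ≤ N) (f : ℤ → ℝ) :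
    ∏ m ∈ (Finset.Icc (-(N : ℤ)) N).erase n, f m
      = (∏ i ∈ Finset.range (N - n).toNat, f (n + 1 + i)) *
        ∏ i ∈ Finset.range (N + n).toNat, f (n - 1 - i) := by
  have hsplit : (Finset.Icc (-(N : ℤ)) N).erase n
      = Finset.Icc (n + 1) (N : ℤ) ∪ Finset.Icc (-(N : ℤ)) (n - 1) := by
    ext m; simp only [Finset.mem_erase, Finset.mem_Icc, Finset.mem_union]; omega
  rw [hsplit, Finset.prod_union]
  · congr 1
    · refine Finset.prod_nbij' (fun m => (m - n - 1).toNat) (fun i => n + 1 + (i : ℤ)) ?_ ?_ ?_ ?_ ?_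
      · intro m hm; simp only [Finset.mem_Icc, Finset.mem_range] at *; omega
      · intro m hm; simp only [Finset.mem_Icc, Finset.mem_range] at *; omega
      · intro m hm; simp only [Finset.mem_Icc] at *; omega
      · intro m hm; simp only [Finset.mem_range] at *; omega
      · intro m hm; simp only [Finset.mem_Icc] at *; congr 1; omega
    · refine Finset.prod_nbij' (fun m => (n - 1 - m).toNat) (fun i => n - 1 - (i : ℤ)) ?_ ?_ ?_ ?_ ?_
      · intro m hm; simp only [Finset.mem_Icc, Finset.mem_range] at *; omega
      · intro m hm; simp only [Finset.mem_Icc, Finset.mem_range] at *; omega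
      · intro m hm; simp only [Finset.mem_Icc] at *; omega
      · intro m hm; simp only [Finset.mem_range] at *; omega
      · intro m hm; simp only [Finset.mem_Icc] at *; congr 1; omega
  · rw [Finset.disjoint_left]; intro m hm hm'; simp only [Finset.mem_Icc] at *; omega

/-- Normalising factor of a block of nodes. -/
noncomputable def blockK (Q x : ℝ) (N : ℕ) : ℝ := (-x) ^ N * Q ^ (-((N : ℝ) * (N + 1) / 2))

lemma prod_upper (hQ : 0 < Q) {x z : ℝ} (hz : z ≠ 0) (n : ℤ) (A : ℕ) :
    ∏ i ∈ Finset.range A, (z * Q ^ n - x * Q ^ (n + 1 + (i : ℤ)))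
      = (z * Q ^ n) ^ A * qP Q (x / z * Q) A := by
  induction A with
  | zero => simp [qP_zero]
  | succ A ih =>
    rw [Finset.prod_range_succ, ih, qP_succ, zpow_add₀ hQ.ne', zpow_add₀ hQ.ne', zpow_natCast]
    field_simp
    ring

lemma prod_lower (hQ : 0 < Q) {x z : ℝ} (hx : x ≠ 0) (n : ℤ) (M : ℕ) :
    ∏ i ∈ Finset.range M, (z * Q ^ n - x * Q ^ (n - 1 - (i : ℤ)))
      = (-x) ^ M * Q ^ ((M : ℝ) * n - M * (M + 1) / 2) * qP Q (Q / (x / z)) M := by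
  induction M with
  | zero => simp [qP_zero]
  | succ M ih =>
    have e : Q ^ (((M + 1 : ℕ) : ℝ) * n - ((M + 1 : ℕ) : ℝ) * (((M + 1 : ℕ) : ℝ) + 1) / 2)
        = Q ^ ((M : ℝ) * n - M * (M + 1) / 2) * (Q ^ n * (Q * Q ^ M)⁻¹) := by
      rw [← pow_succ', ← Real.rpow_natCast Q (M + 1), ← Real.rpow_intCast, ← Real.rpow_neg hQ.le,
        ← Real.rpow_add hQ, ← Real.rpow_add hQ]
      congr 1; push_cast; ring
    rw [Finset.prod_range_succ, ih, qP_succ, e, zpow_sub₀ hQ.ne', zpow_sub₀ hQ.ne', zpow_natCast,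
      zpow_one]
    field_simp
    ring

lemma block_erase (hQ : 0 < Q) {x z : ℝ} (hx : x ≠ 0) (hz : z ≠ 0) {n : ℤ} {N : ℕ}
    (h1 : -(N : ℤ) ≤ n) (h2 : n ≤ N) :
    ∏ m ∈ (Finset.Icc (-(N : ℤ)) N).erase n, (z * Q ^ n - x * Q ^ m)
      = blockK Q x N * (z * Q ^ n) ^ N * (-x / z) ^ n * Q ^ (-((n : ℝ) * (n + 1) / 2)) *
        (qP Q (x / z * Q) (N - n).toNat * qP Q (Q / (x / z)) (N + n).toNat) := by
  rw [prod_Icc_erase h1 h2, prod_upper hQ hz, prod_lower hQ hx]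
  obtain ⟨A, hA⟩ : ∃ A : ℕ, (A : ℤ) = N - n := ⟨(N - n).toNat, by omega⟩
  obtain ⟨M, hM⟩ : ∃ M : ℕ, (M : ℤ) = N + n := ⟨(N + n).toNat, by omega⟩
  rw [← hA, ← hM, Int.toNat_natCast, Int.toNat_natCast]
  have hv : z * Q ^ n ≠ 0 := mul_ne_zero hz (zpow_ne_zero _ hQ.ne')
  have hM' : (M : ℝ) = N + n := by exact_mod_cast hM
  have key : (z * Q ^ n) ^ A * ((-x) ^ M * Q ^ ((M : ℝ) * n - M * (M + 1) / 2))
      = blockK Q x N * (z * Q ^ n) ^ N * (-x / z) ^ n * Q ^ (-((n : ℝ) * (n + 1) / 2)) := by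
    rw [← zpow_natCast _ A, ← zpow_natCast _ M, hA, hM, zpow_sub₀ hv, zpow_add₀ (neg_ne_zero.2 hx),
      div_zpow, mul_zpow, blockK, hM']
    have e : Q ^ (((N : ℝ) + n) * n - (N + n) * (N + n + 1) / 2)
        = Q ^ (-((N : ℝ) * (N + 1) / 2)) * Q ^ (-((n : ℝ) * (n + 1) / 2)) * ((Q ^ n) ^ n) := by
      rw [← zpow_mul, ← Real.rpow_intCast, ← Real.rpow_add hQ, ← Real.rpow_add hQ]
      congr 1; push_cast; ring
    rw [e, zpow_natCast, zpow_natCast]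
    have : Q ^ n ≠ 0 := zpow_ne_zero _ hQ.ne'
    rw [zpow_natCast, mul_zpow]
    field_simp
    ring
  rw [← key]; ring

/-- The truncated version of `jj`. -/
noncomputable def jP (Q w : ℝ) (n : ℤ) (N : ℕ) : ℝ :=
  qP Q w ((N - n).toNat + 1) * qP Q (Q / w) (N + n).toNat

lemma block_full (hQ : 0 < Q) {x z : ℝ} (hx : x ≠ 0) (hz : z ≠ 0) {n : ℤ} {N : ℕ}
    (h1 : -(N : ℤ) ≤ n) (h2 : n ≤ N) :
    ∏ m ∈ Finset.Icc (-(N : ℤ)) N, (z * Q ^ n - x * Q ^ m)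
      = blockK Q x N * (z * Q ^ n) ^ N * (-x / z) ^ n * Q ^ (-((n : ℝ) * (n + 1) / 2)) *
        (z * Q ^ n) * jP Q (x / z) n N := by
  rw [← Finset.mul_prod_erase _ _ (Finset.mem_Icc.2 ⟨h1, h2⟩), block_erase hQ hx hz h1 h2, jP,
    qP_succ']
  field_simp

lemma blockK_ne_zero (hQ : 0 < Q) {x : ℝ} (hx : x ≠ 0) (N : ℕ) : blockK Q x N ≠ 0 :=
  mul_ne_zero (pow_ne_zero _ (neg_ne_zero.2 hx)) (Real.rpow_pos_of_pos hQ _).ne'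

lemma inv_one_sub_bounded (hQ : 0 < Q) (hQ1 : Q < 1) {x : ℝ} (hx : x ≠ 0) :
    ∃ C : ℝ, 0 < C ∧ ∀ n : ℤ, |(1 - x * Q ^ n)⁻¹| ≤ C := by
  have hp := tendsto_pow_atTop_nhds_zero_of_lt_one hQ.le hQ1
  have t1 : Tendsto (fun n : ℕ => (1 - x * Q ^ n)⁻¹) atTop (𝓝 (1 - x * 0)⁻¹) :=
    (tendsto_const_nhds.sub (hp.const_mul x)).inv₀ (by simp)
  have t2 : Tendsto (fun n : ℕ => Q ^ n * (Q ^ n - x)⁻¹) atTop (𝓝 (0 * (0 - x)⁻¹)) :=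
    hp.mul ((hp.sub tendsto_const_nhds).inv₀ (by simpa using hx))
  obtain ⟨C1, h1, b1⟩ := bounded_of_tendsto t1
  obtain ⟨C2, h2, b2⟩ := bounded_of_tendsto t2
  refine ⟨max C1 C2, lt_max_of_lt_left h1, fun n => ?_⟩
  obtain ⟨m, rfl | rfl⟩ := n.eq_nat_or_neg
  · rw [zpow_natCast]; exact (b1 m).trans (le_max_left _ _)
  · refine le_trans (le_of_eq ?_) ((b2 m).trans (le_max_right _ _))
    rw [zpow_neg, zpow_natCast]
    congr 1
    have : Q ^ m ≠ 0 := pow_ne_zero _ hQ.ne'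
    rw [show 1 - x * (Q ^ m)⁻¹ = (Q ^ m - x) * (Q ^ m)⁻¹ by field_simp, mul_inv, inv_inv, mul_comm]

lemma toNat_tendsto (n : ℤ) : Tendsto (fun N : ℕ => ((N : ℤ) + n).toNat) atTop atTop := by
  refine tendsto_atTop.2 fun b => ?_
  filter_upwards [eventually_ge_atTop (b + n.natAbs)] with N hN
  omega

lemma jP_tendsto (hQ : 0 < Q) (hQ1 : Q < 1) (w : ℝ) (n : ℤ) :
    Tendsto (jP Q w n) atTop (𝓝 (jj Q w)) :=
  ((qP_tendsto hQ hQ1 w).comp ((tendsto_add_atTop_iff_nat 1).2 tendsto_id |>.comp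
    (by simpa [sub_eq_add_neg] using toNat_tendsto (-n)))).mul
    ((qP_tendsto hQ hQ1 (Q / w)).comp (toNat_tendsto n))

lemma jP_bounded (hQ : 0 < Q) (hQ1 : Q < 1) (w : ℝ) :
    ∃ C : ℝ, 0 < C ∧ ∀ n N, |jP Q w n N| ≤ C := by
  obtain ⟨C1, h1, b1⟩ := qP_bounded hQ hQ1 w
  obtain ⟨C2, h2, b2⟩ := qP_bounded hQ hQ1 (Q / w)
  refine ⟨C1 * C2, by positivity, fun n N => ?_⟩
  rw [jP, abs_mul]; gcongr <;> apply_assumption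

lemma ne_one_of_zpow (hQ : 0 < Q) {w : ℝ} (hw : w ≠ 0) (h : ∀ n : ℤ, w ≠ Q ^ n) :
    (∀ i : ℕ, w * Q ^ i ≠ 1) ∧ ∀ i : ℕ, Q / w * Q ^ i ≠ 1 := by
  constructor
  · intro i hi
    apply h (-(i : ℤ))
    rw [zpow_neg, zpow_natCast]; exact eq_inv_of_mul_eq_one_left hi
  · intro i hi
    apply h ((i : ℤ) + 1)
    rw [zpow_add₀ hQ.ne', zpow_natCast, zpow_one]
    field_simp at hi; linarith

lemma jP_inv_bounded (hQ : 0 < Q) (hQ1 : Q < 1) {w : ℝ} (hw : w ≠ 0) (h : ∀ n : ℤ, w ≠ Q ^ n) :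
    ∃ C : ℝ, 0 < C ∧ ∀ n N, |(jP Q w n N)⁻¹| ≤ C := by
  obtain ⟨C1, h1, b1⟩ := qP_inv_bounded hQ hQ1 (ne_one_of_zpow hQ hw h).1
  obtain ⟨C2, h2, b2⟩ := qP_inv_bounded hQ hQ1 (ne_one_of_zpow hQ hw h).2
  refine ⟨C1 * C2, by positivity, fun n N => ?_⟩
  rw [jP, mul_inv, abs_mul]; gcongr <;> apply_assumption

lemma jj_ne_zero (hQ : 0 < Q) (hQ1 : Q < 1) {w : ℝ} (hw : w ≠ 0) (h : ∀ n : ℤ, w ≠ Q ^ n) :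
    jj Q w ≠ 0 :=
  mul_ne_zero (qI_ne_zero hQ hQ1 (ne_one_of_zpow hQ hw h).1)
    (qI_ne_zero hQ hQ1 (ne_one_of_zpow hQ hw h).2)

end partialFractions

section partialFractions2
variable {Q : ℝ}

/-- General term of the partial fraction expansions. -/
noncomputable def pfTerm (Q z ρ : ℝ) (l : ℕ) (e n : ℤ) : ℝ :=
  (z * Q ^ n) ^ e * Q ^ ((l : ℝ) * (n * (n + 1) / 2)) * ρ ^ n * (1 - z * Q ^ n)⁻¹

lemma pfTerm_summable (hQ : 0 < Q) (hQ1 : Q < 1) {z ρ : ℝ} (hz : z ≠ 0) (hρ : ρ ≠ 0) {l : ℕ}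
    (hl : 0 < l) (e : ℤ) : Summable fun n => |pfTerm Q z ρ l e n| := by
  obtain ⟨C, hC, hb⟩ := inv_one_sub_bounded hQ hQ1 hz
  have h := (summable_quad_zpow hQ hQ1 (c := (l : ℝ) / 2) (by positivity) (l / 2 + e) 0 hρ).mul_left
    (|z ^ e| * C)
  refine Summable.of_nonneg_of_le (fun n => abs_nonneg _) (fun n => ?_) h
  rw [pfTerm, mul_zpow, abs_mul]
  have : Q ^ ((l : ℝ) / 2 * n ^ 2 + (l / 2 + e) * n + 0)
      = (Q ^ n) ^ e * Q ^ ((l : ℝ) * (n * (n + 1) / 2)) := by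
    rw [← zpow_mul, ← Real.rpow_intCast, ← Real.rpow_add hQ]; congr 1; push_cast; ring
  rw [this, show z ^ e * (Q ^ n) ^ e * Q ^ ((l : ℝ) * (n * (n + 1) / 2)) * ρ ^ n
    = z ^ e * ((Q ^ n) ^ e * Q ^ ((l : ℝ) * (n * (n + 1) / 2)) * ρ ^ n) by ring, abs_mul]
  have := hb n
  nlinarith [mul_nonneg (abs_nonneg (z ^ e))
    (abs_nonneg ((Q ^ n) ^ e * Q ^ ((l : ℝ) * (n * (n + 1) / 2)) * ρ ^ n)), mul_le_mul_of_nonneg_left this (mul_nonneg (abs_nonneg (z ^ e))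
    (abs_nonneg ((Q ^ n) ^ e * Q ^ ((l : ℝ) * (n * (n + 1) / 2)) * ρ ^ n)))]

variable {ι κ : Type} [Fintype ι] [Fintype κ] [DecidableEq ι]

lemma prod_erase_product (i : ι) (n : ℤ) (N : ℕ)
    (hn : n ∈ Finset.Icc (-(N : ℤ)) N) (g : ι × ℤ → ℝ) :
    ∏ b ∈ ((Finset.univ : Finset ι) ×ˢ Finset.Icc (-(N : ℤ)) N).erase (i, n), g b
      = (∏ k ∈ Finset.univ.erase i, ∏ m ∈ Finset.Icc (-(N : ℤ)) N, g (k, m)) *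
        ∏ m ∈ (Finset.Icc (-(N : ℤ)) N).erase n, g (i, m) := by
  have : ((Finset.univ : Finset ι) ×ˢ Finset.Icc (-(N : ℤ)) N).erase (i, n)
      = ((Finset.univ.erase i) ×ˢ Finset.Icc (-(N : ℤ)) N) ∪
        ({i} ×ˢ (Finset.Icc (-(N : ℤ)) N).erase n) := by
    ext ⟨k, m⟩
    simp only [Finset.mem_erase, Finset.mem_product, Finset.mem_union, Finset.mem_univ,
      Finset.mem_singleton, Prod.mk.injEq, ne_eq, true_and, not_and]
    by_cases hk : k = i
    · subst hk; simp
    · simp [hk]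
  rw [this, Finset.prod_union, Finset.prod_product, Finset.prod_product, Finset.prod_singleton]
  rw [Finset.disjoint_left]; rintro ⟨k, m⟩ h h'
  simp only [Finset.mem_erase, Finset.mem_product, Finset.mem_singleton] at h h'
  exact h.1.1 h'.1

/-- The truncated coefficient. -/
noncomputable def pfCoefP (Q : ℝ) (x : ι → ℝ) (y : κ → ℝ) (i : ι) (n : ℤ) (N : ℕ) : ℝ :=
  (∏ j, jP Q (y j / x i) n N) * (∏ k ∈ Finset.univ.erase i, (jP Q (x k / x i) n N)⁻¹) *
    ((qP Q Q (N - n).toNat)⁻¹ * (qP Q Q (N + n).toNat)⁻¹)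

/-- The coefficient of the partial fraction expansion. -/
noncomputable def pfCoef (Q : ℝ) (x : ι → ℝ) (y : κ → ℝ) (i : ι) : ℝ :=
  (∏ j, jj Q (y j / x i)) * (∏ k ∈ Finset.univ.erase i, (jj Q (x k / x i))⁻¹) *
    ((qI Q Q)⁻¹ * (qI Q Q)⁻¹)

/-- The ratio `∏ (-y_j/x_i) / ∏ (-x_k/x_i)`. -/
noncomputable def pfRho (x : ι → ℝ) (y : κ → ℝ) (i : ι) : ℝ :=
  (∏ j, (-y j / x i)) / ∏ k, (-x k / x i)

open Polynomial in
lemma pf_finite (hQ : 0 < Q) {x : ι → ℝ} {y : κ → ℝ} (hx : ∀ i, x i ≠ 0)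
    (hy : ∀ j, y j ≠ 0) (hxx : ∀ i k, i ≠ k → ∀ n : ℤ, x k / x i ≠ Q ^ n)
    (hQ1 : Q < 1) (hx1 : ∀ i, ∀ n : ℤ, x i ≠ Q ^ n) {l : ℕ}
    (hl : 0 < l) (hc : Fintype.card ι = Fintype.card κ + l) (δ N : ℕ) (hN : δ ≤ N) :
    (∏ j, jP Q (y j) 0 N) * (∏ i, (jP Q (x i) 0 N)⁻¹) =
      ∑ i, ∑ n ∈ Finset.Icc (-(N : ℤ)) N,
        pfCoefP Q x y i n N * pfTerm Q (x i) (pfRho x y i) l (δ + 1 - l) n := by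
  classical
  set I := Finset.Icc (-(N : ℤ)) N with hI
  set S := (Finset.univ : Finset ι) ×ˢ I with hS
  set v : ι × ℤ → ℝ := fun p => x p.1 * Q ^ p.2 with hv
  have hQn : ∀ n : ℤ, Q ^ n ≠ 0 := fun n => zpow_ne_zero _ hQ.ne'
  have hv0 : ∀ p, v p ≠ 0 := fun p => mul_ne_zero (hx _) (hQn _)
  have hinj : Set.InjOn v S := by
    rintro ⟨i, n⟩ _ ⟨k, m⟩ _ h
    simp only [hv] at h
    by_cases hik : i = k
    · subst hik
      have := mul_left_cancel₀ (hx i) h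
      rw [zpow_right_injective₀ hQ hQ1.ne this]
    · exfalso
      apply hxx i k hik (n - m)
      have := hQn m; have := hx i
      rw [zpow_sub₀ hQ.ne']; field_simp; linarith
  have hv1 : ∀ p, v p ≠ 1 := by
    rintro ⟨i, n⟩ h
    apply hx1 i (-n)
    rw [zpow_neg]; exact eq_inv_of_mul_eq_one_left h
  set f : ℝ[X] := X ^ (l * N + δ) * ∏ j, ∏ m ∈ I, (X - C (y j * Q ^ m)) with hf
  have hIcard : I.card = 2 * N + 1 := by rw [hI, Int.card_Icc]; omega
  have hdeg : f.degree < S.card := by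
    have hmon : (∏ j, ∏ m ∈ I, (X - C (y j * Q ^ m))).Monic :=
      monic_prod_of_monic _ _ fun j _ => monic_prod_of_monic _ _ fun m _ => monic_X_sub_C _
    have hnd : (∏ j, ∏ m ∈ I, (X - C (y j * Q ^ m))).natDegree = Fintype.card κ * (2 * N + 1) := by
      rw [natDegree_prod_of_monic _ _ fun j _ => monic_prod_of_monic _ _ fun m _ => monic_X_sub_C _]
      simp only [natDegree_finsetProd_X_sub_C_eq_card, hIcard]
      simp
    have hfm : f.Monic := (monic_X_pow _).mul hmon
    rw [degree_eq_natDegree hfm.ne_zero, hf, (monic_X_pow _).natDegree_mul hmon, hnd,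
      natDegree_X_pow, hS, Finset.card_product, hIcard, Finset.card_univ, hc]
    norm_cast
    nlinarith
  have hev := Lagrange.eval_interpolate_not_at_node (s := S) (v := v) (x := 1)
    (fun a => f.eval (v a)) (fun i _ => (hv1 i).symm)
  rw [← Lagrange.eq_interpolate hinj hdeg, Lagrange.eval_nodal] at hev
  have hKx : ∏ i, blockK Q (x i) N ≠ 0 := Finset.prod_ne_zero_iff.2 fun i _ => blockK_ne_zero hQ (hx i) N
  have hKy : ∏ j, blockK Q (y j) N ≠ 0 := Finset.prod_ne_zero_iff.2 fun i _ => blockK_ne_zero hQ (hy i) N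
  have hone : ∀ w : ℝ, w ≠ 0 → ∏ m ∈ I, (1 - w * Q ^ m) = blockK Q w N * jP Q w 0 N := by
    intro w hw
    have := block_full hQ (x := w) (z := 1) (n := 0) (N := N) hw one_ne_zero (by simp) (by simp)
    simpa using this
  have hL : f.eval 1 = (∏ j, blockK Q (y j) N) * ∏ j, jP Q (y j) 0 N := by
    simp only [hf, eval_mul, eval_pow, eval_X, one_pow, eval_prod, eval_sub, eval_C, one_mul]
    rw [← Finset.prod_mul_distrib]
    exact Finset.prod_congr rfl fun j _ => hone _ (hy j)
  have hD : ∏ i ∈ S, (1 - v i) = (∏ i, blockK Q (x i) N) * ∏ i, jP Q (x i) 0 N := by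
    rw [hS, Finset.prod_product, ← Finset.prod_mul_distrib]
    exact Finset.prod_congr rfl fun j _ => hone _ (hx j)
  have hjx : ∏ i, jP Q (x i) 0 N ≠ 0 := Finset.prod_ne_zero_iff.2 fun i _ =>
    mul_ne_zero (qP_ne_zero (ne_one_of_zpow hQ (hx i) (hx1 i)).1 _)
      (qP_ne_zero (ne_one_of_zpow hQ (hx i) (hx1 i)).2 _)
  have hterm : ∀ i, ∀ n ∈ I, Lagrange.nodalWeight S v (i, n) * (1 - v (i, n))⁻¹ * f.eval (v (i, n))
      = (∏ j, blockK Q (y j) N) / (∏ i, blockK Q (x i) N) *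
        (pfCoefP Q x y i n N * pfTerm Q (x i) (pfRho x y i) l (δ + 1 - l) n) := by
    intro i n hn
    have hn' := Finset.mem_Icc.1 hn
    have hz := hx i
    have hvi : v (i, n) = x i * Q ^ n := rfl
    have hv0' := hv0 (i, n)
    rw [hvi] at hv0'
    rw [Lagrange.nodalWeight, Finset.prod_inv_distrib, prod_erase_product i n N hn]
    simp only [hv]
    rw [block_erase hQ hz hz hn'.1 hn'.2]
    have e1 : ∏ k ∈ Finset.univ.erase i, ∏ m ∈ Finset.Icc (-(N : ℤ)) N, (x i * Q ^ n - x k * Q ^ m)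
      = ∏ k ∈ Finset.univ.erase i, (blockK Q (x k) N * (x i * Q ^ n) ^ N * (-x k / x i) ^ n * Q ^ (-((n : ℝ) * (n + 1) / 2)) *
        (x i * Q ^ n) * jP Q (x k / x i) n N) :=
      Finset.prod_congr rfl fun k _ => block_full hQ (hx k) hz hn'.1 hn'.2
    have e2 : f.eval (x i * Q ^ n) = (x i * Q ^ n) ^ (l * N + δ) *
        ∏ j, (blockK Q (y j) N * (x i * Q ^ n) ^ N * (-y j / x i) ^ n * Q ^ (-((n : ℝ) * (n + 1) / 2)) *
        (x i * Q ^ n) * jP Q (y j / x i) n N) := by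
      simp only [hf, eval_mul, eval_pow, eval_X, eval_prod, eval_sub, eval_C]
      congr 1
      exact Finset.prod_congr rfl fun j _ => block_full hQ (hy j) hz hn'.1 hn'.2
    rw [e1, e2]
    obtain ⟨l', rfl⟩ : ∃ l', l = l' + 1 := ⟨l - 1, by omega⟩
    rw [pfCoefP, pfTerm]
    have e3 : Q ^ (((l' + 1 : ℕ) : ℝ) * (n * (n + 1) / 2))
        = ((Q ^ (-((n : ℝ) * (n + 1) / 2))) ^ (l' + 1))⁻¹ := by
      rw [← Real.rpow_natCast, ← Real.rpow_mul hQ.le, ← Real.rpow_neg hQ.le]; congr 1; ring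
    have e4 : (x i * Q ^ n) ^ (((δ : ℤ) + 1 - ((l' + 1 : ℕ) : ℤ)))
        = (x i * Q ^ n) ^ δ * ((x i * Q ^ n) ^ l')⁻¹ := by
      rw [show ((δ : ℤ) + 1 - ((l' + 1 : ℕ) : ℤ)) = (δ : ℤ) - (l' : ℤ) by push_cast; ring,
        zpow_sub₀ hv0', zpow_natCast, zpow_natCast, div_eq_mul_inv]
    have e5 : pfRho x y i ^ n = (∏ j, (-y j / x i) ^ n) * ((-x i / x i) ^ n)⁻¹ *
        (∏ k ∈ Finset.univ.erase i, (-x k / x i) ^ n)⁻¹ := by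
      rw [pfRho, ← Finset.mul_prod_erase Finset.univ (fun k => -x k / x i) (Finset.mem_univ i),
        div_eq_mul_inv, mul_zpow, inv_zpow, mul_zpow, ← Finset.prod_zpow, ← Finset.prod_zpow, mul_inv,
        mul_assoc]
    rw [e3, e4, e5, div_self hz]
    have hT : Q ^ (-((n : ℝ) * (n + 1) / 2)) ≠ 0 := (Real.rpow_pos_of_pos hQ _).ne'
    generalize x i * Q ^ n = V at *
    generalize Q ^ (-((n : ℝ) * (n + 1) / 2)) = T at *
    simp only [Finset.prod_mul_distrib, Finset.prod_const, Finset.card_univ]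
    rw [Finset.card_erase_of_mem (Finset.mem_univ i), Finset.card_univ, hc]
    rw [← Finset.mul_prod_erase Finset.univ (fun i => blockK Q (x i) N) (Finset.mem_univ i)]
    rw [show Fintype.card κ + (l' + 1) - 1 = Fintype.card κ + l' by omega]
    have hK1 : ∏ k ∈ Finset.univ.erase i, blockK Q (x k) N ≠ 0 :=
      Finset.prod_ne_zero_iff.2 fun i _ => blockK_ne_zero hQ (hx i) N
    have hK2 := blockK_ne_zero hQ hz N
    rw [one_mul, Finset.prod_inv_distrib]
    generalize ∏ k ∈ Finset.univ.erase i, blockK Q (x k) N = K1 at *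
    generalize ∏ k ∈ Finset.univ.erase i, jP Q (x k / x i) n N = J1 at *
    generalize (-x i / x i) ^ n = G at *
    generalize ∏ k ∈ Finset.univ.erase i, (-x k / x i) ^ n = G2 at *
    generalize ∏ j, (-y j / x i) ^ n = G3 at *
    generalize ∏ j, jP Q (y j / x i) n N = J2 at *
    generalize ∏ j, blockK Q (y j) N = K3 at *
    generalize blockK Q (x i) N = K2 at *
    simp only [mul_inv, div_eq_mul_inv, inv_one, mul_one]
    generalize (qP Q Q (N - n).toNat) = q1 at *
    have h1 : ∀ c l' : ℕ, ∀ a : ℝ, a ≠ 0 → (a ^ (c + l'))⁻¹ * a ^ c = (a ^ l')⁻¹ := by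
      intro c l' a ha; rw [pow_add]; field_simp
    have a1 := h1 (Fintype.card κ) l' (V ^ N) (pow_ne_zero _ hv0')
    have a2 := h1 (Fintype.card κ) l' T hT
    have a3 := h1 (Fintype.card κ) l' V hv0'
    have a4 : V ^ ((l' + 1) * N + δ) = V ^ δ * (V ^ N) ^ l' * V ^ N := by
      rw [← pow_mul, mul_comm N]; ring
    rw [a4]
    have b1 : (V ^ N) ^ l' * ((V ^ N) ^ l')⁻¹ = 1 := mul_inv_cancel₀ (pow_ne_zero _ (pow_ne_zero _ hv0'))
    have b2 : V ^ N * (V ^ N)⁻¹ = 1 := mul_inv_cancel₀ (pow_ne_zero _ hv0')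
    rw [pow_succ T, mul_inv]
    generalize Fintype.card κ = c at *
    generalize ((V ^ N) ^ (c + l'))⁻¹ = p1 at *
    generalize (V ^ N) ^ c = p2 at *
    generalize ((V ^ N) ^ l')⁻¹ = p3 at *
    generalize (V ^ N) ^ l' = p4 at *
    generalize (T ^ (c + l'))⁻¹ = t1 at *
    generalize T ^ c = t2 at *
    generalize (T ^ l')⁻¹ = t3 at *
    generalize (V ^ (c + l'))⁻¹ = v1 at *
    generalize V ^ c = v2 at *
    generalize (V ^ l')⁻¹ = v3 at *
    generalize (V ^ N)⁻¹ = w1 at *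
    generalize V ^ N = w2 at *
    generalize V ^ δ = w3 at *
    generalize (qP Q Q (N + n).toNat)⁻¹ = q2 at *
    generalize (1 - V)⁻¹ = q3 at *
    generalize q1⁻¹ = q4 at *
    generalize K1⁻¹ = k1 at *
    generalize K2⁻¹ = k2 at *
    generalize G⁻¹ = g1 at *
    generalize G2⁻¹ = g2 at *
    generalize J1⁻¹ = j1 at *
    generalize T⁻¹ = s1 at *
    calc _ = (p1 * p2) * p4 * (w2 * w1) * (t1 * t2) * (v1 * v2) *
          (k1 * g2 * j1 * k2 * g1 * s1 * q4 * q2 * q3 * w3 * K3 * G3 * J2) := by ring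
      _ = _ := by rw [a1, a2, a3, b2, mul_comm p3, b1]; ring
  have hsum : ∑ a ∈ S, Lagrange.nodalWeight S v a * (1 - v a)⁻¹ * f.eval (v a)
      = (∏ j, blockK Q (y j) N) / (∏ i, blockK Q (x i) N) * ∑ i, ∑ n ∈ I,
        pfCoefP Q x y i n N * pfTerm Q (x i) (pfRho x y i) l (δ + 1 - l) n := by
    rw [hS, Finset.sum_product, Finset.mul_sum]
    refine Finset.sum_congr rfl fun i _ => ?_
    rw [Finset.mul_sum]
    exact Finset.sum_congr rfl fun n hn => hterm i n hn
  rw [hsum, hL, hD] at hev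
  rw [Finset.prod_inv_distrib]
  field_simp at hev ⊢
  linarith

lemma bounded_prod {α : Type} {β : Type} (s : Finset β) (F : β → α → ℝ)
    (h : ∀ b ∈ s, ∃ C : ℝ, 0 < C ∧ ∀ a, |F b a| ≤ C) :
    ∃ C : ℝ, 0 < C ∧ ∀ a, |∏ b ∈ s, F b a| ≤ C := by
  choose! C hC hb using h
  refine ⟨∏ b ∈ s, C b, Finset.prod_pos hC, fun a => ?_⟩
  rw [Finset.abs_prod]
  exact Finset.prod_le_prod (fun _ _ => abs_nonneg _) fun b hbs => hb b hbs a

lemma pfCoefP_bounded (hQ : 0 < Q) (hQ1 : Q < 1) {x : ι → ℝ} (y : κ → ℝ) (hx : ∀ i, x i ≠ 0)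
    (hxx : ∀ i k, i ≠ k → ∀ n : ℤ, x k / x i ≠ Q ^ n) (i : ι) :
    ∃ C : ℝ, 0 < C ∧ ∀ n N, |pfCoefP Q x y i n N| ≤ C := by
  obtain ⟨C1, h1, b1⟩ := bounded_prod Finset.univ (fun j (p : ℤ × ℕ) => jP Q (y j / x i) p.1 p.2)
    (fun j _ => by
      obtain ⟨C, h, b⟩ := jP_bounded hQ hQ1 (y j / x i)
      exact ⟨C, h, fun p => b _ _⟩)
  obtain ⟨C2, h2, b2⟩ := bounded_prod (Finset.univ.erase i)
    (fun k (p : ℤ × ℕ) => (jP Q (x k / x i) p.1 p.2)⁻¹)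
    (fun k hk => by
      obtain ⟨C, h, b⟩ := jP_inv_bounded hQ hQ1 (div_ne_zero (hx k) (hx i))
        (hxx i k (Finset.ne_of_mem_erase hk).symm)
      exact ⟨C, h, fun p => b _ _⟩)
  obtain ⟨C3, h3, b3⟩ := qP_inv_bounded hQ hQ1 (self_mul_pow_ne_one hQ hQ1)
  refine ⟨C1 * C2 * (C3 * C3), by positivity, fun n N => ?_⟩
  rw [pfCoefP, abs_mul, abs_mul, abs_mul]
  gcongr
  · exact b1 (n, N)
  · exact b2 (n, N)
  · exact b3 _
  · exact b3 _

lemma pfCoefP_tendsto (hQ : 0 < Q) (hQ1 : Q < 1) {x : ι → ℝ} (y : κ → ℝ) (hx : ∀ i, x i ≠ 0)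
    (hxx : ∀ i k, i ≠ k → ∀ n : ℤ, x k / x i ≠ Q ^ n) (i : ι) (n : ℤ) :
    Tendsto (pfCoefP Q x y i n) atTop (𝓝 (pfCoef Q x y i)) := by
  have h1 := qP_tendsto hQ hQ1 Q
  refine ((tendsto_finsetProd _ fun j _ => jP_tendsto hQ hQ1 _ n).mul
    (tendsto_finsetProd _ fun k hk => (jP_tendsto hQ hQ1 _ n).inv₀ (jj_ne_zero hQ hQ1
      (div_ne_zero (hx k) (hx i)) (hxx i k (Finset.ne_of_mem_erase hk).symm)))).mul
    (((h1.comp ?_).inv₀ (qI_self_ne_zero hQ hQ1)).mul ((h1.comp (toNat_tendsto n)).inv₀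
      (qI_self_ne_zero hQ hQ1)))
  simpa [sub_eq_add_neg] using toNat_tendsto (-n)

lemma pfRho_ne_zero {x : ι → ℝ} {y : κ → ℝ} (hx : ∀ i, x i ≠ 0)
    (hy : ∀ j, y j ≠ 0) (i : ι) : pfRho x y i ≠ 0 :=
  div_ne_zero (Finset.prod_ne_zero_iff.2 fun j _ => div_ne_zero (neg_ne_zero.2 (hy j)) (hx i))
    (Finset.prod_ne_zero_iff.2 fun j _ => div_ne_zero (neg_ne_zero.2 (hx j)) (hx i))

/-- Partial fraction expansion of a quotient of products of theta functions. -/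
theorem pf (hQ : 0 < Q) (hQ1 : Q < 1) {x : ι → ℝ} {y : κ → ℝ} (hx : ∀ i, x i ≠ 0)
    (hy : ∀ j, y j ≠ 0) (hxx : ∀ i k, i ≠ k → ∀ n : ℤ, x k / x i ≠ Q ^ n)
    (hx1 : ∀ i, ∀ n : ℤ, x i ≠ Q ^ n) {l : ℕ}
    (hl : 0 < l) (hc : Fintype.card ι = Fintype.card κ + l) (δ : ℕ) :
    (∏ j, jj Q (y j)) * (∏ i, (jj Q (x i))⁻¹) =
      ∑ i, pfCoef Q x y i * ∑' n : ℤ, pfTerm Q (x i) (pfRho x y i) l (δ + 1 - l) n := by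
  have hL : Tendsto (fun N => (∏ j, jP Q (y j) 0 N) * (∏ i, (jP Q (x i) 0 N)⁻¹)) atTop
      (𝓝 ((∏ j, jj Q (y j)) * (∏ i, (jj Q (x i))⁻¹))) :=
    (tendsto_finsetProd _ fun j _ => jP_tendsto hQ hQ1 _ 0).mul
    (tendsto_finsetProd _ fun k _ => (jP_tendsto hQ hQ1 _ 0).inv₀ (jj_ne_zero hQ hQ1 (hx k) (hx1 k)))
  refine tendsto_nhds_unique hL ?_
  have hR : Tendsto (fun N : ℕ => ∑ i, ∑' n : ℤ, if n ∈ Finset.Icc (-(N : ℤ)) N then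
      pfCoefP Q x y i n N * pfTerm Q (x i) (pfRho x y i) l (δ + 1 - l) n else 0) atTop
      (𝓝 (∑ i, pfCoef Q x y i * ∑' n : ℤ, pfTerm Q (x i) (pfRho x y i) l (δ + 1 - l) n)) := by
    refine tendsto_finsetSum _ fun i _ => ?_
    rw [← tsum_mul_left]
    obtain ⟨C, hC, hb⟩ := pfCoefP_bounded hQ hQ1 y hx hxx i
    refine tendsto_tsum_of_dominated_convergence (bound := fun n : ℤ => C *
      |pfTerm Q (x i) (pfRho x y i) l (δ + 1 - l) n|)
      ((pfTerm_summable hQ hQ1 (hx i) (pfRho_ne_zero hx hy i) hl _).mul_left C) (fun n => ?_)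
      (Eventually.of_forall fun N n => ?_)
    · refine ((pfCoefP_tendsto hQ hQ1 y hx hxx i n).mul_const _).congr' ?_
      filter_upwards [eventually_ge_atTop n.natAbs] with N hN
      rw [if_pos]
      rw [Finset.mem_Icc]; omega
    · split_ifs
      · rw [Real.norm_eq_abs, abs_mul]
        exact mul_le_mul_of_nonneg_right (hb n N) (abs_nonneg _)
      · rw [norm_zero]; positivity
  refine hR.congr' ?_
  filter_upwards [eventually_ge_atTop δ] with N hN
  rw [pf_finite hQ hx hy hxx hQ1 hx1 hl hc δ N hN]
  refine Finset.sum_congr rfl fun i _ => ?_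
  rw [tsum_eq_sum (s := Finset.Icc (-(N : ℤ)) N) fun n hn => if_neg hn]
  exact Finset.sum_congr rfl fun n hn => if_pos hn

end partialFractions2

section theta
variable {q : ℝ}

lemma rpow_q121 (hq : 0 < q) (r : ℝ) : (q ^ 121) ^ r = q ^ (121 * r) := by
  rw [← Real.rpow_natCast q 121, ← Real.rpow_mul hq.le]; norm_num

lemma q121_pos (hq : 0 < q) : 0 < q ^ 121 := by positivity

lemma q121_lt (hq : 0 < q) (hq1 : q < 1) : q ^ 121 < 1 := pow_lt_one₀ hq.le hq1 (by norm_num)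

/-- Theta series `∑ eⁿ q^((11n+x)²/2)`. -/
noncomputable def thF (q e x : ℝ) : ℝ := ∑' n : ℤ, e ^ n * q ^ ((11 * n + x) ^ 2 / 2)

/-- Theta series `∑ q^((11n+x)²)`. -/
noncomputable def thG (q x : ℝ) : ℝ := ∑' n : ℤ, q ^ ((11 * (n : ℝ) + x) ^ 2)

/-- The odd theta function. -/
noncomputable def th (q x : ℝ) : ℝ := thF q (-1) (x - 11 / 2)

lemma summable_thF (hq : 0 < q) (hq1 : q < 1) {e : ℝ} (he : e ≠ 0) (x : ℝ) :
    Summable fun n : ℤ => |e ^ n * q ^ ((11 * n + x) ^ 2 / 2)| := by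
  refine (summable_quad_zpow hq hq1 (c := 121 / 2) (by norm_num) (11 * x) (x ^ 2 / 2) he).congr
    fun n => ?_
  rw [mul_comm]; congr 3; ring

lemma summable_thG (hq : 0 < q) (hq1 : q < 1) (x : ℝ) :
    Summable fun n : ℤ => q ^ ((11 * (n : ℝ) + x) ^ 2) := by
  refine (summable_quad hq hq1 (c := 121) (by norm_num) (22 * x) (x ^ 2)).congr
    fun n => ?_
  congr 1; ring

lemma thF_neg {e : ℝ} (he : e ^ 2 = 1) (x : ℝ) : thF q e (-x) = thF q e x := by
  rw [thF, ← (Equiv.neg ℤ).tsum_eq, thF]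
  refine tsum_congr fun n => ?_
  have : e⁻¹ = e := by rw [sq] at he; exact inv_eq_of_mul_eq_one_left he
  rw [Equiv.neg_apply, zpow_neg, ← inv_zpow, this]
  congr 2; push_cast; ring

lemma thF_add {e : ℝ} (he : e ^ 2 = 1) (x : ℝ) : thF q e (x + 11) = e * thF q e x := by
  have h0 : e ≠ 0 := by rintro rfl; norm_num at he
  rw [thF, ← (Equiv.subRight (1:ℤ)).tsum_eq, thF, ← tsum_mul_left]
  refine tsum_congr fun n => ?_
  have : e⁻¹ = e := by rw [sq] at he; exact inv_eq_of_mul_eq_one_left he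
  rw [Equiv.subRight_apply, zpow_sub_one₀ h0, this, ← mul_assoc, mul_comm e]
  congr 3; push_cast; ring

lemma thG_add (x : ℝ) : thG q (x + 11) = thG q x := by
  rw [thG, ← (Equiv.subRight (1:ℤ)).tsum_eq, thG]
  refine tsum_congr fun n => ?_
  rw [Equiv.subRight_apply]
  congr 1; push_cast; ring

lemma thG_half (x : ℝ) : thG q (x - 11 / 2 + 11 / 2) = thG q x ∧
    thG q (x - 11 / 2) = thG q (x + 11 / 2) :=
  ⟨by congr 1; ring, by rw [← thG_add]; congr 1; ring⟩

/-- Pairs of integers sorted by the parity of the sum. -/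
def paritySplit : (ℤ × ℤ) ⊕ (ℤ × ℤ) ≃ ℤ × ℤ where
  toFun := Sum.elim (fun p => (p.1 + p.2, p.1 - p.2)) (fun p => (p.1 + p.2 + 1, p.1 - p.2))
  invFun p := if (p.1 + p.2) % 2 = 0 then Sum.inl ((p.1 + p.2) / 2, (p.1 - p.2) / 2)
    else Sum.inr ((p.1 + p.2) / 2, (p.1 - p.2) / 2)
  left_inv := by
    rintro (⟨k, j⟩ | ⟨k, j⟩)
    · refine (if_pos ?_).trans ?_ <;> simp only [Sum.elim_inl, Sum.inl.injEq, Prod.mk.injEq] <;> omega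
    · refine (if_neg ?_).trans ?_ <;> simp only [Sum.elim_inr, Sum.inr.injEq, Prod.mk.injEq] <;> omega
  right_inv := by
    rintro ⟨n, m⟩
    simp only
    split_ifs with h
    · simp only [Sum.elim_inl, Prod.mk.injEq]; omega
    · simp only [Sum.elim_inr, Prod.mk.injEq]; omega

lemma thF_mul (hq : 0 < q) (hq1 : q < 1) {e : ℝ} (he : e ^ 2 = 1) (x y : ℝ) :
    thF q e (x + y) * thF q e (x - y) =
      thG q x * thG q y + e * (thG q (x + 11 / 2) * thG q (y + 11 / 2)) := by
  have h0 : e ≠ 0 := by rintro rfl; norm_num at he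
  have hsum : ∀ {f g : ℤ → ℝ}, (Summable fun n => ‖f n‖) → (Summable fun n => ‖g n‖) →
      HasSum (fun p : ℤ × ℤ => f p.1 * g p.2) ((∑' n, f n) * ∑' n, g n) := by
    intro f g hf hg
    rw [tsum_mul_tsum_of_summable_norm hf hg]
    exact (summable_mul_of_summable_norm hf hg).hasSum
  have hG : ∀ x, Summable fun n : ℤ => ‖q ^ ((11 * (n : ℝ) + x) ^ 2)‖ :=
    fun x => (summable_thG hq hq1 x).norm
  refine (hsum (summable_thF hq hq1 h0 (x + y)) (summable_thF hq hq1 h0 (x - y))).unique ?_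
  rw [← paritySplit.hasSum_iff]
  have he' : ∀ k : ℤ, (e ^ k) * (e ^ k) = 1 := by
    intro k; rw [← mul_zpow, ← sq, he, one_zpow]
  refine HasSum.sum ((hsum (hG x) (hG y)).congr_eq ?_ rfl)
    (((hsum (hG (x + 11 / 2)) (hG (y + 11 / 2))).mul_left e).congr_eq ?_ rfl)
  · rintro ⟨k, j⟩
    simp only [paritySplit, Function.comp, Equiv.coe_fn_mk, Sum.elim_inl]
    rw [zpow_add₀ h0, zpow_sub₀ h0, ← Real.rpow_add hq]
    have : e ^ k * e ^ j * q ^ ((11 * ((k + j : ℤ) : ℝ) + (x + y)) ^ 2 / 2) *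
      (e ^ k / e ^ j * q ^ ((11 * ((k - j : ℤ) : ℝ) + (x - y)) ^ 2 / 2)) =
      (e ^ k * e ^ k) * (e ^ j / e ^ j) * (q ^ ((11 * ((k + j : ℤ) : ℝ) + (x + y)) ^ 2 / 2) *
      q ^ ((11 * ((k - j : ℤ) : ℝ) + (x - y)) ^ 2 / 2)) := by ring
    rw [this, he', div_self (zpow_ne_zero _ h0), one_mul, one_mul, ← Real.rpow_add hq]
    congr 1; push_cast; ring
  · rintro ⟨k, j⟩
    simp only [paritySplit, Function.comp, Equiv.coe_fn_mk, Sum.elim_inr]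
    rw [zpow_add₀ h0, zpow_sub₀ h0, zpow_add₀ h0, ← Real.rpow_add hq, zpow_one]
    have : e ^ k * e ^ j * e * q ^ ((11 * ((k + j + 1 : ℤ) : ℝ) + (x + y)) ^ 2 / 2) *
      (e ^ k / e ^ j * q ^ ((11 * ((k - j : ℤ) : ℝ) + (x - y)) ^ 2 / 2)) =
      (e ^ k * e ^ k) * (e ^ j / e ^ j) * (e * (q ^ ((11 * ((k + j + 1 : ℤ) : ℝ) + (x + y)) ^ 2 / 2) *
      q ^ ((11 * ((k - j : ℤ) : ℝ) + (x - y)) ^ 2 / 2))) := by ring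
    rw [this, he', div_self (zpow_ne_zero _ h0), one_mul, one_mul, ← Real.rpow_add hq]
    congr 2; push_cast; ring

lemma th_mul (hq : 0 < q) (hq1 : q < 1) (x y : ℝ) :
    th q (x + y) * th q (x - y) =
      thG q (x + 11 / 2) * thG q y - thG q x * thG q (y + 11 / 2) := by
  have := thF_mul hq hq1 (e := -1) (by norm_num) (x - 11 / 2) y
  rw [(thG_half x).1, (thG_half x).2] at this
  rw [th, th, show x + y - 11 / 2 = x - 11 / 2 + y by ring,
    show x - y - 11 / 2 = x - 11 / 2 - y by ring, this]
  ring

lemma th_add (x : ℝ) : th q (x + 11) = -th q x := by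
  rw [th, show x + 11 - 11 / 2 = x - 11 / 2 + 11 by ring, thF_add (by norm_num), th]; ring

lemma th_refl (x : ℝ) : th q (11 - x) = th q x := by
  rw [th, show 11 - x - 11 / 2 = -(x - 11 / 2) by ring, thF_neg (by norm_num), th]

lemma th_neg (x : ℝ) : th q (-x) = -th q x := by
  rw [← th_refl (-x), ← th_add]; congr 1; ring

lemma th_zero : th q 0 = 0 := by
  have := th_neg (q := q) 0
  rw [neg_zero] at this; linarith

/-- The weighted three-term relation. -/
lemma th_three (hq : 0 < q) (hq1 : q < 1) (x y u v : ℝ) :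
    th q (x + y) * th q (x - y) * (th q (u + v) * th q (u - v)) =
      th q (x + v) * th q (x - v) * (th q (u + y) * th q (u - y))
      - th q (x + u) * th q (x - u) * (th q (v + y) * th q (v - y)) := by
  simp only [th_mul hq hq1]; ring

lemma thF_prod (hq : 0 < q) (hq1 : q < 1) {e : ℝ} (he : e ≠ 0) (x : ℝ) :
    thF q e (x - 11 / 2) = q ^ ((x - 11 / 2) ^ 2 / 2) * (qI (q ^ 121) (q ^ 121) *
      jj (q ^ 121) (-e * q ^ (11 * x))) := by
  have hw : -e * q ^ (11 * x) ≠ 0 := mul_ne_zero (neg_ne_zero.2 he) (by positivity)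
  have h := (jtp (q121_pos hq) (q121_lt hq hq1) hw).mul_left (q ^ ((x - 11 / 2) ^ 2 / 2))
  refine (h.congr_eq (fun n => ?_) ?_).tsum_eq
  · rw [neg_mul, neg_neg, mul_zpow, rpow_q121 hq, ← Real.rpow_mul_intCast hq.le]
    have : q ^ ((11 * (n:ℝ) + (x - 11 / 2)) ^ 2 / 2) =
      q ^ ((x - 11 / 2) ^ 2 / 2) * q ^ (121 * ((n : ℝ) * (n - 1) / 2)) * q ^ (11 * x * n) := by
      rw [← Real.rpow_add hq, ← Real.rpow_add hq]; congr 1; ring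
    rw [this]; ring
  · rw [jj]; ring

lemma th_prod (hq : 0 < q) (hq1 : q < 1) (x : ℝ) :
    th q x = q ^ ((x - 11 / 2) ^ 2 / 2) * (qI (q ^ 121) (q ^ 121) *
      jj (q ^ 121) (q ^ (11 * x))) := by
  rw [th, thF_prod hq hq1 (by norm_num)]; norm_num

lemma qI_pos {Q w : ℝ} (hQ : 0 < Q) (hQ1 : Q < 1) (hw : w < 1) : 0 < qI Q w := by
  rcases le_or_gt w 0 with h | h
  · refine lt_of_lt_of_le one_pos (ge_of_tendsto' (qP_tendsto hQ hQ1 w) fun n => ?_)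
    exact Finset.one_le_prod fun i _ => by nlinarith [pow_pos hQ i]
  · have h1 : ∀ i : ℕ, w * Q ^ i < 1 := fun i => by
      nlinarith [pow_le_one₀ hQ.le hQ1.le (n := i), pow_pos hQ i]
    refine lt_of_le_of_ne (ge_of_tendsto' (qP_tendsto hQ hQ1 w) fun n => ?_)
      (qI_ne_zero hQ hQ1 fun i => (h1 i).ne).symm
    exact Finset.prod_nonneg fun i _ => by linarith [h1 i]

lemma th_pos (hq : 0 < q) (hq1 : q < 1) {x : ℝ} (h0 : 0 < x) (h1 : x < 11) : 0 < th q x := by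
  rw [th_prod hq hq1, jj]
  have hQ := q121_pos hq
  have hQ1 := q121_lt hq hq1
  refine mul_pos (by positivity) (mul_pos (qI_pos hQ hQ1 hQ1) (mul_pos (qI_pos hQ hQ1 ?_)
    (qI_pos hQ hQ1 ?_)))
  · exact Real.rpow_lt_one hq.le hq1 (by linarith)
  · rw [← Real.rpow_natCast q 121, ← Real.rpow_sub hq]
    exact Real.rpow_lt_one hq.le hq1 (by norm_num; linarith)

lemma qI_sq {Q : ℝ} (hQ : 0 < Q) (hQ1 : Q < 1) {s : ℝ} (hs : s ^ 2 = Q) (w : ℝ) :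
    qI Q (w ^ 2) = qI Q w * qI Q (-w) * (qI Q (s * w) * qI Q (-(s * w))) := by
  have h : ∀ N, qP Q (w ^ 2) (N * 2) = qP Q w N * qP Q (-w) N * (qP Q (s * w) N * qP Q (-(s * w)) N) := by
    intro N
    simp only [qP, ← Finset.prod_mul_distrib]
    induction N with
    | zero => simp
    | succ N ih =>
      rw [Nat.succ_mul, Finset.prod_range_succ, Finset.prod_range_succ, ih, Finset.prod_range_succ]
      rw [← hs]; ring
  refine tendsto_nhds_unique ((qP_tendsto hQ hQ1 (w ^ 2)).comp
    (tendsto_id.atTop_mul_const' (r := 2) (by norm_num))) ?_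
  refine Tendsto.congr (fun N => (h N).symm) ?_
  exact ((qP_tendsto hQ hQ1 _).mul (qP_tendsto hQ hQ1 _)).mul
    ((qP_tendsto hQ hQ1 _).mul (qP_tendsto hQ hQ1 _))

lemma jj_sq {Q : ℝ} (hQ : 0 < Q) (hQ1 : Q < 1) {s : ℝ} (hs : s ^ 2 = Q) {w : ℝ} (hw : w ≠ 0) :
    jj Q (w ^ 2) = jj Q w * jj Q (-w) * (jj Q (s * w) * jj Q (-(s * w))) := by
  have hs0 : s ≠ 0 := by rintro rfl; simp at hs; exact hQ.ne hs
  have h2 := qI_sq hQ hQ1 hs (s / w)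
  rw [show (s / w) ^ 2 = Q / w ^ 2 by rw [div_pow, hs], show s * (s / w) = Q / w by rw [← hs]; ring] at h2
  simp only [jj]
  rw [qI_sq hQ hQ1 hs, h2]
  rw [show Q / (s * w) = s / w by rw [← hs]; field_simp,
    show Q / -(s * w) = -(s / w) by rw [← hs]; field_simp, show Q / -w = -(Q / w) by field_simp]
  ring

/-- `q^(121/24) (Q;Q)_∞` with `Q = q^121`. -/
noncomputable def hh (q : ℝ) : ℝ := q ^ ((121 : ℝ) / 24) * qI (q ^ 121) (q ^ 121)

lemma hh_pos (hq : 0 < q) (hq1 : q < 1) : 0 < hh q :=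
  mul_pos (by positivity) (qI_pos (q121_pos hq) (q121_lt hq hq1) (q121_lt hq hq1))

lemma th_double (hq : 0 < q) (hq1 : q < 1) (x : ℝ) :
    th q (2 * x) * hh q ^ 3 = th q x * thF q 1 (x - 11 / 2) * (thF q (-1) x * thF q 1 x) := by
  have hx : x = x + 11 / 2 - 11 / 2 := by ring
  rw [th_prod hq hq1, th_prod hq hq1, thF_prod hq hq1 one_ne_zero]
  rw [show thF q (-1) x = thF q (-1) (x + 11 / 2 - 11 / 2) by rw [← hx],
    show thF q 1 x = thF q 1 (x + 11 / 2 - 11 / 2) by rw [← hx]]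
  rw [thF_prod hq hq1 one_ne_zero, thF_prod hq hq1 (by norm_num)]
  have hs : (q ^ (121 / 2 : ℝ)) ^ 2 = q ^ 121 := by
    rw [← Real.rpow_natCast, ← Real.rpow_mul hq.le, ← Real.rpow_natCast q 121]; norm_num
  have hj := jj_sq (q121_pos hq) (q121_lt hq hq1) hs (w := q ^ (11 * x)) (by positivity)
  rw [show q ^ (11 * (2 * x)) = (q ^ (11 * x)) ^ 2 by
    rw [← Real.rpow_mul_natCast hq.le]; congr 1; push_cast; ring, hj]
  rw [show q ^ (11 * (x + 11 / 2)) = q ^ (121 / 2 : ℝ) * q ^ (11 * x) by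
    rw [← Real.rpow_add hq]; congr 1; ring]
  rw [hh, mul_pow, ← Real.rpow_mul_natCast hq.le, ← hx]
  have : q ^ ((2 * x - 11 / 2) ^ 2 / 2) * q ^ ((121 : ℝ) / 24 * (3 : ℕ)) =
    q ^ ((x - 11 / 2) ^ 2 / 2) * q ^ ((x - 11 / 2) ^ 2 / 2) * (q ^ (x ^ 2 / 2) * q ^ (x ^ 2 / 2)) := by
    simp only [← Real.rpow_add hq]; congr 1; push_cast; ring
  have e1 : ∀ a b c d : ℝ, a * b * (c * d) = (a * c) * (b * d) := fun a b c d => by ring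
  rw [e1, this]
  simp only [neg_mul, one_mul, neg_neg]
  ring
end theta

section thetaDeriv
variable {q : ℝ}

lemma abs_mul_rpow_sq_le (hq : 0 < q) (hq1 : q < 1) (z : ℝ) :
    |z| * q ^ (z ^ 2 / 2) ≤ (1 + 4 / (-Real.log q)) * q ^ (z ^ 2 / 4) := by
  have hl : 0 < -Real.log q := neg_pos.2 (Real.log_neg hq hq1)
  set l := -Real.log q with hldef
  have h1 : q ^ (z ^ 2 / 2) = q ^ (z ^ 2 / 4) * Real.exp (-(l * z ^ 2 / 4)) := by
    rw [Real.rpow_def_of_pos hq, Real.rpow_def_of_pos hq, ← Real.exp_add, hldef]; congr 1; ring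
  have h2 : |z| * Real.exp (-(l * z ^ 2 / 4)) ≤ 1 + 4 / l := by
    have h3 : |z| ≤ (1 + 4 / l) * Real.exp (l * z ^ 2 / 4) := by
      have h4 := Real.add_one_le_exp (l * z ^ 2 / 4)
      have h5 : |z| ≤ (1 + 4 / l) * (l * z ^ 2 / 4 + 1) := by
        have : (1 + 4 / l) * (l * z ^ 2 / 4 + 1) = z ^ 2 + 1 + l * z ^ 2 / 4 + 4 / l := by
          field_simp; ring
        have h6 : 0 ≤ l * z ^ 2 / 4 := by positivity
        have h7 : 0 ≤ 4 / l := by positivity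
        rw [this]; nlinarith [sq_nonneg (|z| - 1), sq_abs z]
      exact h5.trans (mul_le_mul_of_nonneg_left h4 (by positivity))
    rw [Real.exp_neg, ← div_eq_mul_inv, div_le_iff₀ (Real.exp_pos _)]; exact h3
  have h5 : 0 < q ^ (z ^ 2 / 4) := by positivity
  rw [h1]; nlinarith

lemma th_differentiableAt (hq : 0 < q) (hq1 : q < 1) (x : ℝ) : DifferentiableAt ℝ (th q) x := by
  set R := |x| + 1 with hR
  have hu := ((summable_quad hq hq1 (c := 121 / 8) (by norm_num) 0 (-(R + 11 / 2) ^ 2 / 4)).mul_left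
    (|Real.log q| * (1 + 4 / (-Real.log q))))
  refine (hasDerivAt_tsum_of_isPreconnected (𝕜 := ℝ)
    (g := fun (n : ℤ) y => (-1 : ℝ) ^ n * q ^ ((11 * n + (y - 11 / 2)) ^ 2 / 2))
    (g' := fun (n : ℤ) y => (-1 : ℝ) ^ n * (Real.log q * (11 * n + (y - 11 / 2)) *
      q ^ ((11 * n + (y - 11 / 2)) ^ 2 / 2)))
    hu Metric.isOpen_ball (convex_ball (0 : ℝ) R).isPreconnected ?_ ?_ (y₀ := x) ?_ ?_ ?_).differentiableAt
  · intro n y _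
    have h1 : HasDerivAt (fun y : ℝ => (11 * (n : ℝ) + (y - 11 / 2)) ^ 2 / 2)
        (11 * n + (y - 11 / 2)) y := by
      have := ((((hasDerivAt_id y).sub_const (11 / 2)).const_add (11 * (n : ℝ))).pow 2).div_const 2
      refine this.congr_deriv ?_
      simp
    refine ((h1.const_rpow hq).const_mul _).congr_deriv ?_
    ring
  · intro n y hy
    rw [Metric.mem_ball, Real.dist_eq, sub_zero] at hy
    set z := 11 * (n : ℝ) + (y - 11 / 2) with hz
    rw [norm_mul, norm_zpow, norm_neg, norm_one, one_zpow, one_mul, norm_mul, norm_mul,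
      Real.norm_eq_abs, Real.norm_eq_abs, Real.norm_of_nonneg (by positivity), mul_assoc, mul_assoc]
    refine mul_le_mul_of_nonneg_left ((abs_mul_rpow_sq_le hq hq1 z).trans ?_) (abs_nonneg _)
    have hl : 0 < -Real.log q := neg_pos.2 (Real.log_neg hq hq1)
    refine mul_le_mul_of_nonneg_left (Real.rpow_le_rpow_of_exponent_ge hq hq1.le ?_) (by positivity)
    have hw : |y - 11 / 2| ≤ R + 11 / 2 := by
      rw [abs_lt] at hy; rw [abs_le]; constructor <;> linarith [hy.1, hy.2]
    have hw2 : (y - 11 / 2) ^ 2 ≤ (R + 11 / 2) ^ 2 := by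
      rw [← sq_abs]; gcongr
    have : z ^ 2 - (121 * n ^ 2 / 2 - (y - 11 / 2) ^ 2) = (11 * n + 2 * (y - 11 / 2)) ^ 2 / 2 := by
      rw [hz]; ring
    nlinarith [sq_nonneg (11 * n + 2 * (y - 11 / 2))]
  · rw [Metric.mem_ball, Real.dist_eq, sub_zero]; linarith
  · exact (summable_thF hq hq1 (by norm_num) (x - 11 / 2)).of_abs
  · rw [Metric.mem_ball, Real.dist_eq, sub_zero]; linarith

lemma th_hasDerivAt (hq : 0 < q) (hq1 : q < 1) (x : ℝ) : HasDerivAt (th q) (deriv (th q) x) x :=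
  (th_differentiableAt hq hq1 x).hasDerivAt

lemma deriv_th_refl (x : ℝ) : deriv (th q) (11 - x) = -deriv (th q) x := by
  have h : (fun y => th q (11 - y)) = th q := funext fun y => th_refl y
  have := deriv_comp_const_sub (f := th q) (a := 11) (x := x)
  rw [h] at this; linarith

lemma deriv_th_add (x : ℝ) : deriv (th q) (x + 11) = -deriv (th q) x := by
  have h : (fun y => th q (y + 11)) = fun y => -th q y := funext fun y => th_add y
  have := deriv_comp_add_const (f := th q) (a := 11) (x := x)
  rw [h, deriv.fun_neg] at this; exact this.symm

/-- Differentiated three-term relation. -/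
lemma th_deriv_three (hq : 0 < q) (hq1 : q < 1) (x y v : ℝ) :
    th q (x + y) * th q (x - y) * th q (2 * v) * deriv (th q) 0 =
      th q (x + v) * th q (x - v) * (deriv (th q) (v + y) * th q (v - y) +
        th q (v + y) * deriv (th q) (v - y)) -
      (deriv (th q) (x + v) * th q (x - v) - th q (x + v) * deriv (th q) (x - v)) *
        (th q (v + y) * th q (v - y)) := by
  have hd := th_hasDerivAt hq hq1
  have hs : ∀ a : ℝ, HasDerivAt (fun t => th q (a + t)) (deriv (th q) a) 0 := fun a => by
    have := (hd (a + 0)).comp_const_add a 0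
    simpa using this
  have hm : ∀ a : ℝ, HasDerivAt (fun t => th q (a - t)) (-deriv (th q) a) 0 := fun a => by
    have := (hd (a - 0)).comp_const_sub a 0
    simpa using this
  have hL : HasDerivAt (fun t => th q (x + y) * th q (x - y) * (th q (2 * v + t) * th q (0 + t)))
      (th q (x + y) * th q (x - y) * (deriv (th q) (2 * v) * th q (0 + 0) +
        th q (2 * v + 0) * deriv (th q) 0)) 0 := ((hs _).mul (hs 0)).const_mul _
  have hR : HasDerivAt (fun t => th q (x + v) * th q (x - v) * (th q (v + y + t) * th q (v - y + t))
      - th q (x + v + t) * th q (x - v - t) * (th q (v + y) * th q (v - y)))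
      (th q (x + v) * th q (x - v) * (deriv (th q) (v + y) * th q (v - y + 0) +
        th q (v + y + 0) * deriv (th q) (v - y)) -
      (deriv (th q) (x + v) * th q (x - v - 0) + th q (x + v + 0) * (-deriv (th q) (x - v))) *
        (th q (v + y) * th q (v - y))) 0 :=
    (((hs _).mul (hs _)).const_mul _).sub (((hs _).mul (hm _)).mul_const _)
  have heq : (fun t => th q (x + y) * th q (x - y) * (th q (2 * v + t) * th q (0 + t))) =
      (fun t => th q (x + v) * th q (x - v) * (th q (v + y + t) * th q (v - y + t))
      - th q (x + v + t) * th q (x - v - t) * (th q (v + y) * th q (v - y))) := by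
    funext t
    have := th_three hq hq1 x y (v + t) v
    rw [show v + t + v = 2 * v + t by ring, show v + t - v = 0 + t by ring,
      show v + t + y = v + y + t by ring, show v + t - y = v - y + t by ring,
      show x + (v + t) = x + v + t by ring, show x - (v + t) = x - v - t by ring] at this
    exact this
  rw [heq] at hL
  have := hL.unique hR
  simp only [add_zero, sub_zero, th_zero, mul_zero, zero_add] at this
  linear_combination this

/-- Normalized logarithmic derivative. -/
noncomputable def thm (q x : ℝ) : ℝ := deriv (th q) x / (th q x * deriv (th q) 0)

lemma thm_refl (x : ℝ) : thm q (11 - x) = -thm q x := by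
  rw [thm, thm, deriv_th_refl, th_refl, neg_div]

lemma thm_add (x : ℝ) : thm q (x + 11) = thm q x := by
  rw [thm, thm, deriv_th_add, th_add, neg_mul, neg_div_neg_eq]

lemma thm_rel (hq : 0 < q) (hq1 : q < 1) (h0 : deriv (th q) 0 ≠ 0) {a b c d : ℝ}
    (hd : a + b + c = d) (ha : th q a ≠ 0) (hb : th q b ≠ 0) (hc : th q c ≠ 0) (hd' : th q d ≠ 0) :
    thm q a + thm q b + thm q c - thm q d =
      th q (a + b) * th q (b + c) * th q (c + a) / (th q a * th q b * th q c * th q d) := by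
  have h := th_deriv_three hq hq1 (c + (a + b) / 2) ((a - b) / 2) ((a + b) / 2)
  rw [show c + (a + b) / 2 + (a - b) / 2 = c + a by ring,
    show c + (a + b) / 2 - (a - b) / 2 = b + c by ring, show 2 * ((a + b) / 2) = a + b by ring,
    show c + (a + b) / 2 + (a + b) / 2 = d by rw [← hd]; ring,
    show c + (a + b) / 2 - (a + b) / 2 = c by ring, show (a + b) / 2 + (a - b) / 2 = a by ring,
    show (a + b) / 2 - (a - b) / 2 = b by ring] at h
  simp only [thm]
  field_simp
  linear_combination -h
end thetaDeriv

section poleSums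
variable {q : ℝ}

/-- General term of the Appell–Lerch type sums attached to a residue class modulo 11. -/
noncomputable def usTerm (q : ℝ) (r : ℕ) (c s : ℝ) (m : ℤ) : ℝ :=
  (-1) ^ m * q ^ ((r : ℝ) / 2 * (11 * m + c + 11 / 2) ^ 2) / (1 - q ^ (11 * (11 * m + c + s)))

/-- Appell–Lerch type sum attached to a residue class modulo 11. -/
noncomputable def US (q : ℝ) (r : ℕ) (c s : ℝ) : ℝ := ∑' m : ℤ, usTerm q r c s m

lemma US_pf (hq : 0 < q) (r : ℕ) (c s : ℝ) :
    US q r c s = q ^ ((r : ℝ) / 2 * (c + 11 / 2) ^ 2) *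
      ∑' m : ℤ, pfTerm (q ^ 121) (q ^ (11 * (s + c))) (-q ^ (11 * r * c)) r 0 m := by
  rw [US, ← tsum_mul_left]
  refine tsum_congr fun m => ?_
  have hQ : ((q ^ 121 : ℝ)) ^ m = q ^ (121 * (m : ℝ)) := by
    rw [← Real.rpow_intCast, rpow_q121 hq]
  have h1 : (-q ^ (11 * r * c)) ^ m = (-1) ^ m * q ^ (11 * r * c * m) := by
    rw [neg_eq_neg_one_mul, mul_zpow, ← Real.rpow_mul_intCast hq.le]
  rw [usTerm, pfTerm, zpow_zero, one_mul, rpow_q121 hq, h1, hQ, ← Real.rpow_add hq]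
  rw [show 11 * (s + c) + 121 * (m : ℝ) = 11 * (11 * m + c + s) by ring, div_eq_mul_inv]
  have : q ^ ((r : ℝ) / 2 * (11 * m + c + 11 / 2) ^ 2) = q ^ ((r : ℝ) / 2 * (c + 11 / 2) ^ 2) *
      (q ^ (121 * ((r : ℝ) * (m * (m + 1) / 2))) * q ^ (11 * r * c * m)) := by
    rw [← Real.rpow_add hq, ← Real.rpow_add hq]; congr 1; ring
  rw [this]; ring

lemma rpow_ne_zpow (hq : 0 < q) (hq1 : q < 1) {s : ℝ} (h : ∀ n : ℤ, s ≠ 11 * n) (n : ℤ) :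
    q ^ (11 * s) ≠ (q ^ 121) ^ n := by
  rw [← Real.rpow_intCast, rpow_q121 hq]
  intro h1
  have := (Real.strictAnti_rpow_of_base_lt_one hq hq1).injective h1
  exact h n (by linarith)

lemma jj_th (hq : 0 < q) (hq1 : q < 1) (x : ℝ) :
    jj (q ^ 121) (q ^ (11 * x)) = th q x * (q ^ ((x - 11 / 2) ^ 2 / 2))⁻¹ * (qI (q ^ 121) (q ^ 121))⁻¹ := by
  have h1 := qI_self_ne_zero (q121_pos hq) (q121_lt hq hq1)
  have h2 : q ^ ((x - 11 / 2) ^ 2 / 2) ≠ 0 := (Real.rpow_pos_of_pos hq _).ne'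
  rw [th_prod hq hq1]; field_simp

lemma th_ne_zero (hq : 0 < q) (hq1 : q < 1) {s : ℝ} (h : ∀ n : ℤ, s ≠ 11 * n) : th q s ≠ 0 := by
  rw [th_prod hq hq1]
  exact mul_ne_zero (Real.rpow_pos_of_pos hq _).ne' (mul_ne_zero
    (qI_self_ne_zero (q121_pos hq) (q121_lt hq hq1)) (jj_ne_zero (q121_pos hq) (q121_lt hq hq1)
    (Real.rpow_pos_of_pos hq _).ne' (rpow_ne_zpow hq hq1 h)))

lemma US_one (hq : 0 < q) (hq1 : q < 1) {s : ℝ} (h : ∀ n : ℤ, s ≠ 11 * n) :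
    US q 1 0 s * th q s = hh q ^ 3 * q ^ ((s - 11 / 2) ^ 2 / 2) := by
  have hp := pf (ι := Unit) (κ := Empty) (q121_pos hq) (q121_lt hq hq1) (x := fun _ => q ^ (11 * s))
    (y := fun e => e.elim) (fun _ => (Real.rpow_pos_of_pos hq _).ne') (fun j => j.elim)
    (fun i k hik => (hik rfl).elim) (fun _ => rpow_ne_zpow hq hq1 h) one_pos (by simp) 0
  have h0 : q ^ (11 * s) ≠ 0 := (Real.rpow_pos_of_pos hq _).ne'
  simp [pfCoef, pfRho, h0, neg_div] at hp
  rw [jj_th hq hq1] at hp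
  rw [US_pf hq, hh]
  have h1 := qI_self_ne_zero (q121_pos hq) (q121_lt hq hq1)
  have hk : (q ^ (((1:ℕ) : ℝ) / 2 * (0 + 11 / 2) ^ 2)) = (q ^ ((121 : ℝ) / 24)) ^ 3 := by
    rw [← Real.rpow_mul_natCast hq.le]; norm_num
  have hth := th_ne_zero hq hq1 h
  have h2 : q ^ ((s - 11 / 2) ^ 2 / 2) ≠ 0 := (Real.rpow_pos_of_pos hq _).ne'
  rw [hk]
  simp only [mul_zero, Real.rpow_zero, add_zero]
  field_simp at hp ⊢
  rw [hp]

lemma rpow_split (hq : 0 < q) (s c : ℝ) :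
    (q ^ ((s - 11 / 2) ^ 2 / 2) = q ^ (s ^ 2 / 2) * (q ^ (11 * s / 2))⁻¹ * (q ^ ((121 : ℝ) / 24)) ^ 3) ∧
    (q ^ ((s + c - 11 / 2) ^ 2 / 2) = q ^ (s ^ 2 / 2) * q ^ (c ^ 2 / 2) * q ^ (s * c) *
      (q ^ (11 * s / 2))⁻¹ * (q ^ (11 * c / 2))⁻¹ * (q ^ ((121 : ℝ) / 24)) ^ 3) ∧
    (q ^ ((s - c - 11 / 2) ^ 2 / 2) = q ^ (s ^ 2 / 2) * q ^ (c ^ 2 / 2) * (q ^ (s * c))⁻¹ *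
      (q ^ (11 * s / 2))⁻¹ * (q ^ (11 * c / 2)) * (q ^ ((121 : ℝ) / 24)) ^ 3) := by
  simp only [← Real.rpow_neg hq.le, ← Real.rpow_add hq, ← Real.rpow_mul_natCast hq.le]
  refine ⟨?_, ?_, ?_⟩ <;> congr 1 <;> push_cast <;> ring

lemma rpow_split' (hq : 0 < q) (c : ℝ) :
    (q ^ ((c - 11 / 2) ^ 2 / 2) = q ^ (c ^ 2 / 2) * (q ^ (11 * c / 2))⁻¹ * (q ^ ((121 : ℝ) / 24)) ^ 3) ∧
    (q ^ ((-c - 11 / 2) ^ 2 / 2) = q ^ (c ^ 2 / 2) * q ^ (11 * c / 2) * (q ^ ((121 : ℝ) / 24)) ^ 3) ∧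
    (q ^ ((2 * c - 11 / 2) ^ 2 / 2) = (q ^ (c ^ 2 / 2)) ^ 4 * ((q ^ (11 * c / 2)) ^ 2)⁻¹ *
      (q ^ ((121 : ℝ) / 24)) ^ 3) ∧
    (q ^ ((-(2 * c) - 11 / 2) ^ 2 / 2) = (q ^ (c ^ 2 / 2)) ^ 4 * ((q ^ (11 * c / 2)) ^ 2) *
      (q ^ ((121 : ℝ) / 24)) ^ 3) := by
  simp only [← Real.rpow_mul_natCast hq.le, ← Real.rpow_neg hq.le, ← Real.rpow_add hq]
  refine ⟨?_, ?_, ?_, ?_⟩ <;> congr 1 <;> push_cast <;> ring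

lemma rpow_splitU (hq : 0 < q) (r : ℕ) (c : ℝ) :
    q ^ ((r : ℝ) / 2 * (c + 11 / 2) ^ 2) =
      (q ^ (c ^ 2 / 2)) ^ r * (q ^ (11 * c / 2)) ^ r * ((q ^ ((121 : ℝ) / 24)) ^ 3) ^ r ∧
    q ^ ((r : ℝ) / 2 * (-c + 11 / 2) ^ 2) =
      (q ^ (c ^ 2 / 2)) ^ r * ((q ^ (11 * c / 2)) ^ r)⁻¹ * ((q ^ ((121 : ℝ) / 24)) ^ 3) ^ r := by
  simp only [← Real.rpow_mul_natCast hq.le, ← Real.rpow_neg hq.le, ← Real.rpow_add hq]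
  refine ⟨?_, ?_⟩ <;> congr 1 <;> push_cast <;> ring

lemma US_two (hq : 0 < q) (hq1 : q < 1) {s c : ℝ} (h1 : ∀ n : ℤ, s + c ≠ 11 * n)
    (h2 : ∀ n : ℤ, s - c ≠ 11 * n) (hc : ∀ n : ℤ, c ≠ 11 * n) (h2c : ∀ n : ℤ, 2 * c ≠ 11 * n) :
    US q 1 c s + US q 1 (-c) s = hh q ^ 3 * q ^ ((s - 11 / 2) ^ 2 / 2) *
      (th q (2 * c) * th q s / (th q c * th q (s + c) * th q (s - c))) := by
  have hpos : ∀ e : ℝ, q ^ e ≠ 0 := fun e => (Real.rpow_pos_of_pos hq _).ne'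
  have hdiv : ∀ a b : ℝ, q ^ (11 * a) / q ^ (11 * b) = q ^ (11 * (a - b)) := fun a b => by
    rw [← Real.rpow_sub hq]; ring_nf
  have h2c' : ∀ n : ℤ, -(2 * c) ≠ 11 * n := fun n h => h2c (-n) (by push_cast; linarith)
  have hp := pf (ι := Fin 2) (κ := Unit) (q121_pos hq) (q121_lt hq hq1)
    (x := ![q ^ (11 * (s + c)), q ^ (11 * (s - c))])
    (y := fun _ => q ^ (11 * s)) (by intro i; fin_cases i <;> simp [hpos]) (fun j => hpos _)
    (by
      intro i k hik
      fin_cases i <;> fin_cases k <;> simp [hdiv] at hik ⊢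
      · rw [show s - c - (s + c) = -(2 * c) by ring]; exact rpow_ne_zpow hq hq1 h2c'
      · rw [show c + c = 2 * c by ring]; exact rpow_ne_zpow hq hq1 h2c)
    (by
      intro i; fin_cases i
      · exact rpow_ne_zpow hq hq1 h1
      · exact rpow_ne_zpow hq hq1 h2) one_pos (by simp) 0
  have er : (Finset.univ.erase (0 : Fin 2)) = {1} ∧ (Finset.univ.erase (1 : Fin 2)) = {0} := by decide
  simp [Fin.sum_univ_two, Fin.prod_univ_two, pfCoef, pfRho, hdiv, er, neg_div, hpos] at hp
  have e1 : q ^ (-(11 * c)) / q ^ (11 * (s - c - (s + c))) = q ^ (11 * ((1 : ℕ) : ℝ) * c) := by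
    rw [← Real.rpow_sub hq]; congr 1; push_cast; ring
  have e2 : -(11 * c) = 11 * (-c) := by ring
  have e3 : 11 * (-c) = 11 * ((1 : ℕ) : ℝ) * (-c) := by push_cast; ring
  have e4 : s - c - (s + c) = -(2 * c) := by ring
  rw [e1, e4, e2, ← two_mul] at hp
  have t1 := th_ne_zero hq hq1 h1
  have t2 := th_ne_zero hq hq1 h2
  have t3 := th_ne_zero hq hq1 hc
  have t4 := th_ne_zero hq hq1 h2c
  have hI := qI_self_ne_zero (q121_pos hq) (q121_lt hq hq1)
  obtain ⟨s1, s2, s3⟩ := rpow_split hq s c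
  obtain ⟨r1, r2, r3, r4⟩ := rpow_split' hq c
  obtain ⟨u1, u2⟩ := rpow_splitU hq 1 c
  simp only [jj_th hq hq1, th_neg, s1, s2, s3, r1, r2, r3, r4] at hp
  rw [US_pf hq, US_pf hq, u1, u2, hh, s1, ← sub_eq_add_neg]
  rw [e3] at hp
  have a1 := hpos (s ^ 2 / 2)
  have a2 := hpos (c ^ 2 / 2)
  have a3 := hpos (s * c)
  have a4 := hpos (11 * s / 2)
  have a5 := hpos (11 * c / 2)
  have a6 := hpos (121 / 24)
  generalize (∑' n : ℤ, pfTerm (q ^ 121) (q ^ (11 * (s + c))) (-q ^ (11 * ((1 : ℕ) : ℝ) * c)) 1 0 n) = S1 at *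
  generalize (∑' n : ℤ, pfTerm (q ^ 121) (q ^ (11 * (s - c))) (-q ^ (11 * ((1 : ℕ) : ℝ) * (-c))) 1 0 n) = S2 at *
  generalize q ^ (s ^ 2 / 2) = b1 at *
  generalize q ^ (c ^ 2 / 2) = b2 at *
  generalize q ^ (s * c) = b3 at *
  generalize q ^ (11 * s / 2) = b4 at *
  generalize q ^ (11 * c / 2) = b5 at *
  generalize q ^ ((121 : ℝ) / 24) = b6 at *
  generalize qI (q ^ 121) (q ^ 121) = I at *
  clear er hdiv e1 e2 e3 e4 s1 s2 s3 r1 r2 r3 r4 u1 u2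
  generalize th q (s + c) = T1 at *
  generalize th q (s - c) = T2 at *
  generalize th q c = T3 at *
  generalize th q (2 * c) = T4 at *
  generalize th q s = T5 at *
  field_simp at hp ⊢
  rw [← hp]

/-- The `e`-twisted version of `US` for the exponent 3. -/
noncomputable def UT (q : ℝ) (e : ℤ) (c s : ℝ) : ℝ := q ^ (((3 : ℕ) : ℝ) / 2 * (c + 11 / 2) ^ 2) *
      ∑' m : ℤ, pfTerm (q ^ 121) (q ^ (11 * (s + c))) (-q ^ (11 * ((3 : ℕ) : ℝ) * c)) 3 e m

lemma UT_three (hq : 0 < q) (hq1 : q < 1) {s c : ℝ} (h0 : ∀ n : ℤ, s ≠ 11 * n)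
    (h1 : ∀ n : ℤ, s + c ≠ 11 * n)
    (h2 : ∀ n : ℤ, s - c ≠ 11 * n) (hc : ∀ n : ℤ, c ≠ 11 * n) (h2c : ∀ n : ℤ, 2 * c ≠ 11 * n) (δ : ℕ) :
    UT q (δ - 2) c s + UT q (δ - 2) (-c) s = th q (2 * c) / th q c * UT q (δ - 2) 0 s +
      hh q ^ 3 * q ^ ((3 : ℝ) / 2 * (s - 11 / 2) ^ 2) *
      (th q c * th q (2 * c) / (th q s * th q (s + c) * th q (s - c))) := by
  have hpos : ∀ e : ℝ, q ^ e ≠ 0 := fun e => (Real.rpow_pos_of_pos hq _).ne'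
  have hdiv : ∀ a b : ℝ, q ^ (11 * a) / q ^ (11 * b) = q ^ (11 * (a - b)) := fun a b => by
    rw [← Real.rpow_sub hq]; ring_nf
  have h2c' : ∀ n : ℤ, -(2 * c) ≠ 11 * n := fun n h => h2c (-n) (by push_cast; linarith)
  have hc' : ∀ n : ℤ, -c ≠ 11 * n := fun n h => hc (-n) (by push_cast; linarith)
  have hp := pf (ι := Fin 3) (κ := Empty) (q121_pos hq) (q121_lt hq hq1)
    (x := ![q ^ (11 * s), q ^ (11 * (s + c)), q ^ (11 * (s - c))])
    (y := fun e => e.elim) (by intro i; fin_cases i <;> simp [hpos]) (fun j => j.elim)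
    (by
      intro i k hik
      fin_cases i <;> fin_cases k <;> simp [hdiv] at hik ⊢
      · exact rpow_ne_zpow hq hq1 hc
      · rw [show -(11 * c) = 11 * (-c) by ring]; exact rpow_ne_zpow hq hq1 hc'
      · rw [show -(11 * c) = 11 * (-c) by ring]; exact rpow_ne_zpow hq hq1 hc'
      · rw [show s - c - (s + c) = -(2 * c) by ring]; exact rpow_ne_zpow hq hq1 h2c'
      · exact rpow_ne_zpow hq hq1 hc
      · rw [show c + c = 2 * c by ring]; exact rpow_ne_zpow hq hq1 h2c)
    (by
      intro i; fin_cases i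
      · exact rpow_ne_zpow hq hq1 h0
      · exact rpow_ne_zpow hq hq1 h1
      · exact rpow_ne_zpow hq hq1 h2) (l := 3) (by norm_num) (by simp) δ
  have er : (Finset.univ.erase (0 : Fin 3)) = {1, 2} ∧ (Finset.univ.erase (1 : Fin 3)) = {0, 2} ∧
    (Finset.univ.erase (2 : Fin 3)) = {0, 1} := by decide
  simp [Fin.sum_univ_three, Fin.prod_univ_three, pfCoef, pfRho, hdiv, er, neg_div, hpos] at hp
  have e0 : -(q ^ (11 * c) * q ^ (-(11 * c))) = -q ^ (11 * ((3 : ℕ) : ℝ) * 0) := by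
    rw [← Real.rpow_add hq]; congr 2; push_cast; ring
  have e1 : q ^ (11 * (c + c)) * q ^ (11 * c) = q ^ (11 * ((3 : ℕ) : ℝ) * c) := by
    rw [← Real.rpow_add hq]; congr 1; push_cast; ring
  have e2 : q ^ (11 * (s - c - (s + c))) * q ^ (-(11 * c)) = q ^ (11 * ((3 : ℕ) : ℝ) * (-c)) := by
    rw [← Real.rpow_add hq]; congr 1; push_cast; ring
  have e3 : -(11 * c) = 11 * (-c) := by ring
  have e4 : s - c - (s + c) = -(2 * c) := by ring
  have e5 : (δ : ℤ) + 1 - 3 = δ - 2 := by ring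
  rw [e0, e1, e2, e4, e5, e3, ← two_mul] at hp
  have t0 := th_ne_zero hq hq1 h0
  have t1 := th_ne_zero hq hq1 h1
  have t2 := th_ne_zero hq hq1 h2
  have t3 := th_ne_zero hq hq1 hc
  have t4 := th_ne_zero hq hq1 h2c
  have hI := qI_self_ne_zero (q121_pos hq) (q121_lt hq hq1)
  obtain ⟨s1, s2, s3⟩ := rpow_split hq s c
  obtain ⟨r1, r2, r3, r4⟩ := rpow_split' hq c
  obtain ⟨u1, u2⟩ := rpow_splitU hq 3 c
  have u0 : q ^ (((3 : ℕ) : ℝ) / 2 * (0 + 11 / 2) ^ 2) = (q ^ ((121 : ℝ) / 24)) ^ 9 := by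
    rw [← Real.rpow_mul_natCast hq.le]; norm_num
  have u3 : q ^ ((3 : ℝ) / 2 * (s - 11 / 2) ^ 2) = (q ^ ((s - 11 / 2) ^ 2 / 2)) ^ 3 := by
    rw [← Real.rpow_mul_natCast hq.le]; congr 1; push_cast; ring
  simp only [jj_th hq hq1, th_neg, s1, s2, s3, r1, r2, r3, r4] at hp
  rw [UT, UT, UT, u1, u2, u0, hh, u3, s1, ← sub_eq_add_neg, add_zero]
  have a1 := hpos (s ^ 2 / 2)
  have a2 := hpos (c ^ 2 / 2)
  have a3 := hpos (s * c)
  have a4 := hpos (11 * s / 2)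
  have a5 := hpos (11 * c / 2)
  have a6 := hpos (121 / 24)
  generalize (∑' n : ℤ, pfTerm (q ^ 121) (q ^ (11 * s)) (-q ^ (11 * ((3 : ℕ) : ℝ) * 0)) 3 (δ - 2) n) = S0 at *
  generalize (∑' n : ℤ, pfTerm (q ^ 121) (q ^ (11 * (s + c))) (-q ^ (11 * ((3 : ℕ) : ℝ) * c)) 3 (δ - 2) n) = S1 at *
  generalize (∑' n : ℤ, pfTerm (q ^ 121) (q ^ (11 * (s - c))) (-q ^ (11 * ((3 : ℕ) : ℝ) * (-c))) 3 (δ - 2) n) = S2 at *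
  generalize q ^ (s ^ 2 / 2) = b1 at *
  generalize q ^ (c ^ 2 / 2) = b2 at *
  generalize q ^ (s * c) = b3 at *
  generalize q ^ (11 * s / 2) = b4 at *
  generalize q ^ (11 * c / 2) = b5 at *
  generalize q ^ ((121 : ℝ) / 24) = b6 at *
  generalize qI (q ^ 121) (q ^ 121) = I at *
  clear er hdiv e0 e1 e2 e3 e4 s1 s2 s3 r1 r2 r3 r4 u1 u2
  generalize th q (s + c) = T1 at *
  generalize th q (s - c) = T2 at *
  generalize th q c = T3 at *
  generalize th q (2 * c) = T4 at *
  generalize th q s = T5 at *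
  field_simp at hp ⊢
  linear_combination -hp

lemma US_eq_UT (hq : 0 < q) (c s : ℝ) : US q 3 c s = UT q 0 c s := US_pf hq 3 c s

lemma US_three (hq : 0 < q) (hq1 : q < 1) {s c : ℝ} (h0 : ∀ n : ℤ, s ≠ 11 * n)
    (h1 : ∀ n : ℤ, s + c ≠ 11 * n)
    (h2 : ∀ n : ℤ, s - c ≠ 11 * n) (hc : ∀ n : ℤ, c ≠ 11 * n) (h2c : ∀ n : ℤ, 2 * c ≠ 11 * n) :
    US q 3 c s + US q 3 (-c) s = th q (2 * c) / th q c * US q 3 0 s +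
      hh q ^ 3 * q ^ ((3 : ℝ) / 2 * (s - 11 / 2) ^ 2) *
      (th q c * th q (2 * c) / (th q s * th q (s + c) * th q (s - c))) := by
  simpa [US_eq_UT hq] using UT_three hq hq1 h0 h1 h2 hc h2c 2

lemma UT_sub (hq : 0 < q) (hq1 : q < 1) {s c : ℝ} (h : ∀ n : ℤ, s + c ≠ 11 * n) :
    UT q (-1) c s - UT q 0 c s = q ^ (3 / 2 * (11 / 2 : ℝ) ^ 2 - 11 * s - 3 / 2 * (11 / 6) ^ 2) *
      thF (q ^ 3) (-1) (c + 11 / 6) := by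
  have hz : q ^ (11 * (s + c)) ≠ 0 := (Real.rpow_pos_of_pos hq _).ne'
  have hρ : -q ^ (11 * ((3 : ℕ) : ℝ) * c) ≠ 0 := neg_ne_zero.mpr (Real.rpow_pos_of_pos hq _).ne'
  have hs := fun e => (pfTerm_summable (q121_pos hq) (q121_lt hq hq1) hz hρ (l := 3) (by norm_num) e).of_abs
  rw [UT, UT, ← mul_sub, ← (hs (-1)).tsum_sub (hs 0), thF, ← tsum_mul_left, ← tsum_mul_left]
  refine tsum_congr fun m => ?_
  have hQ : ((q ^ 121 : ℝ)) ^ m = q ^ (121 * (m : ℝ)) := by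
    rw [← Real.rpow_intCast, rpow_q121 hq]
  have h1 : (-q ^ (11 * ((3 : ℕ) : ℝ) * c)) ^ m = (-1) ^ m * q ^ (11 * ((3 : ℕ) : ℝ) * c * m) := by
    rw [neg_eq_neg_one_mul, mul_zpow, ← Real.rpow_mul_intCast hq.le]
  have h2 : q ^ (11 * (s + c)) * (q ^ 121) ^ m ≠ 1 := by
    intro h2
    apply rpow_ne_zpow hq hq1 h (-m)
    rw [zpow_neg]; exact eq_inv_of_mul_eq_one_left h2
  have h3 : (q ^ 3 : ℝ) ^ ((11 * (m : ℝ) + (c + 11 / 6)) ^ 2 / 2) =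
      q ^ (3 * ((11 * (m : ℝ) + (c + 11 / 6)) ^ 2 / 2)) := by
    rw [← Real.rpow_natCast_mul hq.le]; norm_num
  rw [pfTerm, pfTerm, zpow_zero, zpow_neg_one, h3, h1, rpow_q121 hq]
  have h4 : (1 - q ^ (11 * (s + c)) * (q ^ 121) ^ m) ≠ 0 := sub_ne_zero.mpr (Ne.symm h2)
  have h5 : q ^ (((3 : ℕ) : ℝ) / 2 * (c + 11 / 2) ^ 2) * (q ^ (121 * (((3 : ℕ) : ℝ) * (m * (m + 1) / 2))) *
      q ^ (11 * ((3 : ℕ) : ℝ) * c * m)) = q ^ (3 / 2 * (11 / 2 : ℝ) ^ 2 - 11 * s - 3 / 2 * (11 / 6) ^ 2) *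
      q ^ (3 * ((11 * (m : ℝ) + (c + 11 / 6)) ^ 2 / 2)) * (q ^ (11 * (s + c)) * (q ^ 121) ^ m) := by
    rw [hQ]
    simp only [← Real.rpow_add hq]
    congr 1; push_cast; ring
  have h6 : q ^ (11 * (s + c)) * (q ^ 121) ^ m ≠ 0 := by
    rw [hQ]; exact mul_ne_zero hz (Real.rpow_pos_of_pos hq _).ne'
  generalize q ^ (11 * (s + c)) * (q ^ 121) ^ m = X at *
  calc _ = (q ^ (((3 : ℕ) : ℝ) / 2 * (c + 11 / 2) ^ 2) * (q ^ (121 * (((3 : ℕ) : ℝ) * (m * (m + 1) / 2))) *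
      q ^ (11 * ((3 : ℕ) : ℝ) * c * m))) * ((-1) ^ m * ((X⁻¹ - 1) * (1 - X)⁻¹)) := by ring
    _ = _ := by rw [h5, show (X⁻¹ - 1) * (1 - X)⁻¹ = X⁻¹ by field_simp]; field_simp

lemma exists_generic (S : Finset ℝ) : ∃ s : ℝ, ∀ c ∈ S, ∀ n : ℤ, s + c ≠ 11 * n := by
  have : (⋃ c ∈ S, Set.range fun n : ℤ => 11 * (n : ℝ) - c).Countable :=
    S.countable_toSet.biUnion fun c _ => Set.countable_range _
  obtain ⟨s, hs⟩ : ∃ s : ℝ, s ∉ (⋃ c ∈ S, Set.range fun n : ℤ => 11 * (n : ℝ) - c) := by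
    by_contra! h
    exact Set.not_countable_univ (this.mono fun x _ => h x)
  refine ⟨s, fun c hc n h => hs ?_⟩
  simp only [Set.mem_iUnion, Set.mem_range]
  exact ⟨c, hc, n, by linarith⟩

lemma quintuple (hq : 0 < q) (hq1 : q < 1) {c : ℝ} (hc : ∀ n : ℤ, c ≠ 11 * n) (h2c : ∀ n : ℤ, 2 * c ≠ 11 * n) :
    thF (q ^ 3) (-1) (c + 11 / 6) + thF (q ^ 3) (-1) (-c + 11 / 6) =
      th q (2 * c) / th q c * thF (q ^ 3) (-1) (11 / 6) := by
  obtain ⟨s, hs⟩ := exists_generic {0, c, -c}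
  simp only [Finset.mem_insert, Finset.mem_singleton, forall_eq_or_imp, forall_eq, add_zero] at hs
  obtain ⟨h0, h1, h2⟩ := hs
  have e1 := UT_three hq hq1 h0 h1 (by simpa [sub_eq_add_neg] using h2) hc h2c 1
  have e2 := UT_three hq hq1 h0 h1 (by simpa [sub_eq_add_neg] using h2) hc h2c 2
  have f1 := UT_sub hq hq1 (c := 0) (by simpa using h0)
  have f2 := UT_sub hq hq1 h1
  have f3 := UT_sub hq hq1 h2
  norm_num at e1 e2
  have hk : q ^ (3 / 2 * (11 / 2 : ℝ) ^ 2 - 11 * s - 3 / 2 * (11 / 6) ^ 2) ≠ 0 :=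
    (Real.rpow_pos_of_pos hq _).ne'
  rw [zero_add] at f1
  apply mul_left_cancel₀ hk
  linear_combination e1 - e2 + th q (2 * c) / th q c * f1 - f2 - f3

lemma qI_three {Q : ℝ} (hQ : 0 < Q) (hQ1 : Q < 1) :
    qI (Q ^ 3) Q * qI (Q ^ 3) (Q ^ 2) * qI (Q ^ 3) (Q ^ 3) = qI Q Q := by
  have h3 : 0 < Q ^ 3 := by positivity
  have h31 : Q ^ 3 < 1 := pow_lt_one₀ hQ.le hQ1 (by norm_num)
  have t := ((qP_tendsto h3 h31 Q).mul (qP_tendsto h3 h31 (Q ^ 2))).mul (qP_tendsto h3 h31 (Q ^ 3))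
  have t2 := (qP_tendsto hQ hQ1 Q).comp (tendsto_id.const_mul_atTop' (show 0 < 3 by norm_num))
  refine tendsto_nhds_unique t (t2.congr fun N => ?_)
  simp only [Function.comp, id]
  induction N with
  | zero => simp [qP_zero]
  | succ N ih =>
    rw [show 3 * (N + 1) = 3 * N + 1 + 1 + 1 by ring, qP_succ, qP_succ, qP_succ, ih, qP_succ, qP_succ, qP_succ]
    ring

lemma pent_hasSum {Q : ℝ} (hQ : 0 < Q) (hQ1 : Q < 1) :
    HasSum (fun k : ℤ => (-1) ^ k * Q ^ ((3 : ℝ) / 2 * (k + 1 / 6) ^ 2)) (Q ^ ((1 : ℝ) / 24) * qI Q Q) := by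
  have h3 : 0 < Q ^ 3 := by positivity
  have h31 : Q ^ 3 < 1 := pow_lt_one₀ hQ.le hQ1 (by norm_num)
  have hj := ((jtp h3 h31 hQ.ne').mul_left (Q ^ ((1 : ℝ) / 24)))
  rw [← (Equiv.neg ℤ).hasSum_iff] at hj
  refine hj.congr_eq (fun k => ?_) ?_
  · simp only [Function.comp, Equiv.neg_apply]
    have : ((-Q) ^ (-k) : ℝ) = (-1) ^ k * Q ^ (-(k : ℝ)) := by
      rw [neg_eq_neg_one_mul, mul_zpow, ← Real.rpow_intCast Q]
      push_cast
      congr 1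
      rw [zpow_neg, ← inv_zpow]; norm_num
    have e : Q ^ ((3 : ℝ) / 2 * (k + 1 / 6) ^ 2) = Q ^ ((1 : ℝ) / 24) *
        (Q ^ (((3 : ℕ) : ℝ) * (((-k : ℤ) : ℝ) * (((-k : ℤ) : ℝ) - 1) / 2)) * Q ^ (-(k : ℝ))) := by
      simp only [← Real.rpow_add hQ]
      congr 1; push_cast; ring
    rw [this, ← Real.rpow_natCast_mul hQ.le, e]
    ring
  · rw [← qI_three hQ hQ1, show Q ^ 3 / Q = Q ^ 2 by field_simp]
    
end poleSums

lemma tsum_mod_eleven {f : ℤ → ℝ} (hf : Summable f) :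
    ∑' k, f k = ∑' m : ℤ, f (11 * m) +
      ∑ c ∈ Finset.Icc (1 : ℤ) 5, (∑' m : ℤ, f (11 * m + c) + ∑' m : ℤ, f (11 * m - c)) := by
  have h1 : Summable (fun p : ℤ × Fin 11 => f ((Int.divModEquiv 11).symm p)) :=
    hf.comp_injective (Equiv.injective _)
  have hsh : ∀ c : ℤ, ∑' m : ℤ, f (11 * m + c) = ∑' m : ℤ, f (11 * m - (11 - c)) := fun c => by
    rw [← (Equiv.subRight (1 : ℤ)).tsum_eq]
    refine tsum_congr fun m => ?_
    simp only [Equiv.subRight_apply]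
    congr 1; ring
  have h2 : ∀ (m : ℤ) (i : Fin 11), (Int.divModEquiv 11).symm (m, i) = 11 * m + (i : ℕ) := fun m i => by
    simp [Int.divModEquiv]; ring
  rw [← (Int.divModEquiv 11).symm.tsum_eq, h1.tsum_prod' fun m => Summable.of_finite]
  simp only [tsum_fintype]
  rw [Summable.tsum_finsetSum]
  · simp only [h2, Fin.sum_univ_succ]
    simp
    have : Finset.Icc (1 : ℤ) 5 = {1, 2, 3, 4, 5} := by decide
    rw [this]
    simp
    rw [hsh 6, hsh 7, hsh 8, hsh 9, hsh 10]
    norm_num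
    ring
  · intro i _
    exact h1.comp_injective (i := fun m => (m, i)) fun a b h => by simpa using h

section
variable {q : ℝ}

lemma thF_cube (hq : 0 < q) (x : ℝ) :
    thF (q ^ 3) (-1) x = ∑' m : ℤ, (-1) ^ m * q ^ ((3 : ℝ) / 2 * (11 * m + x) ^ 2) := by
  rw [thF]
  refine tsum_congr fun m => ?_
  rw [← Real.rpow_natCast_mul hq.le]
  congr 2; push_cast; ring

lemma hh_eq_thF (hq : 0 < q) (hq1 : q < 1) : thF (q ^ 3) (-1) (11 / 6) = hh q := by
  rw [hh, thF_cube hq]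
  have := (pent_hasSum (q121_pos hq) (q121_lt hq hq1)).tsum_eq
  rw [rpow_q121 hq, show 121 * ((1 : ℝ) / 24) = 121 / 24 by norm_num] at this
  rw [← this]
  refine tsum_congr fun m => ?_
  rw [rpow_q121 hq]
  congr 2; ring

lemma int_not_mul_eleven {c : ℤ} (h : ¬ 11 ∣ c) (n : ℤ) : (c : ℝ) ≠ 11 * n := fun e =>
  h ⟨n, by exact_mod_cast e⟩

/-- The pentagonal sum dissected modulo 11. -/
lemma pent_split (hq : 0 < q) (hq1 : q < 1) :
    q ^ ((1 : ℝ) / 24) * qI q q = hh q * (1 + ∑ c ∈ Finset.Icc (1 : ℤ) 5, (-1) ^ c * (th q (2 * c) / th q c)) := by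
  have hp := pent_hasSum hq hq1
  have e : ∀ c : ℤ, ∑' m : ℤ, (-1 : ℝ) ^ (11 * m + c - 2) * q ^ ((3 : ℝ) / 2 * (((11 * m + c - 2 : ℤ) : ℝ) + 1 / 6) ^ 2) =
      (-1) ^ c * thF (q ^ 3) (-1) (-c + 11 / 6) := by
    intro c
    rw [← thF_neg (by norm_num), thF_cube hq, ← tsum_mul_left]
    refine tsum_congr fun m => ?_
    rw [← mul_assoc, ← zpow_add₀ (by norm_num)]
    congr 1
    · rw [show 11 * m + c - 2 = c + m + 2 * (5 * m - 1) by ring, zpow_add₀ (by norm_num), zpow_mul]; norm_num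
    · congr 1; push_cast; ring
  have hs : Summable fun k : ℤ => (-1 : ℝ) ^ (k - 2) * q ^ ((3 : ℝ) / 2 * (((k - 2 : ℤ) : ℝ) + 1 / 6) ^ 2) :=
    (Equiv.subRight (2 : ℤ)).summable_iff.mpr hp.summable
  have ht : ∑' k : ℤ, (-1 : ℝ) ^ (k - 2) * q ^ ((3 : ℝ) / 2 * (((k - 2 : ℤ) : ℝ) + 1 / 6) ^ 2) =
      q ^ ((1 : ℝ) / 24) * qI q q :=
    ((Equiv.subRight (2 : ℤ)).tsum_eq fun k : ℤ => (-1 : ℝ) ^ k * q ^ ((3 : ℝ) / 2 * (k + 1 / 6) ^ 2)).trans hp.tsum_eq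
  rw [← ht, tsum_mod_eleven hs]
  have e0 := e 0
  simp only [add_zero, zpow_zero, one_mul, Int.cast_zero, neg_zero, zero_add] at e0
  rw [e0, hh_eq_thF hq hq1, mul_add, mul_one, Finset.mul_sum]
  congr 1
  refine Finset.sum_congr rfl fun c hc => ?_
  rw [Finset.mem_Icc] at hc
  have e1 := e c
  have e2 := e (-c)
  have qu := quintuple hq hq1 (c := c) (int_not_mul_eleven (by omega))
    (by exact_mod_cast int_not_mul_eleven (c := 2 * c) (by omega))
  rw [hh_eq_thF hq hq1] at qu
  have e3 : ((-1 : ℝ)) ^ (-c) = (-1) ^ c := by rw [zpow_neg, ← inv_zpow]; norm_num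
  simp only [← sub_eq_add_neg] at e2
  rw [e1, e2, e3]
  push_cast at qu ⊢
  rw [neg_neg]
  linear_combination (-1) ^ c * qu
end

section
variable {q : ℝ}

lemma inv_one_sub_rpow_le (hq : 0 < q) (hq1 : q < 1) {t : ℝ} (ht : 1 / 2 ≤ |t|) :
    |(1 - q ^ (11 * t))⁻¹| ≤ (1 - q ^ ((11 : ℝ) / 2))⁻¹ := by
  have h0 : q ^ ((11 : ℝ) / 2) < 1 := Real.rpow_lt_one hq.le hq1 (by norm_num)
  have hp : 0 < q ^ ((11 : ℝ) / 2) := Real.rpow_pos_of_pos hq _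
  rw [abs_inv]
  apply inv_anti₀ (by linarith)
  rcases le_abs'.mp ht with h | h
  · have h1 : q ^ (-((11 : ℝ) / 2)) ≤ q ^ (11 * t) :=
      Real.rpow_le_rpow_of_exponent_ge hq hq1.le (by linarith)
    rw [Real.rpow_neg hq.le] at h1
    have h2 : 2 - q ^ ((11 : ℝ) / 2) ≤ (q ^ ((11 : ℝ) / 2))⁻¹ := by
      rw [le_inv_comm₀ (by linarith) hp, inv_eq_one_div, le_div_iff₀ (by linarith)]
      nlinarith [sq_nonneg (1 - q ^ ((11 : ℝ) / 2))]
    rw [abs_sub_comm]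
    exact le_trans (by linarith) (le_abs_self _)
  · have h1 : q ^ (11 * t) ≤ q ^ ((11 : ℝ) / 2) :=
      Real.rpow_le_rpow_of_exponent_ge hq hq1.le (by linarith)
    exact le_trans (by linarith) (le_abs_self _)

lemma abs_usTerm_le (hq : 0 < q) (hq1 : q < 1) (r : ℕ) (c : ℝ) {s : ℝ} {m : ℤ}
    (h : 1 / 2 ≤ |11 * m + c + s|) :
    |usTerm q r c s m| ≤ q ^ ((r : ℝ) / 2 * (11 * m + c + 11 / 2) ^ 2) * (1 - q ^ ((11 : ℝ) / 2))⁻¹ := by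
  rw [usTerm, div_eq_mul_inv, abs_mul, abs_mul, abs_zpow, abs_neg, abs_one, one_zpow, one_mul,
    abs_of_pos (Real.rpow_pos_of_pos hq _)]
  exact mul_le_mul_of_nonneg_left (inv_one_sub_rpow_le hq hq1 h) (Real.rpow_pos_of_pos hq _).le

lemma usBound_summable (hq : 0 < q) (hq1 : q < 1) {r : ℕ} (hr : 0 < r) (c : ℝ) :
    Summable fun m : ℤ => q ^ ((r : ℝ) / 2 * (11 * m + c + 11 / 2) ^ 2) * (1 - q ^ ((11 : ℝ) / 2))⁻¹ := by
  have hr' : (0 : ℝ) < r := by exact_mod_cast hr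
  refine ((summable_quad hq hq1 (c := (r : ℝ) / 2 * 121) (by positivity) ((r : ℝ) / 2 * 22 * (c + 11 / 2))
    ((r : ℝ) / 2 * (c + 11 / 2) ^ 2)).congr fun m => ?_).mul_right _
  congr 1; ring

lemma half_le_abs {n : ℤ} (hn : n ≠ 0) {e : ℝ} (he : |e| ≤ 1 / 2) : 1 / 2 ≤ |(n : ℝ) + e| := by
  have h1 : (1 : ℝ) ≤ |(n : ℝ)| := by exact_mod_cast Int.one_le_abs hn
  have := abs_sub_abs_le_abs_sub (n : ℝ) (-e)
  rw [abs_neg, sub_neg_eq_add] at this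
  linarith

lemma tendsto_usTerm (hq : 0 < q) (hq1 : q < 1) (r : ℕ) (c a m : ℤ) (h : 11 * m + c + a ≠ 0) :
    Tendsto (fun s => usTerm q r c s m) (𝓝 a) (𝓝 (usTerm q r c a m)) := by
  have hc : ContinuousAt (fun s : ℝ => usTerm q r c s m) a := by
    unfold usTerm
    refine ContinuousAt.div continuousAt_const (ContinuousAt.sub continuousAt_const ?_) ?_
    · exact (Real.continuousAt_const_rpow hq.ne').comp (by fun_prop)
    · intro h2
      have h3 := half_le_abs h (e := 0) (by norm_num)
      have h4 := (Real.strictAnti_rpow_of_base_lt_one hq hq1).injective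
        ((sub_eq_zero.mp h2).symm.trans (Real.rpow_zero q).symm)
      push_cast at h3
      have h5 : (11 * (m : ℝ) + c + a) = 0 := by linarith
      rw [h5] at h3
      norm_num at h3
  exact hc

lemma tendsto_US_punctured (hq : 0 < q) (hq1 : q < 1) {r : ℕ} (hr : 0 < r) (c a : ℤ) (S : Set ℤ)
    [DecidablePred (· ∈ S)] (h : ∀ m ∉ S, 11 * m + c + a ≠ 0) :
    Tendsto (fun s => ∑' m : ℤ, if m ∈ S then 0 else usTerm q r c s m) (𝓝 a)
      (𝓝 (∑' m : ℤ, if m ∈ S then 0 else usTerm q r c a m)) := by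
  refine tendsto_tsum_of_dominated_convergence (usBound_summable hq hq1 hr c) (fun m => ?_) ?_
  · by_cases hm : m ∈ S
    · simp [hm]
    · simp only [hm, if_false]
      exact tendsto_usTerm hq hq1 r c a m (h m hm)
  · filter_upwards [Metric.closedBall_mem_nhds (a : ℝ) (show (0 : ℝ) < 1 / 2 by norm_num)] with s hs m
    rw [Metric.mem_closedBall, Real.dist_eq] at hs
    by_cases hm : m ∈ S
    · simp only [hm, if_true, norm_zero]
      have : q ^ ((11 : ℝ) / 2) < 1 := Real.rpow_lt_one hq.le hq1 (by norm_num)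
      exact mul_nonneg (Real.rpow_pos_of_pos hq _).le (inv_nonneg.mpr (by linarith))
    · simp only [hm, if_false, Real.norm_eq_abs]
      apply abs_usTerm_le hq hq1
      have := half_le_abs (h m hm) hs
      push_cast at this
      convert this using 2; ring

lemma tendsto_US (hq : 0 < q) (hq1 : q < 1) {r : ℕ} (hr : 0 < r) {c a : ℤ} (h : ¬ 11 ∣ c + a) :
    Tendsto (fun s => US q r c s) (𝓝 a) (𝓝 (US q r c a)) := by
  simpa [US] using tendsto_US_punctured hq hq1 hr c a ∅ fun m _ e => h ⟨-m, by linarith⟩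

/-- `US` without the term of index `0`. -/
noncomputable def USz (q : ℝ) (r : ℕ) (c s : ℝ) : ℝ := ∑' m : ℤ, if m ∈ ({0} : Set ℤ) then 0 else usTerm q r c s m

lemma tendsto_USz (hq : 0 < q) (hq1 : q < 1) {r : ℕ} (hr : 0 < r) (a : ℤ) :
    Tendsto (fun s => USz q r (-a) s) (𝓝 a) (𝓝 (US q r (-a) a)) := by
  have := tendsto_US_punctured hq hq1 hr (-a) a {0} fun m hm e => hm (by simp; omega)
  convert this using 2
  · simp [USz]
  · rw [US]
    refine tsum_congr fun m => ?_
    split_ifs with h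
    · simp at h
      simp [usTerm, h]
    · simp

lemma US_eq_USz (hq : 0 < q) (hq1 : q < 1) {r : ℕ} (hr : 0 < r) (a : ℤ) {s : ℝ} (hs : |s - a| ≤ 1 / 2) :
    US q r (-a) s = q ^ ((r : ℝ) / 2 * (-a + 11 / 2) ^ 2) / (1 - q ^ (11 * (s - a))) + USz q r (-a) s := by
  have hsm : Summable fun m : ℤ => if m ∈ ({0} : Set ℤ) then 0 else usTerm q r (-a) s m := by
    refine Summable.of_norm_bounded (usBound_summable hq hq1 hr (-a)) fun m => ?_
    by_cases hm : m ∈ ({0} : Set ℤ)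
    · simp only [hm, if_true, norm_zero]
      have : q ^ ((11 : ℝ) / 2) < 1 := Real.rpow_lt_one hq.le hq1 (by norm_num)
      exact mul_nonneg (Real.rpow_pos_of_pos hq _).le (inv_nonneg.mpr (by linarith))
    · simp only [hm, if_false, Real.norm_eq_abs]
      apply abs_usTerm_le hq hq1
      have := half_le_abs (n := 11 * m) (by simpa using hm) hs
      push_cast at this
      convert this using 2; ring
  have h2 := (hasSum_ite_eq (0 : ℤ) (usTerm q r (-a) s 0)).add hsm.hasSum
  refine (h2.congr_eq (fun m => ?_) ?_).tsum_eq
  · by_cases hm : m = 0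
    · simp [hm]
    · simp [hm]
  · rw [USz]; congr 1; rw [usTerm]; simp; ring_nf
end

section
variable {q : ℝ}

lemma tendsto_ratio_one_sub_rpow (hq : 0 < q) :
    Tendsto (fun ε : ℝ => (1 - q ^ (11 * ε)) / ε) (𝓝[≠] 0) (𝓝 (-(11 * Real.log q))) := by
  have h : HasDerivAt (fun ε : ℝ => 1 - q ^ (11 * ε)) (-(Real.log q * 11 * q ^ ((11 : ℝ) * 0))) 0 :=
    (((hasDerivAt_id (0 : ℝ)).const_mul 11).const_rpow hq |>.const_sub 1).congr_deriv (by simp)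
  refine ((hasDerivAt_iff_tendsto_slope_zero.mp h).congr fun ε => ?_).trans (by simp [mul_comm])
  simp [div_eq_inv_mul]

lemma tendsto_th_ratio (hq : 0 < q) (hq1 : q < 1) :
    Tendsto (fun ε : ℝ => th q ε / ε) (𝓝[≠] 0) (𝓝 (deriv (th q) 0)) := by
  refine (hasDerivAt_iff_tendsto_slope_zero.mp (th_hasDerivAt hq hq1 0)).congr fun ε => ?_
  simp [div_eq_inv_mul, th_zero]

lemma log_ne_zero_of (hq : 0 < q) (hq1 : q < 1) : Real.log q ≠ 0 := (Real.log_neg hq hq1).ne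

lemma eventually_small : ∀ᶠ ε : ℝ in 𝓝[≠] 0, |ε| ≤ 1 / 2 ∧ ε ≠ 0 := by
  have := Metric.closedBall_mem_nhds (0 : ℝ) (show (0 : ℝ) < 1 / 2 by norm_num)
  filter_upwards [nhdsWithin_le_nhds this, self_mem_nhdsWithin] with ε h1 h2
  rw [Metric.mem_closedBall, Real.dist_eq, sub_zero] at h1
  exact ⟨h1, h2⟩

lemma int_add_small_ne {n : ℤ} {ε : ℝ} (h : |ε| ≤ 1 / 2) (h0 : ε ≠ 0) (k : ℤ) : (n : ℝ) + ε ≠ 11 * k := by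
  intro e
  by_cases hk : n - 11 * k = 0
  · have : (n : ℝ) - 11 * k = 0 := by exact_mod_cast hk
    exact h0 (by linarith)
  · have h1 := half_le_abs hk h
    have h2 : ((n - 11 * k : ℤ) : ℝ) + ε = 0 := by push_cast; linarith
    rw [h2] at h1; norm_num at h1

lemma deriv_th_zero (hq : 0 < q) (hq1 : q < 1) : deriv (th q) 0 = -(11 * Real.log q) * hh q ^ 3 := by
  have hlog := log_ne_zero_of hq hq1
  have hk : -(11 * Real.log q) ≠ 0 := neg_ne_zero.mpr (mul_ne_zero (by norm_num) hlog)
  have t1 := (tendsto_ratio_one_sub_rpow hq).inv₀ hk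
  have t2 := tendsto_USz hq hq1 one_pos 0
  have t3 := tendsto_th_ratio hq hq1
  have t0 : Tendsto (fun ε : ℝ => ε) (𝓝[≠] 0) (𝓝 0) := tendsto_id.mono_left nhdsWithin_le_nhds
  rw [Int.cast_zero, neg_zero] at t2
  have t4 := ((t1.const_mul (q ^ (((1 : ℕ) : ℝ) / 2 * (-((0 : ℤ) : ℝ) + 11 / 2) ^ 2))).add
    (t0.mul (t2.mono_left nhdsWithin_le_nhds))).mul t3
  have t5 : Tendsto (fun ε : ℝ => hh q ^ 3 * q ^ ((ε - 11 / 2) ^ 2 / 2)) (𝓝[≠] 0)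
      (𝓝 (hh q ^ 3 * q ^ (((0 : ℝ) - 11 / 2) ^ 2 / 2))) := by
    refine Tendsto.mono_left ?_ nhdsWithin_le_nhds
    refine ((Real.continuousAt_const_rpow hq.ne').comp (f := fun ε : ℝ => (ε - 11 / 2) ^ 2 / 2)
      (by fun_prop)).tendsto.const_mul _
  have h := tendsto_nhds_unique (t4.congr' ?_) t5
  · have h1 : q ^ (((1 : ℕ) : ℝ) / 2 * (-((0 : ℤ) : ℝ) + 11 / 2) ^ 2) = q ^ (((0 : ℝ) - 11 / 2) ^ 2 / 2) := by
      congr 1; norm_num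
    have h2 : q ^ (((0 : ℝ) - 11 / 2) ^ 2 / 2) ≠ 0 := (Real.rpow_pos_of_pos hq _).ne'
    rw [h1, zero_mul, add_zero] at h
    generalize -(11 * Real.log q) = κ at *
    field_simp at h
    linarith
  · filter_upwards [eventually_small] with ε hε
    have e1 := US_one hq hq1 (s := ε) fun n => by simpa using int_add_small_ne (n := 0) hε.1 hε.2 n
    have e2 := US_eq_USz hq hq1 one_pos 0 (s := ε) (by simpa using hε.1)
    rw [← e1]
    rw [Int.cast_zero, neg_zero, sub_zero] at e2
    rw [e2, Int.cast_zero, neg_zero, inv_div]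
    have := hε.2
    field_simp

lemma deriv_th_zero_ne (hq : 0 < q) (hq1 : q < 1) : deriv (th q) 0 ≠ 0 := by
  rw [deriv_th_zero hq hq1]
  exact mul_ne_zero (neg_ne_zero.mpr (mul_ne_zero (by norm_num) (log_ne_zero_of hq hq1)))
    (pow_pos (hh_pos hq hq1) 3).ne.symm

/-- Symmetrized limit of `US` at its singular point. -/
lemma tendsto_US_avg (hq : 0 < q) (hq1 : q < 1) {r : ℕ} (hr : 0 < r) (a : ℤ) :
    Tendsto (fun ε : ℝ => US q r (-a) (a + ε) + US q r (-a) (a + -ε)) (𝓝[≠] 0)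
      (𝓝 (2 * US q r (-a) a + q ^ ((r : ℝ) / 2 * (-a + 11 / 2) ^ 2))) := by
  have t0 : Tendsto (fun ε : ℝ => (a : ℝ) + ε) (𝓝[≠] 0) (𝓝 a) := by
    have : Tendsto (fun ε : ℝ => (a : ℝ) + ε) (𝓝 0) (𝓝 (a + 0)) := tendsto_const_nhds.add tendsto_id
    rw [add_zero] at this
    exact this.mono_left nhdsWithin_le_nhds
  have t0' : Tendsto (fun ε : ℝ => (a : ℝ) + -ε) (𝓝[≠] 0) (𝓝 a) := by
    have : Tendsto (fun ε : ℝ => (a : ℝ) + -ε) (𝓝 0) (𝓝 (a + -0)) := tendsto_const_nhds.add tendsto_id.neg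
    rw [neg_zero, add_zero] at this
    exact this.mono_left nhdsWithin_le_nhds
  have t := ((tendsto_USz hq hq1 hr a).comp t0).add ((tendsto_USz hq hq1 hr a).comp t0')
  refine ((t.add_const (q ^ ((r : ℝ) / 2 * (-a + 11 / 2) ^ 2))).congr' ?_).trans (by rw [two_mul])
  filter_upwards [eventually_small] with ε hε
  simp only [Function.comp]
  have h1 := US_eq_USz hq hq1 hr a (s := a + ε) (by simpa using hε.1)
  have h2 := US_eq_USz hq hq1 hr a (s := a + -ε) (by simpa using hε.1)
  rw [h1, h2, add_sub_cancel_left, add_sub_cancel_left, mul_neg, Real.rpow_neg hq.le]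
  have hw : q ^ (11 * ε) ≠ 1 := by
    intro h
    have := (Real.strictAnti_rpow_of_base_lt_one hq hq1).injective (h.trans (Real.rpow_zero q).symm)
    exact hε.2 (by linarith)
  have hw0 : q ^ (11 * ε) ≠ 0 := (Real.rpow_pos_of_pos hq _).ne'
  generalize q ^ (11 * ε) = w at *
  have e1 : 1 - w ≠ 0 := sub_ne_zero.mpr hw.symm
  have e2 : w - 1 ≠ 0 := sub_ne_zero.mpr hw
  have : 1 - w⁻¹ = (w - 1) / w := by field_simp
  rw [this]
  field_simp
  ring
end

section
variable {q : ℝ}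

lemma tendsto_symm_ratio (hq : 0 < q) (hq1 : q < 1) {g : ℝ → ℝ} {g' : ℝ} (hg : HasDerivAt g g' 0) :
    Tendsto (fun ε => (g ε - g (-ε)) / th q ε) (𝓝[≠] 0) (𝓝 (2 * g' / deriv (th q) 0)) := by
  have h2 : HasDerivAt (fun ε => g (-ε)) (-g') 0 := by
    have hg' : HasDerivAt g g' (-0) := by rwa [neg_zero]
    exact (HasDerivAt.scomp (0 : ℝ) hg' (hasDerivAt_neg (0 : ℝ))).congr_deriv (by simp)
  have h3 := hasDerivAt_iff_tendsto_slope_zero.mp (hg.sub h2)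
  have h4 := h3.div (tendsto_th_ratio hq hq1) (deriv_th_zero_ne hq hq1)
  refine (h4.congr' ?_).trans (by rw [sub_neg_eq_add, two_mul])
  filter_upwards [self_mem_nhdsWithin] with ε hε
  have : ε ≠ 0 := hε
  simp [div_eq_mul_inv]
  field_simp

lemma hasDerivAt_gauss (hq : 0 < q) (κ b : ℝ) :
    HasDerivAt (fun ε : ℝ => q ^ (κ * (b + ε) ^ 2)) (q ^ (κ * b ^ 2) * (2 * κ * b * Real.log q)) 0 := by
  have h : HasDerivAt (fun ε : ℝ => κ * (b + ε) ^ 2) (κ * (2 * b)) 0 := by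
    have := (((hasDerivAt_id (0 : ℝ)).const_add b).pow 2).const_mul κ
    refine this.congr_deriv ?_
    simp
  refine (h.const_rpow hq).congr_deriv ?_
  rw [add_zero]; ring

lemma hasDerivAt_th_shift (hq : 0 < q) (hq1 : q < 1) (b : ℝ) :
    HasDerivAt (fun ε : ℝ => th q (b + ε)) (deriv (th q) b) 0 := by
  have := th_hasDerivAt hq hq1 (b + 0)
  have := HasDerivAt.comp_const_add b (0 : ℝ) this
  simpa using this

lemma tendsto_add_small (f : ℝ → ℝ) (a y : ℝ) (h : Tendsto f (𝓝 a) (𝓝 y)) :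
    Tendsto (fun ε => f (a + ε) + f (a + -ε)) (𝓝[≠] 0) (𝓝 (2 * y)) := by
  have t0 : Tendsto (fun ε : ℝ => a + ε) (𝓝[≠] 0) (𝓝 a) := by
    have : Tendsto (fun ε : ℝ => a + ε) (𝓝 0) (𝓝 (a + 0)) := tendsto_const_nhds.add tendsto_id
    rw [add_zero] at this
    exact this.mono_left nhdsWithin_le_nhds
  have t0' : Tendsto (fun ε : ℝ => a + -ε) (𝓝[≠] 0) (𝓝 a) := by
    have : Tendsto (fun ε : ℝ => a + -ε) (𝓝 0) (𝓝 (a + -0)) := tendsto_const_nhds.add tendsto_id.neg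
    rw [neg_zero, add_zero] at this
    exact this.mono_left nhdsWithin_le_nhds
  rw [two_mul]
  exact (h.comp t0).add (h.comp t0')

lemma US_three_diag (hq : 0 < q) (hq1 : q < 1) {a : ℤ} (ha : ¬ 11 ∣ a) :
    US q 3 a a + US q 3 (-a) a = th q (2 * a) / th q a * US q 3 0 a +
      q ^ ((3 : ℝ) / 2 * (a - 11 / 2) ^ 2) * (1 - 3 * a / 11 - hh q ^ 3 * (thm q a + thm q (2 * a))) := by
  have hna := int_not_mul_eleven ha
  have hn2 : ∀ n : ℤ, 2 * (a : ℝ) ≠ 11 * n := by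
    exact_mod_cast int_not_mul_eleven (c := 2 * a) (by omega)
  have ta := th_ne_zero hq hq1 hna
  have t2 := th_ne_zero hq hq1 hn2
  have g1 := hasDerivAt_gauss hq (3 / 2) (a - 11 / 2)
  have g2 := hasDerivAt_th_shift hq hq1 a
  have g3 := hasDerivAt_th_shift hq hq1 (2 * a)
  have g := g1.mul (((g2.mul g3).inv (by simp [ta, t2])).const_mul (th q a * th q (2 * a)))
  have L1 := ((tendsto_symm_ratio hq hq1 g).const_mul (hh q ^ 3)).add
    ((tendsto_add_small _ _ _ (tendsto_US hq hq1 (r := 3) (by norm_num) (c := 0) (a := a) (by simpa using ha))).const_mul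
      (th q (2 * a) / th q a))
  have L2 := (tendsto_add_small _ _ _ (tendsto_US hq hq1 (r := 3) (by norm_num) (c := a) (a := a) (by omega))).add
    (tendsto_US_avg hq hq1 (r := 3) (by norm_num) a)
  have h := tendsto_nhds_unique (L2.congr' ?_) L1
  · have e1 : q ^ (((3 : ℕ) : ℝ) / 2 * (-(a : ℝ) + 11 / 2) ^ 2) = q ^ ((3 : ℝ) / 2 * (a - 11 / 2) ^ 2) := by
      congr 1; push_cast; ring
    have d0 := deriv_th_zero hq hq1
    have d1 := deriv_th_zero_ne hq hq1
    have hl := log_ne_zero_of hq hq1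
    have hhp := (hh_pos hq hq1).ne'
    rw [e1] at h
    simp only [add_zero, Int.cast_zero, Pi.mul_apply, Pi.inv_apply] at h
    rw [thm, thm]
    have hlq : Real.log q = -(deriv (th q) 0) / (11 * hh q ^ 3) := by rw [d0]; field_simp
    rw [hlq] at h
    clear d0 hlq
    generalize deriv (th q) 0 = D at *
    field_simp at h ⊢
    linear_combination h / 2
  · filter_upwards [eventually_small] with ε hε
    have key : ∀ ε : ℝ, |ε| ≤ 1 / 2 → ε ≠ 0 → US q 3 a (a + ε) + US q 3 (-a) (a + ε) =
        th q (2 * a) / th q a * US q 3 0 (a + ε) + hh q ^ 3 * (q ^ ((3 : ℝ) / 2 * (a - 11 / 2 + ε) ^ 2) *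
          (th q a * th q (2 * a) * (th q (a + ε) * th q (2 * a + ε))⁻¹)) / th q ε := by
      intro ε h1 h2
      have n1 := int_add_small_ne (n := a) h1 h2
      have n2 := int_add_small_ne (n := 2 * a) h1 h2
      have n3 := int_add_small_ne (n := 0) h1 h2
      have := US_three hq hq1 (s := a + ε) (c := a) n1
        (fun n => by have := n2 n; push_cast at this; convert this using 1; ring)
        (fun n => by have := n3 n; push_cast at this; convert this using 1; ring) hna hn2
      rw [this]
      rw [show (a : ℝ) + ε + a = 2 * a + ε by ring, show (a : ℝ) + ε - a = ε by ring,
        show (a : ℝ) + ε - 11 / 2 = a - 11 / 2 + ε by ring]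
      field_simp
    have k1 := key ε hε.1 hε.2
    have k2 := key (-ε) (by rw [abs_neg]; exact hε.1) (neg_ne_zero.mpr hε.2)
    rw [th_neg] at k2
    simp only [Pi.mul_apply, Pi.inv_apply, Int.cast_zero]
    linear_combination k1 + k2

lemma US_two_diag (hq : 0 < q) (hq1 : q < 1) {a : ℤ} (ha : ¬ 11 ∣ a) :
    US q 1 a a + US q 1 (-a) a =
      q ^ ((a - 11 / 2 : ℝ) ^ 2 / 2) * (-a / 11 + hh q ^ 3 * (thm q a - thm q (2 * a))) := by
  have hna := int_not_mul_eleven ha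
  have hn2 : ∀ n : ℤ, 2 * (a : ℝ) ≠ 11 * n := by
    exact_mod_cast int_not_mul_eleven (c := 2 * a) (by omega)
  have ta := th_ne_zero hq hq1 hna
  have t2 := th_ne_zero hq hq1 hn2
  have g1 := hasDerivAt_gauss hq (1 / 2) (a - 11 / 2)
  have g2 := hasDerivAt_th_shift hq hq1 a
  have g3 := hasDerivAt_th_shift hq hq1 (2 * a)
  have g := g1.mul ((g2.mul (g3.inv (by simp [t2]))).const_mul (th q (2 * a) / th q a))
  have L1 := ((tendsto_symm_ratio hq hq1 g).const_mul (hh q ^ 3))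
  have L2 := (tendsto_add_small _ _ _ (tendsto_US hq hq1 (r := 1) (by norm_num) (c := a) (a := a) (by omega))).add
    (tendsto_US_avg hq hq1 (r := 1) (by norm_num) a)
  have h := tendsto_nhds_unique (L2.congr' ?_) L1
  · have e1 : q ^ (((1 : ℕ) : ℝ) / 2 * (-(a : ℝ) + 11 / 2) ^ 2) = q ^ ((1 : ℝ) / 2 * (a - 11 / 2) ^ 2) := by
      congr 1; push_cast; ring
    have e2 : q ^ ((a - 11 / 2 : ℝ) ^ 2 / 2) = q ^ ((1 : ℝ) / 2 * (a - 11 / 2) ^ 2) := by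
      congr 1; ring
    have d0 := deriv_th_zero hq hq1
    have d1 := deriv_th_zero_ne hq hq1
    have hl := log_ne_zero_of hq hq1
    have hhp := (hh_pos hq hq1).ne'
    rw [e1] at h
    simp only [add_zero, Pi.mul_apply, Pi.inv_apply] at h
    rw [thm, thm, e2]
    have hlq : Real.log q = -(deriv (th q) 0) / (11 * hh q ^ 3) := by rw [d0]; field_simp
    rw [hlq] at h
    clear d0 hlq
    generalize deriv (th q) 0 = D at *
    field_simp at h ⊢
    linear_combination h / 2
  · filter_upwards [eventually_small] with ε hε
    have key : ∀ ε : ℝ, |ε| ≤ 1 / 2 → ε ≠ 0 → US q 1 a (a + ε) + US q 1 (-a) (a + ε) =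
        hh q ^ 3 * (q ^ ((1 : ℝ) / 2 * (a - 11 / 2 + ε) ^ 2) *
          (th q (2 * a) / th q a * (th q (a + ε) * (th q (2 * a + ε))⁻¹))) / th q ε := by
      intro ε h1 h2
      have n2 := int_add_small_ne (n := 2 * a) h1 h2
      have n3 := int_add_small_ne (n := 0) h1 h2
      have := US_two hq hq1 (s := a + ε) (c := a)
        (fun n => by have := n2 n; push_cast at this; convert this using 1; ring)
        (fun n => by have := n3 n; push_cast at this; convert this using 1; ring) hna hn2
      rw [this]
      rw [show (a : ℝ) + ε + a = 2 * a + ε by ring, show (a : ℝ) + ε - a = ε by ring,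
        show ((a : ℝ) + ε - 11 / 2) ^ 2 / 2 = 1 / 2 * (a - 11 / 2 + ε) ^ 2 by ring]
      field_simp
    have k1 := key ε hε.1 hε.2
    have k2 := key (-ε) (by rw [abs_neg]; exact hε.1) (neg_ne_zero.mpr hε.2)
    rw [th_neg] at k2
    simp only [Pi.mul_apply, Pi.inv_apply]
    linear_combination k1 + k2
end

/-- The discriminant of a Tate normal form in terms of the values of its division polynomials. -/
lemma tate_disc {b c A B C : ℝ} (hb : b ≠ 0) (hc : c ≠ 0) (hbc : b ≠ c)
    (h1 : 4 * (A * B * C) = b ^ 2)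
    (h2 : 4 * ((b + A) * (b + B) * (b + C)) = c ^ 2 * b ^ 2)
    (h3 : 4 * ((c + A) * (c + B) * (c + C)) = (b - c - c ^ 2) ^ 2) :
    16 * ((A - B) * (B - C) * (C - A)) ^ 2 =
      b ^ 3 * (16 * b ^ 2 - 8 * b * c ^ 2 - 20 * b * c + b - c * (1 - c) ^ 3) := by
  obtain ⟨E, hE⟩ : ∃ E, E = A + B + C := ⟨_, rfl⟩
  obtain ⟨G, hG⟩ : ∃ G, G = A * B + B * C + C * A := ⟨_, rfl⟩
  have e1 : 4 * (b ^ 2 + E * b + G) = (c ^ 2 - 1) * b := by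
    apply mul_left_cancel₀ hb
    rw [hE, hG]; linear_combination h2 - h1
  have e2 : 4 * (c ^ 2 + E * c + G) = -2 * b - 2 * b * c + c + 2 * c ^ 2 + c ^ 3 := by
    apply mul_left_cancel₀ hc
    rw [hE, hG]; linear_combination h3 - h1
  have e3 : 4 * E = (1 - c) ^ 2 - 4 * b := by
    apply mul_left_cancel₀ (sub_ne_zero.mpr hbc)
    linear_combination e1 - e2
  have e4 : 4 * G = -2 * b * (1 - c) := by
    linear_combination e1 - b * e3
  have d : ((A - B) * (B - C) * (C - A)) ^ 2 = E ^ 2 * G ^ 2 - 4 * G ^ 3 - 4 * E ^ 3 * (A * B * C) +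
      18 * E * G * (A * B * C) - 27 * (A * B * C) ^ 2 := by
    rw [hE, hG]; ring
  have e3' : E = ((1 - c) ^ 2 - 4 * b) / 4 := by linarith
  have e4' : G = (-2 * b * (1 - c)) / 4 := by linarith
  have h1' : A * B * C = b ^ 2 / 4 := by linarith
  rw [d, h1', e3', e4']
  ring

/-- Monomial parametrization of a tuple satisfying the three-term relations modulo 11. -/
structure TateParam (v1 v2 v3 v4 v5 l m x y p s : ℝ) : Prop where
  l0 : l ≠ 0
  m0 : m ≠ 0
  x0 : x ≠ 0
  y0 : y ≠ 0
  p0 : p ≠ 0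
  s0 : s ≠ 0
  hp : p = 1 - x
  hs : s = 1 + y
  hF : y ^ 2 + (x ^ 2 + 1) * y + x = 0
  hm : m ^ 11 * (x * y ^ 8 * p ^ 4 * s ^ 4) = -1
  e1 : v1 = l * m
  e2 : v2 = l * m ^ 4 * (y ^ 2 * p * s)
  e3 : v3 = l * m ^ 9 * (y ^ 6 * p ^ 3 * s ^ 3)
  e4 : v4 = l * m ^ 16 * (-x * y ^ 11 * p ^ 6 * s ^ 5)
  e5 : v5 = l * m ^ 25 * (x ^ 2 * y ^ 18 * p ^ 9 * s ^ 8)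

lemma tuple_param {v1 v2 v3 v4 v5 : ℝ} (n1 : v1 ≠ 0) (n2 : v2 ≠ 0) (n3 : v3 ≠ 0) (n4 : v4 ≠ 0)
    (n5 : v5 ≠ 0) (R1 : v5 * v1 ^ 3 = v4 * v2 ^ 3 - v1 * v3 ^ 3)
    (R2 : v5 * v2 * v1 ^ 2 = v3 * v1 * v4 ^ 2 - v5 * v3 * v2 ^ 2)
    (R3 : v4 * v3 * v1 ^ 2 = v5 * v4 * v2 ^ 2 + v3 * v1 * v5 ^ 2) :
    TateParam v1 v2 v3 v4 v5 (v1 ^ 3 * v3 / v2 ^ 3) (v2 ^ 3 / (v1 ^ 2 * v3))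
      (-v1 ^ 2 / (v2 * v3)) (v1 * v3 * v5 / (v2 ^ 2 * v4)) (v1 * v4 ^ 2 / (v2 ^ 2 * v5))
      (v1 ^ 2 * v3 / (v2 ^ 2 * v5)) := by
  refine ⟨by positivity, by positivity, div_ne_zero (neg_ne_zero.mpr (by positivity)) (by positivity),
    by positivity, by positivity, by positivity, ?_, ?_, ?_, ?_, ?_, ?_, ?_, ?_, ?_⟩
  · field_simp
    linear_combination -R2
  · field_simp
    linear_combination R3
  · have hs : v1 ^ 2 * v3 / (v2 ^ 2 * v5) = 1 + v1 * v3 * v5 / (v2 ^ 2 * v4) := by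
      field_simp
      linear_combination R3
    have h : (-v1 ^ 2 / (v2 * v3)) ^ 2 * (v1 * v3 * v5 / (v2 ^ 2 * v4)) + (-v1 ^ 2 / (v2 * v3)) +
        (v1 * v3 * v5 / (v2 ^ 2 * v4)) * (v1 ^ 2 * v3 / (v2 ^ 2 * v5)) = 0 := by
      field_simp
      linear_combination v1 ^ 2 * R1
    rw [hs] at h
    linear_combination h
  all_goals field_simp

section thetaTuple
variable {q : ℝ}

lemma lin_three (hq : 0 < q) (hq1 : q < 1) (k l x a : ℝ) :
    (k * thG q (x + 11 / 2) + l * thG q x) * th q a ^ 2 =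
      th q x ^ 2 * (k * thG q (a + 11 / 2) + l * thG q a) -
        th q (x + a) * th q (x - a) * (k * thG q (0 + 11 / 2) + l * thG q 0) := by
  have h1 := th_mul hq hq1 x a
  have h2 := th_mul hq hq1 x 0
  have h3 := th_mul hq hq1 a 0
  rw [add_zero, sub_zero] at h2 h3
  rw [h1, pow_two, pow_two, h2, h3]
  ring

lemma thF_one_sq (hq : 0 < q) (hq1 : q < 1) (x : ℝ) :
    thF q 1 (x - 11 / 2) ^ 2 =
      thG q 0 * thG q (x + 11 / 2) + thG q (0 + 11 / 2) * thG q x := by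
  have h := thF_mul hq hq1 (e := 1) (by norm_num) (x - 11 / 2) 0
  have h1 := thG_half (q := q) x
  have h2 : thG q (x - 11 / 2) = thG q (x + 11 / 2) := by
    rw [← thG_add (x - 11 / 2)]; congr 1; ring
  rw [add_zero, sub_zero, h1.1, h2] at h
  rw [pow_two, h]; ring

lemma thF_neg_one_sq (hq : 0 < q) (hq1 : q < 1) (x : ℝ) :
    thF q (-1) x ^ 2 =
      -thG q (0 + 11 / 2) * thG q (x + 11 / 2) + thG q 0 * thG q x := by
  have h := thF_mul hq hq1 (e := -1) (by norm_num) x 0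
  rw [add_zero, sub_zero] at h
  rw [pow_two, h]; ring

lemma thF_one_sq' (hq : 0 < q) (hq1 : q < 1) (x : ℝ) :
    thF q 1 x ^ 2 =
      thG q (0 + 11 / 2) * thG q (x + 11 / 2) + thG q 0 * thG q x := by
  have h := thF_mul hq hq1 (e := 1) (by norm_num) x 0
  rw [add_zero, sub_zero] at h
  rw [pow_two, h]; ring

lemma th_double_sq (hq : 0 < q) (hq1 : q < 1) (x a : ℝ) :
    th q (2 * x) ^ 2 * hh q ^ 6 * th q a ^ 6 = th q x ^ 2 *
      (th q x ^ 2 * thF q 1 (a - 11 / 2) ^ 2 - th q (x + a) * th q (x - a) * thF q 1 (0 - 11 / 2) ^ 2) *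
      (th q x ^ 2 * thF q (-1) a ^ 2 - th q (x + a) * th q (x - a) * thF q (-1) 0 ^ 2) *
      (th q x ^ 2 * thF q 1 a ^ 2 - th q (x + a) * th q (x - a) * thF q 1 0 ^ 2) := by
  have h := th_double hq hq1 x
  have h1 := lin_three hq hq1 (thG q 0) (thG q (0 + 11 / 2)) x a
  have h2 := lin_three hq hq1 (-thG q (0 + 11 / 2)) (thG q 0) x a
  have h3 := lin_three hq hq1 (thG q (0 + 11 / 2)) (thG q 0) x a
  simp only [← thF_one_sq hq hq1, ← thF_neg_one_sq hq hq1, ← thF_one_sq' hq hq1] at h1 h2 h3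
  rw [← h1, ← h2, ← h3]
  linear_combination (th q (2 * x) * hh q ^ 3 +
    th q x * thF q 1 (x - 11 / 2) * (thF q (-1) x * thF q 1 x)) * th q a ^ 6 * h

lemma thF_zero_prod (hq : 0 < q) (hq1 : q < 1) :
    thF q 1 (0 - 11 / 2) ^ 2 * thF q (-1) 0 ^ 2 * thF q 1 0 ^ 2 = 4 * hh q ^ 6 := by
  have hD := deriv_th_zero_ne hq hq1
  have t0 := tendsto_th_ratio hq hq1
  have hc : ∀ y : ℝ, Tendsto (fun x => th q (x + y)) (𝓝[≠] 0) (𝓝 (th q y)) := fun y => by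
    have h : Tendsto (fun x : ℝ => x + y) (𝓝[≠] 0) (𝓝 y) := by
      have : Tendsto (fun x : ℝ => x + y) (𝓝 0) (𝓝 (0 + y)) := tendsto_id.add tendsto_const_nhds
      rw [zero_add] at this
      exact this.mono_left nhdsWithin_le_nhds
    exact (th_differentiableAt hq hq1 y).continuousAt.tendsto.comp h
  have t2 : Tendsto (fun x : ℝ => 2 * (th q (2 * x) / (2 * x))) (𝓝[≠] 0)
      (𝓝 (2 * deriv (th q) 0)) := by
    refine (t0.comp (?_ : Tendsto (fun x : ℝ => 2 * x) (𝓝[≠] 0) (𝓝[≠] 0))).const_mul 2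
    refine tendsto_nhdsWithin_iff.mpr ⟨?_, ?_⟩
    · have : Tendsto (fun x : ℝ => 2 * x) (𝓝 0) (𝓝 (2 * 0)) := tendsto_id.const_mul 2
      rw [mul_zero] at this
      exact this.mono_left nhdsWithin_le_nhds
    · filter_upwards [self_mem_nhdsWithin] with x hx
      exact mul_ne_zero two_ne_zero hx
  have hz := hc 0
  simp only [add_zero, th_zero] at hz
  have ha := hc 1
  have hb := hc (-1)
  rw [th_neg] at hb
  have key := tendsto_nhds_unique_of_eventuallyEq
    (((t2.pow 2).mul_const (hh q ^ 6)).mul_const (th q 1 ^ 6))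
    ((((t0.pow 2).mul (((hz.pow 2).mul_const (thF q 1 (1 - 11 / 2) ^ 2)).sub
      ((ha.mul hb).mul_const (thF q 1 (0 - 11 / 2) ^ 2)))).mul
      (((hz.pow 2).mul_const (thF q (-1) 1 ^ 2)).sub ((ha.mul hb).mul_const (thF q (-1) 0 ^ 2)))).mul
      (((hz.pow 2).mul_const (thF q 1 1 ^ 2)).sub ((ha.mul hb).mul_const (thF q 1 0 ^ 2)))) ?_
  · have h1 : th q 1 ≠ 0 := (th_pos hq hq1 one_pos (by norm_num)).ne'
    apply mul_left_cancel₀ (mul_ne_zero (pow_ne_zero 2 hD) (pow_ne_zero 6 h1))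
    linear_combination -key
  · filter_upwards [self_mem_nhdsWithin] with x hx
    have hx : x ≠ 0 := hx
    have := th_double_sq hq hq1 x 1
    rw [← sub_eq_add_neg]
    generalize thF q 1 (1 - 11 / 2) = A at *
    generalize thF q 1 (0 - 11 / 2) = A' at *
    field_simp
    linear_combination this

/-- The odd theta values at integers. -/
noncomputable def psi (q : ℝ) (n : ℤ) : ℝ := (-1) ^ n * th q n

lemma psi_neg (n : ℤ) : psi q (-n) = -psi q n := by
  rw [psi, psi, Int.cast_neg, th_neg, zpow_neg, ← inv_zpow]; norm_num

lemma psi_add (n : ℤ) : psi q (n + 11) = psi q n := by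
  rw [psi, psi, Int.cast_add, Int.cast_ofNat, th_add, zpow_add₀ (by norm_num)]; norm_num

lemma psi_ne_zero (hq : 0 < q) (hq1 : q < 1) {n : ℤ} (h : ¬ 11 ∣ n) : psi q n ≠ 0 :=
  mul_ne_zero (zpow_ne_zero _ (by norm_num)) (th_ne_zero hq hq1 (int_not_mul_eleven h))

lemma th_eq_psi (n : ℤ) : th q n = (-1) ^ n * psi q n := by
  rw [psi, ← mul_assoc, ← mul_zpow]; norm_num

lemma psi_mul (m n : ℤ) : th q (m + n) * th q (m - n) = psi q (m + n) * psi q (m - n) := by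
  rw [psi, psi]
  push_cast
  have : (-1 : ℝ) ^ (m + n) * (-1) ^ (m - n) = 1 := by
    rw [← zpow_add₀ (by norm_num), show m + n + (m - n) = 2 * m by ring, zpow_mul]; norm_num
  linear_combination -(th q (m + n) * th q (m - n)) * this

lemma psi_sq (n : ℤ) : th q n ^ 2 = psi q n ^ 2 := by
  have := psi_mul (q := q) n 0
  simp only [Int.cast_zero, add_zero, sub_zero] at this
  linear_combination this

lemma psi_three (hq : 0 < q) (hq1 : q < 1) (m n a : ℤ) :
    psi q (m + n) * psi q (m - n) * psi q a ^ 2 =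
      psi q (m + a) * psi q (m - a) * psi q n ^ 2 - psi q (n + a) * psi q (n - a) * psi q m ^ 2 := by
  have h := th_three hq hq1 m n a 0
  have h1 := th_neg (q := q) n
  simp only [add_zero, sub_zero, zero_add, zero_sub, th_neg] at h
  rw [← psi_mul, ← psi_mul, ← psi_mul, ← psi_sq, ← psi_sq, ← psi_sq]
  have h2 : th q ((a : ℝ) - n) = -th q (n - a) := by rw [← th_neg]; congr 1; ring
  have h3 : th q ((a : ℝ) + n) = th q (n + a) := by rw [add_comm]
  rw [h2, h3] at h
  linear_combination h

end thetaTuple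

lemma disc_param {v1 v2 v3 v4 v5 l m x y p s a1 a2 a3 h : ℝ} (H : TateParam v1 v2 v3 v4 v5 l m x y p s)
    (k1 : v2 ^ 2 = 4 * v1 ^ 2 * (a1 * a2 * a3))
    (k2 : v4 ^ 2 * v1 ^ 6 = 4 * v2 ^ 2 *
      ((a1 * v2 ^ 2 - v3 * v1) * (a2 * v2 ^ 2 - v3 * v1) * (a3 * v2 ^ 2 - v3 * v1)))
    (k3 : v5 ^ 2 * v1 ^ 6 = 4 * v3 ^ 2 *
      ((a1 * v3 ^ 2 - v4 * v2) * (a2 * v3 ^ 2 - v4 * v2) * (a3 * v3 ^ 2 - v4 * v2)))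
    (k4 : 16 * h * ((a1 - a2) * (a2 - a3) * (a3 - a1)) ^ 2 = v1 ^ 12) :
    h * ((-y ^ 2 * p * s) ^ 3 * (x ^ 4 * y * s ^ 4 * (x ^ 2 - x * y - 4 * x - 2 * y - 1))) =
      l ^ 12 * p := by
  obtain ⟨l0, m0, x0, y0, p0, s0, hp, hs, hF, hm, e1, e2, e3, e4, e5⟩ := H
  have hbc : -y ^ 2 * p * s - x * y * p = x ^ 2 * y ^ 2 * p := by
    rw [hp, hs]
    linear_combination ((-1)*y + 1*x*y) * hF
  have hd : -y ^ 2 * p * s - x * y * p - (x * y * p) ^ 2 = x ^ 3 * y ^ 2 * p := by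
    rw [hp, hs]
    linear_combination ((-1)*y + 1*x*y) * hF
  obtain ⟨A, rfl⟩ : ∃ A, a1 = m ^ 2 * A := ⟨a1 / m ^ 2, by field_simp⟩
  obtain ⟨B, rfl⟩ : ∃ A, a2 = m ^ 2 * A := ⟨a2 / m ^ 2, by field_simp⟩
  obtain ⟨C, rfl⟩ : ∃ A, a3 = m ^ 2 * A := ⟨a3 / m ^ 2, by field_simp⟩
  have b0 : -y ^ 2 * p * s ≠ 0 :=
    mul_ne_zero (mul_ne_zero (neg_ne_zero.mpr (by positivity)) p0) s0
  have T := tate_disc (b := -y ^ 2 * p * s) (c := x * y * p) (A := A) (B := B)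
    (C := C) b0 (by positivity) (sub_ne_zero.mp (by rw [hbc]; positivity)) ?_ ?_ ?_
  · have hD : p * (16 * (-y ^ 2 * p * s) ^ 2 - 8 * (-y ^ 2 * p * s) * (x * y * p) ^ 2 -
        20 * (-y ^ 2 * p * s) * (x * y * p) + (-y ^ 2 * p * s) -
        (x * y * p) * (1 - (x * y * p)) ^ 3) =
        x ^ 4 * y * s ^ 4 * (x ^ 2 - x * y - 4 * x - 2 * y - 1) := by
      rw [hp, hs]
      linear_combination ((-1)*y + 16*y^3 + 16*y^4 + 2*x*y + 4*x*y^2 + (-48)*x*y^3 + (-48)*x*y^4 + (-1)*x^2*y + (-12)*x^2*y^2 + 40*x^2*y^3 + 48*x^2*y^4 + 1*x^3*y + 12*x^3*y^2 + (-16)*x^3*y^4 + 4*x^4*y + 14*x^4*y^2 + 7*x^4*y^3 + 2*x^4*y^4 + (-1)*x^5*y + (-8)*x^5*y^2 + (-9)*x^5*y^3 + 1*x^5*y^4 + 1*x^6*y^2 + 5*x^6*y^3 + (-1)*x^7*y^3) * hF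
    rw [← hD]
    apply mul_left_cancel₀ (pow_ne_zero 12 m0)
    rw [e1] at k4
    linear_combination p * k4 - h * p * m ^ 12 * T
  · rw [e1, e2] at k1
    apply mul_left_cancel₀ (show l ^ 2 * m ^ 8 ≠ 0 by positivity)
    linear_combination -k1
  · rw [e1, e2, e3, e4] at k2
    apply mul_left_cancel₀ (show l ^ 8 * m ^ 38 * y ^ 16 * p ^ 8 * s ^ 8 ≠ 0 by positivity)
    linear_combination -k2
  · rw [hd]
    rw [e1, e2, e3, e4, e5] at k3
    apply mul_left_cancel₀ (show l ^ 8 * m ^ 78 * y ^ 48 * p ^ 24 * s ^ 24 ≠ 0 by positivity)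
    linear_combination -k3 - l ^ 8 * m ^ 56 * x ^ 4 * y ^ 36 * p ^ 18 * s ^ 16 *
      (m ^ 11 * (x * y ^ 8 * p ^ 4 * s ^ 4) - 1) * hm

section thetaTuple
variable {q : ℝ}

lemma thm_psi (hq : 0 < q) (hq1 : q < 1) {a b c d : ℤ} (hd : a + b + c = d) (ha : ¬ 11 ∣ a)
    (hb : ¬ 11 ∣ b) (hc : ¬ 11 ∣ c) (hd' : ¬ 11 ∣ d) :
    thm q a + thm q b + thm q c - thm q d =
      psi q (a + b) * psi q (b + c) * psi q (c + a) / (psi q a * psi q b * psi q c * psi q d) := by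
  have n0 : ∀ {k : ℤ}, ¬ 11 ∣ k → th q k ≠ 0 := fun h => th_ne_zero hq hq1 (int_not_mul_eleven h)
  rw [thm_rel hq hq1 (deriv_th_zero_ne hq hq1) (by exact_mod_cast hd) (n0 ha) (n0 hb) (n0 hc)
    (n0 hd')]
  have e1 : ∀ k : ℤ, ((-1 : ℝ) ^ k) ^ 2 = 1 := fun k => by
    rw [← zpow_natCast, ← zpow_mul, mul_comm, zpow_mul]; norm_num
  rw [← hd] at *
  have z : (-1 : ℝ) ≠ 0 := by norm_num
  rw [← Int.cast_add, ← Int.cast_add, ← Int.cast_add]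
  simp only [th_eq_psi, zpow_add₀ z]
  have ia := e1 a
  have ib := e1 b
  have ic := e1 c
  have pa := psi_ne_zero hq hq1 ha
  have pb := psi_ne_zero hq hq1 hb
  have pc := psi_ne_zero hq hq1 hc
  have pd := psi_ne_zero hq hq1 hd'
  have za := zpow_ne_zero a z
  have zb := zpow_ne_zero b z
  have zc := zpow_ne_zero c z
  generalize (-1 : ℝ) ^ a = A at *
  generalize (-1 : ℝ) ^ b = B at *
  generalize (-1 : ℝ) ^ c = C at *
  field_simp

lemma psi_add_mul (k n : ℤ) : psi q (k + 11 * n) = psi q k := by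
  rw [mul_comm]
  exact Function.Periodic.int_mul (f := psi q) psi_add n k

lemma psi_eq_neg {k l : ℤ} (h : 11 ∣ k + l) : psi q k = -psi q l := by
  obtain ⟨n, hn⟩ := h
  rw [← psi_neg, ← psi_add_mul (-l) n]
  congr 1; linarith

lemma thm_eq_neg {k l : ℤ} (h : 11 ∣ k + l) : thm q k = -thm q l := by
  obtain ⟨n, hn⟩ := h
  rw [← thm_refl, ← Function.Periodic.int_mul (f := thm q) (c := 11) thm_add (n - 1) (11 - l)]
  congr 1
  have : (k : ℝ) + l = 11 * n := by exact_mod_cast hn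
  push_cast; linarith

/-- The theta values `psi (a n)`, `n = 1, …, 5`, in terms of the Tate normal form. -/
lemma psi_param (hq : 0 < q) (hq1 : q < 1) {a : ℤ} (ha : ¬ 11 ∣ a) {v1 v2 v3 v4 v5 : ℝ}
    (hv1 : v1 = psi q a) (hv2 : v2 = psi q (2 * a)) (hv3 : v3 = psi q (3 * a))
    (hv4 : v4 = psi q (4 * a)) (hv5 : v5 = psi q (5 * a)) {l m x y p s : ℝ}
    (hl : l = v1 ^ 3 * v3 / v2 ^ 3) (hm : m = v2 ^ 3 / (v1 ^ 2 * v3)) (hx : x = -v1 ^ 2 / (v2 * v3))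
    (hy : y = v1 * v3 * v5 / (v2 ^ 2 * v4)) (hp : p = v1 * v4 ^ 2 / (v2 ^ 2 * v5))
    (hs : s = v1 ^ 2 * v3 / (v2 ^ 2 * v5)) :
    TateParam v1 v2 v3 v4 v5 l m x y p s ∧
      hh q ^ 12 * ((-y ^ 2 * p * s) ^ 3 * (x ^ 4 * y * s ^ 4 * (x ^ 2 - x * y - 4 * x - 2 * y - 1))) =
        l ^ 12 * p := by
  have n1 := psi_ne_zero hq hq1 ha
  have n2 := psi_ne_zero hq hq1 (n := 2 * a) (by omega)
  have n3 := psi_ne_zero hq hq1 (n := 3 * a) (by omega)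
  have n4 := psi_ne_zero hq hq1 (n := 4 * a) (by omega)
  have n5 := psi_ne_zero hq hq1 (n := 5 * a) (by omega)
  have r1 := psi_three hq hq1 (3 * a) (2 * a) a
  have r2 := psi_three hq hq1 (4 * a) (2 * a) a
  have r3 := psi_three hq hq1 (5 * a) (2 * a) a
  have six : psi q (6 * a) = -psi q (5 * a) := psi_eq_neg ⟨a, by ring⟩
  have seven : psi q (7 * a) = -psi q (4 * a) := psi_eq_neg ⟨a, by ring⟩
  have e : ∀ (i j k : ℤ), i + j = k → i * a + j * a = k * a := fun i j k h => by rw [← h]; ring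
  have e' : ∀ (i j k : ℤ), i - j = k → i * a - j * a = k * a := fun i j k h => by rw [← h]; ring
  have f : ∀ (i k : ℤ), i + 1 = k → i * a + a = k * a := fun i k h => by rw [← h]; ring
  have f' : ∀ (i k : ℤ), i - 1 = k → i * a - a = k * a := fun i k h => by rw [← h]; ring
  rw [e 3 2 5 rfl, e' 3 2 1 rfl, f 3 4 rfl, f' 3 2 rfl, f 2 3 rfl, f' 2 1 rfl, one_mul] at r1
  rw [e 4 2 6 rfl, e' 4 2 2 rfl, f 4 5 rfl, f' 4 3 rfl, f 2 3 rfl, f' 2 1 rfl, one_mul, six] at r2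
  rw [e 5 2 7 rfl, e' 5 2 3 rfl, f 5 6 rfl, f' 5 4 rfl, f 2 3 rfl, f' 2 1 rfl, one_mul, six,
    seven] at r3
  have T := tuple_param n1 n2 n3 n4 n5 (by linear_combination r1)
    (by linear_combination -r2) (by linear_combination -r3)
  rw [← hv1, ← hv2, ← hv3, ← hv4, ← hv5, ← hl, ← hm, ← hx, ← hy, ← hp, ← hs] at T
  refine ⟨T, ?_⟩
  have d1 := th_double_sq hq hq1 a a
  have d2 := th_double_sq hq hq1 (2 * a) a
  have d3 := th_double_sq hq hq1 (3 * a) a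
  have z := thF_zero_prod hq hq1
  have P : ∀ m n : ℤ, th q ((m + n : ℤ) : ℝ) * th q ((m - n : ℤ) : ℝ) =
      psi q (m + n) * psi q (m - n) := fun m n => by
    push_cast; exact psi_mul m n
  have c : ∀ (i : ℤ) (r : ℝ), r = i * a → r = ((i * a : ℤ) : ℝ) := fun i r h => by
    rw [h]; push_cast; ring
  have hh0 := (hh_pos hq hq1).ne'
  rw [sub_self, th_zero, c 2 (2 * a) (by norm_num)] at d1
  rw [c 4 (2 * (2 * a)) (by push_cast; ring), c 2 (2 * a) (by norm_num), ← Int.cast_add,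
    ← Int.cast_sub, P] at d2
  rw [c 6 (2 * (3 * a)) (by push_cast; ring), c 3 (3 * a) (by norm_num), ← Int.cast_add,
    ← Int.cast_sub, P] at d3
  simp only [psi_sq, six, f 2 3 rfl, f 3 4 rfl, f' 2 1 rfl, f' 3 2 rfl, one_mul] at d1 d2 d3
  have pa : th q a ^ 6 = psi q a ^ 6 := by rw [show 6 = 2 * 3 by rfl, pow_mul, psi_sq, pow_mul]
  have h1 := th_mul hq hq1 a 0
  rw [add_zero, sub_zero, ← pow_two, psi_sq] at h1
  have F1 := thF_one_sq hq hq1 a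
  have F2 := thF_neg_one_sq hq hq1 a
  have F3 := thF_one_sq' hq hq1 a
  have F4 := thF_one_sq hq hq1 0
  have F5 := thF_neg_one_sq hq hq1 0
  have F6 := thF_one_sq' hq hq1 0
  rw [pa] at d1 d2 d3
  clear e e' f f' c P pa six seven r1 r2 r3
  have hz : thF q 1 (0 - 11 / 2) ^ 2 * thF q (-1) 0 ^ 2 * thF q 1 0 ^ 2 ≠ 0 := by
    rw [z]; positivity
  have hz' := hz
  simp only [mul_ne_zero_iff] at hz'
  obtain ⟨⟨z1, z2⟩, z3⟩ := hz'
  rw [← hv1] at n1 d1 d2 d3 h1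
  rw [← hv2] at n2 d1 d2 d3
  rw [← hv3] at n3 d2 d3
  rw [← hv4] at n4 d2 d3
  rw [← hv5] at n5 d3
  clear hl hm hx hy hp hs
  generalize thF q 1 (0 - 11 / 2) ^ 2 = A0 at *
  generalize thF q (-1) 0 ^ 2 = B0 at *
  generalize thF q 1 0 ^ 2 = C0 at *
  generalize thF q 1 (a - 11 / 2) ^ 2 = A at *
  generalize thF q (-1) a ^ 2 = B at *
  generalize thF q 1 a ^ 2 = C at *
  generalize hh q = h at *
  refine disc_param T (a1 := A / A0) (a2 := B / B0) (a3 := C / C0) ?_ ?_ ?_ ?_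
  · have : v2 ^ 2 * h ^ 6 = v1 ^ 2 * (A * B * C) := by
      apply mul_left_cancel₀ (pow_ne_zero 6 n1)
      linear_combination d1
    field_simp
    linear_combination 4 * this + v2 ^ 2 * z
  · field_simp
    linear_combination 4 * d2 + v4 ^ 2 * v1 ^ 6 * z
  · field_simp
    linear_combination 4 * d3 + v5 ^ 2 * v1 ^ 6 * z
  · have q1 : A * B0 - B * A0 = C0 * v1 ^ 2 := by
      rw [F1, F2, F4, F5, F6, h1]; ring
    have q2 : B * C0 - C * B0 = -(A0 * v1 ^ 2) := by
      rw [F3, F2, F4, F5, F6, h1]; ring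
    have q3 : C * A0 - A * C0 = -(B0 * v1 ^ 2) := by
      rw [F1, F3, F4, F5, F6, h1]; ring
    rw [div_sub_div _ _ z1 z2, div_sub_div _ _ z2 z3, div_sub_div _ _ z3 z1, mul_comm A0 B, q1,
      mul_comm B0 C, q2, mul_comm C0 A, q3]
    field_simp
    linear_combination -(A0 * B0 * C0 + 4 * h ^ 6) * z
end thetaTuple

/-- Laurent monomial in six quantities. -/
noncomputable def mon (l m x y p s : ℝ) (a b c d e f : ℤ) : ℝ :=
  l ^ a * m ^ b * x ^ c * y ^ d * p ^ e * s ^ f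

section tateSystem
variable {v1 v2 v3 v4 v5 l m x y p s : ℝ}

lemma mon_red (H : TateParam v1 v2 v3 v4 v5 l m x y p s) (a b c d e f k : ℤ) (i j n r : ℕ) :
    mon l m x y p s a b c d e f = (-1) ^ k *
      (mon l m x y p s a (b - 11 * k) (c - k - i) (d - 8 * k - j) (e - 4 * k - n) (f - 4 * k - r) *
        (x ^ i * y ^ j * p ^ n * s ^ r)) := by
  have h : (m ^ (11 * k) * (x ^ k * y ^ (8 * k) * p ^ (4 * k) * s ^ (4 * k)) : ℝ) = (-1) ^ k := by
    rw [← H.hm]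
    simp only [mul_zpow, zpow_mul]
    norm_cast
  have := H.l0; have := H.m0; have := H.x0; have := H.y0; have := H.p0; have := H.s0
  rw [← h]
  simp only [mon]
  rw [zpow_sub₀ H.m0, zpow_sub₀ H.x0, zpow_sub₀ H.x0, zpow_sub₀ H.y0, zpow_sub₀ H.y0,
    zpow_sub₀ H.p0, zpow_sub₀ H.p0, zpow_sub₀ H.s0, zpow_sub₀ H.s0]
  simp only [zpow_natCast]
  field_simp

lemma mon_mul (H : TateParam v1 v2 v3 v4 v5 l m x y p s) (a b c d e f a' b' c' d' e' f' : ℤ) :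
    mon l m x y p s a b c d e f * mon l m x y p s a' b' c' d' e' f' =
      mon l m x y p s (a + a') (b + b') (c + c') (d + d') (e + e') (f + f') := by
  simp only [mon]
  rw [zpow_add₀ H.l0, zpow_add₀ H.m0, zpow_add₀ H.x0, zpow_add₀ H.y0, zpow_add₀ H.p0,
    zpow_add₀ H.s0]
  ring

lemma mon_prod (H : TateParam v1 v2 v3 v4 v5 l m x y p s) (a b c d e f a' b' c' d' e' f' : ℤ)
    (k : ℤ) (i j n r : ℕ) :
    mon l m x y p s a b c d e f * mon l m x y p s a' b' c' d' e' f' = (-1) ^ k *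
      (mon l m x y p s (a + a') (b + b' - 11 * k) (c + c' - k - i) (d + d' - 8 * k - j)
        (e + e' - 4 * k - n) (f + f' - 4 * k - r) * (x ^ i * y ^ j * p ^ n * s ^ r)) := by
  rw [mon_mul H]; exact mon_red H _ _ _ _ _ _ k i j n r

lemma mon_v1 (H : TateParam v1 v2 v3 v4 v5 l m x y p s) : v1 = mon l m x y p s 1 1 0 0 0 0 := by
  rw [H.e1, mon]
  norm_cast
  ring

lemma mon_v2 (H : TateParam v1 v2 v3 v4 v5 l m x y p s) : v2 = mon l m x y p s 1 4 0 2 1 1 := by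
  rw [H.e2, mon]
  norm_cast
  ring

lemma mon_v3 (H : TateParam v1 v2 v3 v4 v5 l m x y p s) : v3 = mon l m x y p s 1 9 0 6 3 3 := by
  rw [H.e3, mon]
  norm_cast
  ring

lemma mon_v4 (H : TateParam v1 v2 v3 v4 v5 l m x y p s) : v4 = -(mon l m x y p s 1 16 1 11 6 5) := by
  rw [H.e4, mon]
  norm_cast
  ring

lemma mon_v5 (H : TateParam v1 v2 v3 v4 v5 l m x y p s) : v5 = mon l m x y p s 1 25 2 18 9 8 := by
  rw [H.e5, mon]
  norm_cast
  ring

/-- Solution of the linear system for the rank (up to the factor 11). -/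
noncomputable def rankSol (D l m x y p s : ℝ) : ℕ → ℝ
  | 0 => mon l m x y p s (-1) (-3) (-1) (-2) (-1) 0 * (D * (11 * y + 16 * x - 23 * x * y - 2 * x ^ 2
    + 5 * x ^ 2 * y - 5 * x ^ 3))
  | 1 => mon l m x y p s (-1) 0 0 1 0 1 * (D * (11 * y + 22 * x ^ 2))
  | 2 => mon l m x y p s (-1) 3 0 3 1 2 * (D * (5 - y - 2 * x + 5 * x * y - 16 * x ^ 2 + 11 * x ^
    3))
  | 3 => mon l m x y p s (-1) 6 1 5 2 3 * (D * (-9 + 4 * y - 3 * x - 9 * x * y + 9 * x ^ 2))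
  | 4 => mon l m x y p s (-1) 9 1 7 4 3 * (D * (1 + y + 13 * x + 4 * x * y - 2 * x ^ 2 + 19 * x ^ 2
    * y - x ^ 3 * y))
  | 5 => mon l m x y p s (-1) 12 2 10 5 4 * (D * (19 + 16 * y - x + 8 * x * y + 3 * x ^ 2))
  | 6 => mon l m x y p s (-1) 15 1 11 5 7 * (D * (-11 * y - 7 * x - 3 * x * y - 6 * x ^ 2 + 4 * x ^
    2 * y + 7 * x ^ 3))
  | 7 => mon l m x y p s (-1) 18 2 14 7 7 * (D * (7 + 3 * y + 6 * x - 4 * x * y + 4 * x ^ 2))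
  | 8 => mon l m x y p s (-1) 21 1 17 9 6 * (D * (-3 - 3 * y + 8 * x + 5 * x * y + 7 * x ^ 2 + 12 *
    x ^ 2 * y + 8 * x ^ 3 + 14 * x ^ 3 * y))
  | 9 => mon l m x y p s (-1) 24 3 18 9 9 * (D * (-1 - 13 * y + 7 * x + 10 * x * y + x ^ 2))
  | 10 => mon l m x y p s (-1) 27 3 20 10 10 * (D * (-2 + 7 * y + 14 * x - 2 * x * y + 2 * x ^ 2 +
    11 * x ^ 2 * y))
  | _ => 0

/-- Solution of the linear system for the crank (up to the factor 11). -/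
noncomputable def crankSol (l m x y p s : ℝ) : ℕ → ℝ
  | 0 => mon l m x y p s (-1) (-1) 0 0 0 0 * (-1)
  | 1 => mon l m x y p s (-1) (-9) 0 (-6) (-3) (-3) * (-4)
  | 2 => mon l m x y p s (-1) (-6) 0 (-4) (-2) (-2) * (3)
  | 3 => mon l m x y p s (-1) (-25) (-2) (-18) (-9) (-8) * (2)
  | 4 => mon l m x y p s 0 0 0 0 0 0 * (0)
  | 5 => mon l m x y p s (-1) (-8) (-1) (-5) (-3) (-2) * (-2)
  | 6 => mon l m x y p s (-1) (-16) (-1) (-11) (-6) (-5) * (3)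
  | 7 => mon l m x y p s (-1) (-13) (-1) (-9) (-4) (-4) * (-4)
  | 8 => mon l m x y p s (-1) 12 2 10 5 4 * (1)
  | 9 => mon l m x y p s (-1) (-40) (-3) (-29) (-15) (-13) * (-6)
  | 10 => mon l m x y p s (-1) (-4) 0 (-2) (-1) (-1) * (5)
  | _ => 0

variable {D : ℝ}

local notation "mn" => mon l m x y p s
local notation "rs" => rankSol D l m x y p s
local notation "cs" => crankSol l m x y p s

lemma rank_system_0 (H : TateParam v1 v2 v3 v4 v5 l m x y p s) :
    rs 0 + (mn 0 3 0 2 1 1 * rs 10) - mn 0 12 1 9 5 4 * rs 7 - mn 0 16 2 12 6 5 * rs 2 + (mn 0 (-7)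
    (-1) (-5) (-3) (-2) * rs 6) - mn 0 (-24) (-2) (-18) (-9) (-8) * rs 8 = 0 := by
  have h0 := mon_red H (-1) (-3) (-1) (-2) (-1) 0 0 0 0 1 2
  have h1 := mon_prod H 0 3 0 2 1 1 (-1) 27 3 20 10 10 3 1 0 1 1
  have h2 := mon_prod H 0 12 1 9 5 4 (-1) 18 2 14 7 7 3 1 1 2 1
  have h3 := mon_prod H 0 16 2 12 6 5 (-1) 3 0 3 1 2 2 1 1 1 1
  have h4 := mon_prod H 0 (-7) (-1) (-5) (-3) (-2) (-1) 15 1 11 5 7 1 0 0 0 3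
  have h5 := mon_prod H 0 (-24) (-2) (-18) (-9) (-8) (-1) 21 1 17 9 6 0 0 1 2 0
  norm_num at h0 h1 h2 h3 h4 h5
  have key : (p * s ^ 2) * (11 * y + 16 * x - 23 * x * y - 2 * x ^ 2 + 5 * x ^ 2 * y - 5 * x ^ 3) -
    (x * p * s) * (-2 + 7 * y + 14 * x - 2 * x * y + 2 * x ^ 2 + 11 * x ^ 2 * y) + (x * y * p ^ 2 *
    s) * (7 + 3 * y + 6 * x - 4 * x * y + 4 * x ^ 2) - (x * y * p * s) * (5 - y - 2 * x + 5 * x * y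
    - 16 * x ^ 2 + 11 * x ^ 3) - (s ^ 3) * (-11 * y - 7 * x - 3 * x * y - 6 * x ^ 2 + 4 * x ^ 2 * y
    + 7 * x ^ 3) - (y * p ^ 2) * (-3 - 3 * y + 8 * x + 5 * x * y + 7 * x ^ 2 + 12 * x ^ 2 * y + 8 *
    x ^ 3 + 14 * x ^ 3 * y) = 0 := by
    simp only [H.hp, H.hs]
    linear_combination (25 + 33 * y + 11 * y ^ 2 - 28 * x - 17 * x * y + 3 * x * y ^ 2 + 2 * x ^ 2 -
      x ^ 2 * y - 4 * x ^ 2 * y ^ 2 + 7 * x ^ 3 + x ^ 3 * y) * H.hF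
  simp only [rankSol]
  linear_combination 1 * D * (11 * y + 16 * x - 23 * x * y - 2 * x ^ 2 + 5 * x ^ 2 * y - 5 * x ^ 3)
    * h0 + D * (-2 + 7 * y + 14 * x - 2 * x * y + 2 * x ^ 2 + 11 * x ^ 2 * y) * h1 - D * (7 + 3 * y
    + 6 * x - 4 * x * y + 4 * x ^ 2) * h2 - D * (5 - y - 2 * x + 5 * x * y - 16 * x ^ 2 + 11 * x ^
    3) * h3 + D * (-11 * y - 7 * x - 3 * x * y - 6 * x ^ 2 + 4 * x ^ 2 * y + 7 * x ^ 3) * h4 - D *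
    (-3 - 3 * y + 8 * x + 5 * x * y + 7 * x ^ 2 + 12 * x ^ 2 * y + 8 * x ^ 3 + 14 * x ^ 3 * y) * h5
    + D * mn (-1) (-3) (-1) (-2) (-2) (-2) * key

lemma rank_system_1 (H : TateParam v1 v2 v3 v4 v5 l m x y p s) (hD : D * (x ^ 2 - x * y - 4 * x - 2
    * y - 1) = 1) :
    rs 1 + (mn 0 3 0 2 1 1 * rs 0) - mn 0 12 1 9 5 4 * rs 8 - mn 0 16 2 12 6 5 * rs 3 + (mn 0 (-7)
    (-1) (-5) (-3) (-2) * rs 7) - mn 0 (-24) (-2) (-18) (-9) (-8) * rs 9 = mn (-1) 0 0 0 0 0 + 3 *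
    mn (-1) 0 (-1) 1 0 1 + mn (-1) 0 0 0 1 0 - 3 * mn (-1) 11 1 9 4 4 + 4 * mn (-1) 0 (-1) 1 1 1 :=
    by
  have h0 := mon_red H (-1) 0 0 1 0 1 0 1 1 0 3
  have h1 := mon_prod H 0 3 0 2 1 1 (-1) (-3) (-1) (-2) (-1) 0 0 0 0 0 3
  have h2 := mon_prod H 0 12 1 9 5 4 (-1) 21 1 17 9 6 3 0 2 2 0
  have h3 := mon_prod H 0 16 2 12 6 5 (-1) 6 1 5 2 3 2 2 1 0 2
  have h4 := mon_prod H 0 (-7) (-1) (-5) (-3) (-2) (-1) 18 2 14 7 7 1 1 1 0 3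
  have h5 := mon_prod H 0 (-24) (-2) (-18) (-9) (-8) (-1) 24 3 18 9 9 0 2 0 0 3
  have h6 : mn (-1) 0 0 0 0 0 = mn (-1) 0 (-1) 0 0 (-2) * (x * s ^ 2) := by
    have h := mon_red H (-1) 0 0 0 0 0 0 1 0 0 2
    norm_num at h
    linear_combination h
  have h7 := mon_red H (-1) 0 (-1) 1 0 1 0 0 1 0 3
  have h8 := mon_red H (-1) 0 0 0 1 0 0 1 0 1 2
  have h9 := mon_red H (-1) 11 1 9 4 4 1 1 1 0 2
  have h10 := mon_red H (-1) 0 (-1) 1 1 1 0 0 1 1 3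
  norm_num at h0 h1 h2 h3 h4 h5 h7 h8 h9 h10
  have key : (x * y * s ^ 3) * (11 * y + 22 * x ^ 2) + (s ^ 3) * (11 * y + 16 * x - 23 * x * y - 2 *
    x ^ 2 + 5 * x ^ 2 * y - 5 * x ^ 3) + (y ^ 2 * p ^ 2) * (-3 - 3 * y + 8 * x + 5 * x * y + 7 * x ^
    2 + 12 * x ^ 2 * y + 8 * x ^ 3 + 14 * x ^ 3 * y) - (x ^ 2 * y * s ^ 2) * (-9 + 4 * y - 3 * x - 9
    * x * y + 9 * x ^ 2) - (x * y * s ^ 3) * (7 + 3 * y + 6 * x - 4 * x * y + 4 * x ^ 2) - (x ^ 2 *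
    s ^ 3) * (-1 - 13 * y + 7 * x + 10 * x * y + x ^ 2) - (x * s ^ 2) * (-1 - 2 * y - 4 * x - x * y
    + x ^ 2) + (y * s ^ 3) * (3 + 6 * y + 12 * x + 3 * x * y - 3 * x ^ 2) - (x * p * s ^ 2) * (-1 -
    2 * y - 4 * x - x * y + x ^ 2) + (x * y * s ^ 2) * (3 + 6 * y + 12 * x + 3 * x * y - 3 * x ^ 2)
    + (y * p * s ^ 3) * (4 + 8 * y + 16 * x + 4 * x * y - 4 * x ^ 2) = 0 := by
    simp only [H.hp, H.hs]
    linear_combination (18 + 47 * y + 46 * y ^ 2 + 14 * y ^ 3 + 6 * x + 21 * x * y + 14 * x * y ^ 2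
      + 7 * x * y ^ 3 - 18 * x ^ 2 - 43 * x ^ 2 * y - 26 * x ^ 2 * y ^ 2 + 8 * x ^ 3 * y + 14 * x ^
      3 * y ^ 2) * H.hF
  simp only [rankSol]
  linear_combination 1 * D * (11 * y + 22 * x ^ 2) * h0 + D * (11 * y + 16 * x - 23 * x * y - 2 * x
    ^ 2 + 5 * x ^ 2 * y - 5 * x ^ 3) * h1 - D * (-3 - 3 * y + 8 * x + 5 * x * y + 7 * x ^ 2 + 12 * x
    ^ 2 * y + 8 * x ^ 3 + 14 * x ^ 3 * y) * h2 - D * (-9 + 4 * y - 3 * x - 9 * x * y + 9 * x ^ 2) *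
    h3 + D * (7 + 3 * y + 6 * x - 4 * x * y + 4 * x ^ 2) * h4 - D * (-1 - 13 * y + 7 * x + 10 * x *
    y + x ^ 2) * h5 - (h6 - mn (-1) 0 (-1) 0 0 (-2) * (x * s ^ 2) * hD) - 3 * (h7 - mn (-1) 0 (-1) 0
    0 (-2) * (y * s ^ 3) * hD) - (h8 - mn (-1) 0 (-1) 0 0 (-2) * (x * p * s ^ 2) * hD) + 3 * (h9 -
    -(mn (-1) 0 (-1) 0 0 (-2) * (x * y * s ^ 2)) * hD) - 4 * (h10 - mn (-1) 0 (-1) 0 0 (-2) * (y * p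
    * s ^ 3) * hD) + D * mn (-1) 0 (-1) 0 0 (-2) * key

lemma rank_system_2 (H : TateParam v1 v2 v3 v4 v5 l m x y p s) :
    rs 2 + (mn 0 3 0 2 1 1 * rs 1) - mn 0 12 1 9 5 4 * rs 9 - mn 0 16 2 12 6 5 * rs 4 + (mn 0 (-7)
    (-1) (-5) (-3) (-2) * rs 8) - mn 0 (-24) (-2) (-18) (-9) (-8) * rs 10 = 0 := by
  have h0 : mn (-1) 3 0 3 1 2 = mn (-1) 3 (-1) 2 1 0 * (x * y * s ^ 2) := by
    have h := mon_red H (-1) 3 0 3 1 2 0 1 1 0 2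
    norm_num at h
    linear_combination h
  have h1 := mon_prod H 0 3 0 2 1 1 (-1) 0 0 1 0 1 0 1 1 0 2
  have h2 := mon_prod H 0 12 1 9 5 4 (-1) 24 3 18 9 9 3 2 1 1 1
  have h3 := mon_prod H 0 16 2 12 6 5 (-1) 9 1 7 4 3 2 2 1 1 0
  have h4 := mon_prod H 0 (-7) (-1) (-5) (-3) (-2) (-1) 21 1 17 9 6 1 0 2 1 0
  have h5 := mon_prod H 0 (-24) (-2) (-18) (-9) (-8) (-1) 27 3 20 10 10 0 2 0 0 2
  norm_num at h1 h2 h3 h4 h5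
  have key : (x * y * s ^ 2) * (5 - y - 2 * x + 5 * x * y - 16 * x ^ 2 + 11 * x ^ 3) + (x * y * s ^
    2) * (11 * y + 22 * x ^ 2) + (x ^ 2 * y * p * s) * (-1 - 13 * y + 7 * x + 10 * x * y + x ^ 2) -
    (x ^ 2 * y * p) * (1 + y + 13 * x + 4 * x * y - 2 * x ^ 2 + 19 * x ^ 2 * y - x ^ 3 * y) - (y ^ 2
    * p) * (-3 - 3 * y + 8 * x + 5 * x * y + 7 * x ^ 2 + 12 * x ^ 2 * y + 8 * x ^ 3 + 14 * x ^ 3 *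
    y) - (x ^ 2 * s ^ 2) * (-2 + 7 * y + 14 * x - 2 * x * y + 2 * x ^ 2 + 11 * x ^ 2 * y) = 0 := by
    simp only [H.hp, H.hs]
    linear_combination (3 * y + 2 * x + 7 * x * y + 10 * x * y ^ 2 - 14 * x ^ 2 - 24 * x ^ 2 * y + 5
      * x ^ 2 * y ^ 2 - 2 * x ^ 3 + 19 * x ^ 3 * y - x ^ 4 * y) * H.hF
  simp only [rankSol]
  linear_combination 1 * D * (5 - y - 2 * x + 5 * x * y - 16 * x ^ 2 + 11 * x ^ 3) * h0 + D * (11 *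
    y + 22 * x ^ 2) * h1 - D * (-1 - 13 * y + 7 * x + 10 * x * y + x ^ 2) * h2 - D * (1 + y + 13 * x
    + 4 * x * y - 2 * x ^ 2 + 19 * x ^ 2 * y - x ^ 3 * y) * h3 + D * (-3 - 3 * y + 8 * x + 5 * x * y
    + 7 * x ^ 2 + 12 * x ^ 2 * y + 8 * x ^ 3 + 14 * x ^ 3 * y) * h4 - D * (-2 + 7 * y + 14 * x - 2 *
    x * y + 2 * x ^ 2 + 11 * x ^ 2 * y) * h5 + D * mn (-1) 3 (-1) 2 1 0 * key

lemma rank_system_3 (H : TateParam v1 v2 v3 v4 v5 l m x y p s) (hD : D * (x ^ 2 - x * y - 4 * x - 2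
    * y - 1) = 1) :
    rs 3 + (mn 0 3 0 2 1 1 * rs 2) - mn 0 12 1 9 5 4 * rs 10 - mn 0 16 2 12 6 5 * rs 5 + (mn 0 (-7)
    (-1) (-5) (-3) (-2) * rs 9) - mn 0 (-24) (-2) (-18) (-9) (-8) * rs 0 = 11 * mn (-1) (-16) (-1)
    (-11) (-6) (-5) := by
  have h0 := mon_red H (-1) 6 1 5 2 3 0 1 1 0 2
  have h1 := mon_prod H 0 3 0 2 1 1 (-1) 3 0 3 1 2 0 0 1 0 2
  have h2 := mon_prod H 0 12 1 9 5 4 (-1) 27 3 20 10 10 3 1 1 1 1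
  have h3 := mon_prod H 0 16 2 12 6 5 (-1) 12 2 10 5 4 2 2 2 1 0
  have h4 := mon_prod H 0 (-7) (-1) (-5) (-3) (-2) (-1) 24 3 18 9 9 1 1 1 0 2
  have h5 := mon_prod H 0 (-24) (-2) (-18) (-9) (-8) (-1) (-3) (-1) (-2) (-1) 0 (-3) 0 0 0 3
  have h6 := mon_red H (-1) (-16) (-1) (-11) (-6) (-5) (-2) 1 1 0 2
  norm_num at h0 h1 h2 h3 h4 h5 h6
  have key : (x * y * s ^ 2) * (-9 + 4 * y - 3 * x - 9 * x * y + 9 * x ^ 2) + (y * s ^ 2) * (5 - y -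
    2 * x + 5 * x * y - 16 * x ^ 2 + 11 * x ^ 3) + (x * y * p * s) * (-2 + 7 * y + 14 * x - 2 * x *
    y + 2 * x ^ 2 + 11 * x ^ 2 * y) - (x ^ 2 * y ^ 2 * p) * (19 + 16 * y - x + 8 * x * y + 3 * x ^
    2) - (x * y * s ^ 2) * (-1 - 13 * y + 7 * x + 10 * x * y + x ^ 2) + (s ^ 3) * (11 * y + 16 * x -
    23 * x * y - 2 * x ^ 2 + 5 * x ^ 2 * y - 5 * x ^ 3) - (x * y * s ^ 2) * (-11 - 22 * y - 44 * x -
    11 * x * y + 11 * x ^ 2) = 0 := by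
    simp only [H.hp, H.hs]
    linear_combination (16 + 26 * y + 10 * y ^ 2 - 2 * x + 22 * x * y + 21 * x * y ^ 2 - 5 * x ^ 2 -
      17 * x ^ 2 * y - 3 * x ^ 2 * y ^ 2 + 3 * x ^ 3 * y) * H.hF
  simp only [rankSol]
  linear_combination 1 * D * (-9 + 4 * y - 3 * x - 9 * x * y + 9 * x ^ 2) * h0 + D * (5 - y - 2 * x
    + 5 * x * y - 16 * x ^ 2 + 11 * x ^ 3) * h1 - D * (-2 + 7 * y + 14 * x - 2 * x * y + 2 * x ^ 2 +
    11 * x ^ 2 * y) * h2 - D * (19 + 16 * y - x + 8 * x * y + 3 * x ^ 2) * h3 + D * (-1 - 13 * y + 7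
    * x + 10 * x * y + x ^ 2) * h4 - D * (11 * y + 16 * x - 23 * x * y - 2 * x ^ 2 + 5 * x ^ 2 * y -
    5 * x ^ 3) * h5 - 11 * (h6 - mn (-1) 6 0 4 2 1 * (x * y * s ^ 2) * hD) + D * mn (-1) 6 0 4 2 1 *
    key

lemma rank_system_4 (H : TateParam v1 v2 v3 v4 v5 l m x y p s) (hD : D * (x ^ 2 - x * y - 4 * x - 2
    * y - 1) = 1) :
    rs 4 + (mn 0 3 0 2 1 1 * rs 3) - mn 0 12 1 9 5 4 * rs 0 - mn 0 16 2 12 6 5 * rs 6 + (mn 0 (-7)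
    (-1) (-5) (-3) (-2) * rs 10) - mn 0 (-24) (-2) (-18) (-9) (-8) * rs 1 = 11 * mn (-1) 9 1 7 4 3
    := by
  have h0 := mon_red H (-1) 9 1 7 4 3 0 1 0 1 0
  have h1 := mon_prod H 0 3 0 2 1 1 (-1) 6 1 5 2 3 0 1 0 0 1
  have h2 := mon_prod H 0 12 1 9 5 4 (-1) (-3) (-1) (-2) (-1) 0 0 0 0 1 1
  have h3 := mon_prod H 0 16 2 12 6 5 (-1) 15 1 11 5 7 2 1 0 0 1
  have h4 := mon_prod H 0 (-7) (-1) (-5) (-3) (-2) (-1) 27 3 20 10 10 1 1 0 0 1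
  have h5 := mon_prod H 0 (-24) (-2) (-18) (-9) (-8) (-1) 0 0 1 0 1 (-3) 1 0 0 2
  have h6 := mon_red H (-1) 9 1 7 4 3 0 1 0 1 0
  norm_num at h0 h1 h2 h3 h4 h5 h6
  have key : (x * p) * (1 + y + 13 * x + 4 * x * y - 2 * x ^ 2 + 19 * x ^ 2 * y - x ^ 3 * y) + (x *
    s) * (-9 + 4 * y - 3 * x - 9 * x * y + 9 * x ^ 2) - (p * s) * (11 * y + 16 * x - 23 * x * y - 2
    * x ^ 2 + 5 * x ^ 2 * y - 5 * x ^ 3) - (x * s) * (-11 * y - 7 * x - 3 * x * y - 6 * x ^ 2 + 4 *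
    x ^ 2 * y + 7 * x ^ 3) - (x * s) * (-2 + 7 * y + 14 * x - 2 * x * y + 2 * x ^ 2 + 11 * x ^ 2 *
    y) + (x * s ^ 2) * (11 * y + 22 * x ^ 2) - (x * p) * (-11 - 22 * y - 44 * x - 11 * x * y + 11 *
    x ^ 2) = 0 := by
    simp only [H.hp, H.hs]
    linear_combination (-11 + 53 * x + 11 * x * y - 32 * x ^ 2 + x ^ 3) * H.hF
  simp only [rankSol]
  linear_combination 1 * D * (1 + y + 13 * x + 4 * x * y - 2 * x ^ 2 + 19 * x ^ 2 * y - x ^ 3 * y) *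
    h0 + D * (-9 + 4 * y - 3 * x - 9 * x * y + 9 * x ^ 2) * h1 - D * (11 * y + 16 * x - 23 * x * y -
    2 * x ^ 2 + 5 * x ^ 2 * y - 5 * x ^ 3) * h2 - D * (-11 * y - 7 * x - 3 * x * y - 6 * x ^ 2 + 4 *
    x ^ 2 * y + 7 * x ^ 3) * h3 + D * (-2 + 7 * y + 14 * x - 2 * x * y + 2 * x ^ 2 + 11 * x ^ 2 * y)
    * h4 - D * (11 * y + 22 * x ^ 2) * h5 - 11 * (h6 - mn (-1) 9 0 7 3 3 * (x * p) * hD) + D * mn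
    (-1) 9 0 7 3 3 * key

lemma rank_system_5 (H : TateParam v1 v2 v3 v4 v5 l m x y p s) (hD : D * (x ^ 2 - x * y - 4 * x - 2
    * y - 1) = 1) :
    rs 5 + (mn 0 3 0 2 1 1 * rs 4) - mn 0 12 1 9 5 4 * rs 1 - mn 0 16 2 12 6 5 * rs 7 + (mn 0 (-7)
    (-1) (-5) (-3) (-2) * rs 0) - mn 0 (-24) (-2) (-18) (-9) (-8) * rs 2 = (-11) * mn (-1) (-10)
    (-1) (-7) (-3) (-3) := by
  have h0 : mn (-1) 12 2 10 5 4 = mn (-1) 12 0 9 4 4 * (x ^ 2 * y * p) := by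
    have h := mon_red H (-1) 12 2 10 5 4 0 2 1 1 0
    norm_num at h
    linear_combination h
  have h1 := mon_prod H 0 3 0 2 1 1 (-1) 9 1 7 4 3 0 1 0 1 0
  have h2 := mon_prod H 0 12 1 9 5 4 (-1) 0 0 1 0 1 0 1 1 1 1
  have h3 := mon_prod H 0 16 2 12 6 5 (-1) 18 2 14 7 7 2 2 1 1 0
  have h4 := mon_prod H 0 (-7) (-1) (-5) (-3) (-2) (-1) (-3) (-1) (-2) (-1) 0 (-2) 0 0 0 2
  have h5 := mon_prod H 0 (-24) (-2) (-18) (-9) (-8) (-1) 3 0 3 1 2 (-3) 1 0 0 2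
  have h6 := mon_red H (-1) (-10) (-1) (-7) (-3) (-3) (-2) 1 0 1 1
  norm_num at h1 h2 h3 h4 h5 h6
  have key : (x ^ 2 * y * p) * (19 + 16 * y - x + 8 * x * y + 3 * x ^ 2) + (x * p) * (1 + y + 13 * x
    + 4 * x * y - 2 * x ^ 2 + 19 * x ^ 2 * y - x ^ 3 * y) - (x * y * p * s) * (11 * y + 22 * x ^ 2)
    - (x ^ 2 * y * p) * (7 + 3 * y + 6 * x - 4 * x * y + 4 * x ^ 2) + (s ^ 2) * (11 * y + 16 * x -
    23 * x * y - 2 * x ^ 2 + 5 * x ^ 2 * y - 5 * x ^ 3) + (x * s ^ 2) * (5 - y - 2 * x + 5 * x * y -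
    16 * x ^ 2 + 11 * x ^ 3) + (x * p * s) * (-11 - 22 * y - 44 * x - 11 * x * y + 11 * x ^ 2) = 0
    := by
    simp only [H.hp, H.hs]
    linear_combination (11 + 11 * y - 25 * x - 35 * x * y + 19 * x ^ 2 + 21 * x ^ 2 * y + 2 * x ^ 3)
      * H.hF
  simp only [rankSol]
  linear_combination 1 * D * (19 + 16 * y - x + 8 * x * y + 3 * x ^ 2) * h0 + D * (1 + y + 13 * x +
    4 * x * y - 2 * x ^ 2 + 19 * x ^ 2 * y - x ^ 3 * y) * h1 - D * (11 * y + 22 * x ^ 2) * h2 - D *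
    (7 + 3 * y + 6 * x - 4 * x * y + 4 * x ^ 2) * h3 + D * (11 * y + 16 * x - 23 * x * y - 2 * x ^ 2
    + 5 * x ^ 2 * y - 5 * x ^ 3) * h4 - D * (5 - y - 2 * x + 5 * x * y - 16 * x ^ 2 + 11 * x ^ 3) *
    h5 + 11 * (h6 - mn (-1) 12 0 9 4 4 * (x * p * s) * hD) + D * mn (-1) 12 0 9 4 4 * key

lemma rank_system_6 (H : TateParam v1 v2 v3 v4 v5 l m x y p s) :
    rs 6 + (mn 0 3 0 2 1 1 * rs 5) - mn 0 12 1 9 5 4 * rs 2 - mn 0 16 2 12 6 5 * rs 8 + (mn 0 (-7)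
    (-1) (-5) (-3) (-2) * rs 1) - mn 0 (-24) (-2) (-18) (-9) (-8) * rs 3 = 0 := by
  have h0 := mon_red H (-1) 15 1 11 5 7 0 0 0 0 4
  have h1 := mon_prod H 0 3 0 2 1 1 (-1) 12 2 10 5 4 0 1 1 1 2
  have h2 := mon_prod H 0 12 1 9 5 4 (-1) 3 0 3 1 2 0 0 1 1 3
  have h3 := mon_prod H 0 16 2 12 6 5 (-1) 21 1 17 9 6 2 0 2 2 0
  have h4 := mon_prod H 0 (-7) (-1) (-5) (-3) (-2) (-1) 0 0 1 0 1 (-2) 0 1 0 4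
  have h5 := mon_prod H 0 (-24) (-2) (-18) (-9) (-8) (-1) 6 1 5 2 3 (-3) 1 0 0 4
  norm_num at h0 h1 h2 h3 h4 h5
  have key : (s ^ 4) * (-11 * y - 7 * x - 3 * x * y - 6 * x ^ 2 + 4 * x ^ 2 * y + 7 * x ^ 3) + (x *
    y * p * s ^ 2) * (19 + 16 * y - x + 8 * x * y + 3 * x ^ 2) - (y * p * s ^ 3) * (5 - y - 2 * x +
    5 * x * y - 16 * x ^ 2 + 11 * x ^ 3) - (y ^ 2 * p ^ 2) * (-3 - 3 * y + 8 * x + 5 * x * y + 7 * x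
    ^ 2 + 12 * x ^ 2 * y + 8 * x ^ 3 + 14 * x ^ 3 * y) + (y * s ^ 4) * (11 * y + 22 * x ^ 2) + (x *
    s ^ 4) * (-9 + 4 * y - 3 * x - 9 * x * y + 9 * x ^ 2) = 0 := by
    simp only [H.hp, H.hs]
    linear_combination (-16 - 28 * y - 3 * y ^ 2 + 23 * y ^ 3 + 11 * y ^ 4 - 9 * x - 25 * x * y - 13
      * x * y ^ 2 - 5 * x * y ^ 3 + 16 * x ^ 2 + 50 * x ^ 2 * y + 46 * x ^ 2 * y ^ 2 + 11 * x ^ 2 *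
      y ^ 3 - 8 * x ^ 3 * y - 14 * x ^ 3 * y ^ 2) * H.hF
  simp only [rankSol]
  linear_combination 1 * D * (-11 * y - 7 * x - 3 * x * y - 6 * x ^ 2 + 4 * x ^ 2 * y + 7 * x ^ 3) *
    h0 + D * (19 + 16 * y - x + 8 * x * y + 3 * x ^ 2) * h1 - D * (5 - y - 2 * x + 5 * x * y - 16 *
    x ^ 2 + 11 * x ^ 3) * h2 - D * (-3 - 3 * y + 8 * x + 5 * x * y + 7 * x ^ 2 + 12 * x ^ 2 * y + 8
    * x ^ 3 + 14 * x ^ 3 * y) * h3 + D * (11 * y + 22 * x ^ 2) * h4 - D * (-9 + 4 * y - 3 * x - 9 *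
    x * y + 9 * x ^ 2) * h5 + D * mn (-1) 15 1 11 5 3 * key

lemma rank_system_7 (H : TateParam v1 v2 v3 v4 v5 l m x y p s) :
    rs 7 + (mn 0 3 0 2 1 1 * rs 6) - mn 0 12 1 9 5 4 * rs 3 - mn 0 16 2 12 6 5 * rs 9 + (mn 0 (-7)
    (-1) (-5) (-3) (-2) * rs 2) - mn 0 (-24) (-2) (-18) (-9) (-8) * rs 4 = 0 := by
  have h0 : mn (-1) 18 2 14 7 7 = mn (-1) 18 1 13 6 6 * (x * y * p * s) := by
    have h := mon_red H (-1) 18 2 14 7 7 0 1 1 1 1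
    norm_num at h
    linear_combination h
  have h1 := mon_prod H 0 3 0 2 1 1 (-1) 15 1 11 5 7 0 0 0 0 2
  have h2 := mon_prod H 0 12 1 9 5 4 (-1) 6 1 5 2 3 0 1 1 1 1
  have h3 := mon_prod H 0 16 2 12 6 5 (-1) 24 3 18 9 9 2 2 1 1 0
  have h4 := mon_prod H 0 (-7) (-1) (-5) (-3) (-2) (-1) 3 0 3 1 2 (-2) 0 1 0 2
  have h5 := mon_prod H 0 (-24) (-2) (-18) (-9) (-8) (-1) 9 1 7 4 3 (-3) 1 0 1 1
  norm_num at h1 h2 h3 h4 h5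
  have key : (x * y * p * s) * (7 + 3 * y + 6 * x - 4 * x * y + 4 * x ^ 2) + (s ^ 2) * (-11 * y - 7
    * x - 3 * x * y - 6 * x ^ 2 + 4 * x ^ 2 * y + 7 * x ^ 3) - (x * y * p * s) * (-9 + 4 * y - 3 * x
    - 9 * x * y + 9 * x ^ 2) - (x ^ 2 * y * p) * (-1 - 13 * y + 7 * x + 10 * x * y + x ^ 2) + (y * s
    ^ 2) * (5 - y - 2 * x + 5 * x * y - 16 * x ^ 2 + 11 * x ^ 3) + (x * p * s) * (1 + y + 13 * x + 4
    * x * y - 2 * x ^ 2 + 19 * x ^ 2 * y - x ^ 3 * y) = 0 := by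
    simp only [H.hp, H.hs]
    linear_combination (-6 - 7 * y - y ^ 2 + 6 * x - x * y + 5 * x * y ^ 2 - 8 * x ^ 2 - 5 * x ^ 2 *
      y + 2 * x ^ 3 + x ^ 3 * y) * H.hF
  simp only [rankSol]
  linear_combination 1 * D * (7 + 3 * y + 6 * x - 4 * x * y + 4 * x ^ 2) * h0 + D * (-11 * y - 7 * x
    - 3 * x * y - 6 * x ^ 2 + 4 * x ^ 2 * y + 7 * x ^ 3) * h1 - D * (-9 + 4 * y - 3 * x - 9 * x * y
    + 9 * x ^ 2) * h2 - D * (-1 - 13 * y + 7 * x + 10 * x * y + x ^ 2) * h3 + D * (5 - y - 2 * x + 5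
    * x * y - 16 * x ^ 2 + 11 * x ^ 3) * h4 - D * (1 + y + 13 * x + 4 * x * y - 2 * x ^ 2 + 19 * x ^
    2 * y - x ^ 3 * y) * h5 + D * mn (-1) 18 1 13 6 6 * key

lemma rank_system_8 (H : TateParam v1 v2 v3 v4 v5 l m x y p s) :
    rs 8 + (mn 0 3 0 2 1 1 * rs 7) - mn 0 12 1 9 5 4 * rs 4 - mn 0 16 2 12 6 5 * rs 10 + (mn 0 (-7)
    (-1) (-5) (-3) (-2) * rs 3) - mn 0 (-24) (-2) (-18) (-9) (-8) * rs 5 = 0 := by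
  have h0 := mon_red H (-1) 21 1 17 9 6 0 0 1 2 0
  have h1 := mon_prod H 0 3 0 2 1 1 (-1) 18 2 14 7 7 0 1 0 1 2
  have h2 := mon_prod H 0 12 1 9 5 4 (-1) 9 1 7 4 3 0 1 0 2 1
  have h3 := mon_prod H 0 16 2 12 6 5 (-1) 27 3 20 10 10 2 2 0 1 1
  have h4 := mon_prod H 0 (-7) (-1) (-5) (-3) (-2) (-1) 6 1 5 2 3 (-2) 1 0 0 3
  have h5 := mon_prod H 0 (-24) (-2) (-18) (-9) (-8) (-1) 12 2 10 5 4 (-3) 2 0 1 2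
  norm_num at h0 h1 h2 h3 h4 h5
  have key : (y * p ^ 2) * (-3 - 3 * y + 8 * x + 5 * x * y + 7 * x ^ 2 + 12 * x ^ 2 * y + 8 * x ^ 3
    + 14 * x ^ 3 * y) + (x * p * s ^ 2) * (7 + 3 * y + 6 * x - 4 * x * y + 4 * x ^ 2) - (x * p ^ 2 *
    s) * (1 + y + 13 * x + 4 * x * y - 2 * x ^ 2 + 19 * x ^ 2 * y - x ^ 3 * y) - (x ^ 2 * p * s) *
    (-2 + 7 * y + 14 * x - 2 * x * y + 2 * x ^ 2 + 11 * x ^ 2 * y) + (x * s ^ 3) * (-9 + 4 * y - 3 *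
    x - 9 * x * y + 9 * x ^ 2) + (x ^ 2 * p * s ^ 2) * (19 + 16 * y - x + 8 * x * y + 3 * x ^ 2) = 0
    := by
    simp only [H.hp, H.hs]
    linear_combination (-3 + 6 * x + 2 * x * y + 4 * x * y ^ 2 - 2 * x ^ 2 - 12 * x ^ 2 * y - 9 * x
      ^ 2 * y ^ 2 - 5 * x ^ 3 + x ^ 3 * y + x ^ 4 + x ^ 4 * y) * H.hF
  simp only [rankSol]
  linear_combination 1 * D * (-3 - 3 * y + 8 * x + 5 * x * y + 7 * x ^ 2 + 12 * x ^ 2 * y + 8 * x ^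
    3 + 14 * x ^ 3 * y) * h0 + D * (7 + 3 * y + 6 * x - 4 * x * y + 4 * x ^ 2) * h1 - D * (1 + y +
    13 * x + 4 * x * y - 2 * x ^ 2 + 19 * x ^ 2 * y - x ^ 3 * y) * h2 - D * (-2 + 7 * y + 14 * x - 2
    * x * y + 2 * x ^ 2 + 11 * x ^ 2 * y) * h3 + D * (-9 + 4 * y - 3 * x - 9 * x * y + 9 * x ^ 2) *
    h4 - D * (19 + 16 * y - x + 8 * x * y + 3 * x ^ 2) * h5 + D * mn (-1) 21 1 16 7 6 * key

lemma rank_system_9 (H : TateParam v1 v2 v3 v4 v5 l m x y p s) (hD : D * (x ^ 2 - x * y - 4 * x - 2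
    * y - 1) = 1) :
    rs 9 + (mn 0 3 0 2 1 1 * rs 8) - mn 0 12 1 9 5 4 * rs 5 - mn 0 16 2 12 6 5 * rs 0 + (mn 0 (-7)
    (-1) (-5) (-3) (-2) * rs 4) - mn 0 (-24) (-2) (-18) (-9) (-8) * rs 6 = (-11) * mn (-1) 13 1 11 5
    5 := by
  have h0 := mon_red H (-1) 24 3 18 9 9 0 2 1 1 2
  have h1 := mon_prod H 0 3 0 2 1 1 (-1) 21 1 17 9 6 0 0 2 2 0
  have h2 := mon_prod H 0 12 1 9 5 4 (-1) 12 2 10 5 4 0 2 2 2 1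
  have h3 := mon_prod H 0 16 2 12 6 5 (-1) (-3) (-1) (-2) (-1) 0 (-1) 1 1 1 2
  have h4 := mon_prod H 0 (-7) (-1) (-5) (-3) (-2) (-1) 9 1 7 4 3 (-2) 1 1 1 2
  have h5 := mon_prod H 0 (-24) (-2) (-18) (-9) (-8) (-1) 15 1 11 5 7 (-3) 1 0 0 4
  have h6 := mon_red H (-1) 13 1 11 5 5 (-1) 1 2 1 2
  norm_num at h0 h1 h2 h3 h4 h5 h6
  have key : (x ^ 2 * y * p * s ^ 2) * (-1 - 13 * y + 7 * x + 10 * x * y + x ^ 2) + (y ^ 2 * p ^ 2)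
    * (-3 - 3 * y + 8 * x + 5 * x * y + 7 * x ^ 2 + 12 * x ^ 2 * y + 8 * x ^ 3 + 14 * x ^ 3 * y) -
    (x ^ 2 * y ^ 2 * p ^ 2 * s) * (19 + 16 * y - x + 8 * x * y + 3 * x ^ 2) + (x * y * p * s ^ 2) *
    (11 * y + 16 * x - 23 * x * y - 2 * x ^ 2 + 5 * x ^ 2 * y - 5 * x ^ 3) + (x * y * p * s ^ 2) *
    (1 + y + 13 * x + 4 * x * y - 2 * x ^ 2 + 19 * x ^ 2 * y - x ^ 3 * y) + (x * s ^ 4) * (-11 * y -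
    7 * x - 3 * x * y - 6 * x ^ 2 + 4 * x ^ 2 * y + 7 * x ^ 3) - (x * y ^ 2 * p * s ^ 2) * (-11 - 22
    * y - 44 * x - 11 * x * y + 11 * x ^ 2) = 0 := by
    simp only [H.hp, H.hs]
    linear_combination (-3 * y - 7 * x + 2 * x * y + 12 * x * y ^ 2 + 11 * x * y ^ 3 - 6 * x ^ 2 -
      45 * x ^ 2 * y - 54 * x ^ 2 * y ^ 2 - 14 * x ^ 2 * y ^ 3 + 7 * x ^ 3 + 27 * x ^ 3 * y + 19 * x
      ^ 3 * y ^ 2 - 7 * x ^ 3 * y ^ 3 - 3 * x ^ 4 * y - 3 * x ^ 4 * y ^ 2) * H.hF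
  simp only [rankSol]
  linear_combination 1 * D * (-1 - 13 * y + 7 * x + 10 * x * y + x ^ 2) * h0 + D * (-3 - 3 * y + 8 *
    x + 5 * x * y + 7 * x ^ 2 + 12 * x ^ 2 * y + 8 * x ^ 3 + 14 * x ^ 3 * y) * h1 - D * (19 + 16 * y
    - x + 8 * x * y + 3 * x ^ 2) * h2 - D * (11 * y + 16 * x - 23 * x * y - 2 * x ^ 2 + 5 * x ^ 2 *
    y - 5 * x ^ 3) * h3 + D * (1 + y + 13 * x + 4 * x * y - 2 * x ^ 2 + 19 * x ^ 2 * y - x ^ 3 * y)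
    * h4 - D * (-11 * y - 7 * x - 3 * x * y - 6 * x ^ 2 + 4 * x ^ 2 * y + 7 * x ^ 3) * h5 + 11 * (h6
    - -(mn (-1) 24 1 17 8 7 * (x * y ^ 2 * p * s ^ 2)) * hD) + D * mn (-1) 24 1 17 8 7 * key

lemma rank_system_10 (H : TateParam v1 v2 v3 v4 v5 l m x y p s) :
    rs 10 + (mn 0 3 0 2 1 1 * rs 9) - mn 0 12 1 9 5 4 * rs 6 - mn 0 16 2 12 6 5 * rs 1 + (mn 0 (-7)
    (-1) (-5) (-3) (-2) * rs 5) - mn 0 (-24) (-2) (-18) (-9) (-8) * rs 7 = 0 := by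
  have h0 := mon_red H (-1) 27 3 20 10 10 0 1 0 0 0
  have h1 := mon_prod H 0 3 0 2 1 1 (-1) 24 3 18 9 9 0 1 0 0 0
  have h2 := mon_prod H 0 12 1 9 5 4 (-1) 15 1 11 5 7 0 0 0 0 1
  have h3 := mon_prod H 0 16 2 12 6 5 (-1) 0 0 1 0 1 (-1) 1 1 0 0
  have h4 := mon_prod H 0 (-7) (-1) (-5) (-3) (-2) (-1) 12 2 10 5 4 (-2) 1 1 0 0
  have h5 := mon_prod H 0 (-24) (-2) (-18) (-9) (-8) (-1) 18 2 14 7 7 (-3) 1 0 0 1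
  norm_num at h0 h1 h2 h3 h4 h5
  have key : (x) * (-2 + 7 * y + 14 * x - 2 * x * y + 2 * x ^ 2 + 11 * x ^ 2 * y) + (x) * (-1 - 13 *
    y + 7 * x + 10 * x * y + x ^ 2) - (s) * (-11 * y - 7 * x - 3 * x * y - 6 * x ^ 2 + 4 * x ^ 2 * y
    + 7 * x ^ 3) + (x * y) * (11 * y + 22 * x ^ 2) + (x * y) * (19 + 16 * y - x + 8 * x * y + 3 * x
    ^ 2) + (x * s) * (7 + 3 * y + 6 * x - 4 * x * y + 4 * x ^ 2) = 0 := by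
    simp only [H.hs]
    linear_combination (11 + 33 * x) * H.hF
  simp only [rankSol]
  linear_combination 1 * D * (-2 + 7 * y + 14 * x - 2 * x * y + 2 * x ^ 2 + 11 * x ^ 2 * y) * h0 + D
    * (-1 - 13 * y + 7 * x + 10 * x * y + x ^ 2) * h1 - D * (-11 * y - 7 * x - 3 * x * y - 6 * x ^ 2
    + 4 * x ^ 2 * y + 7 * x ^ 3) * h2 - D * (11 * y + 22 * x ^ 2) * h3 + D * (19 + 16 * y - x + 8 *
    x * y + 3 * x ^ 2) * h4 - D * (7 + 3 * y + 6 * x - 4 * x * y + 4 * x ^ 2) * h5 + D * mn (-1) 27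
    2 20 10 10 * key

lemma crank_system_0 (H : TateParam v1 v2 v3 v4 v5 l m x y p s) :
    cs 0 + (mn 0 3 0 2 1 1 * cs 10) - mn 0 12 1 9 5 4 * cs 7 - mn 0 16 2 12 6 5 * cs 2 + (mn 0 (-7)
    (-1) (-5) (-3) (-2) * cs 6) - mn 0 (-24) (-2) (-18) (-9) (-8) * cs 8 = 11 * mn (-1) (-1) 0 0 0 0
    := by
  have h0 : mn (-1) (-1) 0 0 0 0 = mn (-1) (-1) 0 0 (-1) (-1) * (p * s) := by
    have h := mon_red H (-1) (-1) 0 0 0 0 0 0 0 1 1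
    norm_num at h
    linear_combination h
  have h1 := mon_prod H 0 3 0 2 1 1 (-1) (-4) 0 (-2) (-1) (-1) 0 0 0 1 1
  have h2 := mon_prod H 0 12 1 9 5 4 (-1) (-13) (-1) (-9) (-4) (-4) 0 0 0 2 1
  have h3 := mon_prod H 0 16 2 12 6 5 (-1) (-6) 0 (-4) (-2) (-2) 1 1 0 1 0
  have h4 := mon_prod H 0 (-7) (-1) (-5) (-3) (-2) (-1) (-16) (-1) (-11) (-6) (-5) (-2) 0 0 0 2
  have h5 := mon_prod H 0 (-24) (-2) (-18) (-9) (-8) (-1) 12 2 10 5 4 (-1) 1 0 1 1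
  norm_num at h1 h2 h3 h4 h5
  have h6 : mn (-1) (-1) 0 0 0 0 = mn (-1) (-1) 0 0 (-1) (-1) * (p * s) := by
    have h := mon_red H (-1) (-1) 0 0 0 0 0 0 0 1 1
    norm_num at h
    linear_combination h
  have key : (p * s) * (-1) + (p * s) * 5 + (p ^ 2 * s) * 4 + (x * p) * 3 - (s ^ 2) * (-3) + (x * p
    * s) * 1 - (p * s) * 11 = 0 := by
    simp only [H.hp, H.hs]
    linear_combination 3 * H.hF
  simp only [crankSol]
  linear_combination (-1) * h0 + 5 * h1 + 4 * h2 - 3 * h3 + 3 * h4 - h5 - 11 * h6 + mn (-1) (-1) 0 0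
    (-1) (-1) * key

lemma crank_system_1 (H : TateParam v1 v2 v3 v4 v5 l m x y p s) :
    cs 1 + (mn 0 3 0 2 1 1 * cs 0) - mn 0 12 1 9 5 4 * cs 8 - mn 0 16 2 12 6 5 * cs 3 + (mn 0 (-7)
    (-1) (-5) (-3) (-2) * cs 7) - mn 0 (-24) (-2) (-18) (-9) (-8) * cs 9 = 11 * mn (-1) (-64) (-5)
    (-47) (-24) (-21) := by
  have h0 := mon_red H (-1) (-9) 0 (-6) (-3) (-3) 0 1 1 1 1
  have h1 := mon_prod H 0 3 0 2 1 1 (-1) (-1) 0 0 0 0 1 0 1 1 1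
  have h2 := mon_prod H 0 12 1 9 5 4 (-1) 12 2 10 5 4 3 1 2 2 0
  have h3 := mon_prod H 0 16 2 12 6 5 (-1) (-25) (-2) (-18) (-9) (-8) 0 1 1 1 1
  have h4 := mon_prod H 0 (-7) (-1) (-5) (-3) (-2) (-1) (-13) (-1) (-9) (-4) (-4) (-1) 0 1 1 2
  have h5 := mon_prod H 0 (-24) (-2) (-18) (-9) (-8) (-1) (-40) (-3) (-29) (-15) (-13) (-5) 1 0 0 3
  have h6 := mon_red H (-1) (-64) (-5) (-47) (-24) (-21) (-5) 1 0 0 3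
  norm_num at h0 h1 h2 h3 h4 h5 h6
  have key : (x * y * p * s) * (-4) - (y * p * s) * (-1) + (x * y ^ 2 * p ^ 2) * 1 - (x * y * p * s)
    * 2 + (y * p * s ^ 2) * 4 - (x * s ^ 3) * 6 + (x * s ^ 3) * 11 = 0 := by
    simp only [H.hp, H.hs]
    linear_combination (5 + 4 * y + x * y) * H.hF
  simp only [crankSol]
  linear_combination (-4) * h0 - h1 - h2 - 2 * h3 - 4 * h4 + 6 * h5 - 11 * h6 + mn (-1) (-9) (-1)
    (-7) (-4) (-4) * key

lemma crank_system_2 (H : TateParam v1 v2 v3 v4 v5 l m x y p s) :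
    cs 2 + (mn 0 3 0 2 1 1 * cs 1) - mn 0 12 1 9 5 4 * cs 9 + (mn 0 (-7) (-1) (-5) (-3) (-2) * cs 8)
    - mn 0 (-24) (-2) (-18) (-9) (-8) * cs 10 = 0 := by
  have h0 : mn (-1) (-6) 0 (-4) (-2) (-2) = mn (-1) (-6) 0 (-4) (-2) (-2) := rfl
  have h1 := mon_prod H 0 3 0 2 1 1 (-1) (-9) 0 (-6) (-3) (-3) 0 0 0 0 0
  have h2 := mon_prod H 0 12 1 9 5 4 (-1) (-40) (-3) (-29) (-15) (-13) (-2) 0 0 0 1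
  have h3 := mon_prod H 0 (-7) (-1) (-5) (-3) (-2) (-1) 12 2 10 5 4 1 0 1 0 0
  have h4 := mon_prod H 0 (-24) (-2) (-18) (-9) (-8) (-1) (-4) 0 (-2) (-1) (-1) (-2) 0 0 0 1
  norm_num at h1 h2 h3 h4
  have key : 1 * 3 + 1 * (-4) + (s) * 6 - (y) * 1 - (s) * 5 = 0 := by
    simp only [H.hs]
    linear_combination 0 * H.hF
  simp only [crankSol]
  linear_combination 3 * h0 - 4 * h1 + 6 * h2 + h3 - 5 * h4 + mn (-1) (-6) 0 (-4) (-2) (-2) * key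

lemma crank_system_3 (H : TateParam v1 v2 v3 v4 v5 l m x y p s) :
    cs 3 + (mn 0 3 0 2 1 1 * cs 2) - mn 0 12 1 9 5 4 * cs 10 - mn 0 16 2 12 6 5 * cs 5 + (mn 0 (-7)
    (-1) (-5) (-3) (-2) * cs 9) - mn 0 (-24) (-2) (-18) (-9) (-8) * cs 0 = (-11) * mn (-1) (-3) 1
    (-1) (-1) (-1) := by
  have h0 := mon_red H (-1) (-25) (-2) (-18) (-9) (-8) 0 0 0 1 1
  have h1 := mon_prod H 0 3 0 2 1 1 (-1) (-6) 0 (-4) (-2) (-2) 2 0 0 1 0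
  have h2 := mon_prod H 0 12 1 9 5 4 (-1) (-4) 0 (-2) (-1) (-1) 3 0 1 2 0
  have h3 := mon_prod H 0 16 2 12 6 5 (-1) (-8) (-1) (-5) (-3) (-2) 3 0 1 1 0
  have h4 := mon_prod H 0 (-7) (-1) (-5) (-3) (-2) (-1) (-40) (-3) (-29) (-15) (-13) (-2) 0 0 0 2
  have h5 := mon_prod H 0 (-24) (-2) (-18) (-9) (-8) (-1) (-1) 0 0 0 0 0 0 0 1 1
  have h6 := mon_red H (-1) (-3) 1 (-1) (-1) (-1) 2 1 1 1 0
  norm_num at h0 h1 h2 h3 h4 h5 h6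
  have key : (p * s) * 2 + (p) * 3 + (y * p ^ 2) * 5 - (y * p) * 2 - (s ^ 2) * 6 - (p * s) * (-1) +
    (x * y * p) * 11 = 0 := by
    simp only [H.hp, H.hs]
    linear_combination (-6) * H.hF
  simp only [crankSol]
  linear_combination 2 * h0 + 3 * h1 - 5 * h2 + 2 * h3 - 6 * h4 + h5 + 11 * h6 + mn (-1) (-25) (-2)
    (-18) (-10) (-9) * key

lemma crank_system_4 (H : TateParam v1 v2 v3 v4 v5 l m x y p s) : (mn 0 3 0 2 1 1 * cs 3) - mn 0 12
    1 9 5 4 * cs 0 - mn 0 16 2 12 6 5 * cs 6 + (mn 0 (-7) (-1) (-5) (-3) (-2) * cs 10) - mn 0 (-24)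
    (-2) (-18) (-9) (-8) * cs 1 = 4 * mn (-1) 0 0 0 0 0 + mn (-1) 0 (-1) 1 0 1 + 4 * mn (-1) 0 0 0 1
    0 - mn (-1) 11 1 9 4 4 + 5 * mn (-1) 0 (-1) 1 1 1 := by
  have h0 := mon_prod H 0 3 0 2 1 1 (-1) (-25) (-2) (-18) (-9) (-8) 0 1 0 0 1
  have h1 := mon_prod H 0 12 1 9 5 4 (-1) (-1) 0 0 0 0 3 1 1 1 0
  have h2 := mon_prod H 0 16 2 12 6 5 (-1) (-16) (-1) (-11) (-6) (-5) 2 2 1 0 0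
  have h3 := mon_prod H 0 (-7) (-1) (-5) (-3) (-2) (-1) (-4) 0 (-2) (-1) (-1) 1 1 1 0 1
  have h4 := mon_prod H 0 (-24) (-2) (-18) (-9) (-8) (-1) (-9) 0 (-6) (-3) (-3) (-1) 2 0 0 1
  have h5 := mon_red H (-1) 0 0 0 0 0 2 1 0 0 0
  have h6 := mon_red H (-1) 0 (-1) 1 0 1 2 0 1 0 1
  have h7 := mon_red H (-1) 0 0 0 1 0 2 1 0 1 0
  have h8 := mon_red H (-1) 11 1 9 4 4 3 1 1 0 0
  have h9 := mon_red H (-1) 0 (-1) 1 1 1 2 0 1 1 1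
  norm_num at h0 h1 h2 h3 h4 h5 h6 h7 h8 h9
  have key : (x * s) * 2 + (x * y * p) * (-1) + (x ^ 2 * y) * (-3) - (x * y * s) * 5 + (x ^ 2 * s) *
    (-4) - (x) * 4 + (y * s) * (-1) - (x * p) * 4 + (x * y) * (-1) + (y * p * s) * (-5) = 0 := by
    simp only [H.hp, H.hs]
    linear_combination (-6) * H.hF
  simp only [crankSol]
  linear_combination 2 * h0 + h1 - 3 * h2 + 5 * h3 + 4 * h4 - 4 * h5 - h6 - 4 * h7 + h8 - 5 * h9 +
    mn (-1) (-22) (-3) (-16) (-8) (-8) * key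

lemma crank_system_5 (H : TateParam v1 v2 v3 v4 v5 l m x y p s) :
    cs 5 - mn 0 12 1 9 5 4 * cs 1 - mn 0 16 2 12 6 5 * cs 7 + (mn 0 (-7) (-1) (-5) (-3) (-2) * cs 0)
    - mn 0 (-24) (-2) (-18) (-9) (-8) * cs 2 = 11 * mn (-1) 3 1 3 2 1 := by
  have h0 := mon_red H (-1) (-8) (-1) (-5) (-3) (-2) 0 0 1 0 1
  have h1 := mon_prod H 0 12 1 9 5 4 (-1) (-9) 0 (-6) (-3) (-3) 1 1 1 1 0
  have h2 := mon_prod H 0 16 2 12 6 5 (-1) (-13) (-1) (-9) (-4) (-4) 1 1 1 1 0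
  have h3 := mon_prod H 0 (-7) (-1) (-5) (-3) (-2) (-1) (-1) 0 0 0 0 0 0 1 0 1
  have h4 := mon_prod H 0 (-24) (-2) (-18) (-9) (-8) (-1) (-6) 0 (-4) (-2) (-2) (-2) 1 0 0 1
  have h5 := mon_red H (-1) 3 1 3 2 1 1 1 1 1 0
  norm_num at h0 h1 h2 h3 h4 h5
  have key : (-1) * (y * s) * 2 + (x * y * p) * (-4) - (x * y * p) * 4 + (y * s) * (-1) - (x * s) *
    3 + (x * y * p) * 11 = 0 := by
    simp only [H.hp, H.hs]
    linear_combination (-3) * H.hF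
  simp only [crankSol]
  linear_combination (-2) * h0 + 4 * h1 + 4 * h2 - h3 - 3 * h4 - 11 * h5 + mn (-1) (-8) (-1) (-6)
    (-3) (-3) * key

lemma crank_system_6 (H : TateParam v1 v2 v3 v4 v5 l m x y p s) :
    cs 6 + (mn 0 3 0 2 1 1 * cs 5) - mn 0 12 1 9 5 4 * cs 2 - mn 0 16 2 12 6 5 * cs 8 + (mn 0 (-7)
    (-1) (-5) (-3) (-2) * cs 1) - mn 0 (-24) (-2) (-18) (-9) (-8) * cs 3 = 0 := by
  have h0 := mon_red H (-1) (-16) (-1) (-11) (-6) (-5) 0 1 1 0 2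
  have h1 := mon_prod H 0 3 0 2 1 1 (-1) (-8) (-1) (-5) (-3) (-2) 1 0 1 0 2
  have h2 := mon_prod H 0 12 1 9 5 4 (-1) (-6) 0 (-4) (-2) (-2) 2 1 1 1 1
  have h3 := mon_prod H 0 16 2 12 6 5 (-1) 12 2 10 5 4 4 2 2 1 0
  have h4 := mon_prod H 0 (-7) (-1) (-5) (-3) (-2) (-1) (-9) 0 (-6) (-3) (-3) 0 1 1 0 2
  have h5 := mon_prod H 0 (-24) (-2) (-18) (-9) (-8) (-1) (-25) (-2) (-18) (-9) (-8) (-3) 1 0 0 3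
  norm_num at h0 h1 h2 h3 h4 h5
  have key : (-1) * (x * y * s ^ 2) * (-3) + (y * s ^ 2) * 2 - (x * y * p * s) * 3 - (x ^ 2 * y ^ 2
    * p) * 1 + (x * y * s ^ 2) * (-4) + (x * s ^ 3) * 2 = 0 := by
    simp only [H.hp, H.hs]
    linear_combination (2 + 2 * y + x * y) * H.hF
  simp only [crankSol]
  linear_combination 3 * h0 - 2 * h1 - 3 * h2 - h3 - 4 * h4 - 2 * h5 + mn (-1) (-16) (-2) (-12) (-6)
    (-7) * key

lemma crank_system_7 (H : TateParam v1 v2 v3 v4 v5 l m x y p s) :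
    cs 7 + (mn 0 3 0 2 1 1 * cs 6) - mn 0 12 1 9 5 4 * cs 3 - mn 0 16 2 12 6 5 * cs 9 + (mn 0 (-7)
    (-1) (-5) (-3) (-2) * cs 2) = 0 := by
  have h0 := mon_red H (-1) (-13) (-1) (-9) (-4) (-4) 0 0 0 1 0
  have h1 := mon_prod H 0 3 0 2 1 1 (-1) (-16) (-1) (-11) (-6) (-5) 0 0 0 0 0
  have h2 := mon_prod H 0 12 1 9 5 4 (-1) (-25) (-2) (-18) (-9) (-8) 0 0 0 1 0
  have h3 := mon_prod H 0 16 2 12 6 5 (-1) (-40) (-3) (-29) (-15) (-13) (-1) 1 0 0 0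
  have h4 := mon_prod H 0 (-7) (-1) (-5) (-3) (-2) (-1) (-6) 0 (-4) (-2) (-2) 0 0 0 0 0
  norm_num at h0 h1 h2 h3 h4
  have key : (-1) * (p) * 4 - 1 * (-3) - (p) * 2 - (x) * 6 + 1 * 3 = 0 := by
    simp only [H.hp]
    linear_combination 0 * H.hF
  simp only [crankSol]
  linear_combination (-4) * h0 + 3 * h1 - 2 * h2 + 6 * h3 + 3 * h4 + mn (-1) (-13) (-1) (-9) (-5)
    (-4) * key

lemma crank_system_8 (H : TateParam v1 v2 v3 v4 v5 l m x y p s) :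
    cs 8 + (mn 0 3 0 2 1 1 * cs 7) - mn 0 16 2 12 6 5 * cs 10 + (mn 0 (-7) (-1) (-5) (-3) (-2) * cs
    3) - mn 0 (-24) (-2) (-18) (-9) (-8) * cs 5 = 0 := by
  have h0 := mon_red H (-1) 12 2 10 5 4 0 1 1 1 0
  have h1 := mon_prod H 0 3 0 2 1 1 (-1) (-13) (-1) (-9) (-4) (-4) (-2) 0 0 1 1
  have h2 := mon_prod H 0 16 2 12 6 5 (-1) (-4) 0 (-2) (-1) (-1) 0 1 1 1 0
  have h3 := mon_prod H 0 (-7) (-1) (-5) (-3) (-2) (-1) (-25) (-2) (-18) (-9) (-8) (-4) 0 0 0 2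
  have h4 := mon_prod H 0 (-24) (-2) (-18) (-9) (-8) (-1) (-8) (-1) (-5) (-3) (-2) (-4) 0 0 0 2
  norm_num at h0 h1 h2 h3 h4
  have key : (x * y * p) * 1 - (p * s) * 4 - (x * y * p) * 5 + (s ^ 2) * 2 + (s ^ 2) * 2 = 0 := by
    simp only [H.hp, H.hs]
    linear_combination 4 * H.hF
  simp only [crankSol]
  linear_combination 1 * h0 - 4 * h1 - 5 * h2 + 2 * h3 + 2 * h4 + mn (-1) 12 1 9 4 4 * key

lemma crank_system_9 (H : TateParam v1 v2 v3 v4 v5 l m x y p s) :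
    cs 9 + (mn 0 3 0 2 1 1 * cs 8) - mn 0 12 1 9 5 4 * cs 5 - mn 0 16 2 12 6 5 * cs 0 - mn 0 (-24)
    (-2) (-18) (-9) (-8) * cs 6 = (-11) * mn (-1) (-40) (-3) (-29) (-15) (-13) := by
  have h0 := mon_red H (-1) (-40) (-3) (-29) (-15) (-13) 0 1 0 0 2
  have h1 := mon_prod H 0 3 0 2 1 1 (-1) 12 2 10 5 4 5 1 1 1 0
  have h2 := mon_prod H 0 12 1 9 5 4 (-1) (-8) (-1) (-5) (-3) (-2) 4 0 1 1 1
  have h3 := mon_prod H 0 16 2 12 6 5 (-1) (-1) 0 0 0 0 5 1 1 1 0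
  have h4 := mon_prod H 0 (-24) (-2) (-18) (-9) (-8) (-1) (-16) (-1) (-11) (-6) (-5) 0 1 0 0 2
  have h5 := mon_red H (-1) (-40) (-3) (-29) (-15) (-13) 0 1 0 0 2
  norm_num at h0 h1 h2 h3 h4 h5
  have key : (-1) * (x * s ^ 2) * 6 - (x * y * p) * 1 + (y * p * s) * 2 + (x * y * p) * (-1) + (x *
    s ^ 2) * (-3) + (x * s ^ 2) * 11 = 0 := by
    simp only [H.hp, H.hs]
    linear_combination 2 * H.hF
  simp only [crankSol]
  linear_combination (-6) * h0 + h1 + 2 * h2 + h3 - 3 * h4 + 11 * h5 + mn (-1) (-40) (-4) (-29)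
    (-15) (-15) * key

lemma crank_system_10 (H : TateParam v1 v2 v3 v4 v5 l m x y p s) :
    cs 10 + (mn 0 3 0 2 1 1 * cs 9) - mn 0 12 1 9 5 4 * cs 6 - mn 0 16 2 12 6 5 * cs 1 + (mn 0 (-7)
    (-1) (-5) (-3) (-2) * cs 5) - mn 0 (-24) (-2) (-18) (-9) (-8) * cs 7 = 0 := by
  have h0 := mon_red H (-1) (-4) 0 (-2) (-1) (-1) 0 1 1 1 1
  have h1 := mon_prod H 0 3 0 2 1 1 (-1) (-40) (-3) (-29) (-15) (-13) (-3) 1 0 0 2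
  have h2 := mon_prod H 0 12 1 9 5 4 (-1) (-16) (-1) (-11) (-6) (-5) 0 1 1 1 1
  have h3 := mon_prod H 0 16 2 12 6 5 (-1) (-9) 0 (-6) (-3) (-3) 1 2 1 1 0
  have h4 := mon_prod H 0 (-7) (-1) (-5) (-3) (-2) (-1) (-8) (-1) (-5) (-3) (-2) (-1) 0 1 0 2
  have h5 := mon_prod H 0 (-24) (-2) (-18) (-9) (-8) (-1) (-13) (-1) (-9) (-4) (-4) (-3) 1 0 1 2
  norm_num at h0 h1 h2 h3 h4 h5
  have key : (x * y * p * s) * 5 + (x * s ^ 2) * 6 + (x * y * p * s) * (-3) + (x ^ 2 * y * p) * (-4)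
    + (y * s ^ 2) * 2 - (x * p * s ^ 2) * 4 = 0 := by
    simp only [H.hp, H.hs]
    linear_combination (2 + 2 * y + 4 * x) * H.hF
  simp only [crankSol]
  linear_combination 5 * h0 - 6 * h1 - 3 * h2 + 4 * h3 - 2 * h4 + 4 * h5 + mn (-1) (-4) (-1) (-3)
    (-2) (-2) * key

end tateSystem

section tateSystem
variable {v1 v2 v3 v4 v5 l m x y p s : ℝ}

local notation "mn" => mon l m x y p s

lemma rank_sum {D : ℝ} (H : TateParam v1 v2 v3 v4 v5 l m x y p s) (hD : D * (x ^ 2 - x * y - 4 * x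
    - 2 * y - 1) = 1) :
    (1 + v2 / v1 + v4 / v2 - v5 / v3 - v3 / v4 - v1 / v5) * ∑ t ∈ Finset.range 11, rankSol D l m x y p
      s t = -11 * (v2 * v4 / (v1 ^ 2 * v3)) + 11 * (v3 * v5 / (v1 * v2 * v4)) + 11 * (v4 / (v1 *
      v5)) - 11 * (1 / v4) + v2 ^ 3 / (v1 ^ 3 * v3) - 3 * (v3 ^ 2 / (v1 ^ 2 * v4)) + v2 * v4 ^ 2 /
      (v1 ^ 2 * v3 * v5) + 3 * (v2 * v5 / (v1 ^ 2 * v4)) - 4 * (v3 ^ 2 * v4 / (v1 * v2 ^ 2 * v5))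
      := by
  have e0 := rank_system_0 (D := D) H
  have e1 := rank_system_1 H hD
  have e2 := rank_system_2 (D := D) H
  have e3 := rank_system_3 H hD
  have e4 := rank_system_4 H hD
  have e5 := rank_system_5 H hD
  have e6 := rank_system_6 (D := D) H
  have e7 := rank_system_7 (D := D) H
  have e8 := rank_system_8 (D := D) H
  have e9 := rank_system_9 H hD
  have e10 := rank_system_10 (D := D) H
  have n1 := H.l0; have n2 := H.m0; have n3 := H.x0; have n4 := H.y0; have n5 := H.p0; have n6 := H.s0
  have c0 : mn 0 3 0 2 1 1 = v2 / v1 := by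
    simp only [H.e1, H.e2, mon]
    field_simp
  have c1 : mn 0 12 1 9 5 4 = -(v4 / v2) := by
    simp only [H.e2, H.e4, mon]
    field_simp
  have c2 : mn 0 16 2 12 6 5 = v5 / v3 := by
    simp only [H.e3, H.e5, mon]
    field_simp
  have c3 : mn 0 (-7) (-1) (-5) (-3) (-2) = -(v3 / v4) := by
    simp only [H.e3, H.e4, mon]
    field_simp
  have c4 : mn 0 (-24) (-2) (-18) (-9) (-8) = v1 / v5 := by
    simp only [H.e1, H.e5, mon]
    field_simp
  have c5 : mn (-1) 9 1 7 4 3 = -(v2 * v4 / (v1 ^ 2 * v3)) := by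
    simp only [H.e1, H.e2, H.e3, H.e4, mon]
    field_simp
  have c6 : mn (-1) 13 1 11 5 5 = -(v3 * v5 / (v1 * v2 * v4)) := by
    simp only [H.e1, H.e2, H.e3, H.e4, H.e5, mon]
    field_simp
  have c7 : mn (-1) (-10) (-1) (-7) (-3) (-3) = -(v4 / (v1 * v5)) := by
    simp only [H.e1, H.e4, H.e5, mon]
    field_simp
  have c8 : mn (-1) (-16) (-1) (-11) (-6) (-5) = -(1 / v4) := by
    simp only [H.e4, mon]
    field_simp
  have c9 : mn (-1) 0 0 0 0 0 = v2 ^ 3 / (v1 ^ 3 * v3) := by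
    simp only [H.e1, H.e2, H.e3, mon]
    field_simp
  have c10 : mn (-1) 0 (-1) 1 0 1 = -(v3 ^ 2 / (v1 ^ 2 * v4)) := by
    simp only [H.e1, H.e3, H.e4, mon]
    field_simp
  have c11 : mn (-1) 0 0 0 1 0 = v2 * v4 ^ 2 / (v1 ^ 2 * v3 * v5) := by
    simp only [H.e1, H.e2, H.e3, H.e4, H.e5, mon]
    field_simp
  have c12 : mn (-1) 11 1 9 4 4 = -(v2 * v5 / (v1 ^ 2 * v4)) := by
    simp only [H.e1, H.e2, H.e4, H.e5, mon]
    field_simp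
  have c13 : mn (-1) 0 (-1) 1 1 1 = -(v3 ^ 2 * v4 / (v1 * v2 ^ 2 * v5)) := by
    simp only [H.e1, H.e2, H.e3, H.e4, H.e5, mon]
    field_simp
  simp only [Finset.sum_range_succ, Finset.sum_range_zero]
  simp only [c0, c1, c2, c3, c4, c5, c6, c7, c8, c9, c10, c11, c12, c13] at e0 e1 e2 e3 e4 e5 e6 e7 e8 e9 e10
  linear_combination e0 + e1 + e2 + e3 + e4 + e5 + e6 + e7 + e8 + e9 + e10

lemma crank_sum (H : TateParam v1 v2 v3 v4 v5 l m x y p s) :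
    (1 + v2 / v1 + v4 / v2 - v5 / v3 - v3 / v4 - v1 / v5) * ∑ t ∈ Finset.range 11, crankSol l m x y p
      s t = 11 * (1 / v1) - 11 * (v4 / (v2 * v3)) + 11 * (v1 * v5 / (v2 * v3 * v4)) + 11 * (v1 /
      (v4 * v5)) - 11 * (v1 ^ 2 / (v4 * v5 ^ 2)) + 4 * (v2 ^ 3 / (v1 ^ 3 * v3)) - v3 ^ 2 / (v1 ^ 2
      * v4) + 4 * (v2 * v4 ^ 2 / (v1 ^ 2 * v3 * v5)) + v2 * v5 / (v1 ^ 2 * v4) - 5 * (v3 ^ 2 * v4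
      / (v1 * v2 ^ 2 * v5)) := by
  have e0 := crank_system_0 H
  have e1 := crank_system_1 H
  have e2 := crank_system_2 H
  have e3 := crank_system_3 H
  have e4 := crank_system_4 H
  have e5 := crank_system_5 H
  have e6 := crank_system_6 H
  have e7 := crank_system_7 H
  have e8 := crank_system_8 H
  have e9 := crank_system_9 H
  have e10 := crank_system_10 H
  have n1 := H.l0; have n2 := H.m0; have n3 := H.x0; have n4 := H.y0; have n5 := H.p0; have n6 := H.s0
  have c0 : mn 0 3 0 2 1 1 = v2 / v1 := by
    simp only [H.e1, H.e2, mon]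
    field_simp
  have c1 : mn 0 12 1 9 5 4 = -(v4 / v2) := by
    simp only [H.e2, H.e4, mon]
    field_simp
  have c2 : mn 0 16 2 12 6 5 = v5 / v3 := by
    simp only [H.e3, H.e5, mon]
    field_simp
  have c3 : mn 0 (-7) (-1) (-5) (-3) (-2) = -(v3 / v4) := by
    simp only [H.e3, H.e4, mon]
    field_simp
  have c4 : mn 0 (-24) (-2) (-18) (-9) (-8) = v1 / v5 := by
    simp only [H.e1, H.e5, mon]
    field_simp
  have c5 : mn (-1) (-1) 0 0 0 0 = 1 / v1 := by
    simp only [H.e1, mon]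
    field_simp
  have c6 : mn (-1) 3 1 3 2 1 = -(v4 / (v2 * v3)) := by
    simp only [H.e2, H.e3, H.e4, mon]
    field_simp
  have c7 : mn (-1) (-3) 1 (-1) (-1) (-1) = -(v1 * v5 / (v2 * v3 * v4)) := by
    simp only [H.e1, H.e2, H.e3, H.e4, H.e5, mon]
    field_simp
  have c8 : mn (-1) (-40) (-3) (-29) (-15) (-13) = -(v1 / (v4 * v5)) := by
    simp only [H.e1, H.e4, H.e5, mon]
    field_simp
  have c9 : mn (-1) (-64) (-5) (-47) (-24) (-21) = -(v1 ^ 2 / (v4 * v5 ^ 2)) := by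
    simp only [H.e1, H.e4, H.e5, mon]
    field_simp
  have c10 : mn (-1) 0 0 0 0 0 = v2 ^ 3 / (v1 ^ 3 * v3) := by
    simp only [H.e1, H.e2, H.e3, mon]
    field_simp
  have c11 : mn (-1) 0 (-1) 1 0 1 = -(v3 ^ 2 / (v1 ^ 2 * v4)) := by
    simp only [H.e1, H.e3, H.e4, mon]
    field_simp
  have c12 : mn (-1) 0 0 0 1 0 = v2 * v4 ^ 2 / (v1 ^ 2 * v3 * v5) := by
    simp only [H.e1, H.e2, H.e3, H.e4, H.e5, mon]
    field_simp
  have c13 : mn (-1) 11 1 9 4 4 = -(v2 * v5 / (v1 ^ 2 * v4)) := by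
    simp only [H.e1, H.e2, H.e4, H.e5, mon]
    field_simp
  have c14 : mn (-1) 0 (-1) 1 1 1 = -(v3 ^ 2 * v4 / (v1 * v2 ^ 2 * v5)) := by
    simp only [H.e1, H.e2, H.e3, H.e4, H.e5, mon]
    field_simp
  simp only [Finset.sum_range_succ, Finset.sum_range_zero]
  simp only [c0, c1, c2, c3, c4, c5, c6, c7, c8, c9, c10, c11, c12, c13, c14] at e0 e1 e2 e3 e4 e5 e6 e7 e8 e9 e10
  rw [show crankSol l m x y p s 4 = 0 by simp [crankSol]]
  linear_combination e0 + e1 + e2 + e3 + e4 + e5 + e6 + e7 + e8 + e9 + e10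

end tateSystem

section assembly
variable {q : ℝ}

/-- Appell–Lerch type sum over all nonzero integers. -/
noncomputable def LL (q : ℝ) (r : ℕ) (b : ℝ) : ℝ :=
  ∑' n : ℤ, (-1) ^ n * q ^ ((n : ℝ) * (r * n + 1) / 2 + b * n) / (1 - q ^ (11 * (n : ℝ)))

lemma LL_split (hq : 0 < q) (hq1 : q < 1) {r : ℕ} (hr : 0 < r) (a : ℤ) :
    (-1) ^ a * q ^ ((r : ℝ) / 2 * (a - 11 / 2) ^ 2) * LL q r (r * (11 / 2 - a) - 1 / 2) =
      US q r 0 a + ∑ c ∈ Finset.Icc (1 : ℤ) 5, (-1) ^ c * (US q r c a + US q r (-c) a) := by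
  have hr' : (0 : ℝ) < r := by exact_mod_cast hr
  set f : ℤ → ℝ := fun k => (-1) ^ k * q ^ ((r : ℝ) / 2 * (k + 11 / 2) ^ 2) /
    (1 - q ^ (11 * ((k : ℝ) + a))) with hf
  have hs : Summable f := by
    have hb := (((summable_quad hq hq1 (c := (r : ℝ) / 2) (by positivity) ((r : ℝ) / 2 * 11)
      ((r : ℝ) / 2 * (11 / 2) ^ 2)).mul_right (1 - q ^ ((11 : ℝ) / 2))⁻¹))
    refine hb.of_norm_bounded fun k => ?_
    rw [Real.norm_eq_abs, hf]
    have e : (r : ℝ) / 2 * k ^ 2 + (r : ℝ) / 2 * 11 * k + (r : ℝ) / 2 * (11 / 2) ^ 2 =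
      (r : ℝ) / 2 * (k + 11 / 2) ^ 2 := by ring
    rw [e]
    simp only [div_eq_mul_inv]
    rw [abs_mul, abs_mul, abs_zpow, abs_neg, abs_one, one_zpow, one_mul,
      abs_of_pos (Real.rpow_pos_of_pos hq _)]
    refine mul_le_mul_of_nonneg_left ?_ (Real.rpow_pos_of_pos hq _).le
    by_cases hk : k + a = 0
    · have : (k : ℝ) + a = 0 := by exact_mod_cast hk
      rw [this, mul_zero, Real.rpow_zero, sub_self, inv_zero, abs_zero]
      have h0 : q ^ ((11 : ℝ) / 2) < 1 := Real.rpow_lt_one hq.le hq1 (by norm_num)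
      exact inv_nonneg.mpr (by linarith)
    · refine inv_one_sub_rpow_le hq hq1 ?_
      have := half_le_abs hk (e := 0) (by norm_num)
      push_cast at this
      simpa using this
  have h1 : (-1) ^ a * q ^ ((r : ℝ) / 2 * (a - 11 / 2) ^ 2) * LL q r (r * (11 / 2 - a) - 1 / 2) =
      ∑' k, f k := by
    rw [← (Equiv.subRight a).tsum_eq f, LL, ← tsum_mul_left]
    refine tsum_congr fun n => ?_
    simp only [hf, Equiv.subRight_apply]
    have e1 : (r : ℝ) / 2 * (((n - a : ℤ) : ℝ) + 11 / 2) ^ 2 = (r : ℝ) / 2 * (a - 11 / 2) ^ 2 +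
        ((n : ℝ) * (r * n + 1) / 2 + (r * (11 / 2 - a) - 1 / 2) * n) := by push_cast; ring
    have e2 : 11 * (((n - a : ℤ) : ℝ) + a) = 11 * (n : ℝ) := by push_cast; ring
    have e3 : (-1 : ℝ) ^ (n - a) = (-1) ^ a * (-1) ^ n := by
      rw [zpow_sub₀ (by norm_num), div_eq_mul_inv, ← inv_zpow]
      norm_num [mul_comm]
    rw [e1, e2, e3, Real.rpow_add hq ((r : ℝ) / 2 * (a - 11 / 2) ^ 2)]
    ring
  have h11 : ∀ m : ℤ, (-1 : ℝ) ^ (11 * m) = (-1) ^ m := fun m => by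
    rw [zpow_mul]; norm_num
  have h2 : ∀ c : ℤ, ∑' m : ℤ, f (11 * m + c) = (-1) ^ c * US q r c a := fun c => by
    rw [US, ← tsum_mul_left]
    refine tsum_congr fun m => ?_
    simp only [hf, usTerm]
    rw [zpow_add₀ (by norm_num), h11]
    push_cast
    ring
  have h3 : ∀ c : ℤ, ∑' m : ℤ, f (11 * m - c) = (-1) ^ c * US q r (-c) a := fun c => by
    have := h2 (-c)
    rw [zpow_neg, ← inv_zpow] at this
    push_cast at this
    norm_num at this
    exact this
  rw [h1, tsum_mod_eleven hs]
  congr 1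
  · simpa using h2 0
  · refine Finset.sum_congr rfl fun c _ => ?_
    rw [h2, h3, mul_add]

lemma sum_half_reindex {f : ℤ → ℝ} (h1 : ∀ k l, 11 ∣ k + l → f k = f l)
    (h2 : ∀ k l, 11 ∣ k - l → f k = f l) {a : ℤ} (ha : a ∈ Finset.Icc (1 : ℤ) 5) :
    ∑ c ∈ Finset.Icc (1 : ℤ) 5, f c = f a + f (2 * a) + f (3 * a) + f (4 * a) + f (5 * a) := by
  have hs : Finset.Icc (1 : ℤ) 5 = {1, 2, 3, 4, 5} := rfl
  rw [hs, Finset.sum_insert (by decide), Finset.sum_insert (by decide),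
    Finset.sum_insert (by decide), Finset.sum_insert (by decide), Finset.sum_singleton]
  have : a = 1 ∨ a = 2 ∨ a = 3 ∨ a = 4 ∨ a = 5 := by
    rw [Finset.mem_Icc] at ha; omega
  rcases this with rfl | rfl | rfl | rfl | rfl
  · norm_num; ring
  · norm_num
    rw [h1 6 5 (by norm_num), h1 8 3 (by norm_num), h1 10 1 (by norm_num)]; ring
  · norm_num
    rw [h1 6 5 (by norm_num), h1 9 2 (by norm_num), h2 12 1 (by norm_num),
      h2 15 4 (by norm_num)]; ring
  · norm_num
    rw [h1 8 3 (by norm_num), h2 12 1 (by norm_num), h2 16 5 (by norm_num),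
      h1 20 2 (by norm_num)]; ring
  · norm_num
    rw [h1 10 1 (by norm_num), h2 15 4 (by norm_num), h1 20 2 (by norm_num),
      h2 25 3 (by norm_num)]; ring

lemma psi_eq_of_dvd {k l : ℤ} (h : 11 ∣ k - l) : psi q k = psi q l := by
  rw [psi_eq_neg (l := -l) (by rwa [← sub_eq_add_neg]), psi_neg, neg_neg]

end assembly

section assembly
variable {q : ℝ}

lemma not_dvd_mul_eleven {a : ℤ} (ha : a ∈ Finset.Icc (1 : ℤ) 5) {n : ℤ} (hn : n ∈ Finset.Icc (1 : ℤ) 6) :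
    ¬ 11 ∣ n * a := by
  rw [Finset.mem_Icc] at ha hn
  obtain ⟨h1, h2⟩ := ha
  obtain ⟨h3, h4⟩ := hn
  interval_cases a <;> interval_cases n <;> norm_num

/-- The five relations between logarithmic derivatives attached to a residue `a`. -/
lemma thm_relations (hq : 0 < q) (hq1 : q < 1) {a : ℤ} (ha : a ∈ Finset.Icc (1 : ℤ) 5)
    {v1 v2 v3 v4 v5 : ℝ} (hv1 : psi q a = v1) (hv2 : psi q (2 * a) = v2)
    (hv3 : psi q (3 * a) = v3) (hv4 : psi q (4 * a) = v4) (hv5 : psi q (5 * a) = v5) :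
    3 * thm q a - thm q (3 * a) = v2 ^ 3 / (v1 ^ 3 * v3) ∧
    2 * thm q a + thm q (2 * a) - thm q (4 * a) = v3 ^ 2 / (v1 ^ 2 * v4) ∧
    2 * thm q a + thm q (3 * a) - thm q (5 * a) = v2 * v4 ^ 2 / (v1 ^ 2 * v3 * v5) ∧
    2 * thm q a + thm q (4 * a) + thm q (5 * a) = -(v2 * v5 / (v1 ^ 2 * v4)) ∧
    thm q a + 2 * thm q (2 * a) - thm q (5 * a) = v3 ^ 2 * v4 / (v1 * v2 ^ 2 * v5) := by
  have nd : ∀ n ∈ Finset.Icc (1 : ℤ) 6, ¬ 11 ∣ n * a := fun n hn => not_dvd_mul_eleven ha hn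
  have n1 : ¬ 11 ∣ a := by simpa using nd 1 (by decide)
  have z5 : v5 ≠ 0 := hv5 ▸ psi_ne_zero hq hq1 (nd 5 (by decide))
  have h6 : psi q (6 * a) = -v5 := by
    rw [psi_eq_neg (l := 5 * a) ⟨a, by ring⟩, hv5]
  have t6 : thm q ((6 * a : ℤ) : ℝ) = -thm q ((5 * a : ℤ) : ℝ) := thm_eq_neg ⟨a, by ring⟩
  have r1 := thm_psi hq hq1 (d := 3 * a) (by ring) n1 n1 n1 (nd 3 (by decide))
  have r2 := thm_psi hq hq1 (d := 4 * a) (by ring) n1 n1 (nd 2 (by decide)) (nd 4 (by decide))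
  have r3 := thm_psi hq hq1 (d := 5 * a) (by ring) n1 n1 (nd 3 (by decide)) (nd 5 (by decide))
  have r4 := thm_psi hq hq1 (d := 6 * a) (by ring) n1 n1 (nd 4 (by decide)) (nd 6 (by decide))
  have r5 := thm_psi hq hq1 (d := 5 * a) (by ring) n1 (nd 2 (by decide)) (nd 2 (by decide))
    (nd 5 (by decide))
  rw [t6] at r4
  have e2 : a + a = 2 * a := by ring
  have e3 : a + 2 * a = 3 * a := by ring
  have e3' : 2 * a + a = 3 * a := by ring
  have e4 : a + 3 * a = 4 * a := by ring
  have e4' : 3 * a + a = 4 * a := by ring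
  have e5 : a + 4 * a = 5 * a := by ring
  have e5' : 4 * a + a = 5 * a := by ring
  have e6 : 2 * a + 2 * a = 4 * a := by ring
  simp only [e2, e3, e3', e4, e4', e5, e5', e6, hv1, hv2, hv3, hv4, hv5, h6] at r1 r2 r3 r4 r5
  push_cast at r1 r2 r3 r4 r5
  have z1 : v1 ≠ 0 := hv1 ▸ psi_ne_zero hq hq1 n1
  have z2 : v2 ≠ 0 := hv2 ▸ psi_ne_zero hq hq1 (nd 2 (by decide))
  have z3 : v3 ≠ 0 := hv3 ▸ psi_ne_zero hq hq1 (nd 3 (by decide))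
  have z4 : v4 ≠ 0 := hv4 ▸ psi_ne_zero hq hq1 (nd 4 (by decide))
  refine ⟨?_, ?_, ?_, ?_, ?_⟩
  · refine Eq.trans (by ring) (r1.trans ?_); field_simp
  · refine Eq.trans (by ring) (r2.trans ?_); field_simp
  · refine Eq.trans (by ring) (r3.trans ?_); field_simp
  · refine Eq.trans (by ring) (r4.trans ?_); field_simp
  · refine Eq.trans (by ring) (r5.trans ?_); field_simp

lemma pent_factor (hq : 0 < q) (hq1 : q < 1) {a : ℤ} (ha : a ∈ Finset.Icc (1 : ℤ) 5)
    {v1 v2 v3 v4 v5 : ℝ} (hv1 : psi q a = v1) (hv2 : psi q (2 * a) = v2)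
    (hv3 : psi q (3 * a) = v3) (hv4 : psi q (4 * a) = v4) (hv5 : psi q (5 * a) = v5) :
    1 + ∑ c ∈ Finset.Icc (1 : ℤ) 5, (-1) ^ c * (th q (2 * c) / th q c) =
      1 + v2 / v1 + v4 / v2 - v5 / v3 - v3 / v4 - v1 / v5 := by
  have h : ∀ c : ℤ, (-1) ^ c * (th q (2 * c) / th q c) = psi q (2 * c) / psi q c := fun c => by
    rw [psi, psi, zpow_mul]
    rcases Int.even_or_odd c with h | h <;> simp [h.neg_one_zpow, div_neg]
  simp only [h]
  rw [sum_half_reindex (f := fun c => psi q (2 * c) / psi q c) _ _ ha]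
  · have e4 : 2 * (2 * a) = 4 * a := by ring
    rw [psi_eq_neg (k := 2 * (3 * a)) (l := 5 * a) ⟨a, by ring⟩,
      psi_eq_neg (k := 2 * (4 * a)) (l := 3 * a) ⟨a, by ring⟩,
      psi_eq_neg (k := 2 * (5 * a)) (l := a) ⟨a, by ring⟩, e4, hv1, hv2, hv3, hv4, hv5]
    ring
  · intro k l hkl
    rw [psi_eq_neg hkl, psi_eq_neg (k := 2 * k) (l := 2 * l) (by rw [← mul_add]; exact hkl.mul_left 2),
      neg_div_neg_eq]
  · intro k l hkl
    rw [psi_eq_of_dvd hkl, psi_eq_of_dvd (k := 2 * k) (l := 2 * l)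
      (by rw [← mul_sub]; exact hkl.mul_left 2)]

lemma rank_theta_sum {a : ℤ} (ha : a ∈ Finset.Icc (1 : ℤ) 5)
    {v1 v2 v3 v4 v5 : ℝ} (hv1 : psi q a = v1) (hv2 : psi q (2 * a) = v2)
    (hv3 : psi q (3 * a) = v3) (hv4 : psi q (4 * a) = v4) (hv5 : psi q (5 * a) = v5)
    (z1 : v1 ≠ 0) (z2 : v2 ≠ 0) (z3 : v3 ≠ 0) (z4 : v4 ≠ 0) (z5 : v5 ≠ 0) :
    ∑ c ∈ Finset.Icc (1 : ℤ) 5, psi q c * psi q (2 * c) / (psi q a * psi q (a + c) * psi q (a - c)) =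
      -(v2 * v4 / (v1 ^ 2 * v3)) + v3 * v5 / (v1 * v2 * v4) + v4 / (v1 * v5) - 1 / v4 := by
  have h0 : psi q 0 = 0 := by simp [psi, th_zero]
  rw [sum_half_reindex (f := fun c => psi q c * psi q (2 * c) / (psi q a * psi q (a + c) * psi q (a - c)))
    _ _ ha]
  · have e : 2 * (2 * a) = 4 * a := by ring
    have e1 : a + 2 * a = 3 * a := by ring
    have e2 : a - 2 * a = -a := by ring
    have e3 : a + 3 * a = 4 * a := by ring
    have e4 : a - 3 * a = -(2 * a) := by ring
    have e5 : a + 4 * a = 5 * a := by ring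
    have e6 : a - 4 * a = -(3 * a) := by ring
    have e8 : a - 5 * a = -(4 * a) := by ring
    rw [psi_eq_neg (k := 2 * (3 * a)) (l := 5 * a) ⟨a, by ring⟩,
      psi_eq_neg (k := 2 * (4 * a)) (l := 3 * a) ⟨a, by ring⟩,
      psi_eq_neg (k := 2 * (5 * a)) (l := a) ⟨a, by ring⟩,
      psi_eq_neg (k := a + 5 * a) (l := 5 * a) ⟨a, by ring⟩,
      sub_self, h0, e, e1, e2, e3, e4, e5, e6, e8]
    simp only [psi_neg, hv1, hv2, hv3, hv4, hv5]
    field_simp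
    ring
  · intro k l hkl
    rw [psi_eq_neg hkl, psi_eq_neg (k := 2 * k) (l := 2 * l) (by rw [← mul_add]; exact hkl.mul_left 2),
      psi_eq_of_dvd (k := a + k) (l := a - l) (by simpa using hkl),
      psi_eq_of_dvd (k := a - k) (l := a + l) (by
        rw [show a - k - (a + l) = -(k + l) by ring]; exact (dvd_neg).mpr hkl)]
    ring
  · intro k l hkl
    rw [psi_eq_of_dvd hkl, psi_eq_of_dvd (k := 2 * k) (l := 2 * l)
      (by rw [← mul_sub]; exact hkl.mul_left 2),
      psi_eq_of_dvd (k := a + k) (l := a + l) (by simpa using hkl),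
      psi_eq_of_dvd (k := a - k) (l := a - l) (by
        rw [show a - k - (a - l) = -(k - l) by ring]; exact (dvd_neg).mpr hkl)]

lemma crank_theta_sum {a : ℤ} (ha : a ∈ Finset.Icc (1 : ℤ) 5)
    {v1 v2 v3 v4 v5 : ℝ} (hv1 : psi q a = v1) (hv2 : psi q (2 * a) = v2)
    (hv3 : psi q (3 * a) = v3) (hv4 : psi q (4 * a) = v4) (hv5 : psi q (5 * a) = v5)
    (z1 : v1 ≠ 0) (z2 : v2 ≠ 0) (z3 : v3 ≠ 0) (z4 : v4 ≠ 0) (z5 : v5 ≠ 0) :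
    ∑ c ∈ Finset.Icc (1 : ℤ) 5, psi q (2 * c) * psi q a / (psi q c * psi q (a + c) * psi q (a - c)) =
      -(v4 / (v2 * v3)) + v1 * v5 / (v2 * v3 * v4) + v1 / (v4 * v5) - v1 ^ 2 / (v4 * v5 ^ 2) := by
  have h0 : psi q 0 = 0 := by simp [psi, th_zero]
  rw [sum_half_reindex (f := fun c => psi q (2 * c) * psi q a / (psi q c * psi q (a + c) * psi q (a - c)))
    _ _ ha]
  · have e : 2 * (2 * a) = 4 * a := by ring
    have e1 : a + 2 * a = 3 * a := by ring
    have e2 : a - 2 * a = -a := by ring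
    have e3 : a + 3 * a = 4 * a := by ring
    have e4 : a - 3 * a = -(2 * a) := by ring
    have e5 : a + 4 * a = 5 * a := by ring
    have e6 : a - 4 * a = -(3 * a) := by ring
    have e8 : a - 5 * a = -(4 * a) := by ring
    rw [psi_eq_neg (k := 2 * (3 * a)) (l := 5 * a) ⟨a, by ring⟩,
      psi_eq_neg (k := 2 * (4 * a)) (l := 3 * a) ⟨a, by ring⟩,
      psi_eq_neg (k := 2 * (5 * a)) (l := a) ⟨a, by ring⟩,
      psi_eq_neg (k := a + 5 * a) (l := 5 * a) ⟨a, by ring⟩,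
      sub_self, h0, e, e1, e2, e3, e4, e5, e6, e8]
    simp only [psi_neg, hv1, hv2, hv3, hv4, hv5]
    field_simp
    ring
  · intro k l hkl
    rw [psi_eq_neg hkl, psi_eq_neg (k := 2 * k) (l := 2 * l) (by rw [← mul_add]; exact hkl.mul_left 2),
      psi_eq_of_dvd (k := a + k) (l := a - l) (by simpa using hkl),
      psi_eq_of_dvd (k := a - k) (l := a + l) (by
        rw [show a - k - (a + l) = -(k + l) by ring]; exact (dvd_neg).mpr hkl)]
    simp only [div_eq_mul_inv, mul_inv, inv_neg]
    ring
  · intro k l hkl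
    rw [psi_eq_of_dvd hkl, psi_eq_of_dvd (k := 2 * k) (l := 2 * l)
      (by rw [← mul_sub]; exact hkl.mul_left 2),
      psi_eq_of_dvd (k := a + k) (l := a + l) (by simpa using hkl),
      psi_eq_of_dvd (k := a - k) (l := a - l) (by
        rw [show a - k - (a - l) = -(k - l) by ring]; exact (dvd_neg).mpr hkl)]

end assembly

section assembly
variable {q : ℝ}

lemma neg_one_zpow_ne (c : ℤ) : (-1 : ℝ) ^ c ≠ 0 := zpow_ne_zero _ (by norm_num)

lemma neg_one_zpow_mul_self (c : ℤ) : (-1 : ℝ) ^ c * (-1) ^ c = 1 := by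
  rw [← mul_zpow]; norm_num

lemma neg_one_zpow_sub (a c : ℤ) : (-1 : ℝ) ^ (a - c) = (-1) ^ a * (-1) ^ c := by
  rw [zpow_sub₀ (by norm_num), div_eq_iff (neg_one_zpow_ne c), mul_assoc, neg_one_zpow_mul_self, mul_one]

/-- The Lambert series for the rank in terms of an Appell–Lerch sum in `q ^ 11` and theta quotients. -/
theorem rank_LL (hq : 0 < q) (hq1 : q < 1) {a : ℤ} (ha : a ∈ Finset.Icc (1 : ℤ) 5)
    {v1 v2 v3 v4 v5 l m x y p s D : ℝ} (hv1 : psi q a = v1) (hv2 : psi q (2 * a) = v2)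
    (hv3 : psi q (3 * a) = v3) (hv4 : psi q (4 * a) = v4) (hv5 : psi q (5 * a) = v5)
    (H : TateParam v1 v2 v3 v4 v5 l m x y p s)
    (hD : D * (x ^ 2 - x * y - 4 * x - 2 * y - 1) = 1) :
    LL q 3 (3 * (11 / 2 - a) - 1 / 2) = q ^ ((1 : ℝ) / 24) * qI q q *
      (US q 3 0 a / ((-1) ^ a * q ^ ((3 : ℝ) / 2 * (a - 11 / 2) ^ 2) * hh q) +
        hh q ^ 2 * (∑ t ∈ Finset.range 11, rankSol D l m x y p s t) / 11) + (1 - 3 * a / 11) := by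
  have hs := LL_split hq hq1 (r := 3) (by norm_num) a
  have nd : ∀ n ∈ Finset.Icc (1 : ℤ) 6, ¬ 11 ∣ n * a := fun n hn => not_dvd_mul_eleven ha hn
  have n1 : ¬ 11 ∣ a := by simpa using nd 1 (by decide)
  have h0 : psi q 0 = 0 := by simp [psi, th_zero]
  have hne : ∀ n : ℤ, ¬ 11 ∣ n → psi q n ≠ 0 := fun n => psi_ne_zero hq hq1
  have z1 : v1 ≠ 0 := hv1 ▸ hne _ n1
  have z2 : v2 ≠ 0 := hv2 ▸ hne _ (nd 2 (by decide))
  have z3 : v3 ≠ 0 := hv3 ▸ hne _ (nd 3 (by decide))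
  have z4 : v4 ≠ 0 := hv4 ▸ hne _ (nd 4 (by decide))
  have z5 : v5 ≠ 0 := hv5 ▸ hne _ (nd 5 (by decide))
  have hpent := pent_split hq hq1
  rw [pent_factor hq hq1 ha hv1 hv2 hv3 hv4 hv5] at hpent
  have hts := rank_theta_sum ha hv1 hv2 hv3 hv4 hv5 z1 z2 z3 z4 z5
  have hsum := rank_sum H hD
  obtain ⟨t1, t2, t3, t4, t5⟩ := thm_relations hq hq1 ha hv1 hv2 hv3 hv4 hv5
  set P : ℝ := (-1) ^ a * q ^ ((3 : ℝ) / 2 * (a - 11 / 2) ^ 2) with hP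
  have hP0 : P ≠ 0 := mul_ne_zero (neg_one_zpow_ne a) (Real.rpow_pos_of_pos hq _).ne'
  have key : ∀ c ∈ Finset.Icc (1 : ℤ) 5, (-1) ^ c * (US q 3 c a + US q 3 (-c) a) =
      (-1) ^ c * (th q (2 * c) / th q c) * US q 3 0 a +
      (P * (hh q ^ 3 * (psi q c * psi q (2 * c) / (psi q a * psi q (a + c) * psi q (a - c)))) +
      if c = a then P * (1 - 3 * a / 11 - hh q ^ 3 * (thm q a + thm q (2 * a))) else 0) := by
    intro c hc
    by_cases hca : c = a
    · subst hca
      rw [US_three_diag hq hq1 n1, if_pos rfl, sub_self, h0, hP]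
      simp only [mul_zero, div_zero]
      ring
    · rw [if_neg hca]
      have nc : ¬ 11 ∣ c := by rw [Finset.mem_Icc] at hc; omega
      have n2c : ¬ 11 ∣ 2 * c := by rw [Finset.mem_Icc] at hc; omega
      have nac : ¬ 11 ∣ a + c := by rw [Finset.mem_Icc] at hc ha; omega
      have nac' : ¬ 11 ∣ a - c := by rw [Finset.mem_Icc] at hc ha; omega
      rw [US_three hq hq1 (int_not_mul_eleven n1) (by exact_mod_cast int_not_mul_eleven nac)
        (by exact_mod_cast int_not_mul_eleven nac') (int_not_mul_eleven nc)
        (by exact_mod_cast int_not_mul_eleven n2c)]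
      have e1 : th q (2 * (c : ℝ)) = psi q (2 * c) := by
        have := th_eq_psi (q := q) (2 * c)
        rw [zpow_mul] at this
        push_cast at this
        simpa using this
      have e2 := th_eq_psi (q := q) c
      have e3 := th_eq_psi (q := q) a
      have e4 := th_eq_psi (q := q) (a + c)
      have e5 := th_eq_psi (q := q) (a - c)
      push_cast at e4 e5
      rw [e1, e2, e3, e4, e5, hP, zpow_add₀ (by norm_num), neg_one_zpow_sub]
      have u1 := neg_one_zpow_mul_self c
      have u2 := neg_one_zpow_mul_self a
      have w1 : (-1 : ℝ) ^ c ≠ 0 := neg_one_zpow_ne c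
      have w2 : (-1 : ℝ) ^ a ≠ 0 := neg_one_zpow_ne a
      have f1 := hne _ n1
      have f2 := hne _ nc
      have f3 := hne _ nac
      have f4 := hne _ nac'
      generalize (-1 : ℝ) ^ c = A at *
      generalize (-1 : ℝ) ^ a = B at *
      have u3 : B ^ 2 = 1 := by rw [sq]; exact u2
      have u4 : A ^ 2 = 1 := by rw [sq]; exact u1
      have u5 : B ^ 4 = 1 := by rw [show B ^ 4 = (B ^ 2) ^ 2 by ring, u3, one_pow]
      generalize q ^ ((3 : ℝ) / 2 * ((a : ℝ) - 11 / 2) ^ 2) = Z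
      rw [add_zero]
      field_simp
      linear_combination (-(psi q (2 * c) * psi q c ^ 2 * hh q ^ 3 * Z)) * u5
  push_cast at hs
  rw [Finset.sum_congr rfl key, Finset.sum_add_distrib, Finset.sum_add_distrib, ← Finset.sum_mul,
    ← Finset.mul_sum, ← Finset.mul_sum, hts, Finset.sum_ite_eq' , if_pos ha] at hs
  have hpf := pent_factor hq hq1 ha hv1 hv2 hv3 hv4 hv5
  have hhne : hh q ≠ 0 := (hh_pos hq hq1).ne'
  have t0 : thm q a + thm q (2 * a) = -(v2 ^ 3 / (v1 ^ 3 * v3) - 3 * (v3 ^ 2 / (v1 ^ 2 * v4)) +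
      v2 * v4 ^ 2 / (v1 ^ 2 * v3 * v5) + 3 * (v2 * v5 / (v1 ^ 2 * v4)) -
      4 * (v3 ^ 2 * v4 / (v1 * v2 ^ 2 * v5))) / 11 := by
    linear_combination (-1 / 11) * t1 + (3 / 11) * t2 - (1 / 11) * t3 + (3 / 11) * t4 + (4 / 11) * t5
  rw [t0] at hs
  generalize (v2 ^ 3 / (v1 ^ 3 * v3)) = g1 at *
  generalize (v3 ^ 2 / (v1 ^ 2 * v4)) = g2 at *
  generalize (v2 * v4 ^ 2 / (v1 ^ 2 * v3 * v5)) = g3 at *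
  generalize (v2 * v5 / (v1 ^ 2 * v4)) = g4 at *
  generalize (v3 ^ 2 * v4 / (v1 * v2 ^ 2 * v5)) = g5 at *
  have hpf' := eq_sub_of_add_eq' hpf
  rw [hpf'] at hs
  generalize 1 + v2 / v1 + v4 / v2 - v5 / v3 - v3 / v4 - v1 / v5 = G at *
  have hE : q ^ ((1 : ℝ) / 24) * qI q q = hh q * G := hpent
  rw [hE]
  apply mul_left_cancel₀ hP0
  refine hs.trans ?_
  generalize ∑ t ∈ Finset.range 11, rankSol D l m x y p s t = R at *
  generalize US q 3 0 a = U at *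
  have : P * (hh q * G * (U / (P * hh q) + hh q ^ 2 * R / 11) + (1 - 3 * a / 11)) =
      G * U + P * (hh q ^ 3 * (G * R) / 11 + (1 - 3 * a / 11)) := by
    field_simp
    ring
  rw [this, hsum]
  ring

/-- The Lambert series for the crank in terms of theta quotients. -/
theorem crank_LL (hq : 0 < q) (hq1 : q < 1) {a : ℤ} (ha : a ∈ Finset.Icc (1 : ℤ) 5)
    {v1 v2 v3 v4 v5 l m x y p s : ℝ} (hv1 : psi q a = v1) (hv2 : psi q (2 * a) = v2)
    (hv3 : psi q (3 * a) = v3) (hv4 : psi q (4 * a) = v4) (hv5 : psi q (5 * a) = v5)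
    (H : TateParam v1 v2 v3 v4 v5 l m x y p s) :
    LL q 1 (11 / 2 - a - 1 / 2) = q ^ ((1 : ℝ) / 24) * qI q q *
      (hh q ^ 2 * (∑ t ∈ Finset.range 11, crankSol l m x y p s t) / 11) - a / 11 := by
  have hs := LL_split hq hq1 (r := 1) (by norm_num) a
  have nd : ∀ n ∈ Finset.Icc (1 : ℤ) 6, ¬ 11 ∣ n * a := fun n hn => not_dvd_mul_eleven ha hn
  have n1 : ¬ 11 ∣ a := by simpa using nd 1 (by decide)
  have h0 : psi q 0 = 0 := by simp [psi, th_zero]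
  have hne : ∀ n : ℤ, ¬ 11 ∣ n → psi q n ≠ 0 := fun n => psi_ne_zero hq hq1
  have z1 : v1 ≠ 0 := hv1 ▸ hne _ n1
  have z2 : v2 ≠ 0 := hv2 ▸ hne _ (nd 2 (by decide))
  have z3 : v3 ≠ 0 := hv3 ▸ hne _ (nd 3 (by decide))
  have z4 : v4 ≠ 0 := hv4 ▸ hne _ (nd 4 (by decide))
  have z5 : v5 ≠ 0 := hv5 ▸ hne _ (nd 5 (by decide))
  have hpent := pent_split hq hq1
  rw [pent_factor hq hq1 ha hv1 hv2 hv3 hv4 hv5] at hpent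
  have hts := crank_theta_sum ha hv1 hv2 hv3 hv4 hv5 z1 z2 z3 z4 z5
  have hsum := crank_sum H
  obtain ⟨t1, t2, t3, t4, t5⟩ := thm_relations hq hq1 ha hv1 hv2 hv3 hv4 hv5
  set P : ℝ := (-1) ^ a * q ^ ((a - 11 / 2 : ℝ) ^ 2 / 2) with hP
  have hP0 : P ≠ 0 := mul_ne_zero (neg_one_zpow_ne a) (Real.rpow_pos_of_pos hq _).ne'
  have key : ∀ c ∈ Finset.Icc (1 : ℤ) 5, (-1) ^ c * (US q 1 c a + US q 1 (-c) a) =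
      P * (hh q ^ 3 * (psi q (2 * c) * psi q a / (psi q c * psi q (a + c) * psi q (a - c)))) +
      if c = a then P * (-a / 11 + hh q ^ 3 * (thm q a - thm q (2 * a))) else 0 := by
    intro c hc
    by_cases hca : c = a
    · subst hca
      rw [US_two_diag hq hq1 n1, if_pos rfl, sub_self, h0, hP]
      simp only [mul_zero, div_zero]
      ring
    · rw [if_neg hca]
      have nc : ¬ 11 ∣ c := by rw [Finset.mem_Icc] at hc; omega
      have n2c : ¬ 11 ∣ 2 * c := by rw [Finset.mem_Icc] at hc; omega
      have nac : ¬ 11 ∣ a + c := by rw [Finset.mem_Icc] at hc ha; omega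
      have nac' : ¬ 11 ∣ a - c := by rw [Finset.mem_Icc] at hc ha; omega
      rw [US_two hq hq1 (by exact_mod_cast int_not_mul_eleven nac)
        (by exact_mod_cast int_not_mul_eleven nac') (int_not_mul_eleven nc)
        (by exact_mod_cast int_not_mul_eleven n2c)]
      have e1 : th q (2 * (c : ℝ)) = psi q (2 * c) := by
        have := th_eq_psi (q := q) (2 * c)
        rw [zpow_mul] at this
        push_cast at this
        simpa using this
      have e2 := th_eq_psi (q := q) c
      have e3 := th_eq_psi (q := q) a
      have e4 := th_eq_psi (q := q) (a + c)
      have e5 := th_eq_psi (q := q) (a - c)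
      push_cast at e4 e5
      rw [e1, e2, e3, e4, e5, hP, zpow_add₀ (by norm_num), neg_one_zpow_sub]
      have u1 := neg_one_zpow_mul_self c
      have u2 := neg_one_zpow_mul_self a
      have w1 : (-1 : ℝ) ^ c ≠ 0 := neg_one_zpow_ne c
      have w2 : (-1 : ℝ) ^ a ≠ 0 := neg_one_zpow_ne a
      have f1 := hne _ n1
      have f2 := hne _ nc
      have f3 := hne _ nac
      have f4 := hne _ nac'
      generalize (-1 : ℝ) ^ c = A at *
      generalize (-1 : ℝ) ^ a = B at *
      have u3 : B ^ 2 = 1 := by rw [sq]; exact u2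
      have u4 : A ^ 2 = 1 := by rw [sq]; exact u1
      have u5 : B ^ 4 = 1 := by rw [show B ^ 4 = (B ^ 2) ^ 2 by ring, u3, one_pow]
      generalize q ^ (((a : ℝ) - 11 / 2) ^ 2 / 2) = Z
      rw [add_zero]
      field_simp
      rw [u3, u4]; ring
  have h1 : US q 1 0 a = P * (hh q ^ 3 * (1 / v1)) := by
    have e := US_one hq hq1 (int_not_mul_eleven n1)
    rw [th_eq_psi, hv1] at e
    have u2 := neg_one_zpow_mul_self a
    rw [← mul_assoc, mul_one_div, eq_div_iff z1, hP]
    linear_combination (-1) ^ a * e - US q 1 0 a * v1 * u2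
  have hs' : P * LL q 1 (11 / 2 - a - 1 / 2) =
      US q 1 0 a + ∑ c ∈ Finset.Icc (1 : ℤ) 5, (-1) ^ c * (US q 1 c a + US q 1 (-c) a) := by
    rw [← hs, hP]
    push_cast
    ring_nf
  rw [Finset.sum_congr rfl key, Finset.sum_add_distrib,
    ← Finset.mul_sum, ← Finset.mul_sum, hts, Finset.sum_ite_eq' , if_pos ha, h1] at hs'
  have t0 : thm q a - thm q (2 * a) = (4 * (v2 ^ 3 / (v1 ^ 3 * v3)) - v3 ^ 2 / (v1 ^ 2 * v4) +
      4 * (v2 * v4 ^ 2 / (v1 ^ 2 * v3 * v5)) + v2 * v5 / (v1 ^ 2 * v4) -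
      5 * (v3 ^ 2 * v4 / (v1 * v2 ^ 2 * v5))) / 11 := by
    linear_combination (4 / 11) * t1 - (1 / 11) * t2 + (4 / 11) * t3 - (1 / 11) * t4 - (5 / 11) * t5
  rw [t0] at hs'
  apply mul_left_cancel₀ hP0
  rw [hs', hpent]
  linear_combination (-P * hh q ^ 3 / 11) * hsum

end assembly

section partitionSums

/-- Partitions of arbitrary size, as multisets of positive integers. -/
abbrev PartMS : Type := {s : Multiset ℕ // 0 ∉ s}

/-- Partitions of arbitrary size are the disjoint union of the partitions of each size. -/
def partMSEquiv : (Σ n, Nat.Partition n) ≃ PartMS where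
  toFun π := ⟨π.2.parts, fun h => (π.2.parts_pos h).ne' rfl⟩
  invFun s := ⟨s.1.sum, ⟨s.1, fun {i} hi => Nat.pos_of_ne_zero fun h => s.2 (h ▸ hi), rfl⟩⟩
  left_inv := by
    rintro ⟨n, parts, hpos, rfl⟩
    rfl
  right_inv s := rfl

lemma card_partition_le (n : ℕ) : Fintype.card (Nat.Partition n) ≤ 2 ^ n := by
  refine (Fintype.card_le_of_surjective _ Nat.Partition.ofComposition_surj).trans ?_
  rw [composition_card]
  exact Nat.pow_le_pow_right (by norm_num) (Nat.sub_le _ _)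

variable {q : ℝ}

lemma summable_partMS (hq : 0 < q) (hq2 : q < 1 / 2) :
    Summable fun s : PartMS => q ^ s.1.sum := by
  have e : ∀ n, ∀ π : Nat.Partition n, q ^ (partMSEquiv ⟨n, π⟩).1.sum = q ^ n := fun n π => by
    show q ^ π.parts.sum = q ^ n
    rw [π.parts_sum]
  refine (partMSEquiv.summable_iff).mp ((summable_sigma_of_nonneg fun _ =>
    (pow_pos hq _).le).mpr ⟨fun n => (hasSum_fintype _).summable, ?_⟩)
  refine Summable.of_nonneg_of_le (fun n => tsum_nonneg fun _ => (pow_pos hq _).le) (fun n => ?_)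
    (summable_geometric_of_lt_one (r := 2 * q) (by positivity) (by linarith))
  simp only [e, tsum_fintype, Finset.sum_const, Finset.card_univ, nsmul_eq_mul]
  rw [mul_pow]
  have := card_partition_le n
  gcongr
  exact_mod_cast this

lemma summable_ite_partMS (hq : 0 < q) (hq2 : q < 1 / 2) (P : PartMS → Prop) [DecidablePred P] :
    Summable fun s : PartMS => if P s then q ^ s.1.sum else 0 :=
  (summable_partMS hq hq2).of_nonneg_of_le
    (fun s => by split_ifs; exacts [(pow_pos hq _).le, le_rfl])
    (fun s => by split_ifs; exacts [le_rfl, (pow_pos hq _).le])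

/-- The generating function of the partitions with a given property. -/
lemma hasSum_partition_count (hq : 0 < q) (hq2 : q < 1 / 2) (p : ∀ n, Nat.Partition n → Prop)
    [∀ n, DecidablePred (p n)] {P : PartMS → Prop} [DecidablePred P]
    (hP : ∀ n π, P (partMSEquiv ⟨n, π⟩) ↔ p n π) :
    HasSum (fun n => ((Finset.univ.filter (p n)).card : ℝ) * q ^ n)
      (∑' s : PartMS, if P s then q ^ s.1.sum else 0) := by
  have hs := summable_ite_partMS hq hq2 P
  have h := (partMSEquiv.hasSum_iff.mpr hs.hasSum).sigma
    (g := fun n => ((Finset.univ.filter (p n)).card : ℝ) * q ^ n) fun n => by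
      have := hasSum_fintype fun π : Nat.Partition n => if p n π then q ^ n else 0
      rw [← Finset.sum_filter, Finset.sum_const, nsmul_eq_mul] at this
      refine this.congr_eq (fun π => ?_) rfl
      show (if P (partMSEquiv ⟨n, π⟩) then q ^ π.parts.sum else 0) = _
      rw [π.parts_sum, if_congr (hP n π) rfl rfl]
  exact h

/-- The total weight `∑ q ^ |s|` of the partitions `s` satisfying `P`. -/
noncomputable def wt (q : ℝ) (P : PartMS → Prop) : ℝ :=
  ∑' s : {s : PartMS // P s}, q ^ s.1.1.sum

lemma summable_wt (hq : 0 < q) (hq2 : q < 1 / 2) (P : PartMS → Prop) :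
    Summable fun s : {s : PartMS // P s} => q ^ s.1.1.sum :=
  (summable_partMS hq hq2).comp_injective Subtype.val_injective

lemma wt_congr {P P' : PartMS → Prop} (h : ∀ s, P s ↔ P' s) : wt q P = wt q P' := by
  rw [show P = P' from funext fun s => propext (h s)]

lemma wt_eq_tsum (P : PartMS → Prop) [DecidablePred P] :
    wt q P = ∑' s : PartMS, if P s then q ^ s.1.sum else 0 := by
  have := tsum_subtype {s | P s} fun s : PartMS => q ^ s.1.sum
  refine Eq.trans this (tsum_congr fun s => ?_)
  simp [Set.indicator_apply]

lemma wt_nonneg (hq : 0 < q) (P : PartMS → Prop) : 0 ≤ wt q P :=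
  tsum_nonneg fun _ => (pow_pos hq _).le

lemma wt_add_not (hq : 0 < q) (hq2 : q < 1 / 2) (P : PartMS → Prop) :
    wt q P + wt q (fun s => ¬ P s) = wt q fun _ => True := by
  classical
  rw [wt_eq_tsum, wt_eq_tsum, wt_eq_tsum, 
    ← (summable_ite_partMS hq hq2 _).tsum_add (summable_ite_partMS hq hq2 _)]
  refine tsum_congr fun s => ?_
  by_cases hs : P s <;> simp [hs]

lemma wt_mono (hq : 0 < q) (hq2 : q < 1 / 2) (P P' : PartMS → Prop) (h : ∀ s, P s → P' s) :
    wt q P ≤ wt q P' := 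
  (summable_wt hq hq2 P).tsum_le_tsum_of_inj (fun s => ⟨s.1, h _ s.2⟩)
    (fun a b hab => Subtype.ext (Subtype.mk.inj hab)) (fun _ _ => (pow_pos hq _).le)
    (fun _ => le_rfl) (summable_wt hq hq2 P')

/-- Dyson's rank on multisets. -/
def msRank (s : Multiset ℕ) : ℤ := (s.sup : ℤ) - Multiset.card s

section Dyson

/-- Dyson's map: remove the first column of the Young diagram and put it, with `c` extra
cells, as a new first row. -/
def dysonFun (c : ℤ) (s : Multiset ℕ) : Multiset ℕ :=
  ((Multiset.card s + c).toNat ::ₘ s.map Nat.pred).filter (· ≠ 0)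

/-- The inverse of Dyson's map. -/
def dysonInv (c : ℤ) (μ : Multiset ℕ) : Multiset ℕ :=
  (μ.erase μ.sup).map Nat.succ +
    Multiset.replicate (μ.sup - c - Multiset.card (μ.erase μ.sup)).toNat 1

lemma sum_filter_ne_zero (s : Multiset ℕ) : (s.filter (· ≠ 0)).sum = s.sum := by
  induction s using Multiset.induction_on with
  | empty => rfl
  | cons a s ih =>
    by_cases h : a = 0
    · rw [Multiset.filter_cons_of_neg (p := fun x => x ≠ 0) _ (by simpa using h), Multiset.sum_cons, ih, h, zero_add]
    · rw [Multiset.filter_cons_of_pos (p := fun x => x ≠ 0) _ h, Multiset.sum_cons, Multiset.sum_cons, ih]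

lemma sup_filter_ne_zero (s : Multiset ℕ) : (s.filter (· ≠ 0)).sup = s.sup := by
  induction s using Multiset.induction_on with
  | empty => rfl
  | cons a s ih =>
    by_cases h : a = 0
    · rw [Multiset.filter_cons_of_neg (p := fun x => x ≠ 0) _ (by simpa using h), Multiset.sup_cons, ih, h]
      simp
    · rw [Multiset.filter_cons_of_pos (p := fun x => x ≠ 0) _ h, Multiset.sup_cons, Multiset.sup_cons, ih]

lemma sum_map_pred (s : Multiset ℕ) (h : 0 ∉ s) :
    (s.map Nat.pred).sum + Multiset.card s = s.sum := by
  induction s using Multiset.induction_on with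
  | empty => rfl
  | cons a s ih =>
    rw [Multiset.mem_cons, not_or] at h
    have := ih h.2
    simp only [Multiset.map_cons, Multiset.sum_cons, Multiset.card_cons, Nat.pred_eq_sub_one] at *
    omega

lemma sup_mem {s : Multiset ℕ} (h : s ≠ 0) : s.sup ∈ s := by
  induction s using Multiset.induction_on with
  | empty => exact absurd rfl h
  | cons a s ih =>
    rw [Multiset.sup_cons, Multiset.mem_cons]
    by_cases hs : s = 0
    · simp [hs]
    · rcases le_total a s.sup with h1 | h1
      · right; rw [sup_eq_right.mpr h1]; exact ih hs
      · left; exact sup_eq_left.mpr h1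

lemma sup_pos {s : Multiset ℕ} (h : s ≠ 0) (h0 : 0 ∉ s) : 0 < s.sup :=
  Nat.pos_of_ne_zero fun h' => h0 (h' ▸ sup_mem h)

lemma filter_map_pred_map_succ (s : Multiset ℕ) (h : 0 ∉ s) :
    ((s.map Nat.pred).filter (· ≠ 0)).map Nat.succ +
      Multiset.replicate (Multiset.card s - Multiset.card ((s.map Nat.pred).filter (· ≠ 0))) 1
      = s := by
  induction s using Multiset.induction_on with
  | empty => rfl
  | cons a s ih =>
    rw [Multiset.mem_cons, not_or] at h
    have := ih h.2
    have hc : Multiset.card ((s.map Nat.pred).filter (· ≠ 0)) ≤ Multiset.card s :=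
      (Multiset.card_le_card (Multiset.filter_le _ _)).trans (Multiset.card_map _ _).le
    obtain ⟨b, rfl⟩ : ∃ b, a = b + 1 := ⟨a - 1, by omega⟩
    rw [Multiset.map_cons, Nat.pred_succ, Multiset.card_cons]
    by_cases hb : b = 0
    · rw [Multiset.filter_cons_of_neg (p := fun x => x ≠ 0) _ (by simpa using hb), Nat.succ_sub hc,
        Multiset.replicate_succ, Multiset.add_cons, this, hb]
    · rw [Multiset.filter_cons_of_pos (p := fun x => x ≠ 0) _ hb, Multiset.card_cons, Nat.add_sub_add_right,
        Multiset.map_cons, Multiset.cons_add, this]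

lemma sup_dysonFun {c : ℤ} {s : Multiset ℕ} (h0 : 0 ∉ s) (h1 : msRank s ≤ c + 1)
    (h2 : 0 ≤ Multiset.card s + c) : ((dysonFun c s).sup : ℤ) = Multiset.card s + c := by
  rw [dysonFun, sup_filter_ne_zero, Multiset.sup_cons]
  have : (s.map Nat.pred).sup ≤ (Multiset.card s + c).toNat := by
    rw [Multiset.sup_le]
    intro b hb
    obtain ⟨a, ha, rfl⟩ := Multiset.mem_map.mp hb
    have h3 : a ≤ s.sup := Multiset.le_sup ha
    have : a ≠ 0 := fun h => h0 (h ▸ ha)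
    unfold msRank at h1
    rw [Nat.pred_eq_sub_one]
    omega
  rw [sup_eq_left.mpr this]
  omega

lemma sum_dysonFun {c : ℤ} {s : Multiset ℕ} (h0 : 0 ∉ s) (h2 : 0 ≤ Multiset.card s + c) :
    ((dysonFun c s).sum : ℤ) = s.sum + c := by
  rw [dysonFun, sum_filter_ne_zero, Multiset.sum_cons]
  have := sum_map_pred s h0
  omega

lemma le_rank_dysonFun {c : ℤ} {s : Multiset ℕ} (h0 : 0 ∉ s) (h1 : msRank s ≤ c + 1)
    (h2 : 0 ≤ Multiset.card s + c) : c - 1 ≤ msRank (dysonFun c s) := by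
  have h3 : Multiset.card (dysonFun c s) ≤ Multiset.card s + 1 :=
    (Multiset.card_le_card (Multiset.filter_le _ _)).trans (by simp)
  rw [msRank, sup_dysonFun h0 h1 h2]
  omega

lemma erase_dysonFun {c : ℤ} {s : Multiset ℕ} (h0 : 0 ∉ s) (h1 : msRank s ≤ c + 1)
    (h2 : 0 ≤ Multiset.card s + c) :
    (dysonFun c s).erase (dysonFun c s).sup = (s.map Nat.pred).filter (· ≠ 0) := by
  have h := sup_dysonFun h0 h1 h2
  rw [show (dysonFun c s).sup = (Multiset.card s + c).toNat by omega, dysonFun]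
  by_cases hz : (Multiset.card s + c).toNat = 0
  · rw [Multiset.filter_cons_of_neg (p := fun x => x ≠ 0) _ (by simpa using hz), hz, Multiset.erase_of_notMem]
    simp
  · rw [Multiset.filter_cons_of_pos (p := fun x => x ≠ 0) _ hz, Multiset.erase_cons_head]

lemma dysonInv_dysonFun {c : ℤ} {s : Multiset ℕ} (h0 : 0 ∉ s) (h1 : msRank s ≤ c + 1)
    (h2 : 0 ≤ Multiset.card s + c) : dysonInv c (dysonFun c s) = s := by
  rw [dysonInv, erase_dysonFun h0 h1 h2, sup_dysonFun h0 h1 h2]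
  conv_rhs => rw [← filter_map_pred_map_succ s h0]
  congr 2
  omega

lemma card_erase_sup {c : ℤ} {μ : Multiset ℕ} (h0 : 0 ∉ μ) (h1 : c - 1 ≤ msRank μ)
    (h2 : c ≤ μ.sup) : (Multiset.card (μ.erase μ.sup) : ℤ) ≤ μ.sup - c := by
  by_cases h : μ = 0
  · subst h; simp at h2 ⊢; exact h2
  · have := Multiset.card_erase_add_one (sup_mem h)
    unfold msRank at h1
    omega

lemma dysonFun_dysonInv {c : ℤ} {μ : Multiset ℕ} (h0 : 0 ∉ μ) (h1 : c - 1 ≤ msRank μ)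
    (h2 : c ≤ μ.sup) : dysonFun c (dysonInv c μ) = μ := by
  have h3 := card_erase_sup h0 h1 h2
  have hc : (Multiset.card (dysonInv c μ) : ℤ) + c = μ.sup := by
    simp only [dysonInv, Multiset.card_add, Multiset.card_map, Multiset.card_replicate]
    push_cast
    omega
  have h4 : (μ.erase μ.sup).filter (· ≠ 0) = μ.erase μ.sup :=
    Multiset.filter_eq_self.mpr fun a ha h => h0 (h ▸ Multiset.mem_of_mem_erase ha)
  rw [dysonFun, hc, dysonInv, Multiset.map_add, Multiset.map_replicate, Multiset.map_map,
    Int.toNat_natCast]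
  have h5 : (μ.erase μ.sup).map (Nat.pred ∘ Nat.succ) = μ.erase μ.sup := by
    simp
  rw [h5]
  by_cases h : μ = 0
  · subst h; simp [Multiset.filter_eq_nil, Multiset.mem_replicate]
  · rw [Multiset.filter_cons_of_pos (p := fun x => x ≠ 0) _ (sup_pos h h0).ne', Multiset.filter_add, h4]
    rw [show (Multiset.replicate _ (Nat.pred 1)).filter (· ≠ 0) = 0 from
      Multiset.filter_eq_nil.mpr fun a ha => by simp [Multiset.eq_of_mem_replicate ha], add_zero,
      Multiset.cons_erase (sup_mem h)]

lemma zero_notMem_dysonInv (c : ℤ) (μ : Multiset ℕ) : 0 ∉ dysonInv c μ := by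
  simp [dysonInv, Multiset.mem_replicate]

lemma dysonInv_card {c : ℤ} {μ : Multiset ℕ} (h0 : 0 ∉ μ) (h1 : c - 1 ≤ msRank μ)
    (h2 : c ≤ μ.sup) : (Multiset.card (dysonInv c μ) : ℤ) + c = μ.sup := by
  have h3 := card_erase_sup h0 h1 h2
  simp only [dysonInv, Multiset.card_add, Multiset.card_map, Multiset.card_replicate]
  push_cast
  omega

lemma dysonInv_rank {c : ℤ} {μ : Multiset ℕ} (h0 : 0 ∉ μ) (h1 : c - 1 ≤ msRank μ)
    (h2 : c ≤ μ.sup) : msRank (dysonInv c μ) ≤ c + 1 := by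
  have h : (dysonInv c μ).sup ≤ μ.sup + 1 := by
    rw [Multiset.sup_le]
    intro b hb
    rcases Multiset.mem_add.mp hb with hb | hb
    · obtain ⟨a, ha, rfl⟩ := Multiset.mem_map.mp hb
      exact Nat.succ_le_succ (Multiset.le_sup (Multiset.mem_of_mem_erase ha))
    · rw [Multiset.eq_of_mem_replicate hb]; omega
  have := dysonInv_card h0 h1 h2
  unfold msRank
  omega

/-- Dyson's adjoint as a bijection. -/
def dysonEquiv (c : ℤ) :
    {s : PartMS // msRank s.1 ≤ c + 1 ∧ 0 ≤ Multiset.card s.1 + c} ≃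
      {s : PartMS // c - 1 ≤ msRank s.1 ∧ c ≤ s.1.sup} where
  toFun s := ⟨⟨dysonFun c s.1.1, by simp [dysonFun]⟩, le_rank_dysonFun s.1.2 s.2.1 s.2.2, by
    show c ≤ ((dysonFun c s.1.1).sup : ℤ)
    rw [sup_dysonFun s.1.2 s.2.1 s.2.2]; omega⟩
  invFun s := ⟨⟨dysonInv c s.1.1, zero_notMem_dysonInv c _⟩, dysonInv_rank s.1.2 s.2.1 s.2.2, by
    show 0 ≤ (Multiset.card (dysonInv c s.1.1) : ℤ) + c
    rw [dysonInv_card s.1.2 s.2.1 s.2.2]; omega⟩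
  left_inv s := Subtype.ext (Subtype.ext (dysonInv_dysonFun s.1.2 s.2.1 s.2.2))
  right_inv s := Subtype.ext (Subtype.ext (dysonFun_dysonInv s.1.2 s.2.1 s.2.2))

lemma wt_dyson (hq : 0 < q) (c : ℤ) :
    wt q (fun s => c - 1 ≤ msRank s.1 ∧ c ≤ s.1.sup) =
      q ^ c * wt q (fun s => msRank s.1 ≤ c + 1 ∧ 0 ≤ Multiset.card s.1 + c) := by
  rw [wt, wt, ← (dysonEquiv c).tsum_eq, ← tsum_mul_left]
  refine tsum_congr fun s => ?_
  have h := sum_dysonFun (c := c) s.1.2 s.2.2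
  show q ^ (dysonFun c s.1.1).sum = _
  rw [← zpow_natCast, h, add_comm, zpow_add₀ hq.ne', zpow_natCast]

end Dyson

end partitionSums

section rankSeries

variable {q : ℝ}

/-- The alternating series expressing rank (`r = 3`) and crank (`r = 1`) counts. -/
noncomputable def SS (q : ℝ) (r : ℕ) (m : ℝ) : ℝ :=
  ∑' n : ℕ, (-1) ^ n * q ^ (((n : ℝ) + 1) * m + ((n : ℝ) + 1) * (r * ((n : ℝ) + 1) - 1) / 2)

/-- The series `SS` summed along an arithmetic progression of difference `11`. -/
noncomputable def GG (q : ℝ) (r : ℕ) (m : ℝ) : ℝ :=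
  ∑' n : ℕ, (-1) ^ n * q ^ (((n : ℝ) + 1) * m + ((n : ℝ) + 1) * (r * ((n : ℝ) + 1) - 1) / 2) /
    (1 - q ^ (11 * ((n : ℝ) + 1)))

lemma SS_exponent_le {r : ℕ} (hr : 1 ≤ r) {m : ℝ} (hm : 0 ≤ m) (n : ℕ) :
    (n : ℝ) + m ≤ ((n : ℝ) + 1) * m + ((n : ℝ) + 1) * (r * ((n : ℝ) + 1) - 1) / 2 := by
  have h1 : (1 : ℝ) ≤ r := by exact_mod_cast hr
  have h2 : (n : ℝ) ≤ (n : ℝ) ^ 2 := by exact_mod_cast Nat.le_self_pow two_ne_zero n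
  have h0 : (0 : ℝ) ≤ n := n.cast_nonneg
  have h3 : ((n : ℝ) + 1) * (1 * ((n : ℝ) + 1) - 1) ≤ ((n : ℝ) + 1) * (r * ((n : ℝ) + 1) - 1) := by
    gcongr
  nlinarith [mul_nonneg h0 hm]

lemma SS_term_le (hq : 0 < q) (hq1 : q < 1) {r : ℕ} (hr : 1 ≤ r) {m : ℝ} (hm : 0 ≤ m) (n : ℕ) :
    ‖(-1) ^ n * q ^ (((n : ℝ) + 1) * m + ((n : ℝ) + 1) * (r * ((n : ℝ) + 1) - 1) / 2)‖ ≤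
      q ^ n * q ^ m := by
  rw [norm_mul, norm_pow, norm_neg, norm_one, one_pow, one_mul, Real.norm_eq_abs,
    abs_of_pos (Real.rpow_pos_of_pos hq _), ← Real.rpow_natCast, ← Real.rpow_add hq]
  exact Real.rpow_le_rpow_of_exponent_ge hq hq1.le (SS_exponent_le hr hm n)

lemma summable_SS (hq : 0 < q) (hq1 : q < 1) {r : ℕ} (hr : 1 ≤ r) {m : ℝ} (hm : 0 ≤ m) :
    Summable fun n : ℕ =>
      (-1) ^ n * q ^ (((n : ℝ) + 1) * m + ((n : ℝ) + 1) * (r * ((n : ℝ) + 1) - 1) / 2) :=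
  .of_norm_bounded ((summable_geometric_of_lt_one hq.le hq1).mul_right (q ^ m))
    (SS_term_le hq hq1 hr hm)

lemma abs_SS_le (hq : 0 < q) (hq1 : q < 1) {r : ℕ} (hr : 1 ≤ r) {m : ℝ} (hm : 0 ≤ m) :
    |SS q r m| ≤ (1 - q)⁻¹ := by
  have h := tsum_of_norm_bounded (((hasSum_geometric_of_lt_one hq.le hq1)).mul_right (q ^ m))
    (SS_term_le hq hq1 hr hm)
  refine h.trans ?_
  have : q ^ m ≤ 1 := Real.rpow_le_one hq.le hq1.le hm
  have h2 : 0 ≤ (1 - q)⁻¹ := inv_nonneg.mpr (by linarith)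
  nlinarith

lemma SS_three (hq : 0 < q) (hq1 : q < 1) {m : ℝ} (hm : 0 ≤ m) :
    SS q 3 m = q ^ (m + 1) * (1 - SS q 3 (m + 3)) := by
  rw [SS, (summable_SS hq hq1 (by norm_num) hm).tsum_eq_zero_add, SS,
    mul_one_sub, ← tsum_mul_left, sub_eq_add_neg (q ^ (m + 1)), ← tsum_neg]
  congr 1
  · norm_num
  · refine tsum_congr fun n => ?_
    rw [mul_left_comm, ← Real.rpow_add hq, pow_succ, mul_neg_one, neg_mul]
    push_cast
    ring_nf

lemma summable_SS_prog (hq : 0 < q) (hq1 : q < 1) {r : ℕ} (hr : 1 ≤ r) {m : ℝ} (hm : 0 ≤ m) :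
    HasSum (fun j : ℕ => SS q r (11 * j + m)) (GG q r m) := by
  have hs : Summable fun p : ℕ × ℕ => (-1) ^ p.1 * q ^ (((p.1 : ℝ) + 1) * (11 * p.2 + m) +
      ((p.1 : ℝ) + 1) * (r * ((p.1 : ℝ) + 1) - 1) / 2) := by
    have hg := summable_geometric_of_lt_one hq.le hq1
    refine .of_norm_bounded (hg.mul_of_nonneg hg (fun n => (pow_pos hq n).le)
      (fun n => (pow_pos hq n).le)) fun p => (SS_term_le hq hq1 hr (by positivity) p.1).trans ?_
    have : q ^ (11 * (p.2 : ℝ) + m) ≤ q ^ p.2 := by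
      rw [← Real.rpow_natCast]
      refine Real.rpow_le_rpow_of_exponent_ge hq hq1.le ?_
      have : (0 : ℝ) ≤ p.2 := p.2.cast_nonneg
      linarith
    gcongr
  have e : ∀ n : ℕ, HasSum (fun j : ℕ => (-1) ^ n * q ^ (((n : ℝ) + 1) * (11 * j + m) +
      ((n : ℝ) + 1) * (r * ((n : ℝ) + 1) - 1) / 2))
      ((-1) ^ n * q ^ (((n : ℝ) + 1) * m + ((n : ℝ) + 1) * (r * ((n : ℝ) + 1) - 1) / 2) /
        (1 - q ^ (11 * ((n : ℝ) + 1)))) := fun n => by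
    have h1 : q ^ (11 * ((n : ℝ) + 1)) < 1 := Real.rpow_lt_one hq.le hq1 (by positivity)
    refine ((hasSum_geometric_of_lt_one (Real.rpow_pos_of_pos hq _).le h1).mul_left
      ((-1) ^ n * q ^ (((n : ℝ) + 1) * m +
        ((n : ℝ) + 1) * (r * ((n : ℝ) + 1) - 1) / 2))).congr_eq (fun j => ?_) ?_
    · rw [← Real.rpow_natCast (q ^ _), ← Real.rpow_mul hq.le, mul_assoc, ← Real.rpow_add hq]
      ring_nf
    · rw [div_eq_mul_inv]
  have h1 := hs.hasSum.prod_fiberwise e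
  have h2 : HasSum (fun j : ℕ => SS q r (11 * j + m)) _ :=
    hs.prod_symm.hasSum.prod_fiberwise fun j =>
      (summable_SS hq hq1 hr (m := 11 * j + m) (by positivity)).hasSum
  refine h2.congr_eq (fun _ => rfl) ?_
  rw [GG, h1.tsum_eq]
  exact ((Equiv.prodComm ℕ ℕ).tsum_eq _).symm

lemma LL_eq_GG (hq : 0 < q) (hq1 : q < 1) {r : ℕ} (hr : 1 ≤ r) {b : ℝ} (hb : -1 ≤ b)
    (hb' : b ≤ 11) : LL q r b = GG q r (11 - b) - GG q r (b + 1) := by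
  have hG : ∀ m : ℝ, 0 ≤ m → Summable fun n : ℕ => (-1) ^ n * q ^ (((n : ℝ) + 1) * m +
      ((n : ℝ) + 1) * (r * ((n : ℝ) + 1) - 1) / 2) / (1 - q ^ (11 * ((n : ℝ) + 1))) := fun m hm => by
    have h := (summable_geometric_of_lt_one hq.le hq1).mul_right (q ^ m * (1 - q)⁻¹)
    refine .of_norm_bounded h fun n => ?_
    rw [norm_div, ← mul_assoc]
    have h1 : q ^ (11 * ((n : ℝ) + 1)) ≤ q := by
      conv_rhs => rw [← Real.rpow_one q]
      refine Real.rpow_le_rpow_of_exponent_ge hq hq1.le ?_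
      have : (0 : ℝ) ≤ n := n.cast_nonneg
      linarith
    rw [Real.norm_of_nonneg (by linarith : 0 ≤ 1 - q ^ (11 * ((n : ℝ) + 1))), div_eq_mul_inv]
    have := SS_term_le hq hq1 hr hm n
    have h3 : (1 - q ^ (11 * ((n : ℝ) + 1)))⁻¹ ≤ (1 - q)⁻¹ :=
      inv_anti₀ (by linarith) (by linarith)
    exact mul_le_mul this h3 (inv_nonneg.mpr (by linarith)) (by positivity)
  have h1 := (hG (b + 1) (by linarith)).hasSum.neg
  have h2 := (hG (11 - b) (by linarith)).hasSum
  have hz : HasSum (fun n : ℤ => (-1) ^ n * q ^ ((n : ℝ) * (r * n + 1) / 2 + b * n) /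
      (1 - q ^ (11 * (n : ℝ)))) (-GG q r (b + 1) + GG q r (11 - b)) := by
    refine HasSum.of_nat_of_neg_add_one ?_ ?_
    · rw [← hasSum_nat_add_iff' 1]
      refine h1.congr_eq (fun n => ?_) ?_
      · push_cast
        rw [← Nat.cast_succ n, zpow_natCast, ← neg_div, pow_succ, mul_neg_one, neg_mul]
        congr 4
        ring
      · simp [GG]
    · refine h2.congr_eq (fun n => ?_) rfl
      have e1 : (-1 : ℝ) ^ (-((n : ℤ) + 1)) = -(-1) ^ n := by
        rw [zpow_neg, ← Nat.cast_succ n, zpow_natCast, ← inv_pow, inv_neg, inv_one, pow_succ,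
          mul_neg_one]
      have hX : q ^ (11 * ((n : ℝ) + 1)) < 1 := Real.rpow_lt_one hq.le hq1 (by positivity)
      have hX0 : 0 < q ^ (11 * ((n : ℝ) + 1)) := Real.rpow_pos_of_pos hq _
      have e2 : q ^ (11 * ((-((n : ℤ) + 1) : ℤ) : ℝ)) = (q ^ (11 * ((n : ℝ) + 1)))⁻¹ := by
        rw [← Real.rpow_neg hq.le]
        push_cast
        congr 1
        ring
      have e3 : q ^ (((n : ℝ) + 1) * (11 - b) + ((n : ℝ) + 1) * (r * ((n : ℝ) + 1) - 1) / 2) =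
          q ^ (11 * ((n : ℝ) + 1)) * q ^ (((-((n : ℤ) + 1) : ℤ) : ℝ) *
            (r * ((-((n : ℤ) + 1) : ℤ) : ℝ) + 1) / 2 + b * ((-((n : ℤ) + 1) : ℤ) : ℝ)) := by
        rw [← Real.rpow_add hq]
        push_cast
        congr 1
        ring
      rw [e1, e2, e3]
      generalize q ^ (11 * ((n : ℝ) + 1)) = X at *
      have h3 : 1 - X ≠ 0 := by linarith
      have h4 : X - 1 ≠ 0 := by linarith
      have h5 : 1 - X⁻¹ = -(1 - X) / X := by field_simp; ring
      rw [h5]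
      field_simp
  rw [LL, hz.tsum_eq]
  ring

end rankSeries

section rankResidue

variable {q : ℝ}

lemma eq_zero_of_abs_le_half {d : ℕ → ℝ} {C : ℝ} (hC : ∀ m, |d m| ≤ C)
    (h : ∀ m, 1 ≤ m → |d m| ≤ 1 / 2 * |d (m + 3)|) {m : ℕ} (hm : 1 ≤ m) : d m = 0 := by
  have key : ∀ k m, 1 ≤ m → |d m| ≤ C * (1 / 2) ^ k := by
    intro k
    induction k with
    | zero => intro m _; simpa using hC m
    | succ k ih =>
      intro m hm
      have h1 := h m hm
      have h2 := ih (m + 3) (by omega)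
      rw [pow_succ]
      linarith
  have h0 : Filter.Tendsto (fun k : ℕ => C * (1 / 2 : ℝ) ^ k) Filter.atTop (nhds (C * 0)) :=
    (tendsto_pow_atTop_nhds_zero_of_lt_one (by norm_num) (by norm_num)).const_mul C
  rw [mul_zero] at h0
  have := ge_of_tendsto h0 (Filter.Eventually.of_forall fun k => key k m hm)
  exact abs_eq_zero.mp (le_antisymm this (abs_nonneg _))

lemma wt_le_rank_rec (hq : 0 < q) (hq2 : q < 1 / 2) {m : ℕ} (hm : 1 ≤ m) :
    wt q (fun s => (m : ℤ) ≤ msRank s.1) = q ^ (m + 1) *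
      (wt q (fun _ => True) - wt q (fun s => ((m + 3 : ℕ) : ℤ) ≤ msRank s.1)) := by
  have h := wt_dyson hq ((m : ℤ) + 1)
  rw [wt_congr (P' := fun s => (m : ℤ) ≤ msRank s.1) fun s => ?_,
    wt_congr (P := fun s => msRank s.1 ≤ (m : ℤ) + 1 + 1 ∧ _)
      (P' := fun s => ¬ ((m + 3 : ℕ) : ℤ) ≤ msRank s.1) fun s => ?_] at h
  · rw [h, ← wt_add_not hq hq2 fun s => ((m + 3 : ℕ) : ℤ) ≤ msRank s.1, add_sub_cancel_left]
    norm_cast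
  · push_cast
    omega
  · refine ⟨fun h => by omega, fun h => ⟨by omega, ?_⟩⟩
    have hs : s.1 ≠ 0 := fun h0 => by
      rw [h0] at h
      simp [msRank] at h
      omega
    have := Multiset.card_pos.mpr hs
    unfold msRank at h
    omega

lemma wt_zero_le_rank (hq : 0 < q) (hq2 : q < 1 / 2) :
    wt q (fun s => 0 ≤ msRank s.1) = 1 + q *
      (wt q (fun _ => True) - wt q (fun s => 3 ≤ msRank s.1)) := by
  have h := wt_dyson hq 1
  rw [wt_congr (P := fun s => msRank s.1 ≤ 1 + 1 ∧ _)
      (P' := fun s => ¬ 3 ≤ msRank s.1) fun s => ?_] at h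
  · rw [← wt_add_not hq hq2 fun s => 3 ≤ msRank s.1, add_sub_cancel_left]
    rw [zpow_one] at h
    rw [← h]
    classical
    rw [wt_eq_tsum, wt_eq_tsum]
    have h1 := hasSum_ite_eq (⟨0, by simp⟩ : PartMS) (1 : ℝ)
    rw [← h1.tsum_eq, ← h1.summable.tsum_add (summable_ite_partMS hq hq2 _)]
    refine tsum_congr fun s => ?_
    by_cases h0 : s = ⟨0, by simp⟩
    · subst h0
      simp [msRank]
    · have hs0 : s.1 ≠ 0 := fun h => h0 (Subtype.ext h)
      have := sup_pos hs0 s.2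
      rw [if_neg h0, zero_add]
      refine if_congr ?_ rfl rfl
      omega
  · omega

lemma wt_rank_le_rec (hq : 0 < q) (hq2 : q < 1 / 2) {m : ℕ} (hm : 1 ≤ m) :
    wt q (fun s => msRank s.1 ≤ -(m : ℤ)) = q ^ (m + 1) *
      (wt q (fun _ => True) - wt q (fun s => msRank s.1 ≤ -((m + 3 : ℕ) : ℤ))) := by
  have h := wt_dyson hq (-((m : ℤ) + 1))
  rw [wt_congr (P := fun s => _ ≤ msRank s.1 ∧ _)
      (P' := fun s => ¬ msRank s.1 ≤ -((m + 3 : ℕ) : ℤ)) fun s => ?_,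
    wt_congr (P := fun s => msRank s.1 ≤ _ ∧ _)
      (P' := fun s => msRank s.1 ≤ -(m : ℤ)) fun s => ?_] at h
  · rw [← wt_add_not hq hq2 fun s => msRank s.1 ≤ -((m + 3 : ℕ) : ℤ), add_sub_cancel_left, h,
      zpow_neg, ← Nat.cast_succ, zpow_natCast, mul_inv_cancel_left₀ (pow_pos hq _).ne']
  · refine ⟨fun h => by omega, fun h => ⟨by omega, ?_⟩⟩
    have hs : s.1 ≠ 0 := fun h0 => by
      rw [h0] at h
      simp [msRank] at h
      omega
    have := sup_pos hs s.2
    unfold msRank at h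
    omega
  · push_cast
    omega

lemma abs_wt_le (hq : 0 < q) (hq2 : q < 1 / 2) (P : PartMS → Prop) :
    |wt q P| ≤ wt q fun _ => True := by
  rw [abs_of_nonneg (wt_nonneg hq P)]
  exact wt_mono hq hq2 _ _ fun _ _ => trivial

lemma eq_mul_SS_of_rec (hq : 0 < q) (hq2 : q < 1 / 2) {P : ℝ} {B : ℕ → ℝ} (hB : ∀ m, |B m| ≤ P)
    (h : ∀ m, 1 ≤ m → B m = q ^ (m + 1) * (P - B (m + 3))) {m : ℕ} (hm : 1 ≤ m) :
    B m = P * SS q 3 m := by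
  have hq1 : q < 1 := by linarith
  have hP : 0 ≤ P := (abs_nonneg _).trans (hB 0)
  rw [← sub_eq_zero]
  refine eq_zero_of_abs_le_half (d := fun m => B m - P * SS q 3 m) (C := P + P * (1 - q)⁻¹)
    (fun m => ?_) (fun m hm => ?_) hm
  · refine (abs_sub _ _).trans (add_le_add (hB m) ?_)
    rw [abs_mul, abs_of_nonneg hP]
    exact mul_le_mul_of_nonneg_left (abs_SS_le hq hq1 (by norm_num) m.cast_nonneg) hP
  · have e : B m - P * SS q 3 m = -q ^ (m + 1) * (B (m + 3) - P * SS q 3 ((m + 3 : ℕ) : ℝ)) := by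
      rw [h m hm, SS_three hq hq1 m.cast_nonneg]
      push_cast
      rw [← Nat.cast_succ, Real.rpow_natCast, Nat.succ_eq_add_one]
      ring
    rw [e, abs_mul, abs_neg, abs_of_pos (pow_pos hq _)]
    refine mul_le_mul_of_nonneg_right ?_ (abs_nonneg _)
    exact (pow_le_of_le_one hq.le hq1.le (by omega)).trans hq2.le

lemma wt_le_rank (hq : 0 < q) (hq2 : q < 1 / 2) {m : ℕ} (hm : 1 ≤ m) :
    wt q (fun s => (m : ℤ) ≤ msRank s.1) = wt q (fun _ => True) * SS q 3 m :=
  eq_mul_SS_of_rec hq hq2 (B := fun m => wt q (fun s => (m : ℤ) ≤ msRank s.1))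
    (fun _ => abs_wt_le hq hq2 _) (fun _ h => wt_le_rank_rec hq hq2 h) hm

lemma wt_rank_le (hq : 0 < q) (hq2 : q < 1 / 2) {m : ℕ} (hm : 1 ≤ m) :
    wt q (fun s => msRank s.1 ≤ -(m : ℤ)) = wt q (fun _ => True) * SS q 3 m :=
  eq_mul_SS_of_rec hq hq2 (B := fun m => wt q (fun s => msRank s.1 ≤ -(m : ℤ)))
    (fun _ => abs_wt_le hq hq2 _) (fun _ h => wt_rank_le_rec hq hq2 h) hm

lemma wt_zero_le_rank' (hq : 0 < q) (hq2 : q < 1 / 2) :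
    wt q (fun s => 0 ≤ msRank s.1) = wt q (fun _ => True) * SS q 3 0 + 1 := by
  rw [wt_zero_le_rank hq hq2, SS_three hq (by linarith) le_rfl]
  have := wt_le_rank hq hq2 (m := 3) (by norm_num)
  push_cast at this
  rw [this, zero_add, zero_add, Real.rpow_one]
  ring

/-- Euler's identity: the generating function of partitions is `1 / (q; q)_∞`. -/
lemma wt_true (hq : 0 < q) (hq2 : q < 1 / 2) : wt q (fun _ => True) * qI q q = 1 := by
  have hq1 : q < 1 := by linarith
  have h1 := wt_add_not hq hq2 fun s => 0 ≤ msRank s.1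
  rw [wt_congr (P := fun s => ¬ 0 ≤ msRank s.1) (P' := fun s => msRank s.1 ≤ -((1 : ℕ) : ℤ))
    fun s => by push_cast; omega, wt_rank_le hq hq2 le_rfl, wt_zero_le_rank' hq hq2] at h1
  have hp := pent_hasSum hq hq1
  have e : qI q q = 1 - SS q 3 0 - SS q 3 (1 : ℕ) := by
    have h2 := (summable_SS hq hq1 (r := 3) (by norm_num) (m := 1) (by norm_num)).hasSum.neg
    have h3 := (summable_SS hq hq1 (r := 3) (by norm_num) (m := 0) le_rfl).hasSum.neg
    have hz : HasSum (fun n : ℤ => (-1) ^ n * q ^ ((3 : ℝ) / 2 * (n + 1 / 6) ^ 2))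
        (q ^ ((1 : ℝ) / 24) * ((1 - SS q 3 1) + -SS q 3 0)) := by
      refine HasSum.congr_eq (HasSum.mul_left (q ^ ((1 : ℝ) / 24))
        (f := fun n : ℤ => (-1) ^ n * q ^ ((n : ℝ) * (3 * n + 1) / 2))
        (HasSum.of_nat_of_neg_add_one (m := 1 - SS q 3 1) ?_ ?_)) (fun n => ?_) rfl
      · rw [← hasSum_nat_add_iff' 1]
        refine h2.congr_eq (fun n => ?_) ?_
        · push_cast
          rw [← Nat.cast_succ n, zpow_natCast, pow_succ, mul_neg_one, neg_mul]
          congr 3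
          ring
        · simp [SS]
      · refine h3.congr_eq (fun n => ?_) rfl
        have e1 : (-1 : ℝ) ^ (-((n : ℤ) + 1)) = -(-1) ^ n := by
          rw [zpow_neg, ← Nat.cast_succ n, zpow_natCast, ← inv_pow, inv_neg, inv_one, pow_succ,
            mul_neg_one]
        rw [e1, neg_mul]
        push_cast
        congr 3
        ring
      · rw [mul_left_comm, ← Real.rpow_add hq]
        congr 2
        ring
    have := mul_left_cancel₀ (Real.rpow_pos_of_pos hq _).ne' (hp.unique hz)
    rw [this]
    push_cast
    ring
  rw [e]
  linarith

lemma wt_rank_eq (hq : 0 < q) (hq2 : q < 1 / 2) (k : ℤ) :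
    wt q (fun s => msRank s.1 = k) = wt q (fun _ => True) * (SS q 3 |(k : ℝ)| - SS q 3 (|(k : ℝ)| + 1)) +
      if k = 0 then 1 else 0 := by
  have key : ∀ P P' : PartMS → Prop, (∀ s, P' s → P s) →
      wt q P = wt q P' + wt q (fun s => P s ∧ ¬ P' s) := by
    intro P P' h
    classical
    rw [wt_eq_tsum, wt_eq_tsum, wt_eq_tsum, 
      ← (summable_ite_partMS hq hq2 _).tsum_add (summable_ite_partMS hq hq2 _)]
    refine tsum_congr fun s => ?_
    have := h s
    by_cases h1 : P s <;> by_cases h2 : P' s <;> simp [h1, h2] <;> tauto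
  rcases lt_trichotomy k 0 with hk | rfl | hk
  · obtain ⟨m, rfl⟩ : ∃ m : ℕ, k = -((m + 1 : ℕ) : ℤ) := ⟨(-k - 1).toNat, by omega⟩
    have h := key (fun s => msRank s.1 ≤ -((m + 1 : ℕ) : ℤ)) 
      (fun s => msRank s.1 ≤ -((m + 2 : ℕ) : ℤ)) fun s hs => by omega
    rw [wt_rank_le hq hq2 (by omega), wt_rank_le hq hq2 (by omega)] at h
    rw [if_neg hk.ne, wt_congr (P' := fun s => msRank s.1 ≤ -((m + 1 : ℕ) : ℤ) ∧
      ¬ msRank s.1 ≤ -((m + 2 : ℕ) : ℤ)) fun s => by omega]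
    have e : |((-((m + 1 : ℕ) : ℤ) : ℤ) : ℝ)| = ((m + 1 : ℕ) : ℝ) := by
      rw [Int.cast_neg, abs_neg, Int.cast_natCast, Nat.abs_cast]
    rw [e]
    push_cast at h ⊢
    rw [show (m : ℝ) + 1 + 1 = m + 2 by ring]
    linarith
  · have h := key (fun s => 0 ≤ msRank s.1) (fun s => ((1 : ℕ) : ℤ) ≤ msRank s.1)
      fun s hs => by omega
    rw [wt_zero_le_rank' hq hq2, wt_le_rank hq hq2 le_rfl] at h
    rw [if_pos rfl, wt_congr (P' := fun s => 0 ≤ msRank s.1 ∧ ¬ ((1 : ℕ) : ℤ) ≤ msRank s.1)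
      fun s => by omega]
    push_cast at h ⊢
    rw [abs_zero, zero_add]
    linarith
  · obtain ⟨m, rfl⟩ : ∃ m : ℕ, k = ((m + 1 : ℕ) : ℤ) := ⟨(k - 1).toNat, by omega⟩
    have h := key (fun s => ((m + 1 : ℕ) : ℤ) ≤ msRank s.1) 
      (fun s => ((m + 2 : ℕ) : ℤ) ≤ msRank s.1) fun s hs => by omega
    rw [wt_le_rank hq hq2 (by omega), wt_le_rank hq hq2 (by omega)] at h
    rw [if_neg hk.ne', wt_congr (P' := fun s => ((m + 1 : ℕ) : ℤ) ≤ msRank s.1 ∧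
      ¬ ((m + 2 : ℕ) : ℤ) ≤ msRank s.1) fun s => by omega]
    have e : |((((m + 1 : ℕ) : ℤ) : ℤ) : ℝ)| = ((m + 1 : ℕ) : ℝ) := by
      rw [Int.cast_natCast, Nat.abs_cast]
    rw [e]
    push_cast at h ⊢
    rw [show (m : ℝ) + 1 + 1 = m + 2 by ring]
    linarith

/-- The weight of a residue class of an integer statistic. -/
lemma hasSum_wt_residue (hq : 0 < q) (hq2 : q < 1 / 2) (g : PartMS → ℤ) {b : ℤ} (hb : 0 ≤ b)
    (hb' : b < 11) :
    HasSum (fun j : ℤ => wt q fun s => g s = 11 * j + b) (wt q fun s => g s % 11 = b) := by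
  let e : (Σ j : ℤ, {s : PartMS // g s = 11 * j + b}) ≃ {s : PartMS // g s % 11 = b} :=
    { toFun := fun s => ⟨s.2.1, by have := s.2.2; omega⟩
      invFun := fun s => ⟨g s.1 / 11, s.1, by have := s.2; omega⟩
      left_inv := by
        rintro ⟨j, s, hs⟩
        have : g s / 11 = j := by omega
        subst this
        rfl
      right_inv := fun s => rfl }
  exact (e.hasSum_iff.mpr (summable_wt hq hq2 _).hasSum).sigma fun j =>
    (summable_wt hq hq2 fun s => g s = 11 * j + b).hasSum

lemma hasSum_SS_residue (hq : 0 < q) (hq1 : q < 1) {r : ℕ} (hr : 1 ≤ r) {b : ℤ} (hb : 0 ≤ b)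
    (hb' : b < 11) :
    HasSum (fun j : ℤ => SS q r |11 * (j : ℝ) + b| - SS q r (|11 * (j : ℝ) + b| + 1))
      (LL q r b - LL q r (b - 1)) := by
  have c0 : (0 : ℝ) ≤ b := by exact_mod_cast hb
  have c1 : (b : ℝ) ≤ 10 := by exact_mod_cast (by omega : b ≤ 10)
  rw [LL_eq_GG hq hq1 hr (by linarith) (by linarith),
    LL_eq_GG hq hq1 hr (by linarith) (by linarith)]
  have h : ∀ m : ℝ, 0 ≤ m → _ := fun m hm => summable_SS_prog hq hq1 hr hm
  refine HasSum.congr_eq (HasSum.of_nat_of_neg_add_one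
    (((h b c0).sub (h (b + 1) (by linarith))).congr_eq (fun j => ?_) rfl)
    (((h (11 - b) (by linarith)).sub (h (11 - b + 1) (by linarith))).congr_eq (fun j => ?_) rfl))
    (fun _ => rfl) ?_
  · push_cast
    rw [abs_of_nonneg (by positivity), add_assoc]
  · push_cast
    rw [abs_of_nonpos (by linarith [(j.cast_nonneg : (0 : ℝ) ≤ j)])]
    congr 2 <;> ring
  · rw [show (b : ℝ) - 1 + 1 = b by ring, show (11 : ℝ) - (b - 1) = 11 - b + 1 by ring]
    ring

/-- The generating function of partitions with rank in a residue class modulo `11`. -/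
lemma wt_rank_residue (hq : 0 < q) (hq2 : q < 1 / 2) {b : ℤ} (hb : 0 ≤ b) (hb' : b < 11) :
    wt q (fun s => msRank s.1 % 11 = b) * qI q q =
      LL q 3 b - LL q 3 (b - 1) + if b = 0 then qI q q else 0 := by
  have h1 := hasSum_wt_residue hq hq2 (fun s => msRank s.1) hb hb'
  have h2 := ((hasSum_SS_residue hq (by linarith) (r := 3) (by norm_num) hb hb').mul_left
    (wt q fun _ => True)).add (hasSum_ite_eq (0 : ℤ) (if b = 0 then (1 : ℝ) else 0))
  have h3 := h1.unique (h2.congr_eq (fun j => ?_) rfl)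
  · rw [h3, add_mul, mul_right_comm, wt_true hq hq2, one_mul, ite_mul, one_mul, zero_mul]
  · rw [wt_rank_eq hq hq2]
    push_cast
    congr 1
    by_cases hj : j = 0
    · simp [hj]
    · rw [if_neg hj, if_neg]
      omega

end rankResidue

section crankFibers

variable {q : ℝ}

lemma wt_and_add (hq : 0 < q) (hq2 : q < 1 / 2) (P P' : PartMS → Prop) :
    wt q P = wt q (fun s => P s ∧ P' s) + wt q (fun s => P s ∧ ¬ P' s) := by
  classical
  rw [wt_eq_tsum, wt_eq_tsum, wt_eq_tsum,
    ← (summable_ite_partMS hq hq2 _).tsum_add (summable_ite_partMS hq hq2 _)]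
  refine tsum_congr fun s => ?_
  by_cases h1 : P s <;> by_cases h2 : P' s <;> simp [h1, h2]

lemma wt_singleton (P : PartMS → Prop) (s : PartMS) (h : ∀ t, P t ↔ t = s) :
    wt q P = q ^ s.1.sum := by
  have : Unique {t // P t} := ⟨⟨⟨s, (h s).mpr rfl⟩⟩, fun t => Subtype.ext ((h _).mp t.2)⟩
  rw [wt, tsum_eq_single ⟨s, (h s).mpr rfl⟩]
  intro t ht
  exact absurd (Subsingleton.elim _ _) ht

lemma wt_mem_erase (P : Multiset ℕ → Prop) {a : ℕ} (ha : a ≠ 0) :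
    wt q (fun s => a ∈ s.1 ∧ P (s.1.erase a)) = q ^ a * wt q (fun s => P s.1) := by
  let e : {s : PartMS // P s.1} ≃ {s : PartMS // a ∈ s.1 ∧ P (s.1.erase a)} :=
    { toFun := fun s => ⟨⟨a ::ₘ s.1.1, by simp [ha.symm, s.1.2]⟩, by
        simp [s.2]⟩
      invFun := fun s => ⟨⟨s.1.1.erase a, fun h => s.1.2 (Multiset.mem_of_mem_erase h)⟩, s.2.2⟩
      left_inv := fun s => Subtype.ext (Subtype.ext (Multiset.erase_cons_head _ _))
      right_inv := fun s => Subtype.ext (Subtype.ext (Multiset.cons_erase s.2.1)) }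
  rw [wt, wt, ← e.tsum_eq, ← tsum_mul_left]
  refine tsum_congr fun s => ?_
  show q ^ (a ::ₘ s.1.1).sum = _
  rw [Multiset.sum_cons, pow_add]

lemma wt_shift (i j : ℕ) :
    wt q (fun s => (∀ x ∈ s.1, j < x) ∧ Multiset.card s.1 = i) =
      q ^ (i * j) * wt q (fun s => Multiset.card s.1 = i) := by
  have hm : ∀ s : Multiset ℕ, (∀ x ∈ s, j < x) → (s.map (· - j)).map (· + j) = s := by
    intro s hs
    rw [Multiset.map_map]
    exact (Multiset.map_congr rfl fun x hx => Nat.sub_add_cancel (hs x hx).le).trans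
      (Multiset.map_id _)
  let e : {s : PartMS // Multiset.card s.1 = i} ≃
      {s : PartMS // (∀ x ∈ s.1, j < x) ∧ Multiset.card s.1 = i} :=
    { toFun := fun s => ⟨⟨s.1.1.map (· + j), fun h => by
          obtain ⟨x, hx, h⟩ := Multiset.mem_map.mp h
          exact s.1.2 ((by omega : x = 0) ▸ hx)⟩, fun x hx => by
          obtain ⟨y, hy, h⟩ := Multiset.mem_map.mp hx
          have : y ≠ 0 := fun h => s.1.2 (h ▸ hy)
          omega, by simp [s.2]⟩
      invFun := fun s => ⟨⟨s.1.1.map (· - j), fun h => by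
          obtain ⟨x, hx, h⟩ := Multiset.mem_map.mp h
          have := s.2.1 x hx
          omega⟩, by simp [s.2.2]⟩
      left_inv := fun s => Subtype.ext (Subtype.ext (by simp [Multiset.map_map]))
      right_inv := fun s => Subtype.ext (Subtype.ext (hm _ s.2.1)) }
  rw [wt, wt, ← e.tsum_eq, ← tsum_mul_left]
  refine tsum_congr fun s => ?_
  show q ^ (s.1.1.map (· + j)).sum = _
  rw [Multiset.sum_map_add, Multiset.map_id', Multiset.map_const', Multiset.sum_replicate, s.2,
    smul_eq_mul, add_comm, pow_add]

/-- `1 / (q; q)_n`. -/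
noncomputable def uN (q : ℝ) (n : ℕ) : ℝ := (qP q q n)⁻¹

lemma uN_zero (q : ℝ) : uN q 0 = 1 := by simp [uN, qP_zero]

lemma uN_succ (hq : 0 < q) (hq1 : q < 1) (n : ℕ) : uN q (n + 1) * (1 - q ^ (n + 1)) = uN q n := by
  have := self_mul_pow_ne_one hq hq1 n
  rw [uN, uN, qP_succ, mul_inv, ← pow_succ']
  rw [← pow_succ'] at this
  exact inv_mul_cancel_right₀ (sub_ne_zero.mpr this.symm) _

lemma wt_card (hq : 0 < q) (hq2 : q < 1 / 2) (i : ℕ) :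
    wt q (fun s => Multiset.card s.1 = i) = q ^ i * uN q i := by
  induction i with
  | zero =>
    rw [wt_singleton _ ⟨0, by simp⟩ fun t => by
      rw [Multiset.card_eq_zero, Subtype.ext_iff], uN_zero]
    simp
  | succ i ih =>
    have h := wt_and_add hq hq2 (fun s => Multiset.card s.1 = i + 1) fun s => 1 ∈ s.1
    rw [wt_congr (P := fun s => Multiset.card s.1 = i + 1 ∧ 1 ∈ s.1)
        (P' := fun s => 1 ∈ s.1 ∧ Multiset.card (s.1.erase 1) = i) fun s => ?_,
      wt_mem_erase (fun s => Multiset.card s = i) one_ne_zero,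
      wt_congr (P := fun s => Multiset.card s.1 = i + 1 ∧ ¬ 1 ∈ s.1)
        (P' := fun s => (∀ x ∈ s.1, 1 < x) ∧ Multiset.card s.1 = i + 1) fun s => ?_,
      wt_shift, mul_one, ih, ← uN_succ hq (by linarith)] at h
    · have h1 : 1 - q ^ (i + 1) ≠ 0 :=
        sub_ne_zero.mpr (pow_lt_one₀ hq.le (by linarith) (by omega)).ne'
      refine mul_right_cancel₀ h1 ?_
      rw [pow_succ] at h h1 ⊢
      linear_combination h
    · rw [and_comm]
      refine and_congr_left fun _ => ⟨fun h x hx => ?_, fun h h1 => lt_irrefl _ (h 1 h1)⟩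
      have h0 : x ≠ 0 := fun h => s.2 (h ▸ hx)
      have h1 : x ≠ 1 := fun h' => h (h' ▸ hx)
      omega
    · rw [and_comm]
      refine and_congr_right fun h1 => ?_
      have := Multiset.card_erase_add_one h1
      omega

lemma wt_parts_between (hq : 0 < q) (hq2 : q < 1 / 2) (j : ℕ) :
    wt q (fun s => ∀ x ∈ s.1, 2 ≤ x ∧ x ≤ j + 1) = (1 - q) * uN q (j + 1) := by
  induction j with
  | zero =>
    have h := uN_succ hq (by linarith : q < 1) 0
    rw [zero_add, pow_one, uN_zero] at h
    rw [wt_singleton _ ⟨0, by simp⟩ fun t => by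
      rw [Subtype.ext_iff]
      exact ⟨fun h => Multiset.eq_zero_of_forall_notMem fun x hx => by have := h x hx; omega,
        fun h => by simp [h]⟩, zero_add]
    simp only [Multiset.sum_zero, pow_zero]
    linarith
  | succ j ih =>
    have h := wt_and_add hq hq2 (fun s => ∀ x ∈ s.1, 2 ≤ x ∧ x ≤ j + 1 + 1) fun s => j + 2 ∈ s.1
    rw [wt_congr (P := fun s => (∀ x ∈ s.1, 2 ≤ x ∧ x ≤ j + 1 + 1) ∧ j + 2 ∈ s.1)
        (P' := fun s => j + 2 ∈ s.1 ∧ ∀ x ∈ s.1.erase (j + 2), 2 ≤ x ∧ x ≤ j + 1 + 1) fun s => ?_,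
      wt_mem_erase (fun s => ∀ x ∈ s, 2 ≤ x ∧ x ≤ j + 1 + 1) (by omega),
      wt_congr (P := fun s => (∀ x ∈ s.1, 2 ≤ x ∧ x ≤ j + 1 + 1) ∧ ¬ j + 2 ∈ s.1)
        (P' := fun s => ∀ x ∈ s.1, 2 ≤ x ∧ x ≤ j + 1) fun s => ?_, ih,
        ← uN_succ hq (by linarith) (j + 1)] at h
    · have h1 : 1 - q ^ (j + 2) ≠ 0 :=
        sub_ne_zero.mpr (pow_lt_one₀ hq.le (by linarith) (by omega)).ne'
      refine mul_right_cancel₀ h1 ?_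
      linear_combination h
    · constructor
      · rintro ⟨h, h1⟩ x hx
        have := h x hx
        have h2 : x ≠ j + 2 := fun h' => h1 (h' ▸ hx)
        omega
      · refine fun h => ⟨fun x hx => ?_, fun h1 => ?_⟩
        · have := h x hx; omega
        · have := h _ h1; omega
    · rw [and_comm]
      refine and_congr_right fun h1 => ⟨fun h x hx => h x (Multiset.mem_of_mem_erase hx),
        fun h x hx => ?_⟩
      rw [← Multiset.cons_erase h1, Multiset.mem_cons] at hx
      rcases hx with rfl | hx
      · omega
      · exact h x hx

lemma wt_no_ones_sup (hq : 0 < q) (hq2 : q < 1 / 2) (i : ℕ) :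
    wt q (fun s => s.1.count 1 = 0 ∧ s.1.sup = i + 2) = q ^ (i + 2) * ((1 - q) * uN q (i + 2)) := by
  rw [← wt_parts_between hq hq2 (i + 1), ← wt_mem_erase (fun s => ∀ x ∈ s, 2 ≤ x ∧ x ≤ i + 1 + 1)
    (by omega : i + 2 ≠ 0)]
  refine wt_congr fun s => ⟨?_, ?_⟩
  · rintro ⟨h1, h2⟩
    rw [Multiset.count_eq_zero] at h1
    have h3 : s.1 ≠ 0 := fun h => by rw [h] at h2; simp at h2
    refine ⟨h2 ▸ sup_mem h3, fun x hx => ?_⟩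
    have hx' := Multiset.mem_of_mem_erase hx
    have h4 : x ≤ s.1.sup := Multiset.le_sup hx'
    have h5 : x ≠ 0 := fun h => s.2 (h ▸ hx')
    have h6 : x ≠ 1 := fun h => h1 (h ▸ hx')
    omega
  · rintro ⟨h1, h2⟩
    rw [Multiset.count_eq_zero]
    have h3 : ∀ x ∈ s.1, 2 ≤ x ∧ x ≤ i + 2 := fun x hx => by
      rw [← Multiset.cons_erase h1, Multiset.mem_cons] at hx
      rcases hx with rfl | hx
      · omega
      · exact h2 x hx
    exact ⟨fun h => by have := h3 _ h; omega, le_antisymm (Multiset.sup_le.mpr fun x hx =>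
      (h3 x hx).2) (Multiset.le_sup h1)⟩

lemma wt_ones (hq : 0 < q) (hq2 : q < 1 / 2) (i j : ℕ) :
    wt q (fun s => s.1.count 1 = j + 1 ∧ Multiset.card (s.1.filter (j + 1 < ·)) = i) =
      q ^ (j + 1) * ((1 - q) * uN q (j + 1)) * (q ^ (i * (j + 1)) * (q ^ i * uN q i)) := by
  rw [← wt_card hq hq2, ← wt_shift, ← wt_parts_between hq hq2, mul_assoc]
  let e : {s : PartMS // ∀ x ∈ s.1, 2 ≤ x ∧ x ≤ j + 1} ×
      {s : PartMS // (∀ x ∈ s.1, j + 1 < x) ∧ Multiset.card s.1 = i} ≃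
      {s : PartMS // s.1.count 1 = j + 1 ∧ Multiset.card (s.1.filter (j + 1 < ·)) = i} :=
    { toFun := fun p => ⟨⟨p.1.1.1 + p.2.1.1 + Multiset.replicate (j + 1) 1, by
          simp [p.1.1.2, p.2.1.2, Multiset.mem_replicate]⟩, by
          have h1 : 1 ∉ p.1.1.1 := fun h => by have := p.1.2 _ h; omega
          have h2 : 1 ∉ p.2.1.1 := fun h => by have := p.2.2.1 _ h; omega
          have h3 : p.1.1.1.filter (j + 1 < ·) = 0 := 
            Multiset.filter_eq_nil.mpr fun x hx => by have := p.1.2 _ hx; omega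
          have h4 : p.2.1.1.filter (j + 1 < ·) = p.2.1.1 := Multiset.filter_eq_self.mpr p.2.2.1
          have h5 : (Multiset.replicate (j + 1) 1).filter (j + 1 < ·) = 0 :=
            Multiset.filter_eq_nil.mpr fun x hx => by
              rw [Multiset.eq_of_mem_replicate hx]; omega
          constructor
          · simp [Multiset.count_eq_zero.mpr h1, Multiset.count_eq_zero.mpr h2]
          · simp only [Multiset.filter_add, h3, h4, h5, zero_add, add_zero, p.2.2.2]⟩
      invFun := fun s => (⟨⟨s.1.1.filter fun x => 2 ≤ x ∧ x ≤ j + 1, by simp⟩, by simp⟩,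
        ⟨⟨s.1.1.filter (j + 1 < ·), by simp⟩, by simp, s.2.2⟩)
      left_inv := fun p => by
        have h1 : p.1.1.1.filter (fun x => 2 ≤ x ∧ x ≤ j + 1) = p.1.1.1 :=
          Multiset.filter_eq_self.mpr p.1.2
        have h2 : p.2.1.1.filter (fun x => 2 ≤ x ∧ x ≤ j + 1) = 0 :=
          Multiset.filter_eq_nil.mpr fun x hx => by have := p.2.2.1 _ hx; omega
        have h6 : (Multiset.replicate (j + 1) 1).filter (fun x => 2 ≤ x ∧ x ≤ j + 1) = 0 :=
          Multiset.filter_eq_nil.mpr fun x hx => by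
            rw [Multiset.eq_of_mem_replicate hx]; omega
        have h3 : p.1.1.1.filter (j + 1 < ·) = 0 := 
          Multiset.filter_eq_nil.mpr fun x hx => by have := p.1.2 _ hx; omega
        have h4 : p.2.1.1.filter (j + 1 < ·) = p.2.1.1 := Multiset.filter_eq_self.mpr p.2.2.1
        have h5 : (Multiset.replicate (j + 1) 1).filter (j + 1 < ·) = 0 :=
          Multiset.filter_eq_nil.mpr fun x hx => by
            rw [Multiset.eq_of_mem_replicate hx]; omega
        refine Prod.ext (Subtype.ext (Subtype.ext ?_)) (Subtype.ext (Subtype.ext ?_))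
        · show (p.1.1.1 + p.2.1.1 + Multiset.replicate (j + 1) 1).filter
            (fun x => 2 ≤ x ∧ x ≤ j + 1) = p.1.1.1
          rw [Multiset.filter_add, Multiset.filter_add, h1, h2, h6, add_zero, add_zero]
        · show (p.1.1.1 + p.2.1.1 + Multiset.replicate (j + 1) 1).filter (j + 1 < ·) = p.2.1.1
          rw [Multiset.filter_add, Multiset.filter_add, h3, h4, h5, zero_add, add_zero]
      right_inv := fun s => by
        refine Subtype.ext (Subtype.ext ?_)
        show s.1.1.filter (fun x => 2 ≤ x ∧ x ≤ j + 1) + s.1.1.filter (j + 1 < ·) +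
          Multiset.replicate (j + 1) 1 = s.1.1
        ext a
        rw [Multiset.count_add, Multiset.count_add, Multiset.count_filter, Multiset.count_filter,
          Multiset.count_replicate]
        have h0 := Multiset.count_eq_zero.mpr s.1.2
        have h1 := s.2.1
        rcases Nat.lt_or_ge a 2 with ha | ha
        · interval_cases a
          · simp [h0]
          · simp [h1]
        · split_ifs <;> omega }
  rw [wt, wt, wt, ← e.tsum_eq, tsum_mul_tsum_of_summable_norm (summable_wt hq hq2 _).norm
    (summable_wt hq hq2 _).norm, ← tsum_mul_left]
  refine tsum_congr fun p => ?_
  show q ^ (p.1.1.1 + p.2.1.1 + Multiset.replicate (j + 1) 1).sum = _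
  rw [Multiset.sum_add, Multiset.sum_add, Multiset.sum_replicate, smul_eq_mul, mul_one, pow_add,
    pow_add]
  ring

/-- The crank of a multiset is `msTop s - count 1 s`. -/
def msTop (s : Multiset ℕ) : ℕ :=
  if s.count 1 = 0 then s.sup else Multiset.card (s.filter (s.count 1 < ·))

lemma wt_count_top (hq : 0 < q) (hq2 : q < 1 / 2) (i j : ℕ) :
    wt q (fun s => s.1.count 1 = j ∧ msTop s.1 = i) =
      (1 - q) * q ^ (i * j + i + j) * uN q i * uN q j +
        if j = 0 ∧ i = 0 then q else if j = 0 ∧ i = 1 then -q else 0 := by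
  rcases j with _ | j
  · rw [wt_congr (P' := fun s => s.1.count 1 = 0 ∧ s.1.sup = i) fun s =>
      and_congr_right fun h => by rw [msTop, if_pos h]]
    have hs : ∀ s : PartMS, s.1.count 1 = 0 → s.1 ≠ 0 → 2 ≤ s.1.sup := fun s h1 h2 => by
      have h3 := sup_pos h2 s.2
      have h4 := sup_mem h2
      have : s.1.sup ≠ 1 := fun h => Multiset.count_eq_zero.mp h1 (h ▸ h4)
      omega
    rcases i with _ | _ | i
    · rw [wt_singleton _ ⟨0, by simp⟩ fun t => by
        rw [Subtype.ext_iff]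
        refine ⟨fun h => ?_, fun h => by simp [h]⟩
        by_contra h0
        have := hs t h.1 h0
        omega]
      simp [uN_zero]
    · have h := uN_succ hq (by linarith : q < 1) 0
      rw [zero_add, pow_one, uN_zero] at h
      rw [wt_congr (P' := fun s => False) fun s => ⟨fun h => ?_, False.elim⟩]
      · rw [if_neg (by omega), if_pos (by omega), wt, tsum_empty, uN_zero]
        simp only [zero_add, mul_zero, add_zero, pow_one, mul_one]
        linear_combination -q * h
      · by_cases h0 : s.1 = 0
        · have := h.2
          rw [h0] at this
          simp at this
        · have := hs s h.1 h0
          omega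
    · rw [wt_no_ones_sup hq hq2, if_neg (by omega), if_neg (by omega), uN_zero]
      ring
  · rw [wt_congr (P' := fun s => s.1.count 1 = j + 1 ∧
      Multiset.card (s.1.filter (j + 1 < ·)) = i) fun s =>
      and_congr_right fun h => by rw [msTop, if_neg (by omega), h], wt_ones hq hq2,
      if_neg (by omega), if_neg (by omega)]
    ring

end crankFibers

section crankResidue

variable {q : ℝ}

lemma hasSum_wt_fiber (hq : 0 < q) (hq2 : q < 1 / 2) (P : PartMS → Prop) (g : PartMS → ℕ) :
    HasSum (fun j : ℕ => wt q fun s => P s ∧ g s = j) (wt q P) := by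
  let e : (Σ j : ℕ, {s : PartMS // P s ∧ g s = j}) ≃ {s : PartMS // P s} :=
    { toFun := fun s => ⟨s.2.1, s.2.2.1⟩
      invFun := fun s => ⟨g s.1, s.1, s.2, rfl⟩
      left_inv := by
        rintro ⟨j, s, hs, rfl⟩
        rfl
      right_inv := fun s => rfl }
  exact (e.hasSum_iff.mpr (summable_wt hq hq2 _).hasSum).sigma fun j =>
    (summable_wt hq hq2 fun s => P s ∧ g s = j).hasSum

/-- Crank generating function, up to the factor `1 - q`. -/
noncomputable def crankW (q : ℝ) (k : ℕ) : ℝ :=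
  ∑' j : ℕ, q ^ (j * (j + k) + 2 * j + k) * uN q j * uN q (j + k)

/-- Generating function of partitions with crank at most `k`. -/
noncomputable def crankV (q : ℝ) (k : ℕ) : ℝ :=
  ∑' j : ℕ, q ^ (j * (j + k) + j) * uN q j * uN q (j + k)

lemma uN_bounded (hq : 0 < q) (hq1 : q < 1) : ∃ C : ℝ, 0 < C ∧ ∀ n, |uN q n| ≤ C :=
  qP_inv_bounded hq hq1 (self_mul_pow_ne_one hq hq1)

lemma summable_uN (hq : 0 < q) (hq1 : q < 1) (e : ℕ → ℕ) (he : ∀ j, j ≤ e j) (a b : ℕ → ℕ) :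
    Summable fun j : ℕ => q ^ e j * uN q (a j) * uN q (b j) := by
  obtain ⟨C, hC, h⟩ := uN_bounded hq hq1
  refine .of_norm_bounded (((summable_geometric_of_lt_one hq.le hq1).mul_right C).mul_right C)
    fun j => ?_
  rw [norm_mul, norm_mul, norm_pow, Real.norm_of_nonneg hq.le]
  have := pow_le_pow_of_le_one hq.le hq1.le (he j)
  have h1 := h (a j)
  have h2 := h (b j)
  rw [← Real.norm_eq_abs] at h1 h2
  gcongr

lemma wt_crank_nonneg (hq : 0 < q) (hq2 : q < 1 / 2) (k : ℕ) :
    wt q (fun s => (msTop s.1 : ℤ) - s.1.count 1 = k) =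
      (1 - q) * crankW q k + if k = 0 then q else if k = 1 then -q else 0 := by
  refine (hasSum_wt_fiber hq hq2 (fun s => (msTop s.1 : ℤ) - s.1.count 1 = k)
    fun s => s.1.count 1).unique ?_
  refine ((((summable_uN hq (by linarith) (fun j => j * (j + k) + 2 * j + k)
    (fun j => by nlinarith [Nat.zero_le (j * (j + k))]) id (· + k)).hasSum).mul_left (1 - q)).add
    (hasSum_ite_eq (0 : ℕ) (if k = 0 then q else if k = 1 then -q else 0))).congr_eq
    (fun j => ?_) rfl
  rw [wt_congr (P' := fun s => s.1.count 1 = j ∧ msTop s.1 = j + k) fun s => by omega,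
    wt_count_top hq hq2]
  congr 1
  · simp only [id]
    ring
  · by_cases hj : j = 0 <;> simp [hj]

lemma wt_crank_neg (hq : 0 < q) (hq2 : q < 1 / 2) (k : ℕ) (hk : k ≠ 0) :
    wt q (fun s => (msTop s.1 : ℤ) - s.1.count 1 = -(k : ℤ)) = (1 - q) * crankW q k := by
  refine (hasSum_wt_fiber hq hq2 (fun s => (msTop s.1 : ℤ) - s.1.count 1 = -(k : ℤ))
    fun s => msTop s.1).unique ?_
  refine (((summable_uN hq (by linarith) (fun j => j * (j + k) + 2 * j + k)
    (fun j => by nlinarith [Nat.zero_le (j * (j + k))]) id (· + k)).hasSum).mul_left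
    (1 - q)).congr_eq (fun j => ?_) rfl
  rw [wt_congr (P' := fun s => s.1.count 1 = j + k ∧ msTop s.1 = j) fun s => by omega,
    wt_count_top hq hq2, if_neg (by omega), if_neg (by omega), add_zero]
  simp only [id]
  ring

lemma crankV_zero_rec (hq : 0 < q) (hq1 : q < 1) (k : ℕ) :
    q ^ k * crankV q k = crankW q k + q ^ (k + 1) * crankW q (k + 1) := by
  rw [crankV, crankW, crankW, ← tsum_mul_left, ← tsum_mul_left, ← sub_eq_iff_eq_add',
    ← Summable.tsum_sub]
  · rw [Summable.tsum_eq_zero_add]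
    · simp only [mul_zero, zero_mul, zero_add, pow_zero, one_mul, add_zero]
      rw [← mul_assoc, sub_self, zero_add]
      refine tsum_congr fun j => ?_
      rw [← uN_succ hq hq1 j, show j + (k + 1) = j + 1 + k by ring]
      ring
    · refine Summable.sub ?_ ?_
      · exact (summable_uN hq hq1 (fun j => j * (j + k) + j) (fun j => by nlinarith) id
          (· + k)).mul_left _
      · exact summable_uN hq hq1 (fun j => j * (j + k) + 2 * j + k) (fun j => by nlinarith) id
          (· + k)
  · exact (summable_uN hq hq1 (fun j => j * (j + k) + j) (fun j => by nlinarith) id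
      (· + k)).mul_left _
  · exact summable_uN hq hq1 (fun j => j * (j + k) + 2 * j + k) (fun j => by nlinarith) id (· + k)

lemma crankV_succ_rec (hq : 0 < q) (hq1 : q < 1) (k : ℕ) :
    q ^ k * crankV q (k + 1) = q ^ k * crankW q (k + 1) + crankW q k := by
  rw [crankV, crankW, crankW, ← tsum_mul_left, ← tsum_mul_left, ← Summable.tsum_add]
  · refine tsum_congr fun j => ?_
    rw [← uN_succ hq hq1 (j + k)]
    rw [show j + (k + 1) = j + k + 1 by ring]
    ring
  · exact (summable_uN hq hq1 (fun j => j * (j + (k + 1)) + 2 * j + (k + 1))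
      (fun j => by nlinarith) id (· + (k + 1))).mul_left _
  · exact summable_uN hq hq1 (fun j => j * (j + k) + 2 * j + k) (fun j => by nlinarith) id (· + k)

lemma crankV_sub (hq : 0 < q) (hq1 : q < 1) (k : ℕ) :
    crankV q (k + 1) - crankV q k = (1 - q) * crankW q (k + 1) := by
  have h1 := crankV_zero_rec hq hq1 k
  have h2 := crankV_succ_rec hq hq1 k
  refine mul_left_cancel₀ (pow_pos hq k).ne' ?_
  rw [pow_succ] at h1
  linear_combination h2 - h1

lemma crankV_add_const (hq : 0 < q) (hq1 : q < 1) (k : ℕ) :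
    crankV q k + q ^ (k + 1) * crankV q (k + 1) = crankV q 0 + q * crankV q 1 := by
  induction k with
  | zero => simp
  | succ k ih =>
    rw [← ih]
    have h1 := crankV_zero_rec hq hq1 (k + 1)
    have h2 := crankV_succ_rec hq hq1 (k + 1)
    have h3 := crankV_sub hq hq1 k
    rw [pow_succ q (k + 1)] at h1 ⊢
    linear_combination h3 - h1 + q * h2

lemma crankV_tendsto (hq : 0 < q) (hq1 : q < 1) :
    Tendsto (crankV q) atTop (𝓝 (qI q q)⁻¹) := by
  obtain ⟨C, hC, h⟩ := uN_bounded hq hq1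
  have hu : Tendsto (uN q) atTop (𝓝 (qI q q)⁻¹) :=
    (qP_tendsto hq hq1 q).inv₀ (qI_self_ne_zero hq hq1)
  have h1 := tendsto_tsum_of_dominated_convergence (𝓕 := atTop)
    (f := fun k j => q ^ (j * (j + k) + j) * uN q j * uN q (j + k))
    (g := fun j => if j = 0 then (qI q q)⁻¹ else 0) (bound := fun j => q ^ j * C * C)
    (((summable_geometric_of_lt_one hq.le hq1).mul_right C).mul_right C) (fun j => ?_)
    (Eventually.of_forall fun k j => ?_)
  · rwa [tsum_ite_eq] at h1
  · rcases j with _ | j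
    · simpa [uN_zero] using hu
    · have hp : Tendsto (fun k : ℕ => q ^ k) atTop (𝓝 0) :=
        tendsto_pow_atTop_nhds_zero_of_lt_one hq.le hq1
      rw [if_neg (by omega)]
      refine squeeze_zero_norm (a := fun k => q ^ k * C * C) (fun k => ?_)
        (by simpa using (hp.mul_const C).mul_const C)
      rw [norm_mul, norm_mul, norm_pow, Real.norm_of_nonneg hq.le]
      have h1 := h (j + 1)
      have h2 := h (j + 1 + k)
      rw [← Real.norm_eq_abs] at h1 h2
      have : q ^ ((j + 1) * (j + 1 + k) + (j + 1)) ≤ q ^ k :=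
        pow_le_pow_of_le_one hq.le hq1.le (by nlinarith)
      gcongr
  · rw [norm_mul, norm_mul, norm_pow, Real.norm_of_nonneg hq.le]
    have h1 := h j
    have h2 := h (j + k)
    rw [← Real.norm_eq_abs] at h1 h2
    have : q ^ (j * (j + k) + j) ≤ q ^ j := pow_le_pow_of_le_one hq.le hq1.le (by nlinarith)
    gcongr

lemma crankV_add (hq : 0 < q) (hq1 : q < 1) (k : ℕ) :
    crankV q k + q ^ (k + 1) * crankV q (k + 1) = (qI q q)⁻¹ := by
  have hV := crankV_tendsto hq hq1
  have hp : Tendsto (fun k : ℕ => q ^ (k + 1)) atTop (𝓝 0) :=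
    (tendsto_add_atTop_iff_nat 1).mpr (tendsto_pow_atTop_nhds_zero_of_lt_one hq.le hq1)
  have h := hV.add (hp.mul ((tendsto_add_atTop_iff_nat 1).mpr hV))
  rw [zero_mul, add_zero] at h
  rw [crankV_add_const hq hq1]
  exact tendsto_nhds_unique (tendsto_const_nhds.congr fun k =>
    (crankV_add_const hq hq1 k).symm) h

lemma SS_one (hq : 0 < q) (hq1 : q < 1) {m : ℝ} (hm : 0 ≤ m) :
    SS q 1 m = q ^ m * (1 - SS q 1 (m + 1)) := by
  rw [SS, (summable_SS hq hq1 (by norm_num) hm).tsum_eq_zero_add, SS, mul_one_sub,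
    ← tsum_mul_left, sub_eq_add_neg (q ^ m), ← tsum_neg]
  congr 1
  · norm_num
  · refine tsum_congr fun n => ?_
    rw [mul_left_comm, ← Real.rpow_add hq, pow_succ, mul_neg_one, neg_mul]
    push_cast
    ring_nf

lemma crankV_eq (hq : 0 < q) (hq2 : q < 1 / 2) (k : ℕ) :
    crankV q k = (qI q q)⁻¹ * (1 - SS q 1 (k + 1)) := by
  have hq1 : q < 1 := by linarith
  set P := (qI q q)⁻¹
  obtain ⟨C, hC, h⟩ := bounded_of_tendsto (crankV_tendsto hq hq1)
  have key : ∀ n k : ℕ, |crankV q k - P * (1 - SS q 1 (k + 1))| ≤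
      (C + |P| * (1 + (1 - q)⁻¹)) * (1 / 2) ^ n := by
    intro n
    induction n with
    | zero =>
      intro k
      rw [pow_zero, mul_one]
      refine (abs_sub _ _).trans (add_le_add (h k) ?_)
      rw [abs_mul]
      refine mul_le_mul_of_nonneg_left ((abs_sub _ _).trans ?_) (abs_nonneg _)
      rw [abs_one]
      have := abs_SS_le hq hq1 (r := 1) le_rfl (m := (k : ℝ) + 1) (by positivity)
      linarith
    | succ n ih =>
      intro k
      have h1 := ih (k + 1)
      have h2 := crankV_add hq hq1 k
      have h3 := SS_one hq hq1 (m := (k : ℝ) + 1) (by positivity)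
      rw [← Nat.cast_succ, Real.rpow_natCast] at h3
      have e : crankV q k - P * (1 - SS q 1 (k + 1)) =
          -q ^ (k + 1) * (crankV q (k + 1) - P * (1 - SS q 1 (((k + 1 : ℕ) : ℝ) + 1))) := by
        rw [← Nat.cast_succ, h3, Nat.succ_eq_add_one]
        linear_combination h2
      rw [e, abs_mul, abs_neg, abs_of_pos (pow_pos hq _), pow_succ (1 / 2 : ℝ), ← mul_assoc,
        mul_comm]
      exact mul_le_mul h1 ((pow_le_of_le_one hq.le hq1.le (by omega)).trans hq2.le)
        (pow_pos hq _).le ((abs_nonneg _).trans h1)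
  have h0 : Tendsto (fun n : ℕ => (C + |P| * (1 + (1 - q)⁻¹)) * (1 / 2 : ℝ) ^ n) atTop
      (𝓝 ((C + |P| * (1 + (1 - q)⁻¹)) * 0)) :=
    (tendsto_pow_atTop_nhds_zero_of_lt_one (by norm_num) (by norm_num)).const_mul _
  rw [mul_zero] at h0
  have := ge_of_tendsto h0 (Eventually.of_forall fun n => key n k)
  exact sub_eq_zero.mp (abs_eq_zero.mp (le_antisymm this (abs_nonneg _)))

lemma crankW_eq (hq : 0 < q) (hq2 : q < 1 / 2) (k : ℕ) :
    (1 - q) * crankW q k = (qI q q)⁻¹ * (SS q 1 k - SS q 1 (k + 1)) := by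
  have hq1 : q < 1 := by linarith
  rcases k with _ | k
  · have h1 := crankV_zero_rec hq hq1 0
    have h2 := crankV_succ_rec hq hq1 0
    have h3 := SS_one hq hq1 (m := 0) le_rfl
    have h4 := SS_one hq hq1 (m := 1) (by norm_num)
    rw [crankV_eq hq hq2] at h1 h2
    simp only [pow_zero, zero_add, pow_one, one_mul, Nat.cast_zero, Nat.cast_one,
      Real.rpow_zero, Real.rpow_one] at *
    linear_combination q * h2 - h1 - (qI q q)⁻¹ * (h3 - h4)
  · rw [← crankV_sub hq hq1, crankV_eq hq hq2, crankV_eq hq hq2]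
    push_cast
    ring

lemma wt_crank_eq (hq : 0 < q) (hq2 : q < 1 / 2) (k : ℤ) :
    wt q (fun s => (msTop s.1 : ℤ) - s.1.count 1 = k) =
      (qI q q)⁻¹ * (SS q 1 |(k : ℝ)| - SS q 1 (|(k : ℝ)| + 1)) +
        if k = 0 then q else if k = 1 then -q else 0 := by
  rcases le_or_gt 0 k with hk | hk
  · obtain ⟨k, rfl⟩ := Int.eq_ofNat_of_zero_le hk
    rw [wt_crank_nonneg hq hq2, crankW_eq hq hq2, Int.cast_natCast, Nat.abs_cast]
    norm_cast
  · obtain ⟨m, rfl⟩ : ∃ m : ℕ, k = -((m + 1 : ℕ) : ℤ) := ⟨(-k - 1).toNat, by omega⟩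
    rw [wt_crank_neg hq hq2 _ (by omega), crankW_eq hq hq2, Int.cast_neg, abs_neg,
      Int.cast_natCast, Nat.abs_cast, if_neg (by omega), if_neg (by omega), add_zero]

/-- The generating function of partitions with crank in a residue class modulo `11`. -/
lemma wt_crank_residue (hq : 0 < q) (hq2 : q < 1 / 2) {b : ℤ} (hb : 0 ≤ b) (hb' : b < 11) :
    wt q (fun s => ((msTop s.1 : ℤ) - s.1.count 1) % 11 = b) * qI q q =
      LL q 1 b - LL q 1 (b - 1) + (if b = 0 then q else if b = 1 then -q else 0) * qI q q := by
  have hE := qI_self_ne_zero hq (by linarith : q < 1)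
  have h1 := hasSum_wt_residue hq hq2 (fun s => (msTop s.1 : ℤ) - s.1.count 1) hb hb'
  have h2 := ((hasSum_SS_residue hq (by linarith) (r := 1) le_rfl hb hb').mul_left
    (qI q q)⁻¹).add (hasSum_ite_eq (0 : ℤ) (if b = 0 then q else if b = 1 then -q else 0))
  have h3 := h1.unique (h2.congr_eq (fun j => ?_) rfl)
  · rw [h3, add_mul, mul_right_comm, inv_mul_cancel₀ hE, one_mul]
  · rw [wt_crank_eq hq hq2]
    push_cast
    congr 1
    by_cases hj : j = 0
    · simp [hj]
    · rw [if_neg hj, if_neg (by omega), if_neg (by omega)]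

end crankResidue

section seriesRelations

variable {q : ℝ}

lemma summable_LL (hq : 0 < q) (hq1 : q < 1) {r : ℕ} (hr : 0 < r) (b : ℝ) :
    Summable fun n : ℤ => (-1) ^ n * q ^ ((n : ℝ) * (r * n + 1) / 2 + b * n) /
      (1 - q ^ (11 * (n : ℝ))) := by
  have hr' : (0 : ℝ) < r := by exact_mod_cast hr
  have hb := ((summable_quad hq hq1 (c := (r : ℝ) / 2) (by positivity) (1 / 2 + b) 0).mul_right
    (1 - q ^ ((11 : ℝ) / 2))⁻¹)
  refine hb.of_norm_bounded fun k => ?_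
  rw [Real.norm_eq_abs]
  have e : (r : ℝ) / 2 * k ^ 2 + (1 / 2 + b) * k + 0 = (k : ℝ) * (r * k + 1) / 2 + b * k := by ring
  rw [e]
  rw [div_eq_mul_inv, abs_mul, abs_mul, abs_zpow, abs_neg, abs_one, one_zpow, one_mul,
    abs_of_pos (Real.rpow_pos_of_pos hq _)]
  refine mul_le_mul_of_nonneg_left ?_ (Real.rpow_pos_of_pos hq _).le
  by_cases hk : k = 0
  · rw [hk, Int.cast_zero, mul_zero, Real.rpow_zero, sub_self, inv_zero, abs_zero]
    have h0 : q ^ ((11 : ℝ) / 2) < 1 := Real.rpow_lt_one hq.le hq1 (by norm_num)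
    exact inv_nonneg.mpr (by linarith)
  · refine inv_one_sub_rpow_le hq hq1 ?_
    have := half_le_abs hk (e := 0) (by norm_num)
    simpa using this

/-- Shifting the parameter of `LL` by `11`. -/
lemma LL_sub_shift (hq : 0 < q) (hq1 : q < 1) {r : ℕ} (hr : 0 < r) {b T : ℝ}
    (hT : HasSum (fun n : ℤ => (-1) ^ n * q ^ ((n : ℝ) * (r * n + 1) / 2 + b * n)) T) :
    LL q r b = LL q r (b + 11) + T - 1 := by
  have h1 := ((summable_LL hq hq1 hr b).hasSum.sub (summable_LL hq hq1 hr (b + 11)).hasSum)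
  have h2 := (hT.sub (hasSum_ite_eq (0 : ℤ) (1 : ℝ)))
  have h := h1.unique (h2.congr_eq (fun n => ?_) rfl)
  · unfold LL
    linear_combination h
  · by_cases hn : n = 0
    · simp [hn]
    · rw [if_neg hn, sub_zero]
      have hX : 1 - q ^ (11 * (n : ℝ)) ≠ 0 := by
        rw [sub_ne_zero]
        intro h0
        have : 11 * (n : ℝ) = 0 := by
          rw [← Real.rpow_zero q] at h0
          exact ((Real.rpow_right_inj hq hq1.ne).mp h0).symm
        simp [hn] at this
      have e : (n : ℝ) * (r * n + 1) / 2 + (b + 11) * n =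
        ((n : ℝ) * (r * n + 1) / 2 + b * n) + 11 * n := by ring
      rw [e, Real.rpow_add hq _ (11 * (n : ℝ))]
      generalize q ^ (11 * (n : ℝ)) = X at *
      generalize q ^ ((n : ℝ) * (r * n + 1) / 2 + b * n) = Y at *
      field_simp

lemma LL_reflect (hq : 0 < q) (hq1 : q < 1) {r : ℕ} (hr : 1 ≤ r) {b : ℝ} (hb : -1 ≤ b)
    (hb' : b ≤ 11) : LL q r (10 - b) = -LL q r b := by
  rw [LL_eq_GG hq hq1 hr hb hb', LL_eq_GG hq hq1 hr (by linarith) (by linarith)]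
  ring_nf

lemma hasSum_pent (hq : 0 < q) (hq1 : q < 1) :
    HasSum (fun n : ℤ => (-1) ^ n * q ^ ((n : ℝ) * (3 * n + 1) / 2)) (qI q q) := by
  have h := (pent_hasSum hq hq1).mul_left (q ^ (-(1 : ℝ) / 24))
  refine h.congr_eq (fun n => ?_) ?_
  · rw [mul_left_comm, ← Real.rpow_add hq]
    ring_nf
  · rw [← mul_assoc, ← Real.rpow_add hq]
    norm_num

lemma hasSum_pent_two (hq : 0 < q) (hq1 : q < 1) :
    HasSum (fun n : ℤ => (-1) ^ n * q ^ ((n : ℝ) * (3 * n + 1) / 2 + 2 * n)) (-(q⁻¹ * qI q q)) := by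
  have h' := (((Equiv.neg ℤ).trans (Equiv.addRight (-1))).hasSum_iff.mpr
    (hasSum_pent hq hq1)).mul_left q⁻¹
  have h'' := h'.neg
  refine h''.congr_eq (fun n => ?_) rfl
  simp only [Function.comp_apply, Equiv.trans_apply, Equiv.neg_apply, Equiv.coe_addRight]
  have e1 : (-1 : ℝ) ^ (-n + -1) = -(-1) ^ n := by
    rw [zpow_add₀ (by norm_num), zpow_neg, ← inv_zpow]
    norm_num
  rw [e1, mul_left_comm, ← Real.rpow_neg_one q, ← Real.rpow_add hq]
  push_cast
  rw [neg_mul, neg_neg]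
  ring_nf

lemma hasSum_triangular (hq : 0 < q) (hq1 : q < 1) :
    HasSum (fun n : ℤ => (-1) ^ n * q ^ ((n : ℝ) * (n + 1) / 2)) 0 := by
  have h := jtp hq hq1 hq.ne'
  rw [div_self hq.ne', show qI q 1 = 0 by rw [qI_succ hq hq1]; simp] at h
  refine h.congr_eq (fun n => ?_) (by ring)
  rw [neg_eq_neg_one_mul q, mul_zpow, ← Real.rpow_intCast q, mul_left_comm, ← Real.rpow_add hq]
  ring_nf

end seriesRelations

section generatingFunctions

variable {q : ℝ}

/-- Generating function of partitions by rank modulo `11`. -/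
noncomputable def rankGF (b : ℤ) (q : ℝ) : ℝ := wt q fun s => msRank s.1 % 11 = b

/-- Generating function of partitions by crank modulo `11`. -/
noncomputable def crankGF (b : ℤ) (q : ℝ) : ℝ :=
  wt q fun s => ((msTop s.1 : ℤ) - s.1.count 1) % 11 = b

lemma hasSum_rankCount (hq : 0 < q) (hq2 : q < 1 / 2) {b : ℤ} (hb : 0 ≤ b) (hb' : b < 11) :
    HasSum (fun n => (rankCount b 11 n : ℝ) * q ^ n) (rankGF b q) := by
  classical
  rw [rankGF, wt_eq_tsum]
  refine hasSum_partition_count hq hq2 (fun n π => partitionRank π % 11 = b % 11) fun n π => ?_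
  rw [Int.emod_eq_of_lt hb hb']
  rfl

lemma hasSum_crankCard (hq : 0 < q) (hq2 : q < 1 / 2) {b : ℤ} (hb : 0 ≤ b) (hb' : b < 11) :
    HasSum (fun n => (((Finset.univ.filter fun π : Nat.Partition n =>
      partitionCrank π % 11 = b % 11).card : ℕ) : ℝ) * q ^ n) (crankGF b q) := by
  classical
  rw [crankGF, wt_eq_tsum]
  refine hasSum_partition_count hq hq2 (fun n π => partitionCrank π % 11 = b % 11) fun n π => ?_
  rw [Int.emod_eq_of_lt hb hb']
  have : ((msTop π.parts : ℤ) - π.parts.count 1) = partitionCrank π := by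
    unfold msTop partitionCrank
    split_ifs with h <;> simp [h]
  rw [← this]
  rfl

lemma LL_five (hq : 0 < q) (hq1 : q < 1) : LL q 3 5 = 0 := by
  have h := LL_reflect hq hq1 (r := 3) (b := 5) (by norm_num) (by norm_num) (by norm_num)
  norm_num at h
  linarith

lemma rank_gen (hq : 0 < q) (hq2 : q < 1 / 2) :
    rankGF 0 q * qI q q = 1 - 2 * LL q 3 10 ∧
    rankGF 1 q * qI q q = LL q 3 1 + LL q 3 10 ∧
    rankGF 2 q * qI q q = LL q 3 13 - q⁻¹ * qI q q - 1 - LL q 3 1 ∧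
    rankGF 3 q * qI q q = -LL q 3 7 - LL q 3 13 + q⁻¹ * qI q q + 1 ∧
    rankGF 4 q * qI q q = LL q 3 4 + LL q 3 7 ∧
    rankGF 5 q * qI q q = -LL q 3 4 := by
  have hq1 : q < 1 := by linarith
  have h0 := wt_rank_residue hq hq2 (b := 0) (by norm_num) (by norm_num)
  have h1 := wt_rank_residue hq hq2 (b := 1) (by norm_num) (by norm_num)
  have h2 := wt_rank_residue hq hq2 (b := 2) (by norm_num) (by norm_num)
  have h3 := wt_rank_residue hq hq2 (b := 3) (by norm_num) (by norm_num)
  have h4 := wt_rank_residue hq hq2 (b := 4) (by norm_num) (by norm_num)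
  have h5 := wt_rank_residue hq hq2 (b := 5) (by norm_num) (by norm_num)
  have r0 := LL_reflect hq hq1 (r := 3) (b := 0) (by norm_num) (by norm_num) (by norm_num)
  have r11 := LL_reflect hq hq1 (r := 3) (b := 11) (by norm_num) (by norm_num) (by norm_num)
  have r3 := LL_reflect hq hq1 (r := 3) (b := 3) (by norm_num) (by norm_num) (by norm_num)
  have s0 := LL_sub_shift hq hq1 (r := 3) (by norm_num) (b := 0)
    ((hasSum_pent hq hq1).congr_eq (fun n => by norm_num) rfl)
  have s2 := LL_sub_shift hq hq1 (r := 3) (by norm_num) (b := 2)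
    ((hasSum_pent_two hq hq1).congr_eq (fun n => by norm_num) rfl)
  have l5 := LL_five hq hq1
  unfold rankGF
  norm_num at h0 h1 h2 h3 h4 h5 r0 r11 r3 s0 s2 ⊢
  refine ⟨?_, ?_, ?_, ?_, ?_, ?_⟩ <;> linarith

lemma crank_gen (hq : 0 < q) (hq2 : q < 1 / 2) :
    crankGF 0 q * qI q q = 1 + 2 * LL q 1 0 + q * qI q q ∧
    crankGF 1 q * qI q q = LL q 1 1 - LL q 1 0 - q * qI q q := by
  have hq1 : q < 1 := by linarith
  have h0 := wt_crank_residue hq hq2 (b := 0) (by norm_num) (by norm_num)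
  have h1 := wt_crank_residue hq hq2 (b := 1) (by norm_num) (by norm_num)
  have r11 := LL_reflect hq hq1 (r := 1) (b := 11) (by norm_num) (by norm_num) (by norm_num)
  have s0 := LL_sub_shift hq hq1 (r := 1) (by norm_num) (b := 0)
    ((hasSum_triangular hq hq1).congr_eq (fun n => by norm_num) rfl)
  unfold crankGF
  norm_num at h0 h1 r11 s0 ⊢
  constructor <;> linarith

end generatingFunctions

section powerSeries

/-- `F` is given on `(0, 1)` by a power series with nonnegative coefficients. -/
def NN (F : ℝ → ℝ) : Prop :=
  ∃ c : ℕ → ℝ, (∀ n, 0 ≤ c n) ∧ ∀ y, 0 < y → y < 1 → HasSum (fun n => c n * y ^ n) (F y)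

/-- `F` is given on `(0, 1)` by a Laurent series. -/
def AN (F : ℝ → ℝ) : Prop :=
  ∃ K : ℕ, ∃ c : ℕ → ℝ, ∀ y, 0 < y → y < 1 → HasSum (fun n => c n * y ^ n) (y ^ K * F y)

/-- Collecting the terms of a sum of monomials. -/
lemma exists_coeff {ι : Type*} {a : ι → ℝ} {k : ι → ℕ} {F : ℝ → ℝ}
    (h : ∀ y, 0 < y → y < 1 → HasSum (fun i => a i * y ^ k i) (F y)) :
    ∃ c : ℕ → ℝ, (∀ n, c n = ∑' i : k ⁻¹' {n}, a i) ∧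
      ∀ y, 0 < y → y < 1 → HasSum (fun n => c n * y ^ n) (F y) := by
  refine ⟨fun n => ∑' i : k ⁻¹' {n}, a i, fun n => rfl, fun y hy hy1 => ?_⟩
  refine ((h y hy hy1).tsum_fiberwise k).congr_eq (fun n => ?_) rfl
  rw [← tsum_mul_right]
  refine tsum_congr fun i => ?_
  rw [show k i = n from i.2]

lemma NN.of_hasSum {ι : Type*} {a : ι → ℝ} {k : ι → ℕ} {F : ℝ → ℝ} (ha : ∀ i, 0 ≤ a i)
    (h : ∀ y, 0 < y → y < 1 → HasSum (fun i => a i * y ^ k i) (F y)) : NN F := by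
  obtain ⟨c, hc, hF⟩ := exists_coeff h
  exact ⟨c, fun n => by rw [hc]; exact tsum_nonneg fun i => ha i, hF⟩

lemma AN.of_hasSum {ι : Type*} {a : ι → ℝ} {k : ι → ℕ} {F : ℝ → ℝ}
    (h : ∀ y, 0 < y → y < 1 → HasSum (fun i => a i * y ^ k i) (F y)) : AN F := by
  obtain ⟨c, -, hF⟩ := exists_coeff h
  exact ⟨0, c, fun y hy hy1 => by simpa using hF y hy hy1⟩

lemma NN.an {F : ℝ → ℝ} (h : NN F) : AN F := by
  obtain ⟨c, -, hF⟩ := h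
  exact ⟨0, c, fun y hy hy1 => by simpa using hF y hy hy1⟩

lemma NN.congr {F G : ℝ → ℝ} (h : NN F) (e : ∀ y, 0 < y → y < 1 → G y = F y) : NN G := by
  obtain ⟨c, hc, hF⟩ := h
  exact ⟨c, hc, fun y hy hy1 => by rw [e y hy hy1]; exact hF y hy hy1⟩

lemma AN.congr {F G : ℝ → ℝ} (h : AN F) (e : ∀ y, 0 < y → y < 1 → G y = F y) : AN G := by
  obtain ⟨K, c, hF⟩ := h
  exact ⟨K, c, fun y hy hy1 => by rw [e y hy hy1]; exact hF y hy hy1⟩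

lemma NN.monomial (k : ℕ) : NN fun y => y ^ k :=
  .of_hasSum (ι := Unit) (a := fun _ => 1) (k := fun _ => k) (fun _ => zero_le_one)
    fun y _ _ => by simp

lemma NN.const {a : ℝ} (ha : 0 ≤ a) : NN fun _ => a :=
  .of_hasSum (ι := Unit) (a := fun _ => a) (k := fun _ => 0) (fun _ => ha)
    fun y _ _ => by simp

lemma AN.const (a : ℝ) : AN fun _ => a :=
  .of_hasSum (ι := Unit) (a := fun _ => a) (k := fun _ => 0)
    fun y _ _ => by simp

lemma hasSum_mul_coeff {c d : ℕ → ℝ} {y A B : ℝ} (h1 : HasSum (fun n => c n * y ^ n) A)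
    (h2 : HasSum (fun n => d n * y ^ n) B) :
    HasSum (fun i : ℕ × ℕ => c i.1 * d i.2 * y ^ (i.1 + i.2)) (A * B) :=
  (h1.mul h2 (summable_mul_of_summable_norm h1.summable.norm h2.summable.norm)).congr_eq
    (fun i => by rw [pow_add]; ring) rfl

lemma NN.mul {F G : ℝ → ℝ} (h1 : NN F) (h2 : NN G) : NN fun y => F y * G y := by
  obtain ⟨c, hc, hF⟩ := h1
  obtain ⟨d, hd, hG⟩ := h2
  exact NN.of_hasSum (ι := ℕ × ℕ) (a := fun i => c i.1 * d i.2) (k := fun i => i.1 + i.2)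
    (fun i => mul_nonneg (hc i.1) (hd i.2)) fun y hy hy1 =>
      hasSum_mul_coeff (hF y hy hy1) (hG y hy hy1)

lemma NN.pow {F : ℝ → ℝ} (h : NN F) (k : ℕ) : NN fun y => F y ^ k := by
  induction k with
  | zero => exact (NN.const zero_le_one).congr fun y _ _ => pow_zero _
  | succ k ih => exact (ih.mul h).congr fun y _ _ => pow_succ _ _

lemma AN.mul {F G : ℝ → ℝ} (h1 : AN F) (h2 : AN G) : AN fun y => F y * G y := by
  obtain ⟨K, c, hF⟩ := h1
  obtain ⟨K', d, hG⟩ := h2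
  obtain ⟨e, -, he⟩ := exists_coeff fun y hy hy1 => hasSum_mul_coeff (hF y hy hy1) (hG y hy hy1)
  exact ⟨K + K', e, fun y hy hy1 => (he y hy hy1).congr_eq (fun _ => rfl) (by rw [pow_add]; ring)⟩

lemma AN.pow {F : ℝ → ℝ} (h : AN F) (k : ℕ) : AN fun y => F y ^ k := by
  induction k with
  | zero => exact (AN.const 1).congr fun y _ _ => pow_zero _
  | succ k ih => exact (ih.mul h).congr fun y _ _ => pow_succ _ _

lemma AN.zpow {F : ℝ → ℝ} (h : AN F) (h' : AN fun y => (F y)⁻¹) (k : ℤ) :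
    AN fun y => F y ^ k := by
  obtain ⟨n, rfl | rfl⟩ := k.eq_nat_or_neg
  · exact (h.pow n).congr fun y _ _ => zpow_natCast _ _
  · exact (h'.pow n).congr fun y _ _ => by rw [zpow_neg, zpow_natCast, inv_pow]

lemma AN.monomial (k : ℤ) : AN fun y => y ^ k :=
  .zpow ((NN.monomial 1).an.congr fun y _ _ => (pow_one y).symm)
    ⟨1, fun n => if n = 0 then 1 else 0, fun y hy _ => by
      rw [pow_one, mul_inv_cancel₀ hy.ne']
      refine (hasSum_ite_eq (0 : ℕ) (1 : ℝ)).congr_eq (fun n => ?_) rfl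
      split_ifs with h <;> simp [h]⟩ k

lemma AN.add {F G : ℝ → ℝ} (h1 : AN F) (h2 : AN G) : AN fun y => F y + G y := by
  obtain ⟨K, c, hF⟩ := h1
  obtain ⟨K', d, hG⟩ := h2
  have h : ∀ y : ℝ, 0 < y → y < 1 → HasSum (fun i : ℕ ⊕ ℕ =>
      (Sum.elim c d i) * y ^ (Sum.elim (fun n => n + K') (fun n => n + K) i))
      (y ^ (K + K') * (F y + G y)) := fun y hy hy1 => by
    have := HasSum.sum (f := fun i : ℕ ⊕ ℕ => (Sum.elim c d i) *
      y ^ (Sum.elim (fun n => n + K') (fun n => n + K) i))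
      (((hF y hy hy1).mul_right (y ^ K')).congr_eq (fun n => by simp [pow_add, mul_assoc]) rfl)
      (((hG y hy hy1).mul_right (y ^ K)).congr_eq (fun n => by simp [pow_add, mul_assoc]) rfl)
    exact this.congr_eq (fun _ => rfl) (by rw [pow_add]; ring)
  obtain ⟨e, -, he⟩ := exists_coeff h
  exact ⟨K + K', e, he⟩

/-- A sum of power series with nonnegative coefficients. -/
lemma NN.of_hasSum_nn {F : ℝ → ℝ} {G : ℕ → ℝ → ℝ} (hG : ∀ j, NN (G j))
    (h : ∀ y, 0 < y → y < 1 → HasSum (fun j => G j y) (F y)) : NN F := by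
  choose c hc hs using hG
  refine .of_hasSum (ι := Σ _ : ℕ, ℕ) (a := fun i => c i.1 i.2) (k := fun i => i.2)
    (fun i => hc i.1 i.2) fun y hy hy1 => ?_
  have hs' : Summable fun i : Σ _ : ℕ, ℕ => c i.1 i.2 * y ^ i.2 := by
    rw [summable_sigma_of_nonneg fun i => mul_nonneg (hc _ _) (pow_pos hy _).le]
    refine ⟨fun j => (hs j y hy hy1).summable, ?_⟩
    refine (h y hy hy1).summable.congr fun j => ?_
    exact (hs j y hy hy1).tsum_eq.symm
  have := hs'.hasSum.sigma fun j => hs j y hy hy1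
  exact (this.unique (h y hy hy1)) ▸ hs'.hasSum

/-- `g` is `q ^ k` times a Laurent series in `q ^ 11`. -/
def LC (k : ℤ) (g : ℝ → ℝ) : Prop :=
  ∃ F, AN F ∧ ∀ q, 0 < q → q < 1 → g q = q ^ k * F (q ^ 11)

/-- `g` is a Laurent series in `q` without exponents congruent to `8` modulo `11`. -/
def Rem (g : ℝ → ℝ) : Prop :=
  ∃ K : ℕ, ∃ d : ℕ → ℝ, (∀ n, n % 11 = 8 → d n = 0) ∧
    ∀ q, 0 < q → q < 1 → HasSum (fun n => d n * q ^ n) (q ^ (11 * K) * g q)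

lemma LC.congr {k : ℤ} {f g : ℝ → ℝ} (h : LC k f) (e : ∀ q, 0 < q → q < 1 → g q = f q) :
    LC k g := by
  obtain ⟨F, hF, hf⟩ := h
  exact ⟨F, hF, fun q hq hq1 => by rw [e q hq hq1, hf q hq hq1]⟩

lemma LC.mul {k k' : ℤ} {f g : ℝ → ℝ} (h1 : LC k f) (h2 : LC k' g) :
    LC (k + k') fun q => f q * g q := by
  obtain ⟨F, hF, hf⟩ := h1
  obtain ⟨G, hG, hg⟩ := h2
  exact ⟨_, hF.mul hG, fun q hq hq1 => by dsimp only; rw [hf q hq hq1, hg q hq hq1, zpow_add₀ hq.ne']; ring⟩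

lemma LC.pow {k : ℤ} {f : ℝ → ℝ} (h : LC k f) (n : ℕ) : LC (k * n) fun q => f q ^ n := by
  obtain ⟨F, hF, hf⟩ := h
  exact ⟨_, hF.pow n, fun q hq hq1 => by dsimp only; rw [hf q hq hq1, mul_pow, zpow_mul, zpow_natCast]⟩

lemma LC.zpow {k k' : ℤ} {f : ℝ → ℝ} (h : LC k f) (h' : LC k' fun q => (f q)⁻¹) (hk : k' = -k)
    (n : ℤ) : LC (k * n) fun q => f q ^ n := by
  subst hk
  obtain ⟨n, rfl | rfl⟩ := n.eq_nat_or_neg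
  · exact (h.pow n).congr fun y _ _ => zpow_natCast _ _
  · have := (h'.pow n).congr (g := fun q => f q ^ (-(n : ℤ))) fun y _ _ => by
      rw [zpow_neg, zpow_natCast, inv_pow]
    rwa [neg_mul, ← mul_neg] at this

lemma LC.shift {k k' : ℤ} {f : ℝ → ℝ} (h : LC k f) (hk : (k - k') % 11 = 0) : LC k' f := by
  obtain ⟨F, hF, hf⟩ := h
  obtain ⟨j, hj⟩ := Int.dvd_of_emod_eq_zero hk
  refine ⟨_, (AN.monomial j).mul hF, fun q hq hq1 => ?_⟩
  rw [hf q hq hq1, show k = k' + 11 * j by omega, zpow_add₀ hq.ne', zpow_mul,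
    show q ^ (11 : ℤ) = q ^ 11 from zpow_natCast q 11]
  ring

lemma LC.add {k : ℤ} {f g : ℝ → ℝ} (h1 : LC k f) (h2 : LC k g) : LC k fun q => f q + g q := by
  obtain ⟨F, hF, hf⟩ := h1
  obtain ⟨G, hG, hg⟩ := h2
  exact ⟨_, hF.add hG, fun q hq hq1 => by dsimp only; rw [hf q hq hq1, hg q hq hq1]; ring⟩

lemma LC.const (a : ℝ) : LC 0 fun _ => a := ⟨_, AN.const a, fun q _ _ => by simp⟩

lemma LC.const_mul {k : ℤ} {f : ℝ → ℝ} (a : ℝ) (h : LC k f) : LC k fun q => a * f q := by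
  simpa using (LC.const a).mul h

lemma LC.rem {k : ℤ} {f : ℝ → ℝ} (h : LC k f) (hk : k % 11 ≠ 8) : Rem f := by
  obtain ⟨F, ⟨K, c, hF⟩, hf⟩ := h.shift (k' := k % 11) (by omega)
  obtain ⟨r, hr⟩ : ∃ r : ℕ, k % 11 = r := ⟨(k % 11).toNat, by omega⟩
  have h : ∀ q : ℝ, 0 < q → q < 1 → HasSum (fun n : ℕ => c n * q ^ (11 * n + r))
      (q ^ (11 * K) * f q) := fun q hq hq1 => by
    refine ((hF (q ^ 11) (by positivity) (pow_lt_one₀ hq.le hq1 (by norm_num))).mul_right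
      (q ^ r)).congr_eq (fun n => ?_) ?_
    · rw [pow_add, pow_mul, mul_assoc]
    · rw [hf q hq hq1, hr, zpow_natCast, pow_mul]
      ring
  obtain ⟨d, hd, hs⟩ := exists_coeff h
  refine ⟨K, d, fun n hn => ?_, hs⟩
  rw [hd]
  have : IsEmpty ((fun n : ℕ => 11 * n + r) ⁻¹' {n}) := by
    refine ⟨fun ⟨i, hi⟩ => ?_⟩
    have : 11 * i + r = n := hi
    omega
  exact tsum_empty

lemma Rem.congr {f g : ℝ → ℝ} (h : Rem f) (e : ∀ q, 0 < q → q < 1 → g q = f q) : Rem g := by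
  obtain ⟨K, d, h0, hd⟩ := h
  exact ⟨K, d, h0, fun q hq hq1 => by rw [e q hq hq1]; exact hd q hq hq1⟩

lemma Rem.add {f g : ℝ → ℝ} (h1 : Rem f) (h2 : Rem g) : Rem fun q => f q + g q := by
  obtain ⟨K, c, hc0, hF⟩ := h1
  obtain ⟨K', d, hd0, hG⟩ := h2
  have h : ∀ y : ℝ, 0 < y → y < 1 → HasSum (fun i : ℕ ⊕ ℕ =>
      (Sum.elim c d i) * y ^ (Sum.elim (fun n => n + 11 * K') (fun n => n + 11 * K) i))
      (y ^ (11 * (K + K')) * (f y + g y)) := fun y hy hy1 => by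
    have := HasSum.sum (f := fun i : ℕ ⊕ ℕ => (Sum.elim c d i) *
      y ^ (Sum.elim (fun n => n + 11 * K') (fun n => n + 11 * K) i))
      (((hF y hy hy1).mul_right (y ^ (11 * K'))).congr_eq
        (fun n => by simp [pow_add, mul_assoc]) rfl)
      (((hG y hy hy1).mul_right (y ^ (11 * K))).congr_eq
        (fun n => by simp [pow_add, mul_assoc]) rfl)
    exact this.congr_eq (fun _ => rfl) (by rw [mul_add 11, pow_add]; ring)
  obtain ⟨e, he0, he⟩ := exists_coeff h
  refine ⟨K + K', e, fun n hn => ?_, he⟩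
  rw [he0]
  refine (tsum_congr fun i => ?_).trans tsum_zero
  obtain ⟨i | i, hi⟩ := i
  · have : i + 11 * K' = n := hi
    exact hc0 i (by omega)
  · have : i + 11 * K = n := hi
    exact hd0 i (by omega)

lemma Rem.const_mul {f : ℝ → ℝ} (a : ℝ) (h : Rem f) : Rem fun q => a * f q := by
  obtain ⟨K, d, h0, hd⟩ := h
  refine ⟨K, fun n => a * d n, fun n hn => by dsimp only; rw [h0 n hn, mul_zero], fun q hq hq1 => ?_⟩
  exact ((hd q hq hq1).mul_left a).congr_eq (fun n => by ring) (by ring)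

lemma Rem.sum {ι : Type*} {f : ι → ℝ → ℝ} (s : Finset ι) (h : ∀ i ∈ s, Rem (f i)) :
    Rem fun q => ∑ i ∈ s, f i q := by
  classical
  induction s using Finset.induction_on with
  | empty =>
    exact ((LC.const 0).rem (by norm_num)).congr fun q _ _ => by simp
  | insert i s hi ih =>
    exact ((h i (by simp)).add (ih fun j hj => h j (by simp [hj]))).congr fun q _ _ => by
      rw [Finset.sum_insert hi]

/-- Uniqueness of the coefficients of a power series. -/
lemma coeff_eq_zero {a : ℕ → ℝ} (h : ∀ q : ℝ, 0 < q → q < 1 / 2 → HasSum (fun n => a n * q ^ n) 0)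
    (n : ℕ) : a n = 0 := by
  induction n using Nat.strong_induction_on with
  | _ m ih =>
    have h1 : ∀ q : ℝ, 0 < q → q < 1 / 2 → HasSum (fun n => a (n + m) * q ^ n) 0 := fun q hq hq2 => by
      have h := (hasSum_nat_add_iff' m).mpr (h q hq hq2)
      rw [Finset.sum_eq_zero fun i hi => by rw [ih i (Finset.mem_range.mp hi), zero_mul]] at h
      refine (h.mul_right (q ^ m)⁻¹).congr_eq (fun n => ?_) (by simp)
      rw [pow_add, mul_assoc, mul_assoc, mul_inv_cancel₀ (pow_pos hq m).ne', mul_one]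
    have hb := (h1 (1 / 4) (by norm_num) (by norm_num)).summable.norm
    have hev : ∀ᶠ q : ℝ in 𝓝[>] 0, 0 < q ∧ q < 1 / 4 := Ioo_mem_nhdsGT (by norm_num)
    have ht : Tendsto (fun q : ℝ => ∑' n, a (n + m) * q ^ n) (𝓝[>] 0)
        (𝓝 (∑' n, a (n + m) * 0 ^ n)) := by
      refine tendsto_tsum_of_dominated_convergence hb (fun n => ?_) ?_
      · exact ((continuous_const.mul (continuous_pow n)).tendsto 0).mono_left nhdsWithin_le_nhds
      · filter_upwards [hev] with q hq n
        rw [norm_mul, norm_mul, norm_pow, norm_pow]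
        refine mul_le_mul_of_nonneg_left (pow_le_pow_left₀ (norm_nonneg _) ?_ n) (norm_nonneg _)
        rw [Real.norm_of_nonneg hq.1.le]
        norm_num
        linarith [hq.2]
    have h0 : Tendsto (fun q : ℝ => ∑' n, a (n + m) * q ^ n) (𝓝[>] 0) (𝓝 0) := by
      refine tendsto_const_nhds.congr' ?_
      filter_upwards [hev] with q hq
      exact (h1 q hq.1 (by linarith [hq.2])).tsum_eq.symm
    have := tendsto_nhds_unique ht h0
    rwa [tsum_eq_single 0 fun n hn => by simp [hn], zero_add, pow_zero, mul_one] at this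

/-- The coefficients in the residue class `8` modulo `11` are determined by the terms of that
class. -/
lemma coeff_nonneg {c : ℕ → ℝ} {F R : ℝ → ℝ} (hF : NN F) (hR : Rem R)
    (hc : ∀ q : ℝ, 0 < q → q < 1 / 2 → HasSum (fun n => c n * q ^ n) (q ^ 8 * F (q ^ 11) + R q))
    (n : ℕ) : 0 ≤ c (11 * n + 8) := by
  obtain ⟨b, hb, hs⟩ := hF
  obtain ⟨K, d, hd, hr⟩ := hR
  set u : ℕ → ℝ := fun m => (if 11 * K ≤ m then c (m - 11 * K) - (if m % 11 = 8 then
    b ((m - 11 * K) / 11) else 0) else 0) - d m with hu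
  have key : ∀ q : ℝ, 0 < q → q < 1 / 2 → HasSum (fun m => u m * q ^ m) 0 := fun q hq hq2 => by
    have hq1 : q < 1 := by linarith
    have hinj : Function.Injective fun i : ℕ => 11 * i + 8 := fun i j h => by
      simpa using h
    have h1 : HasSum (fun m => (if m % 11 = 8 then b (m / 11) else 0) * q ^ m)
        (q ^ 8 * F (q ^ 11)) := by
      refine (hinj.hasSum_iff fun m hm => ?_).mp (((hs (q ^ 11) (by positivity)
        (pow_lt_one₀ hq.le hq1 (by norm_num))).mul_left (q ^ 8)).congr_eq (fun i => ?_) rfl)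
      · rw [if_neg, zero_mul]
        intro h
        exact hm ⟨m / 11, by show 11 * (m / 11) + 8 = m; omega⟩
      · show (if (11 * i + 8) % 11 = 8 then b ((11 * i + 8) / 11) else 0) * q ^ (11 * i + 8) = _
        rw [if_pos (by omega), show (11 * i + 8) / 11 = i by omega, pow_add, pow_mul]
        ring
    have h2 := ((hc q hq hq2).sub h1).mul_right (q ^ (11 * K))
    have hinj2 : Function.Injective fun i : ℕ => i + 11 * K := add_left_injective _
    have h3 : HasSum (fun m => (if 11 * K ≤ m then c (m - 11 * K) - (if m % 11 = 8 then
        b ((m - 11 * K) / 11) else 0) else 0) * q ^ m)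
        ((q ^ 8 * F (q ^ 11) + R q - q ^ 8 * F (q ^ 11)) * q ^ (11 * K)) := by
      refine (hinj2.hasSum_iff fun m hm => ?_).mp (h2.congr_eq (fun i => ?_) rfl)
      · rw [if_neg, zero_mul]
        intro h
        exact hm ⟨m - 11 * K, by show m - 11 * K + 11 * K = m; omega⟩
      · show (if 11 * K ≤ i + 11 * K then c (i + 11 * K - 11 * K) - (if (i + 11 * K) % 11 = 8 then
          b ((i + 11 * K - 11 * K) / 11) else 0) else 0) * q ^ (i + 11 * K) = _
        rw [if_pos (by omega), Nat.add_sub_cancel, Nat.add_mul_mod_self_left, pow_add]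
        ring
    exact (h3.sub (hr q hq hq1)).congr_eq (fun m => by rw [hu]; ring) (by ring)
  have h := coeff_eq_zero key (11 * n + 8 + 11 * K)
  rw [hu] at h
  simp only at h
  rw [if_pos (by omega), Nat.add_sub_cancel, if_pos (by omega), hd _ (by omega),
    show (11 * n + 8) / 11 = n by omega] at h
  linarith [hb n]

end powerSeries

section qBinomial

variable {Q : ℝ}

lemma qI_eq_qP_mul (hQ : 0 < Q) (hQ1 : Q < 1) (w : ℝ) (n : ℕ) :
    qI Q w = qP Q w n * qI Q (w * Q ^ n) := by
  induction n with
  | zero => simp [qP_zero]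
  | succ n ih => rw [ih, qP_succ, qI_succ hQ hQ1 (w * Q ^ n), pow_succ, mul_assoc, mul_assoc]

/-- The `q`-binomial theorem. -/
lemma q_binomial (hQ : 0 < Q) (hQ1 : Q < 1) (a : ℝ) {b : ℝ} (hb : 0 ≤ b) (hb1 : b < 1) :
    HasSum (fun j => qP Q a j / qP Q Q j * b ^ j) (qI Q (a * b) / qI Q b) := by
  obtain ⟨C, hC, hC'⟩ := qP_bounded hQ hQ1 a
  obtain ⟨D, hD, hD'⟩ := qP_inv_bounded hQ hQ1 (self_mul_pow_ne_one hQ hQ1)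
  set c : ℕ → ℝ := fun j => qP Q a j / qP Q Q j with hc
  have hcb : ∀ j, |c j| ≤ C * D := fun j => by
    show |qP Q a j / qP Q Q j| ≤ _
    rw [div_eq_mul_inv, abs_mul]
    exact mul_le_mul (hC' j) (hD' j) (abs_nonneg _) hC.le
  have hs : ∀ x : ℝ, 0 ≤ x → x ≤ b → Summable fun j => c j * x ^ j := fun x hx hxb => by
    refine .of_norm_bounded ((summable_geometric_of_lt_one hx (hxb.trans_lt hb1)).mul_left (C * D))
      fun j => ?_
    rw [norm_mul, norm_pow, Real.norm_of_nonneg hx, Real.norm_eq_abs]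
    exact mul_le_mul_of_nonneg_right (hcb j) (pow_nonneg hx j)
  set f : ℝ → ℝ := fun x => ∑' j, c j * x ^ j with hf
  have hrec : ∀ x : ℝ, 0 ≤ x → x ≤ b → (1 - x) * f x = (1 - a * x) * f (x * Q) := fun x hx hxb => by
    have hxQ : x * Q ≤ x := mul_le_of_le_one_right hx hQ1.le
    have h1 := (hs x hx hxb).hasSum
    have h2 := (hs (x * Q) (by positivity) (hxQ.trans hxb)).hasSum
    have h3 := (hasSum_nat_add_iff' 1).mpr (h1.sub h2)
    have h4 := (h1.mul_left x).sub (h2.mul_left (a * x))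
    have h := h3.unique (h4.congr_eq (fun j => ?_) rfl)
    · simp only [Finset.sum_range_one, pow_zero, sub_self, sub_zero] at h
      rw [hf]
      linear_combination h
    · have hn := qP_ne_zero (self_mul_pow_ne_one hQ hQ1) j
      have hn' := qP_ne_zero (self_mul_pow_ne_one hQ hQ1) (j + 1)
      simp only [hc]
      rw [qP_succ] at hn'
      rw [qP_succ, qP_succ]
      have h0 : 1 - Q * Q ^ j ≠ 0 := right_ne_zero_of_mul hn'
      generalize qP Q Q j = P at *
      rw [mul_pow, mul_pow, pow_succ x, pow_succ' Q]
      generalize Q ^ j = R at *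
      clear hn'
      generalize Q * R = Z at *
      field_simp
  have hit : ∀ n, qP Q b n * f b = qP Q (a * b) n * f (b * Q ^ n) := fun n => by
    induction n with
    | zero => simp [qP_zero]
    | succ n ih =>
      have h := hrec (b * Q ^ n) (by positivity)
        (mul_le_of_le_one_right hb (pow_le_one₀ hQ.le hQ1.le))
      rw [qP_succ, qP_succ, mul_right_comm, ih, pow_succ, ← mul_assoc b]
      linear_combination (qP Q (a * b) n) * h
  have hlim : Tendsto (fun n : ℕ => f (b * Q ^ n)) atTop (𝓝 1) := by
    have h0 : Tendsto (fun n : ℕ => b * Q ^ n) atTop (𝓝 0) := by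
      simpa using (tendsto_pow_atTop_nhds_zero_of_lt_one hQ.le hQ1).const_mul b
    have : Tendsto (fun n : ℕ => f (b * Q ^ n)) atTop (𝓝 (∑' j, c j * 0 ^ j)) := by
      refine tendsto_tsum_of_dominated_convergence (hs b hb le_rfl).norm (fun j => ?_) ?_
      · exact (((continuous_const.mul (continuous_pow j)).tendsto 0).comp h0)
      · refine .of_forall fun n j => ?_
        rw [norm_mul, norm_mul, norm_pow, norm_pow]
        refine mul_le_mul_of_nonneg_left (pow_le_pow_left₀ (norm_nonneg _) ?_ j) (norm_nonneg _)
        rw [Real.norm_of_nonneg hb, Real.norm_of_nonneg (by positivity)]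
        exact mul_le_of_le_one_right hb (pow_le_one₀ hQ.le hQ1.le)
    rwa [tsum_eq_single 0 fun n hn => by simp [hn], pow_zero, mul_one,
      show c 0 = 1 by simp [hc, qP_zero]] at this
  have hb' : qI Q b ≠ 0 := qI_ne_zero hQ hQ1 fun i => by
    have : Q ^ i ≤ 1 := pow_le_one₀ hQ.le hQ1.le
    nlinarith [pow_pos hQ i]
  have hfin : qI Q b * f b = qI Q (a * b) * 1 := by
    refine tendsto_nhds_unique ((qP_tendsto hQ hQ1 b).mul_const (f b)) ?_
    simp only [hit]
    exact (qP_tendsto hQ hQ1 (a * b)).mul hlim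
  refine (hs b hb le_rfl).hasSum.congr_eq (fun _ => rfl) ?_
  show _ = f b
  rw [div_eq_iff hb', ← mul_one (qI Q (a * b)), ← hfin, mul_comm]

end qBinomial

section positiveSeries

lemma NN.inv_one_sub {k : ℕ} (hk : k ≠ 0) : NN fun y => (1 - y ^ k)⁻¹ :=
  .of_hasSum (a := fun _ => 1) (k := fun j : ℕ => k * j) (fun _ => zero_le_one) fun y hy hy1 =>
    (hasSum_geometric_of_lt_one (by positivity) (pow_lt_one₀ hy.le hy1 hk)).congr_eq
      (fun j => by rw [one_mul, pow_mul]) rfl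

lemma NN.inv_qP {k : ℕ} (hk : k ≠ 0) (j : ℕ) : NN fun y => (qP (y ^ 11) (y ^ k) j)⁻¹ := by
  induction j with
  | zero => exact (NN.const zero_le_one).congr fun y _ _ => by rw [qP_zero, inv_one]
  | succ j ih =>
    refine (ih.mul (NN.inv_one_sub (k := k + 11 * j) (by omega))).congr fun y _ _ => ?_
    rw [qP_succ, mul_inv, pow_add, pow_mul]

lemma pow_mul_pow_ne_one {y : ℝ} (hy : 0 < y) (hy1 : y < 1) {k : ℕ} (hk : k ≠ 0) (i : ℕ) :
    y ^ k * (y ^ 11) ^ i ≠ 1 := by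
  rw [← pow_mul, ← pow_add]
  exact (pow_lt_one₀ hy.le hy1 (by omega)).ne

lemma qI_pow_ne_zero {y : ℝ} (hy : 0 < y) (hy1 : y < 1) {k : ℕ} (hk : k ≠ 0) :
    qI (y ^ 11) (y ^ k) ≠ 0 :=
  qI_ne_zero (by positivity) (pow_lt_one₀ hy.le hy1 (by norm_num)) (pow_mul_pow_ne_one hy hy1 hk)

lemma NN.inv_qI {k : ℕ} (hk : k ≠ 0) : NN fun y => (qI (y ^ 11) (y ^ k))⁻¹ := by
  refine .of_hasSum_nn (G := fun j y => (qP (y ^ 11) (y ^ 11) j)⁻¹ * y ^ (k * j))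
    (fun j => (NN.inv_qP (by norm_num) j).mul (.monomial _)) fun y hy hy1 => ?_
  have hQ1 : y ^ 11 < 1 := pow_lt_one₀ hy.le hy1 (by norm_num)
  refine (q_binomial (by positivity) hQ1 0 (pow_nonneg hy.le k)
    (pow_lt_one₀ hy.le hy1 hk)).congr_eq (fun j => ?_) ?_
  · rw [pow_mul, show qP (y ^ 11) 0 j = 1 by simp [qP], one_div]
  · rw [show qI (y ^ 11) (0 * y ^ k) = 1 by simp [qI], one_div]

/-- The theta product of the parameter `y ^ n` in base `y ^ 11`. -/
noncomputable def jN (n : ℕ) (y : ℝ) : ℝ := jj (y ^ 11) (y ^ n)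

lemma jN_eq {y : ℝ} (hy : 0 < y) {n : ℕ} (hn : n ≤ 11) :
    jN n y = qI (y ^ 11) (y ^ n) * qI (y ^ 11) (y ^ (11 - n)) := by
  rw [jN, jj, pow_sub₀ y hy.ne' hn, div_eq_mul_inv]

lemma NN.inv_jN {n : ℕ} (h0 : 0 < n) (hn : n < 11) : NN fun y => (jN n y)⁻¹ :=
  ((NN.inv_qI h0.ne').mul (NN.inv_qI (k := 11 - n) (by omega))).congr fun y hy _ => by
    rw [jN_eq hy hn.le, mul_inv]

/-- The base product. -/
noncomputable def eN (y : ℝ) : ℝ := qI (y ^ 11) (y ^ 11)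

lemma NN.inv_eN : NN fun y => (eN y)⁻¹ := NN.inv_qI (by norm_num)

lemma eN_ne_zero {y : ℝ} (hy : 0 < y) (hy1 : y < 1) : eN y ≠ 0 :=
  qI_pow_ne_zero hy hy1 (by norm_num)

lemma jN_ne_zero {y : ℝ} (hy : 0 < y) (hy1 : y < 1) {n : ℕ} (h0 : 0 < n) (hn : n < 11) :
    jN n y ≠ 0 := by
  rw [jN_eq hy hn.le]
  exact mul_ne_zero (qI_pow_ne_zero hy hy1 h0.ne') (qI_pow_ne_zero hy hy1 (by omega))

lemma NN.eN_div_jN {n : ℕ} (h0 : 0 < n) (hn : n < 11) : NN fun y => eN y * (jN n y)⁻¹ := by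
  refine .of_hasSum_nn (G := fun j y => (qP (y ^ 11) (y ^ 11) j)⁻¹ * y ^ (n * j) *
    (qI (y ^ 11) (y ^ (11 - n + 11 * j)))⁻¹) (fun j => ((NN.inv_qP (by norm_num) j).mul
    (.monomial _)).mul (NN.inv_qI (by omega))) fun y hy hy1 => ?_
  have hQ1 : y ^ 11 < 1 := pow_lt_one₀ hy.le hy1 (by norm_num)
  have hA := qI_pow_ne_zero hy hy1 (k := 11 - n) (by omega)
  refine ((q_binomial (by positivity) hQ1 (y ^ (11 - n)) (pow_nonneg hy.le n)
    (pow_lt_one₀ hy.le hy1 h0.ne')).mul_right (qI (y ^ 11) (y ^ (11 - n)))⁻¹).congr_eq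
    (fun j => ?_) ?_
  · have h := qI_eq_qP_mul (Q := y ^ 11) (by positivity) hQ1 (y ^ (11 - n)) j
    rw [← pow_mul, ← pow_add] at h
    rw [h, mul_inv, pow_mul]
    have := left_ne_zero_of_mul (h ▸ hA)
    field_simp
  · rw [← pow_add, Nat.sub_add_cancel hn.le, jN_eq hy hn.le, eN, mul_inv, div_eq_mul_inv]
    ring

lemma an_eN : AN eN := by
  have hev : ∀ k : ℤ, 2 ∣ k * (3 * k + 1) := fun k => by
    rcases Int.even_or_odd' k with ⟨m, rfl | rfl⟩
    · exact ⟨m * (3 * (2 * m) + 1), by ring⟩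
    · exact ⟨(2 * m + 1) * (3 * m + 2), by ring⟩
  have hpos : ∀ k : ℤ, 0 ≤ k * (3 * k + 1) := fun k => by
    rcases le_or_gt 0 k with h | h
    · positivity
    · nlinarith
  refine AN.of_hasSum (a := fun k : ℤ => (-1) ^ k) (k := fun k : ℤ => (11 * (k * (3 * k + 1) / 2)).toNat)
    fun y hy hy1 => ?_
  refine (hasSum_pent (q := y ^ 11) (by positivity) (pow_lt_one₀ hy.le hy1 (by norm_num))).congr_eq
    (fun k => ?_) rfl
  congr 1
  rw [← Real.rpow_natCast, ← Real.rpow_natCast, ← Real.rpow_mul hy.le]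
  congr 1
  obtain ⟨m, hm⟩ := hev k
  have hm0 := hpos k
  rw [hm, Int.mul_ediv_cancel_left _ two_ne_zero]
  have : (((11 * m).toNat : ℤ) : ℝ) = ((11 * m : ℤ) : ℝ) := by
    rw [Int.toNat_of_nonneg (by omega)]
  have hm' : (k : ℝ) * (3 * k + 1) = 2 * m := by exact_mod_cast hm
  rw [Int.cast_natCast] at this
  rw [this, hm']
  push_cast
  ring

lemma an_jN_mul_eN {n : ℕ} (hn : n ≤ 11) : AN fun y => jN n y * eN y := by
  have hev : ∀ k : ℤ, 2 ∣ k * (k - 1) := fun k => by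
    rcases Int.even_or_odd' k with ⟨m, rfl | rfl⟩
    · exact ⟨m * (2 * m - 1), by ring⟩
    · exact ⟨(2 * m + 1) * m, by ring⟩
  have hpos : ∀ k : ℤ, 0 ≤ 11 * (k * (k - 1)) + 2 * (n * k) := fun k => by
    have h1 : (n : ℤ) ≤ 11 := by exact_mod_cast hn
    rcases le_or_gt 0 k with h | h
    · rcases h.eq_or_lt with rfl | h
      · simp
      · have : 0 ≤ k * (k - 1) := mul_nonneg h.le (by omega)
        positivity
    · nlinarith [mul_nonneg (show (0 : ℤ) ≤ 11 - n by omega) (show 0 ≤ -k by omega)]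
  refine AN.of_hasSum (a := fun k : ℤ => (-1) ^ k)
    (k := fun k : ℤ => (11 * (k * (k - 1) / 2) + n * k).toNat) fun y hy hy1 => ?_
  refine (jtp (Q := y ^ 11) (by positivity) (pow_lt_one₀ hy.le hy1 (by norm_num))
    (pow_pos hy n).ne').congr_eq (fun k => ?_) rfl
  rw [neg_eq_neg_one_mul (y ^ n), mul_zpow, mul_left_comm]
  congr 1
  rw [← Real.rpow_intCast, ← Real.rpow_natCast, ← Real.rpow_natCast, ← Real.rpow_natCast,
    ← Real.rpow_mul hy.le, ← Real.rpow_mul hy.le, ← Real.rpow_add hy]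
  congr 1
  obtain ⟨m, hm⟩ := hev k
  have hm0 := hpos k
  rw [hm, Int.mul_ediv_cancel_left _ two_ne_zero]
  have : (((11 * m + n * k).toNat : ℤ) : ℝ) = ((11 * m + n * k : ℤ) : ℝ) := by
    rw [Int.toNat_of_nonneg (by omega)]
  have hm' : (k : ℝ) * (k - 1) = 2 * m := by exact_mod_cast hm
  rw [Int.cast_natCast] at this
  rw [this, hm']
  push_cast
  ring

end positiveSeries

section

open Real Set Filter Topology

section units

variable {k k' : ℤ} {f g : ℝ → ℝ}

/-- `f` and `f⁻¹` are `q ^ k`, respectively `q ^ (-k)`, times a Laurent series in `q ^ 11`. -/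
def LU (k : ℤ) (f : ℝ → ℝ) : Prop := LC k f ∧ LC (-k) fun q => (f q)⁻¹

lemma LU.shift (h : LU k f) (hk : (k - k') % 11 = 0) : LU k' f :=
  ⟨h.1.shift hk, h.2.shift (by omega)⟩

lemma LU.congr (h : LU k f) (e : ∀ q, 0 < q → q < 1 → g q = f q) : LU k g :=
  ⟨h.1.congr e, h.2.congr fun q hq hq1 => by rw [e q hq hq1]⟩

lemma LU.mul (h1 : LU k f) (h2 : LU k' g) : LU (k + k') fun q => f q * g q :=
  ⟨h1.1.mul h2.1, ((h1.2.mul h2.2).shift (by ring_nf; simp)).congr fun q _ _ => mul_inv _ _⟩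

lemma LU.inv (h : LU k f) : LU (-k) fun q => (f q)⁻¹ :=
  ⟨h.2, (h.1.shift (by ring_nf; simp)).congr fun q _ _ => inv_inv _⟩

lemma LU.zpow (h : LU k f) (n : ℤ) : LU (k * n) fun q => f q ^ n :=
  ⟨h.1.zpow h.2 rfl n, ((h.1.zpow h.2 rfl (-n)).shift (by ring_nf; simp)).congr
    fun q _ _ => (zpow_neg _ _).symm⟩

lemma LU.pow (h : LU k f) (n : ℕ) : LU (k * n) fun q => f q ^ n :=
  (h.zpow n).congr fun q _ _ => (zpow_natCast _ _).symm

lemma LU.div (h1 : LU k f) (h2 : LU k' g) : LU (k - k') fun q => f q / g q :=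
  (h1.mul h2.inv).congr fun q _ _ => div_eq_mul_inv _ _

lemma LU.neg (h : LU k f) : LU k fun q => -f q :=
  ⟨(h.1.const_mul (-1)).congr fun q _ _ => by ring,
    (h.2.const_mul (-1)).congr fun q _ _ => by rw [inv_neg]; ring⟩

lemma hh_eq {q : ℝ} : hh q = q ^ ((121 : ℝ) / 24) * eN (q ^ 11) := by
  rw [hh, eN, ← pow_mul]

lemma psi_div_hh {n : ℕ} {k : ℤ} (hk : (n : ℤ) ^ 2 - 11 * n = 2 * k) {q : ℝ} (hq : 0 < q)
    (hq1 : q < 1) : psi q n / hh q ^ 3 =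
      q ^ k * ((-1) ^ n * (jN n (q ^ 11) * eN (q ^ 11)) * (eN (q ^ 11))⁻¹ ^ 3) := by
  have he := eN_ne_zero (y := q ^ 11) (by positivity) (pow_lt_one₀ hq.le hq1 (by norm_num))
  have e1 : q ^ ((((n : ℤ) : ℝ) - 11 / 2) ^ 2 / 2) = q ^ k * (q ^ ((121 : ℝ) / 24)) ^ 3 := by
    rw [← rpow_natCast (q ^ ((121 : ℝ) / 24)), ← rpow_mul hq.le, ← rpow_intCast, ← rpow_add hq]
    congr 1
    have : ((n : ℝ) ^ 2 - 11 * n) = 2 * k := by exact_mod_cast hk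
    push_cast
    linear_combination this / 2
  have e2 : q ^ (11 * (((n : ℤ)) : ℝ)) = (q ^ 11) ^ n := by
    rw [← pow_mul, ← rpow_natCast]; push_cast; rfl
  rw [psi, th_prod hq hq1, hh_eq, e1, e2, zpow_natCast, jN, mul_pow, ← pow_mul q 11 11,
    show qI (q ^ 121) (q ^ 121) = eN (q ^ 11) by rw [eN, ← pow_mul]]
  have hq0 : q ^ ((121 : ℝ) / 24) ≠ 0 := (rpow_pos_of_pos hq _).ne'
  field_simp

lemma lu_psi_nat {n : ℕ} (h0 : 0 < n) (hn : n < 11) :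
    LU (6 * (n : ℤ) ^ 2) fun q => psi q n / hh q ^ 3 := by
  obtain ⟨k, hk⟩ : ∃ k : ℤ, (n : ℤ) ^ 2 - 11 * n = 2 * k := by
    refine ⟨((n : ℤ) ^ 2 - 11 * n) / 2, ?_⟩
    interval_cases n <;> rfl
  have hF := fun (q : ℝ) (hq : 0 < q) (hq1 : q < 1) => psi_div_hh hk hq hq1
  have hs : (k - 6 * (n : ℤ) ^ 2) % 11 = 0 := by
    interval_cases n <;> omega
  refine LU.shift ⟨⟨_, ((AN.const ((-1) ^ n)).mul (an_jN_mul_eN hn.le)).mul (NN.inv_eN.an.pow 3), hF⟩,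
    ⟨fun y => (-1) ^ n * (jN n y)⁻¹ * eN y ^ 2, ((AN.const ((-1) ^ n)).mul (NN.inv_jN h0 hn).an).mul
      (an_eN.pow 2), fun q hq hq1 => ?_⟩⟩ hs
  have hy1 : q ^ 11 < 1 := pow_lt_one₀ hq.le hq1 (by norm_num)
  have he := eN_ne_zero (y := q ^ 11) (by positivity) hy1
  have hj := jN_ne_zero (y := q ^ 11) (by positivity) hy1 h0 hn
  dsimp only
  rw [hF q hq hq1, zpow_neg]
  have h1 : (-1 : ℝ) ^ n * (-1) ^ n = 1 := by rw [← mul_pow]; norm_num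
  have h2 : (-1 : ℝ) ^ n ≠ 0 := left_ne_zero_of_mul_eq_one h1
  field_simp
  linear_combination -h1

lemma lu_psi {n : ℤ} (hn : ¬ 11 ∣ n) : LU (6 * n ^ 2) fun q => psi q n / hh q ^ 3 := by
  obtain ⟨r, hr⟩ : ∃ r : ℕ, n % 11 = r := ⟨(n % 11).toNat, by omega⟩
  refine ((lu_psi_nat (n := r) (by omega) (by omega)).shift ?_).congr fun q _ _ => by
    rw [psi_eq_of_dvd (l := (r : ℤ)) (by omega)]
  rw [← hr]
  obtain ⟨j, hj⟩ : ∃ j, n = n % 11 + 11 * j := ⟨n / 11, by omega⟩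
  generalize n % 11 = u at *
  rw [hj]
  exact Int.emod_eq_zero_of_dvd ⟨-(12 * u * j + 66 * j ^ 2), by ring⟩

end units

section tateFunctions

/-- Scale parameter of the tuple `psi q a, …, psi q (5 * a)`. -/
noncomputable def tl (a : ℤ) (q : ℝ) : ℝ := psi q a ^ 3 * psi q (3 * a) / psi q (2 * a) ^ 3

/-- Exponential parameter of the tuple. -/
noncomputable def tm (a : ℤ) (q : ℝ) : ℝ := psi q (2 * a) ^ 3 / (psi q a ^ 2 * psi q (3 * a))

/-- First coordinate on the modular curve. -/
noncomputable def tx (a : ℤ) (q : ℝ) : ℝ := -psi q a ^ 2 / (psi q (2 * a) * psi q (3 * a))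

/-- Second coordinate on the modular curve. -/
noncomputable def ty (a : ℤ) (q : ℝ) : ℝ :=
  psi q a * psi q (3 * a) * psi q (5 * a) / (psi q (2 * a) ^ 2 * psi q (4 * a))

/-- The function `1 - x` on the modular curve. -/
noncomputable def tp (a : ℤ) (q : ℝ) : ℝ :=
  psi q a * psi q (4 * a) ^ 2 / (psi q (2 * a) ^ 2 * psi q (5 * a))

/-- The function `1 + y` on the modular curve. -/
noncomputable def ts (a : ℤ) (q : ℝ) : ℝ :=
  psi q a ^ 2 * psi q (3 * a) / (psi q (2 * a) ^ 2 * psi q (5 * a))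

/-- Inverse of the remaining factor of the discriminant. -/
noncomputable def tD (a : ℤ) (q : ℝ) : ℝ :=
  -(hh q ^ 12 * (tx a q ^ 4 * ty a q ^ 7 * tp a q ^ 2 * ts a q ^ 7) / tl a q ^ 12)

lemma tate_psi {q : ℝ} (hq : 0 < q) (hq1 : q < 1) {a : ℤ} (ha : ¬ 11 ∣ a) :
    TateParam (psi q a) (psi q (2 * a)) (psi q (3 * a)) (psi q (4 * a)) (psi q (5 * a))
      (tl a q) (tm a q) (tx a q) (ty a q) (tp a q) (ts a q) ∧
    tD a q * (tx a q ^ 2 - tx a q * ty a q - 4 * tx a q - 2 * ty a q - 1) = 1 := by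
  obtain ⟨H, h⟩ := psi_param hq hq1 ha rfl rfl rfl rfl rfl (l := tl a q) (m := tm a q)
    (x := tx a q) (y := ty a q) (p := tp a q) (s := ts a q) rfl rfl rfl rfl rfl rfl
  refine ⟨H, ?_⟩
  have hl := H.l0
  have hp := H.p0
  rw [tD]
  generalize tl a q = l, tx a q = x, ty a q = y, tp a q = p, ts a q = s at *
  field_simp
  apply mul_left_cancel₀ hp
  linear_combination h

variable {a : ℤ}

lemma lu_psi_mul (ha : ¬ 11 ∣ a) {n : ℤ} (hn : ¬ 11 ∣ n) :
    LU (6 * a ^ 2 * n ^ 2) fun q => psi q (n * a) / hh q ^ 3 :=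
  (lu_psi fun h => (Int.Prime.dvd_mul' (p := 11) (by norm_num) h).elim hn ha).shift (by
    rw [show 6 * (n * a) ^ 2 - 6 * a ^ 2 * n ^ 2 = 0 by ring]; rfl)

lemma lu_tate (ha : ¬ 11 ∣ a) : LU 0 (fun q => tl a q / hh q ^ 3) ∧ LU (6 * a ^ 2) (tm a) ∧
    LU 0 (tx a) ∧ LU 0 (ty a) ∧ LU 0 (tp a) ∧ LU 0 (ts a) := by
  have h1 : LU (6 * a ^ 2) fun q => psi q a / hh q ^ 3 := lu_psi ha
  have h2 := lu_psi_mul ha (n := 2) (by norm_num)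
  have h3 := lu_psi_mul ha (n := 3) (by norm_num)
  have h4 := lu_psi_mul ha (n := 4) (by norm_num)
  have h5 := lu_psi_mul ha (n := 5) (by norm_num)
  refine ⟨?_, ?_, ?_, ?_, ?_, ?_⟩
  · refine LU.congr (LU.shift (((h1.pow 3).mul h3).div (h2.pow 3)) ?_) fun q hq hq1 => ?_
    · ring_nf; omega
    · have := hh_pos hq hq1; rw [tl]; field_simp
  · refine LU.congr (LU.shift ((h2.pow 3).div ((h1.pow 2).mul h3)) ?_) fun q hq hq1 => ?_
    · ring_nf; omega
    · have := hh_pos hq hq1; rw [tm]; field_simp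
  · refine LU.congr (LU.shift ((h1.pow 2).neg.div (h2.mul h3)) ?_) fun q hq hq1 => ?_
    · ring_nf; omega
    · have := hh_pos hq hq1; rw [tx]; field_simp
  · refine LU.congr (LU.shift (((h1.mul h3).mul h5).div ((h2.pow 2).mul h4)) ?_) fun q hq hq1 => ?_
    · ring_nf; omega
    · have := hh_pos hq hq1; rw [ty]; field_simp
  · refine LU.congr (LU.shift ((h1.mul (h4.pow 2)).div ((h2.pow 2).mul h5)) ?_) fun q hq hq1 => ?_
    · ring_nf; omega
    · have := hh_pos hq hq1; rw [tp]; field_simp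
  · refine LU.congr (LU.shift (((h1.pow 2).mul h3).div ((h2.pow 2).mul h5)) ?_) fun q hq hq1 => ?_
    · ring_nf; omega
    · have := hh_pos hq hq1; rw [ts]; field_simp

lemma lu_eN : LU 0 fun q => eN (q ^ 11) :=
  ⟨⟨eN, an_eN, fun q _ _ => by simp⟩, ⟨fun y => (eN y)⁻¹, NN.inv_eN.an, fun q _ _ => by simp⟩⟩

lemma lu_zpow (k : ℤ) : LU k fun q => q ^ k :=
  ⟨⟨_, AN.const 1, fun q _ _ => by simp⟩, ⟨_, AN.const 1, fun q _ _ => by simp⟩⟩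

lemma lc_tD (ha : ¬ 11 ∣ a) : LC 0 (tD a) := by
  obtain ⟨hl, -, hx, hy, hp, hs⟩ := lu_tate ha
  refine (LU.congr (LU.shift ((((((hx.pow 4).mul (hy.pow 7)).mul (hp.pow 2)).mul (hs.pow 7)).div
    (((lu_zpow 121).mul (lu_eN.pow 24)).mul (hl.pow 12))).neg) ?_) fun q hq hq1 => ?_).1
  · norm_num
  · have h0 := hh_pos hq hq1
    have h1 : q ^ (121 : ℤ) * eN (q ^ 11) ^ 24 = hh q ^ 24 := by
      rw [hh_eq, mul_pow, ← rpow_natCast (q ^ ((121 : ℝ) / 24)), ← rpow_mul hq.le,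
        ← rpow_intCast]
      norm_num
    rw [h1, tD]
    field_simp

/-- The common prefactor of the theta part. -/
lemma lc_mon_mul (ha : ¬ 11 ∣ a) {P : ℝ → ℝ} (hP : LC 0 P) (b c d e f : ℤ) :
    LC (6 + 6 * a ^ 2 * b) fun q => q ^ ((1 : ℝ) / 24) * hh q ^ 2 *
      (mon (tl a q) (tm a q) (tx a q) (ty a q) (tp a q) (ts a q) (-1) b c d e f * P q) := by
  obtain ⟨hl, hm, hx, hy, hp, hs⟩ := lu_tate ha
  refine LC.congr (LC.shift (((((lu_zpow (-5)).div lu_eN).mul ((((((hl.zpow (-1)).mul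
    (hm.zpow b)).mul (hx.zpow c)).mul (hy.zpow d)).mul (hp.zpow e)).mul (hs.zpow f))).1.mul hP)) ?_)
    fun q hq hq1 => ?_
  · ring_nf; norm_num
  · have h0 := hh_pos hq hq1
    have h1 : q ^ ((1 : ℝ) / 24) * hh q ^ 2 = q ^ (-5 : ℤ) / eN (q ^ 11) * hh q ^ 3 := by
      have he := eN_ne_zero (y := q ^ 11) (by positivity) (pow_lt_one₀ hq.le hq1 (by norm_num))
      have : q ^ ((1 : ℝ) / 24) = q ^ (-5 : ℤ) * q ^ ((121 : ℝ) / 24) := by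
        rw [← rpow_intCast, ← rpow_add hq]; norm_num
      rw [pow_succ _ 2, hh_eq, this]
      field_simp
    rw [h1, mon, div_zpow]
    field_simp

end tateFunctions

section classes

lemma LC.mul_zero_class {f g : ℝ → ℝ} (h1 : LC 0 f) (h2 : LC 0 g) : LC 0 fun q => f q * g q :=
  h1.mul h2

lemma LC.sub_zero_class {f g : ℝ → ℝ} (h1 : LC 0 f) (h2 : LC 0 g) : LC 0 fun q => f q - g q :=
  (h1.add (h2.const_mul (-1))).congr fun q _ _ => by ring

variable {a : ℤ}

/-- The `t`-th term of the theta part of the rank. -/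
noncomputable def rankTerm (a : ℤ) (t : ℕ) (q : ℝ) : ℝ := q ^ ((1 : ℝ) / 24) * hh q ^ 2 *
  rankSol (tD a q) (tl a q) (tm a q) (tx a q) (ty a q) (tp a q) (ts a q) t

/-- The `t`-th term of the theta part of the crank. -/
noncomputable def crankTerm (a : ℤ) (t : ℕ) (q : ℝ) : ℝ := q ^ ((1 : ℝ) / 24) * hh q ^ 2 *
  crankSol (tl a q) (tm a q) (tx a q) (ty a q) (tp a q) (ts a q) t

lemma lc_rankTerm (ha : ¬ 11 ∣ a) {t : ℕ} (ht : t < 11) :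
    LC (6 + 6 * a ^ 2 * (3 * (t - 1))) (rankTerm a t) := by
  obtain ⟨-, -, ⟨hx, -⟩, ⟨hy, -⟩, -, -⟩ := lu_tate ha
  have hD := lc_tD ha
  unfold rankTerm
  interval_cases t <;> simp only [rankSol] <;>
  refine (lc_mon_mul ha (hD.mul_zero_class ?_) _ _ _ _ _).shift (by push_cast; ring_nf; norm_num) <;>
  repeat first
    | exact LC.const _
    | exact hx
    | exact hy
    | apply LC.sub_zero_class
    | apply LC.add
    | apply LC.neg_zero_class
    | apply LC.mul_zero_class
    | apply LC.pow_zero_class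

/-- The exponents of the exponential parameter in `crankSol`. -/
def crankExp : ℕ → ℤ
  | 0 => -1
  | 1 => -9
  | 2 => -6
  | 3 => -25
  | 4 => 0
  | 5 => -8
  | 6 => -16
  | 7 => -13
  | 8 => 12
  | 9 => -40
  | _ => -4

lemma lc_crankTerm (ha : ¬ 11 ∣ a) {t : ℕ} (ht : t < 11) :
    LC (6 + 6 * a ^ 2 * crankExp t) (crankTerm a t) := by
  unfold crankTerm
  interval_cases t <;> simp only [crankSol, crankExp]
  all_goals first
    | exact lc_mon_mul ha (LC.const _) _ _ _ _ _
    | exact (lc_mon_mul ha (LC.const 0) 0 0 0 0 0).congr fun q _ _ => by simp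

/-- Theta part of the rank series with one exceptional class. -/
lemma exists_rem_rankTerm (ha : ¬ 11 ∣ a) {t₀ : ℕ} (ht₀ : t₀ ∈ Finset.range 11)
    (h : ∀ t ∈ (Finset.range 11).erase t₀, (6 + 6 * a ^ 2 * (3 * ((t : ℤ) - 1))) % 11 ≠ 8) :
    ∃ R, Rem R ∧ ∀ q, ∑ t ∈ Finset.range 11, rankTerm a t q = rankTerm a t₀ q + R q :=
  ⟨_, Rem.sum _ fun t ht => (lc_rankTerm ha (Finset.mem_range.mp (Finset.mem_of_mem_erase ht))).rem
    (h t ht), fun q => (Finset.add_sum_erase _ _ ht₀).symm⟩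

lemma exists_rem_crankTerm (ha : ¬ 11 ∣ a) {t₀ : ℕ} (ht₀ : t₀ ∈ Finset.range 11)
    (h : ∀ t ∈ (Finset.range 11).erase t₀, (6 + 6 * a ^ 2 * crankExp t) % 11 ≠ 8) :
    ∃ R, Rem R ∧ ∀ q, ∑ t ∈ Finset.range 11, crankTerm a t q = crankTerm a t₀ q + R q :=
  ⟨_, Rem.sum _ fun t ht => (lc_crankTerm ha (Finset.mem_range.mp (Finset.mem_of_mem_erase ht))).rem
    (h t ht), fun q => (Finset.add_sum_erase _ _ ht₀).symm⟩

end classes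

section appell

/-- The Appell part of the rank. -/
noncomputable def appellTerm (a : ℤ) (q : ℝ) : ℝ :=
  q ^ ((1 : ℝ) / 24) * (US q 3 0 a / ((-1) ^ a * q ^ ((3 : ℝ) / 2 * (a - 11 / 2) ^ 2) * hh q))

lemma an_appell {a : ℤ} (ha : a ∈ Finset.Icc (1 : ℤ) 5) :
    AN fun y => ∑' m : ℤ, (-1) ^ m * y ^ ((33 : ℝ) / 2 * m ^ 2 + 33 / 2 * m + 0) /
      (1 - y ^ (11 * m + a)) := by
  obtain ⟨ha1, ha5⟩ := Finset.mem_Icc.mp ha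
  set d : ℤ → ℕ := fun m => (11 * m + a).natAbs with hd
  set T : ℤ → ℕ := fun m => 33 * (m * (m + 1) / 2).toNat with hT
  have hd0 : ∀ m, d m ≠ 0 := fun m => by simp only [hd]; omega
  have hTm : ∀ m : ℤ, (T m : ℝ) = 33 / 2 * m ^ 2 + 33 / 2 * m + 0 := fun m => by
    have h : ∃ k : ℤ, m * (m + 1) = 2 * k ∧ 0 ≤ k := by
      rcases Int.even_or_odd' m with ⟨k, rfl | rfl⟩
      · exact ⟨k * (2 * k + 1), by ring, by nlinarith [mul_self_nonneg k, Int.le_self_sq (-k)]⟩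
      · exact ⟨(2 * k + 1) * (k + 1), by ring, by nlinarith [mul_self_nonneg k, Int.le_self_sq (-k)]⟩
    obtain ⟨k, hk, hk0⟩ := h
    have h1 : ((m * (m + 1) / 2).toNat : ℤ) = k := by omega
    have h2 : ((m * (m + 1) / 2).toNat : ℝ) = k := by exact_mod_cast h1
    have h3 : (m : ℝ) * (m + 1) = 2 * k := by exact_mod_cast hk
    simp only [hT]
    push_cast
    rw [h2]
    linear_combination -33 / 2 * h3
  set e : ℤ → ℕ := fun m => if 0 ≤ m then 0 else d m with he
  set A : ℤ → ℝ := fun m => (-1) ^ m * if 0 ≤ m then 1 else -1 with hA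
  have hA1 : ∀ m, ‖A m‖ = 1 := fun m => by simp only [hA]; split_ifs <;> simp
  have hj : ∀ y : ℝ, 0 < y → y < 1 → ∀ m, HasSum (fun j : ℕ => y ^ (T m + e m + d m * j))
      (y ^ (T m + e m) * (1 - y ^ d m)⁻¹) := fun y hy hy1 m =>
    ((hasSum_geometric_of_lt_one (by positivity)
      (pow_lt_one₀ hy.le hy1 (hd0 m))).mul_left (y ^ (T m + e m))).congr_eq
        (fun j => by rw [pow_add, pow_mul]) rfl
  have hs : ∀ y : ℝ, 0 < y → y < 1 → Summable fun i : ℤ × ℕ => A i.1 * y ^ (T i.1 + e i.1 + d i.1 * i.2) :=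
    fun y hy hy1 => by
    refine .of_norm ?_
    simp only [norm_mul, hA1, one_mul, norm_pow, Real.norm_of_nonneg hy.le]
    refine (summable_prod_of_nonneg fun i => by positivity).mpr ⟨fun m => (hj y hy hy1 m).summable, ?_⟩
    simp only [fun m => (hj y hy hy1 m).tsum_eq]
    refine ((summable_quad hy hy1 (c := 33 / 2) (by norm_num) (33 / 2) 0).mul_right
      (1 - y)⁻¹).of_nonneg_of_le (fun m => ?_) fun m => ?_
    · have := pow_le_one₀ (n := d m) hy.le hy1.le
      exact mul_nonneg (by positivity) (inv_nonneg.mpr (by linarith))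
    · rw [← hTm, rpow_natCast]
      have h1 : y ^ d m ≤ y := by
        simpa using pow_le_pow_of_le_one hy.le hy1.le (Nat.one_le_iff_ne_zero.mpr (hd0 m))
      exact mul_le_mul (pow_le_pow_of_le_one hy.le hy1.le (Nat.le_add_right _ _))
        (inv_anti₀ (by linarith) (by linarith)) (inv_nonneg.mpr (by linarith)) (by positivity)
  refine AN.of_hasSum (ι := ℤ × ℕ) (a := fun i => A i.1) (k := fun i => T i.1 + e i.1 + d i.1 * i.2)
    fun y hy hy1 => (hs y hy hy1).hasSum.congr_eq (fun _ => rfl) ?_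
  rw [(hs y hy hy1).tsum_prod]
  refine tsum_congr fun m => ?_
  dsimp only
  rw [tsum_mul_left, (hj y hy hy1 m).tsum_eq, ← hTm, rpow_natCast, pow_add]
  have hd1 : y ^ d m < 1 := pow_lt_one₀ hy.le hy1 (hd0 m)
  have h0 : (0 : ℝ) < y ^ d m := by positivity
  simp only [hA, he]
  split_ifs with hm
  · rw [show 11 * m + a = (d m : ℕ) by simp only [hd]; omega, zpow_natCast]
    ring
  · rw [show 11 * m + a = -(d m : ℕ) by simp only [hd]; omega, zpow_neg, zpow_natCast]
    have h1 : (1 : ℝ) - y ^ d m ≠ 0 := by linarith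
    have h2 : (1 : ℝ) - (y ^ d m)⁻¹ ≠ 0 := by
      rw [sub_ne_zero]; exact (one_lt_inv₀ h0 |>.mpr hd1).ne
    generalize y ^ d m = z at *
    have h3 : z - 1 ≠ 0 := by intro h; apply h1; linarith
    field_simp
    ring

/-- The exponent of `q` in front of the Appell part. -/
def appellExp (a : ℤ) : ℤ := -5 - (3 * a ^ 2 - 33 * a) / 2

lemma lc_appellTerm {a : ℤ} (ha : a ∈ Finset.Icc (1 : ℤ) 5) : LC (appellExp a) (appellTerm a) := by
  have hk : (3 * a ^ 2 - 33 * a) = 2 * (-5 - appellExp a) := by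
    obtain ⟨h1, h5⟩ := Finset.mem_Icc.mp ha
    interval_cases a <;> rfl
  refine ⟨fun y => (-1) ^ a * (eN y)⁻¹ * ∑' m : ℤ, (-1) ^ m * y ^ ((33 : ℝ) / 2 * m ^ 2 + 33 / 2 * m + 0) /
      (1 - y ^ (11 * m + a)), ((AN.const _).mul NN.inv_eN.an).mul (an_appell ha), fun q hq hq1 => ?_⟩
  have he := eN_ne_zero (y := q ^ 11) (by positivity) (pow_lt_one₀ hq.le hq1 (by norm_num))
  have h1 : (-1 : ℝ) ^ a * (-1) ^ a = 1 := neg_one_zpow_mul_self a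
  have h2 : (-1 : ℝ) ^ a ≠ 0 := left_ne_zero_of_mul_eq_one h1
  have hq2 : q ^ ((3 : ℝ) / 2 * (a - 11 / 2) ^ 2) ≠ 0 := (rpow_pos_of_pos hq _).ne'
  have hq3 : q ^ ((121 : ℝ) / 24) ≠ 0 := (rpow_pos_of_pos hq _).ne'
  have h3 : US q 3 0 a = q ^ ((363 : ℝ) / 8) * ∑' m : ℤ, (-1) ^ m *
      (q ^ 11) ^ ((33 : ℝ) / 2 * m ^ 2 + 33 / 2 * m + 0) / (1 - (q ^ 11) ^ (11 * m + a)) := by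
    rw [US, ← tsum_mul_left]
    refine tsum_congr fun m => ?_
    rw [usTerm, ← rpow_natCast q 11, ← rpow_mul hq.le, ← rpow_intCast (q ^ ((11 : ℕ) : ℝ)),
      ← rpow_mul hq.le, mul_div_assoc', mul_left_comm, ← rpow_add hq]
    congr 3
    · push_cast; ring
    · congr 1; push_cast; ring
  have h4 : q ^ ((1 : ℝ) / 24) * q ^ ((363 : ℝ) / 8) =
      q ^ appellExp a * (q ^ ((3 : ℝ) / 2 * (a - 11 / 2) ^ 2) * q ^ ((121 : ℝ) / 24)) := by
    rw [← rpow_intCast, ← rpow_add hq, ← rpow_add hq, ← rpow_add hq]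
    congr 1
    have : (3 * (a : ℝ) ^ 2 - 33 * a) = 2 * (-5 - appellExp a) := by exact_mod_cast hk
    linear_combination -this / 2
  dsimp only
  rw [appellTerm, h3, hh_eq]
  generalize (∑' m : ℤ, (-1) ^ m *
      (q ^ 11) ^ ((33 : ℝ) / 2 * m ^ 2 + 33 / 2 * m + 0) / (1 - (q ^ 11) ^ (11 * m + a))) = S
  generalize eN (q ^ 11) = E at *
  generalize q ^ ((3 : ℝ) / 2 * (a - 11 / 2) ^ 2) = u at *
  generalize q ^ ((121 : ℝ) / 24) = v at *
  generalize (-1 : ℝ) ^ a = w at *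
  field_simp
  linear_combination S * h4 - S * q ^ appellExp a * u * v * h1

end appell

section rationality

variable {v1 v2 v3 v4 v5 l m x y p s : ℝ}

lemma mon_zpow (a b c d e f i : ℤ) : mon l m x y p s a b c d e f ^ i =
    mon l m x y p s (a * i) (b * i) (c * i) (d * i) (e * i) (f * i) := by
  simp only [mon, mul_zpow, zpow_mul]

/-- Monomials in the theta values in terms of the parameters. -/
lemma zpow_prod_eq_mon (H : TateParam v1 v2 v3 v4 v5 l m x y p s) (i₁ i₂ i₃ i₄ i₅ k : ℤ) :
    v1 ^ i₁ * v2 ^ i₂ * v3 ^ i₃ * v4 ^ i₄ * v5 ^ i₅ = (-1) ^ (i₄ + k) *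
      mon l m x y p s (i₁ + i₂ + i₃ + i₄ + i₅) (i₁ + 4 * i₂ + 9 * i₃ + 16 * i₄ + 25 * i₅ - 11 * k)
        (i₄ + 2 * i₅ - k) (2 * i₂ + 6 * i₃ + 11 * i₄ + 18 * i₅ - 8 * k)
        (i₂ + 3 * i₃ + 6 * i₄ + 9 * i₅ - 4 * k) (i₂ + 3 * i₃ + 5 * i₄ + 8 * i₅ - 4 * k) := by
  rw [mon_v1 H, mon_v2 H, mon_v3 H, mon_v4 H, mon_v5 H, neg_eq_neg_one_mul, mul_zpow]
  simp only [mon_zpow]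
  have e : ∀ A B C D E ε : ℝ, A * B * C * (ε * D) * E = ε * (A * B * C * D * E) := fun _ _ _ _ _ _ => by
    ring
  rw [e, mon_mul H, mon_mul H, mon_mul H, mon_mul H, mon_red H _ _ _ _ _ _ k 0 0 0 0,
    zpow_add₀ (by norm_num : (-1 : ℝ) ≠ 0)]
  simp only [pow_zero, mul_one, Nat.cast_zero, sub_zero, ← mul_assoc]
  congr 1
  ring_nf

/-- The common monomial factor of the exceptional terms. -/
noncomputable def monBase (q : ℝ) : ℝ := q ^ ((1 : ℝ) / 24) * hh q ^ 2 * (hh q ^ 12 *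
  mon (tl 1 q) (tm 1 q) (tx 1 q) (ty 1 q) (tp 1 q) (ts 1 q) (-13) 4 4 9 2 6)

variable {q : ℝ}

lemma tate_psi_one (hq : 0 < q) (hq1 : q < 1) :
    TateParam (psi q 1) (psi q 2) (psi q 3) (psi q 4) (psi q 5)
      (tl 1 q) (tm 1 q) (tx 1 q) (ty 1 q) (tp 1 q) (ts 1 q) := by
  simpa using (tate_psi hq hq1 (a := 1) (by norm_num)).1

lemma psi_ne_zero_tuple (hq : 0 < q) (hq1 : q < 1) :
    psi q 1 ≠ 0 ∧ psi q 2 ≠ 0 ∧ psi q 3 ≠ 0 ∧ psi q 4 ≠ 0 ∧ psi q 5 ≠ 0 :=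
  ⟨psi_ne_zero hq hq1 (by norm_num), psi_ne_zero hq hq1 (by norm_num),
    psi_ne_zero hq hq1 (by norm_num), psi_ne_zero hq hq1 (by norm_num),
    psi_ne_zero hq hq1 (by norm_num)⟩

/-- The exceptional rank term in terms of the parameters. -/
lemma rankTerm_one (hq : 0 < q) (hq1 : q < 1) : rankTerm 1 6 q = monBase q * (-11 * (ty 1 q ^ 2 * tp
  1 q * ts 1 q ^ 4) - 7 * (tx 1 q * ty 1 q * tp 1 q * ts 1 q ^ 4) - 3 * (tx 1 q * ty 1 q ^ 2 * tp 1
  q * ts 1 q ^ 4) - 6 * (tx 1 q ^ 2 * ty 1 q * tp 1 q * ts 1 q ^ 4) + 4 * (tx 1 q ^ 2 * ty 1 q ^ 2 *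
  tp 1 q * ts 1 q ^ 4) + 7 * (tx 1 q ^ 3 * ty 1 q * tp 1 q * ts 1 q ^ 4)) := by
  have H := tate_psi_one hq hq1
  obtain ⟨n1, n2, n3, n4, n5⟩ := psi_ne_zero_tuple hq hq1
  have w2 : psi q (2 * 1) = psi q 2 := rfl
  have w3 : psi q (3 * 1) = psi q 3 := rfl
  have w4 : psi q (4 * 1) = psi q 4 := rfl
  have w5 : psi q (5 * 1) = psi q 5 := rfl
  have hT : rankTerm 1 6 q = q ^ ((1 : ℝ) / 24) * hh q ^ 2 * (hh q ^ 12 * ((psi q 1 ^ (-6 : ℤ) * psi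
    q 2 ^ (1 : ℤ) * psi q 3 ^ (-1 : ℤ) * psi q 4 ^ (-4 : ℤ) * psi q 5 ^ (-3 : ℤ)))) * (-11 * ty 1 q
    - 7 * tx 1 q - 3 * tx 1 q * ty 1 q - 6 * tx 1 q ^ 2 + 4 * tx 1 q ^ 2 * ty 1 q + 7 * tx 1 q ^ 3)
    := by
    rw [rankTerm, rankSol, mon]
    generalize -11 * ty 1 q - 7 * tx 1 q - 3 * tx 1 q * ty 1 q - 6 * tx 1 q ^ 2 + 4 * tx 1 q ^ 2 *
      ty 1 q + 7 * tx 1 q ^ 3 = P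
    rw [tD, tl, tm, tx, ty, tp, ts, w2, w3, w4, w5]
    field_simp
  have hM := zpow_prod_eq_mon H (-6) 1 (-1) (-4) (-3) (-14)
  have h0 := mon_red H (-13) 4 4 10 3 10 0 0 1 1 4
  rw [hT, hM, monBase]
  norm_num at h0 ⊢
  rw [h0]
  ring

/-- The exceptional rank term in terms of the parameters. -/
lemma rankTerm_two (hq : 0 < q) (hq1 : q < 1) : rankTerm 2 5 q = monBase q * (16 * (tx 1 q ^ 3 * ty
  1 q ^ 2 * tp 1 q ^ 2 * ts 1 q ^ 3) + 19 * (tx 1 q ^ 2 * ty 1 q ^ 2 * tp 1 q ^ 3 * ts 1 q ^ 3) - tx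
  1 q ^ 2 * ty 1 q * tp 1 q ^ 2 * ts 1 q ^ 4 + 8 * (tx 1 q ^ 3 * ty 1 q * tp 1 q * ts 1 q ^ 4) + 3 *
  (tx 1 q ^ 2 * tp 1 q * ts 1 q ^ 5)) := by
  have H := tate_psi_one hq hq1
  obtain ⟨n1, n2, n3, n4, n5⟩ := psi_ne_zero_tuple hq hq1
  have w2 : psi q (2 * 2) = psi q 4 := rfl
  have w3 : psi q (3 * 2) = -psi q 5 := psi_eq_neg (by norm_num)
  have w4 : psi q (4 * 2) = -psi q 3 := psi_eq_neg (by norm_num)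
  have w5 : psi q (5 * 2) = -psi q 1 := psi_eq_neg (by norm_num)
  have hx : tx 2 q = ts 1 q / (ty 1 q * tp 1 q) := by
    rw [show tx 2 q = (psi q 1 ^ (0 : ℤ) * psi q 2 ^ (2 : ℤ) * psi q 3 ^ (0 : ℤ) * psi q 4 ^ (-1 :
      ℤ) * psi q 5 ^ (-1 : ℤ)) by rw [tx, w2, w3]; field_simp,
      zpow_prod_eq_mon H 0 2 0 (-1) (-1) (-3), mon]
    norm_num
    field_simp
  have hy : ty 2 q = tx 1 q / tp 1 q := by
    rw [show ty 2 q = -(psi q 1 ^ (1 : ℤ) * psi q 2 ^ (1 : ℤ) * psi q 3 ^ (-1 : ℤ) * psi q 4 ^ (-2 :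
      ℤ) * psi q 5 ^ (1 : ℤ)) by rw [ty, w2, w3, w4, w5]; field_simp,
      zpow_prod_eq_mon H 1 1 (-1) (-2) 1 (-1), mon]
    norm_num
    field_simp
  have hT : rankTerm 2 5 q = q ^ ((1 : ℝ) / 24) * hh q ^ 2 * (hh q ^ 12 * ((psi q 1 ^ (-1 : ℤ) * psi
    q 2 ^ (-5 : ℤ) * psi q 3 ^ (-3 : ℤ) * psi q 4 ^ (-1 : ℤ) * psi q 5 ^ (-3 : ℤ)))) * (19 + 16 * ty
    2 q - tx 2 q + 8 * tx 2 q * ty 2 q + 3 * tx 2 q ^ 2) := by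
    rw [rankTerm, rankSol, mon]
    generalize 19 + 16 * ty 2 q - tx 2 q + 8 * tx 2 q * ty 2 q + 3 * tx 2 q ^ 2 = P
    rw [tD, tl, tm, tx, ty, tp, ts, w2, w3, w4, w5]
    field_simp
  have hM := zpow_prod_eq_mon H (-1) (-5) (-3) (-1) (-3) (-13)
  have h0 := mon_red H (-13) 4 6 11 5 9 0 2 2 3 3
  rw [hT, hM, hx, hy, monBase]
  norm_num at h0 ⊢
  rw [h0]
  have := H.x0; have := H.y0; have := H.p0; have := H.s0
  field_simp
  ring

/-- The exceptional rank term in terms of the parameters. -/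
lemma rankTerm_three (hq : 0 < q) (hq1 : q < 1) : rankTerm 3 4 q = monBase q * (tx 1 q ^ 3 * ty 1 q
  ^ 2 * tp 1 q ^ 3 * ts 1 q + tx 1 q ^ 4 * ty 1 q ^ 3 * tp 1 q ^ 3 + 13 * (tx 1 q ^ 3 * ty 1 q ^ 3 *
  tp 1 q ^ 3 * ts 1 q) + 4 * (tx 1 q ^ 2 * ty 1 q ^ 2 * tp 1 q ^ 3 * ts 1 q ^ 2) - 2 * (tx 1 q ^ 2 *
  ty 1 q ^ 3 * tp 1 q ^ 3 * ts 1 q ^ 2) + 19 * (tx 1 q * ty 1 q ^ 2 * tp 1 q ^ 3 * ts 1 q ^ 3) - ty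
  1 q ^ 2 * tp 1 q ^ 3 * ts 1 q ^ 4) := by
  have H := tate_psi_one hq hq1
  obtain ⟨n1, n2, n3, n4, n5⟩ := psi_ne_zero_tuple hq hq1
  have w2 : psi q (2 * 3) = -psi q 5 := psi_eq_neg (by norm_num)
  have w3 : psi q (3 * 3) = -psi q 2 := psi_eq_neg (by norm_num)
  have w4 : psi q (4 * 3) = psi q 1 := psi_eq_of_dvd (by norm_num)
  have w5 : psi q (5 * 3) = psi q 4 := psi_eq_of_dvd (by norm_num)
  have hx : tx 3 q = ts 1 q / tx 1 q := by
    rw [show tx 3 q = -(psi q 1 ^ (0 : ℤ) * psi q 2 ^ (-1 : ℤ) * psi q 3 ^ (2 : ℤ) * psi q 4 ^ (0 :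
      ℤ) * psi q 5 ^ (-1 : ℤ)) by rw [tx, w2, w3]; field_simp,
      zpow_prod_eq_mon H 0 (-1) 2 0 (-1) (-1), mon]
    norm_num
    field_simp
  have hy : ty 3 q = ts 1 q / (tx 1 q * ty 1 q) := by
    rw [show ty 3 q = -(psi q 1 ^ (-1 : ℤ) * psi q 2 ^ (1 : ℤ) * psi q 3 ^ (1 : ℤ) * psi q 4 ^ (1 :
      ℤ) * psi q 5 ^ (-2 : ℤ)) by rw [ty, w2, w3, w4, w5]; field_simp,
      zpow_prod_eq_mon H (-1) 1 1 1 (-2) (-2), mon]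
    norm_num
    field_simp
  have hT : rankTerm 3 4 q = q ^ ((1 : ℝ) / 24) * hh q ^ 2 * (hh q ^ 12 * ((psi q 1 ^ (-2 : ℤ) * psi
    q 2 ^ (-3 : ℤ) * psi q 3 ^ (-7 : ℤ) * psi q 4 ^ (-2 : ℤ) * psi q 5 ^ (1 : ℤ)))) * (1 + ty 3 q +
    13 * tx 3 q + 4 * tx 3 q * ty 3 q - 2 * tx 3 q ^ 2 + 19 * tx 3 q ^ 2 * ty 3 q - tx 3 q ^ 3 * ty
    3 q) := by
    rw [rankTerm, rankSol, mon]
    generalize 1 + ty 3 q + 13 * tx 3 q + 4 * tx 3 q * ty 3 q - 2 * tx 3 q ^ 2 + 19 * tx 3 q ^ 2 *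
      ty 3 q - tx 3 q ^ 3 * ty 3 q = P
    rw [tD, tl, tm, tx, ty, tp, ts, w2, w3, w4, w5]
    field_simp
  have hM := zpow_prod_eq_mon H (-2) (-3) (-7) (-2) 1 (-8)
  have h0 := mon_red H (-13) 4 8 12 5 6 0 4 3 3 0
  rw [hT, hM, hx, hy, monBase]
  norm_num at h0 ⊢
  rw [h0]
  have := H.x0; have := H.y0; have := H.p0; have := H.s0
  field_simp
  ring

/-- The exceptional rank term in terms of the parameters. -/
lemma rankTerm_four (hq : 0 < q) (hq1 : q < 1) : rankTerm 4 2 q = monBase q * (5 * (tx 1 q * ty 1 q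
  * ts 1 q ^ 6) - tx 1 q ^ 2 * ts 1 q ^ 6 - 2 * (tx 1 q * ty 1 q * tp 1 q * ts 1 q ^ 5) + 5 * (tx 1
  q ^ 2 * tp 1 q * ts 1 q ^ 5) - 16 * (tx 1 q * ty 1 q * tp 1 q ^ 2 * ts 1 q ^ 4) + 11 * (tx 1 q *
  ty 1 q * tp 1 q ^ 3 * ts 1 q ^ 3)) := by
  have H := tate_psi_one hq hq1
  obtain ⟨n1, n2, n3, n4, n5⟩ := psi_ne_zero_tuple hq hq1
  have w2 : psi q (2 * 4) = -psi q 3 := psi_eq_neg (by norm_num)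
  have w3 : psi q (3 * 4) = psi q 1 := psi_eq_of_dvd (by norm_num)
  have w4 : psi q (4 * 4) = psi q 5 := psi_eq_of_dvd (by norm_num)
  have w5 : psi q (5 * 4) = -psi q 2 := psi_eq_neg (by norm_num)
  have hx : tx 4 q = tp 1 q / ts 1 q := by
    rw [show tx 4 q = (psi q 1 ^ (-1 : ℤ) * psi q 2 ^ (0 : ℤ) * psi q 3 ^ (-1 : ℤ) * psi q 4 ^ (2 :
      ℤ) * psi q 5 ^ (0 : ℤ)) by rw [tx, w2, w3]; field_simp,
      zpow_prod_eq_mon H (-1) 0 (-1) 2 0 2, mon]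
    norm_num
    field_simp
  have hy : ty 4 q = tx 1 q / ty 1 q := by
    rw [show ty 4 q = -(psi q 1 ^ (1 : ℤ) * psi q 2 ^ (1 : ℤ) * psi q 3 ^ (-2 : ℤ) * psi q 4 ^ (1 :
      ℤ) * psi q 5 ^ (-1 : ℤ)) by rw [ty, w2, w3, w4, w5]; field_simp,
      zpow_prod_eq_mon H 1 1 (-2) 1 (-1) (-2), mon]
    norm_num
    field_simp
  have hT : rankTerm 4 2 q = q ^ ((1 : ℝ) / 24) * hh q ^ 2 * (hh q ^ 12 * (-(psi q 1 ^ (-1 : ℤ) *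
    psi q 2 ^ (-2 : ℤ) * psi q 3 ^ (0 : ℤ) * psi q 4 ^ (-6 : ℤ) * psi q 5 ^ (-4 : ℤ)))) * (5 - ty 4
    q - 2 * tx 4 q + 5 * tx 4 q * ty 4 q - 16 * tx 4 q ^ 2 + 11 * tx 4 q ^ 3) := by
    rw [rankTerm, rankSol, mon]
    generalize 5 - ty 4 q - 2 * tx 4 q + 5 * tx 4 q * ty 4 q - 16 * tx 4 q ^ 2 + 11 * tx 4 q ^ 3 = P
    rw [tD, tl, tm, tx, ty, tp, ts, w2, w3, w4, w5]
    field_simp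
  have hM := zpow_prod_eq_mon H (-1) (-2) 0 (-6) (-4) (-19)
  have h0 := mon_red H (-13) 4 5 10 2 12 0 1 1 0 6
  rw [hT, hM, hx, hy, monBase]
  norm_num at h0 ⊢
  rw [h0]
  have := H.x0; have := H.y0; have := H.p0; have := H.s0
  field_simp

/-- The exceptional rank term in terms of the parameters. -/
lemma rankTerm_five (hq : 0 < q) (hq1 : q < 1) : rankTerm 5 10 q = monBase q * (7 * (tx 1 q * ty 1 q
  * tp 1 q ^ 2 * ts 1 q ^ 5) - 2 * (tx 1 q ^ 2 * tp 1 q * ts 1 q ^ 6) + 14 * (tx 1 q ^ 2 * ty 1 q *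
  tp 1 q * ts 1 q ^ 5) - 2 * (tx 1 q * ty 1 q ^ 2 * tp 1 q ^ 2 * ts 1 q ^ 4) + 2 * (tx 1 q ^ 2 * ty
  1 q ^ 2 * tp 1 q * ts 1 q ^ 4) + 11 * (tx 1 q * ty 1 q ^ 3 * tp 1 q ^ 2 * ts 1 q ^ 3)) := by
  have H := tate_psi_one hq hq1
  obtain ⟨n1, n2, n3, n4, n5⟩ := psi_ne_zero_tuple hq hq1
  have w2 : psi q (2 * 5) = -psi q 1 := psi_eq_neg (by norm_num)
  have w3 : psi q (3 * 5) = psi q 4 := psi_eq_of_dvd (by norm_num)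
  have w4 : psi q (4 * 5) = -psi q 2 := psi_eq_neg (by norm_num)
  have w5 : psi q (5 * 5) = psi q 3 := psi_eq_of_dvd (by norm_num)
  have hx : tx 5 q = ty 1 q / ts 1 q := by
    rw [show tx 5 q = (psi q 1 ^ (-1 : ℤ) * psi q 2 ^ (0 : ℤ) * psi q 3 ^ (0 : ℤ) * psi q 4 ^ (-1 :
      ℤ) * psi q 5 ^ (2 : ℤ)) by rw [tx, w2, w3]; field_simp,
      zpow_prod_eq_mon H (-1) 0 0 (-1) 2 3, mon]
    norm_num
    field_simp
  have hy : ty 5 q = ty 1 q * tp 1 q / (tx 1 q * ts 1 q) := by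
    rw [show ty 5 q = -(psi q 1 ^ (-2 : ℤ) * psi q 2 ^ (-1 : ℤ) * psi q 3 ^ (1 : ℤ) * psi q 4 ^ (1 :
      ℤ) * psi q 5 ^ (1 : ℤ)) by rw [ty, w2, w3, w4, w5]; field_simp,
      zpow_prod_eq_mon H (-2) (-1) 1 1 1 4, mon]
    norm_num
    field_simp
  have hT : rankTerm 5 10 q = q ^ ((1 : ℝ) / 24) * hh q ^ 2 * (hh q ^ 12 * ((psi q 1 ^ (1 : ℤ) * psi
    q 2 ^ (-3 : ℤ) * psi q 3 ^ (-2 : ℤ) * psi q 4 ^ (-3 : ℤ) * psi q 5 ^ (-6 : ℤ)))) * (-2 + 7 * ty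
    5 q + 14 * tx 5 q - 2 * tx 5 q * ty 5 q + 2 * tx 5 q ^ 2 + 11 * tx 5 q ^ 2 * ty 5 q) := by
    rw [rankTerm, rankSol, mon]
    generalize -2 + 7 * ty 5 q + 14 * tx 5 q - 2 * tx 5 q * ty 5 q + 2 * tx 5 q ^ 2 + 11 * tx 5 q ^
      2 * ty 5 q = P
    rw [tD, tl, tm, tx, ty, tp, ts, w2, w3, w4, w5]
    field_simp
  have hM := zpow_prod_eq_mon H 1 (-3) (-2) (-3) (-6) (-21)
  have h0 := mon_red H (-13) 4 6 9 3 12 0 2 0 1 6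
  rw [hT, hM, hx, hy, monBase]
  norm_num at h0 ⊢
  rw [h0]
  have := H.x0; have := H.y0; have := H.p0; have := H.s0
  field_simp
  ring

end rationality

section exceptional

variable {q : ℝ}

lemma not_eleven_dvd {a : ℤ} (ha : a ∈ Finset.Icc (1 : ℤ) 5) : ¬ 11 ∣ a := by
  obtain ⟨h1, h5⟩ := Finset.mem_Icc.mp ha
  omega

lemma exists_rem_rank_LL {a : ℤ} (ha : a ∈ Finset.Icc (1 : ℤ) 5) {t : ℕ} (ht : t ∈ Finset.range 11)
    (h : ∀ t' ∈ (Finset.range 11).erase t, (6 + 6 * a ^ 2 * (3 * ((t' : ℤ) - 1))) % 11 ≠ 8)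
    (h' : appellExp a % 11 ≠ 8) :
    ∃ R, Rem R ∧ ∀ q, 0 < q → q < 1 → LL q 3 (3 * (11 / 2 - a) - 1 / 2) =
      qI q q * (rankTerm a t q / 11 + R q) + (1 - 3 * a / 11) := by
  have hd := not_eleven_dvd ha
  obtain ⟨R, hR, hs⟩ := exists_rem_rankTerm hd ht h
  refine ⟨_, ((lc_appellTerm ha).rem h').add (hR.const_mul (1 / 11)), fun q hq hq1 => ?_⟩
  obtain ⟨H, hD⟩ := tate_psi hq hq1 hd
  rw [rank_LL hq hq1 ha rfl rfl rfl rfl rfl H hD]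
  have := hs q
  simp only [rankTerm] at this ⊢
  rw [← Finset.mul_sum] at this
  rw [appellTerm]
  linear_combination qI q q / 11 * this

lemma exists_rem_crank_LL {a : ℤ} (ha : a ∈ Finset.Icc (1 : ℤ) 5) {t : ℕ} (ht : t ∈ Finset.range 11)
    (h : ∀ t' ∈ (Finset.range 11).erase t, (6 + 6 * a ^ 2 * crankExp t') % 11 ≠ 8) :
    ∃ R, Rem R ∧ ∀ q, 0 < q → q < 1 → LL q 1 (11 / 2 - a - 1 / 2) =
      qI q q * (crankTerm a t q / 11 + R q) - a / 11 := by
  have hd := not_eleven_dvd ha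
  obtain ⟨R, hR, hs⟩ := exists_rem_crankTerm hd ht h
  refine ⟨_, hR.const_mul (1 / 11), fun q hq hq1 => ?_⟩
  rw [crank_LL hq hq1 ha rfl rfl rfl rfl rfl (tate_psi hq hq1 hd).1]
  have := hs q
  simp only [crankTerm] at this ⊢
  rw [← Finset.mul_sum] at this
  linear_combination qI q q / 11 * this

/-- The theta quotient in the exceptional class of the crank. -/
noncomputable def thetaQuot (q : ℝ) : ℝ :=
  q ^ ((1 : ℝ) / 24) * hh q ^ 2 * (psi q 1 ^ (1 : ℤ) * psi q 2 ^ (0 : ℤ) * psi q 3 ^ (0 : ℤ) *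
    psi q 4 ^ (-1 : ℤ) * psi q 5 ^ (-1 : ℤ))

lemma crankTerm_four (hq : 0 < q) (hq1 : q < 1) : crankTerm 4 5 q = 2 * thetaQuot q := by
  obtain ⟨n1, n2, n3, n4, n5⟩ := psi_ne_zero_tuple hq hq1
  have w2 : psi q (2 * 4) = -psi q 3 := psi_eq_neg (by norm_num)
  have w3 : psi q (3 * 4) = psi q 1 := psi_eq_of_dvd (by norm_num)
  have w4 : psi q (4 * 4) = psi q 5 := psi_eq_of_dvd (by norm_num)
  have w5 : psi q (5 * 4) = -psi q 2 := psi_eq_neg (by norm_num)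
  rw [crankTerm, crankSol, mon, thetaQuot, tl, tm, tx, ty, tp, ts, w2, w3, w4, w5]
  field_simp

lemma crankTerm_five (hq : 0 < q) (hq1 : q < 1) : crankTerm 5 2 q = -3 * thetaQuot q := by
  obtain ⟨n1, n2, n3, n4, n5⟩ := psi_ne_zero_tuple hq hq1
  have w2 : psi q (2 * 5) = -psi q 1 := psi_eq_neg (by norm_num)
  have w3 : psi q (3 * 5) = psi q 4 := psi_eq_of_dvd (by norm_num)
  have w4 : psi q (4 * 5) = -psi q 2 := psi_eq_neg (by norm_num)
  have w5 : psi q (5 * 5) = psi q 3 := psi_eq_of_dvd (by norm_num)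
  rw [crankTerm, crankSol, mon, thetaQuot, tl, tm, tx, ty, tp, ts, w2, w3, w4, w5]
  field_simp

lemma thetaQuot_eq (hq : 0 < q) (hq1 : q < 1) : thetaQuot q = monBase q *
    (tx 1 q * ty 1 q * tp 1 q * ts 1 q ^ 4 *
      (tx 1 q ^ 2 - tx 1 q * ty 1 q - 4 * tx 1 q - 2 * ty 1 q - 1)) := by
  have H := tate_psi_one hq hq1
  have hD := (tate_psi hq hq1 (a := 1) (by norm_num)).2
  rw [thetaQuot, zpow_prod_eq_mon H 1 0 0 (-1) (-1) (-4), monBase, mon, mon]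
  rw [tD] at hD
  have := H.l0; have := H.m0; have := H.x0; have := H.y0; have := H.p0; have := H.s0
  generalize tl 1 q = l, tm 1 q = m, tx 1 q = x, ty 1 q = y, tp 1 q = p, ts 1 q = s at *
  norm_num
  field_simp at hD ⊢
  linear_combination hh q ^ 2 * hD

end exceptional

section positivity

variable {q : ℝ}

/-- A monomial in the theta values, with the normalization of the exceptional class. -/
noncomputable def thetaMon (e₁ e₂ e₃ e₄ e₅ : ℕ) (q : ℝ) : ℝ := q ^ ((1 : ℝ) / 24) * hh q ^ 2 *
  (hh q ^ 12 * (psi q 1 ^ (-e₁ : ℤ) * psi q 2 ^ (-e₂ : ℤ) * psi q 3 ^ (-e₃ : ℤ) *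
    psi q 4 ^ (-e₄ : ℤ) * psi q 5 ^ (-e₅ : ℤ)))

lemma thetaMon_eq {e₁ e₂ e₃ e₄ e₅ k : ℕ} (he : e₁ + e₂ + e₃ + e₄ + e₅ = 13)
    (hk : 5 * e₁ + 9 * e₂ + 12 * e₃ + 14 * e₄ + 15 * e₅ = 134 + 11 * k) (hq : 0 < q) (hq1 : q < 1) :
    thetaMon e₁ e₂ e₃ e₄ e₅ q = (-1) ^ (e₁ + e₃ + e₅) * (q ^ 8 * ((q ^ 11) ^ k * (eN (q ^ 11) *
      (((jN 1 (q ^ 11))⁻¹ ^ e₁ * (jN 2 (q ^ 11))⁻¹ ^ e₂ * (jN 3 (q ^ 11))⁻¹ ^ e₃ *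
      (jN 4 (q ^ 11))⁻¹ ^ e₄ * (jN 5 (q ^ 11))⁻¹ ^ e₅))))) := by
  have hE := eN_ne_zero (y := q ^ 11) (by positivity) (pow_lt_one₀ hq.le hq1 (by norm_num))
  have hh0 := hh_pos hq hq1
  have hP : ∀ n c : ℕ, (n : ℤ) ^ 2 - 11 * n = 2 * (-c : ℤ) → (psi q n)⁻¹ =
      q ^ c * ((-1) ^ n * ((jN n (q ^ 11))⁻¹ * (eN (q ^ 11) ^ 2 * (hh q ^ 3)⁻¹))) := fun n c hc => by
    have h := psi_div_hh hc hq hq1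
    have h1 : ((-1 : ℝ) ^ n)⁻¹ = (-1) ^ n := by rw [← inv_pow]; norm_num
    rw [← h1, (div_eq_iff (by positivity)).mp h, zpow_neg, zpow_natCast]
    simp only [mul_inv, inv_inv, inv_pow]
    field_simp
  have p1 := hP 1 5 (by norm_num)
  have p2 := hP 2 9 (by norm_num)
  have p3 := hP 3 12 (by norm_num)
  have p4 := hP 4 14 (by norm_num)
  have p5 := hP 5 15 (by norm_num)
  norm_num at p1 p2 p3 p4 p5
  have hc : q ^ ((1 : ℝ) / 24) * hh q ^ 2 * (hh q ^ 12 * ((q ^ 134 * q ^ (11 * k)) *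
      (eN (q ^ 11) ^ 26 * (hh q ^ 39)⁻¹))) = q ^ 8 * ((q ^ 11) ^ k * eN (q ^ 11)) := by
    have h1 : q ^ ((1 : ℝ) / 24) * q ^ 126 = (q ^ ((121 : ℝ) / 24)) ^ 25 := by
      rw [← rpow_natCast q, ← rpow_add hq, ← rpow_natCast (q ^ ((121 : ℝ) / 24)), ← rpow_mul hq.le]
      norm_num
    have h2 := hh_eq (q := q)
    have h3 : q ^ ((121 : ℝ) / 24) ≠ 0 := (rpow_pos_of_pos hq _).ne'
    rw [h2, pow_mul]
    generalize q ^ ((1 : ℝ) / 24) = w, q ^ ((121 : ℝ) / 24) = u, eN (q ^ 11) = E at *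
    field_simp
    linear_combination h1
  simp only [thetaMon, zpow_neg, zpow_natCast, ← inv_pow]
  rw [p1, p2, p3, p4, p5]
  rw [← pow_add, ← hk] at hc
  have hs : eN (q ^ 11) ^ 26 * (hh q ^ 39)⁻¹ = (eN (q ^ 11) ^ 2 * (hh q ^ 3)⁻¹) ^ (e₁ + e₂ + e₃ + e₄ + e₅) := by
    rw [he, mul_pow, inv_pow, ← pow_mul, ← pow_mul]
  rw [hs] at hc
  linear_combination (-1) ^ (e₁ + e₃ + e₅) * ((jN 1 (q ^ 11))⁻¹ ^ e₁ * (jN 2 (q ^ 11))⁻¹ ^ e₂ * (jN 3 (q ^ 11))⁻¹ ^ e₃ *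
      (jN 4 (q ^ 11))⁻¹ ^ e₄ * (jN 5 (q ^ 11))⁻¹ ^ e₅) * hc

lemma NN.thetaMon {e₁ e₂ e₃ e₄ e₅ : ℕ} (h : 0 < e₄) (k : ℕ) : NN fun y => 11 * (y ^ k * (eN y *
    ((jN 1 y)⁻¹ ^ e₁ * (jN 2 y)⁻¹ ^ e₂ * (jN 3 y)⁻¹ ^ e₃ * (jN 4 y)⁻¹ ^ e₄ * (jN 5 y)⁻¹ ^ e₅))) := by
  obtain ⟨e, rfl⟩ := Nat.exists_eq_succ_of_ne_zero h.ne'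
  have hj : ∀ n : ℕ, 0 < n → n < 11 → ∀ e, NN fun y => (jN n y)⁻¹ ^ e := fun n h1 h2 e =>
    (NN.inv_jN h1 h2).pow e
  refine ((NN.const (a := 11) (by norm_num)).mul ((NN.monomial k).mul
    ((NN.eN_div_jN (n := 4) (by norm_num) (by norm_num)).mul
    (((((hj 1 (by norm_num) (by norm_num) e₁).mul (hj 2 (by norm_num) (by norm_num) e₂)).mul
    (hj 3 (by norm_num) (by norm_num) e₃)).mul (hj 4 (by norm_num) (by norm_num) e)).mul
    (hj 5 (by norm_num) (by norm_num) e₅))))).congr fun y _ _ => ?_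
  rw [pow_succ]
  ring

end positivity

section identities

variable {q : ℝ}

lemma exceptional_identity_one (hq : 0 < q) (hq1 : q < 1) : 2 * rankTerm 1 6 q - 5 * rankTerm 2 5
  q + 3 * rankTerm 3 4 q + 6 * rankTerm 4 2 q - 5 * rankTerm 5 10 q - 55 * thetaQuot q = 121 *
  ((-1) ^ 6 * thetaMon 0 3 2 4 4 q) := by
  have H := tate_psi_one hq hq1
  have hM := zpow_prod_eq_mon H 0 (-3) (-2) (-4) (-4) (-18)
  have h0 := mon_red H (-13) 4 6 10 3 11 0 2 1 1 5
  have hV : thetaMon 0 3 2 4 4 q = (monBase q * (tx 1 q ^ 2 * ty 1 q ^ 1 * tp 1 q ^ 1 * ts 1 q ^ 5))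
    := by
    rw [thetaMon, monBase]
    norm_num at h0 hM ⊢
    rw [hM, h0]
    ring
  rw [hV, rankTerm_one hq hq1, rankTerm_two hq hq1, rankTerm_three hq hq1, rankTerm_four hq hq1,
    rankTerm_five hq hq1, thetaQuot_eq hq hq1, H.hp, H.hs]
  have hF := H.hF
  generalize tx 1 q = x, ty 1 q = y at hF ⊢
  linear_combination monBase q * ((-25) * y - 75 * y ^ 2 - 75 * y ^ 3 - 25 * y ^ 4 + 19 * x
    + 181 * x * y + 438 * x * y ^ 2 + 439 * x * y ^ 3 + 193 * x * y ^ 4 + 30 * x * y ^ 5 - 25 * x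
    ^ 2 - 195 * x ^ 2 * y - 429 * x ^ 2 * y ^ 2 - 334 * x ^ 2 * y ^ 3 - 75 * x ^ 2 * y ^
    4 + 45 * x ^ 3 * y + 186 * x ^ 3 * y ^ 2 + 165 * x ^ 3 * y ^ 3 + 21 * x ^ 3 * y ^ 4 - 33 * x
    ^ 4 * y ^ 2 - 39 * x ^ 4 * y ^ 3 - 3 * x ^ 5 * y ^ 2) * hF

lemma exceptional_identity_two (hq : 0 < q) (hq1 : q < 1) : (-6) * rankTerm 1 6 q + 4 * rankTerm 2 5
  q - 9 * rankTerm 3 4 q - 7 * rankTerm 4 2 q + 4 * rankTerm 5 10 q + 33 * thetaQuot q = 121 *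
  ((-1) ^ 6 * thetaMon 0 4 4 3 2 q) := by
  have H := tate_psi_one hq hq1
  have hM := zpow_prod_eq_mon H 0 (-4) (-4) (-3) (-2) (-14)
  have h0 := mon_red H (-13) 4 7 11 4 9 0 3 2 2 3
  have hV : thetaMon 0 4 4 3 2 q = -(monBase q * (tx 1 q ^ 3 * ty 1 q ^ 2 * tp 1 q ^ 2 * ts 1 q ^
    3)) := by
    rw [thetaMon, monBase]
    norm_num at h0 hM ⊢
    rw [hM, h0]
    ring
  rw [hV, rankTerm_one hq hq1, rankTerm_two hq hq1, rankTerm_three hq hq1, rankTerm_four hq hq1,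
    rankTerm_five hq hq1, thetaQuot_eq hq hq1, H.hp, H.hs]
  have hF := H.hF
  generalize tx 1 q = x, ty 1 q = y at hF ⊢
  linear_combination monBase q * (75 * y + 225 * y ^ 2 + 225 * y ^ 3 + 75 * y ^ 4 - 24 * x -
    268 * x * y - 632 * x * y ^ 2 - 591 * x * y ^ 3 - 238 * x * y ^ 4 - 35 * x * y ^
    5 + 31 * x ^ 2 + 167 * x ^ 2 * y + 297 * x ^ 2 * y ^ 2 + 100 * x ^ 2 * y ^ 3 - 61 * x ^ 2 * y
    ^ 4 + 19 * x ^ 3 * y - 96 * x ^ 3 * y ^ 2 - 33 * x ^ 3 * y ^ 3 + 91 * x ^ 3 * y ^ 4 + 99 *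
    x ^ 4 * y ^ 2 + 117 * x ^ 4 * y ^ 3 + 9 * x ^ 5 * y ^ 2) * hF

lemma exceptional_identity_three (hq : 0 < q) (hq1 : q < 1) : 10 * rankTerm 1 6 q + 8 * rankTerm 2 5
  q + 4 * rankTerm 3 4 q - 3 * rankTerm 4 2 q - 3 * rankTerm 5 10 q + 11 * thetaQuot q = 121 *
  ((-1) ^ 7 * thetaMon 0 2 4 4 3 q) := by
  have H := tate_psi_one hq hq1
  have hM := zpow_prod_eq_mon H 0 (-2) (-4) (-4) (-3) (-17)
  have h0 := mon_red H (-13) 4 7 10 3 10 0 3 1 1 4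
  have hV : thetaMon 0 2 4 4 3 q = -(monBase q * (tx 1 q ^ 3 * ty 1 q ^ 1 * tp 1 q ^ 1 * ts 1 q ^
    4)) := by
    rw [thetaMon, monBase]
    norm_num at h0 hM ⊢
    rw [hM, h0]
    ring
  rw [hV, rankTerm_one hq hq1, rankTerm_two hq hq1, rankTerm_three hq hq1, rankTerm_four hq hq1,
    rankTerm_five hq hq1, thetaQuot_eq hq hq1, H.hp, H.hs]
  have hF := H.hF
  generalize tx 1 q = x, ty 1 q = y at hF ⊢
  linear_combination monBase q * ((-114) * y - 342 * y ^ 2 - 342 * y ^ 3 - 114 * y ^ 4 + 18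
    * x + 80 * x * y + 89 * x * y ^ 2 - 5 * x * y ^ 3 - 47 * x * y ^ 4 - 15 * x * y ^ 5 -
    15 * x ^ 2 + 15 * x ^ 2 * y + 143 * x ^ 2 * y ^ 2 + 233 * x ^ 2 * y ^ 3 + 120 * x ^ 2 * y ^ 4
    + 16 * x ^ 3 * y + 116 * x ^ 3 * y ^ 2 + 88 * x ^ 3 * y ^ 3 - 16 * x ^ 3 * y ^ 4 - 44 * x
    ^ 4 * y ^ 2 - 52 * x ^ 4 * y ^ 3 - 4 * x ^ 5 * y ^ 2) * hF

lemma exceptional_identity_four (hq : 0 < q) (hq1 : q < 1) : (-7) * rankTerm 1 6 q - 10 *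
  rankTerm 2 5 q + 6 * rankTerm 3 4 q + 1 * rankTerm 4 2 q + 12 * rankTerm 5 10 q - 11 *
  thetaQuot q = 121 * ((-1) ^ 7 * thetaMon 0 1 2 5 5 q) := by
  have H := tate_psi_one hq hq1
  have hM := zpow_prod_eq_mon H 0 (-1) (-2) (-5) (-5) (-21)
  have h0 := mon_red H (-13) 4 6 9 2 12 0 2 0 0 6
  have hV : thetaMon 0 1 2 5 5 q = (monBase q * (tx 1 q ^ 2 * ty 1 q ^ 0 * tp 1 q ^ 0 * ts 1 q ^ 6))
    := by
    rw [thetaMon, monBase]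
    norm_num at h0 hM ⊢
    rw [hM, h0]
    ring
  rw [hV, rankTerm_one hq hq1, rankTerm_two hq hq1, rankTerm_three hq hq1, rankTerm_four hq hq1,
    rankTerm_five hq hq1, thetaQuot_eq hq hq1, H.hp, H.hs]
  have hF := H.hF
  generalize tx 1 q = x, ty 1 q = y at hF ⊢
  linear_combination monBase q * (71 * y + 213 * y ^ 2 + 213 * y ^ 3 + 71 * y ^ 4 + 71 * x + 439 * x
    * y + 854 * x * y ^ 2 + 680 * x * y ^ 3 + 199 * x * y ^ 4 + 5 * x * y ^ 5 + 49 * x ^ 2 - 115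
    * x ^ 2 * y - 627 * x ^ 2 * y ^ 2 - 635 * x ^ 2 * y ^ 3 - 172 * x ^ 2 * y ^ 4 + 90 * x
    ^ 3 * y + 372 * x ^ 3 * y ^ 2 + 330 * x ^ 3 * y ^ 3 + 42 * x ^ 3 * y ^ 4 - 66 * x ^ 4 * y ^ 2
    - 78 * x ^ 4 * y ^ 3 - 6 * x ^ 5 * y ^ 2) * hF

lemma exceptional_identity_five (hq : 0 < q) (hq1 : q < 1) : (-5) * rankTerm 1 6 q - 4 * rankTerm
  2 5 q - 2 * rankTerm 3 4 q + 7 * rankTerm 4 2 q + 7 * rankTerm 5 10 q + 11 * thetaQuot q = 121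
  * ((-1) ^ 6 * thetaMon 3 3 3 4 0 q) := by
  have H := tate_psi_one hq hq1
  have hM := zpow_prod_eq_mon H (-3) (-3) (-3) (-4) 0 (-10)
  have h0 := mon_red H (-13) 4 6 12 4 8 0 2 3 2 2
  have hV : thetaMon 3 3 3 4 0 q = (monBase q * (tx 1 q ^ 2 * ty 1 q ^ 3 * tp 1 q ^ 2 * ts 1 q ^ 2))
    := by
    rw [thetaMon, monBase]
    norm_num at h0 hM ⊢
    rw [hM, h0]
    ring
  rw [hV, rankTerm_one hq hq1, rankTerm_two hq hq1, rankTerm_three hq hq1, rankTerm_four hq hq1,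
    rankTerm_five hq hq1, thetaQuot_eq hq hq1, H.hp, H.hs]
  have hF := H.hF
  generalize tx 1 q = x, ty 1 q = y at hF ⊢
  linear_combination monBase q * (57 * y + 171 * y ^ 2 + 171 * y ^ 3 + 57 * y ^ 4 + 2 * x - 29 *
    x * y + 71 * x * y ^ 2 + 272 * x * y ^ 3 + 205 * x * y ^ 4 + 35 * x * y ^ 5 - 9 * x ^ 2 -
    13 * x ^ 2 * y - 110 * x ^ 2 * y ^ 2 - 243 * x ^ 2 * y ^ 3 - 137 * x ^ 2 * y ^ 4 -
    8 * x ^ 3 * y - 58 * x ^ 3 * y ^ 2 - 44 * x ^ 3 * y ^ 3 + 8 * x ^ 3 * y ^ 4 + 22 * x ^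
    4 * y ^ 2 + 26 * x ^ 4 * y ^ 3 + 2 * x ^ 5 * y ^ 2) * hF

end identities

section inequalities

/-- The generating functions modulo terms with exponents not congruent to `8` modulo `11`. -/
lemma exists_rem_gen : ∃ R : Fin 8 → ℝ → ℝ, (∀ i, Rem (R i)) ∧ ∀ q : ℝ, 0 < q → q < 1 / 2 →
    rankGF 0 q = -2 / 11 * rankTerm 2 5 q + R 0 q + (qI q q)⁻¹ / 11 ∧
    rankGF 1 q = 1 / 11 * (rankTerm 5 10 q + rankTerm 2 5 q) + R 1 q + (qI q q)⁻¹ / 11 ∧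
    rankGF 2 q = 1 / 11 * (rankTerm 1 6 q - rankTerm 5 10 q) + R 2 q + (qI q q)⁻¹ / 11 ∧
    rankGF 3 q = 1 / 11 * (-rankTerm 3 4 q - rankTerm 1 6 q) + R 3 q + (qI q q)⁻¹ / 11 ∧
    rankGF 4 q = 1 / 11 * (rankTerm 4 2 q + rankTerm 3 4 q) + R 4 q + (qI q q)⁻¹ / 11 ∧
    rankGF 5 q = -1 / 11 * rankTerm 4 2 q + R 5 q + (qI q q)⁻¹ / 11 ∧
    crankGF 0 q = -6 / 11 * thetaQuot q + R 6 q + (qI q q)⁻¹ / 11 ∧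
    crankGF 1 q = 5 / 11 * thetaQuot q + R 7 q + (qI q q)⁻¹ / 11 := by
  obtain ⟨R1, r1, h1⟩ := exists_rem_rank_LL (a := 1) (t := 6) (by decide) (by decide) (by decide)
    (by decide)
  obtain ⟨R2, r2, h2⟩ := exists_rem_rank_LL (a := 2) (t := 5) (by decide) (by decide) (by decide)
    (by decide)
  obtain ⟨R3, r3, h3⟩ := exists_rem_rank_LL (a := 3) (t := 4) (by decide) (by decide) (by decide)
    (by decide)
  obtain ⟨R4, r4, h4⟩ := exists_rem_rank_LL (a := 4) (t := 2) (by decide) (by decide) (by decide)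
    (by decide)
  obtain ⟨R5, r5, h5⟩ := exists_rem_rank_LL (a := 5) (t := 10) (by decide) (by decide) (by decide)
    (by decide)
  obtain ⟨S1, s1, g1⟩ := exists_rem_crank_LL (a := 4) (t := 5) (by decide) (by decide) (by decide)
  obtain ⟨S0, s0, g0⟩ := exists_rem_crank_LL (a := 5) (t := 2) (by decide) (by decide) (by decide)
  have i1 : Rem fun q => q ^ (-1 : ℤ) := (lu_zpow (-1)).1.rem (by decide)
  have i2 : Rem fun q => q ^ (1 : ℤ) := (lu_zpow 1).1.rem (by decide)
  refine ⟨![fun q => -2 * R2 q, fun q => R5 q + R2 q,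
    fun q => R1 q + (-1 * R5 q + -1 * q ^ (-1 : ℤ)),
    fun q => -1 * R3 q + (-1 * R1 q + q ^ (-1 : ℤ)), fun q => R4 q + R3 q, fun q => -1 * R4 q,
    fun q => 2 * S0 q + q ^ (1 : ℤ), fun q => S1 q + (-1 * S0 q + -1 * q ^ (1 : ℤ))], ?_, ?_⟩
  · intro i
    fin_cases i
    · exact r2.const_mul _
    · exact r5.add r2
    · exact r1.add ((r5.const_mul _).add (i1.const_mul _))
    · exact (r3.const_mul _).add ((r1.const_mul _).add i1)
    · exact r4.add r3
    · exact r4.const_mul _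
    · exact (s0.const_mul _).add i2
    · exact s1.add ((s0.const_mul _).add (i2.const_mul _))
  · intro q hq hq2
    have hq1 : q < 1 := by linarith
    have hE : qI q q ≠ 0 := qI_self_ne_zero hq hq1
    obtain ⟨a0, a1, a2, a3, a4, a5⟩ := rank_gen hq hq2
    obtain ⟨b0, b1⟩ := crank_gen hq hq2
    have k1 := h1 q hq hq1
    have k2 := h2 q hq hq1
    have k3 := h3 q hq hq1
    have k4 := h4 q hq hq1
    have k5 := h5 q hq hq1
    have l1 := g1 q hq hq1
    have l0 := g0 q hq hq1
    rw [crankTerm_four hq hq1] at l1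
    rw [crankTerm_five hq hq1] at l0
    norm_num at k1 k2 k3 k4 k5 l1 l0
    have key : ∀ {F X : ℝ}, F * qI q q = qI q q * X + 1 / 11 → F = X + (qI q q)⁻¹ / 11 := by
      intro F X h
      field_simp at h ⊢
      linarith
    simp only [zpow_neg, zpow_one, Matrix.cons_val]
    refine ⟨key ?_, key ?_, key ?_, key ?_, key ?_, key ?_, key ?_, key ?_⟩
    · rw [a0, k2]; ring
    · rw [a1, k5, k2]; ring
    · rw [a2, k1, k5]; ring
    · rw [a3, k3, k1]; ring
    · rw [a4, k4, k3]; ring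
    · rw [a5, k4]; ring
    · rw [b0, l0]; ring
    · rw [b1, l1, l0]; ring

lemma combination_nonneg {n₀ n₁ n₂ n₃ n₄ n₅ m₀ m₁ : ℤ}
    (hs : n₀ + n₁ + n₂ + n₃ + n₄ + n₅ + m₀ + m₁ = 0) {e₁ e₂ e₃ e₄ e₅ k : ℕ}
    (he : e₁ + e₂ + e₃ + e₄ + e₅ = 13) (h4 : 0 < e₄)
    (hk : 5 * e₁ + 9 * e₂ + 12 * e₃ + 14 * e₄ + 15 * e₅ = 134 + 11 * k)
    (hid : ∀ q : ℝ, 0 < q → q < 1 → ((n₂ - n₃ : ℤ) : ℝ) * rankTerm 1 6 q +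
      ((-2 * n₀ + n₁ : ℤ) : ℝ) * rankTerm 2 5 q + ((n₄ - n₃ : ℤ) : ℝ) * rankTerm 3 4 q +
      ((n₄ - n₅ : ℤ) : ℝ) * rankTerm 4 2 q + ((n₁ - n₂ : ℤ) : ℝ) * rankTerm 5 10 q +
      ((-6 * m₀ + 5 * m₁ : ℤ) : ℝ) * thetaQuot q =
      121 * ((-1) ^ (e₁ + e₃ + e₅) * thetaMon e₁ e₂ e₃ e₄ e₅ q)) (n : ℕ) :
    0 ≤ n₀ * (rankCount 0 11 (11 * n + 8) : ℤ) + n₁ * rankCount 1 11 (11 * n + 8) +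
      n₂ * rankCount 2 11 (11 * n + 8) + n₃ * rankCount 3 11 (11 * n + 8) +
      n₄ * rankCount 4 11 (11 * n + 8) + n₅ * rankCount 5 11 (11 * n + 8) +
      m₀ * crankCount 0 (11 * n + 8) + m₁ * crankCount 1 (11 * n + 8) := by
  obtain ⟨R, hR, h⟩ := exists_rem_gen
  have hc : ∀ a, crankCount a (11 * n + 8) = ((Finset.univ.filter fun ρ : Nat.Partition (11 * n + 8) =>
      partitionCrank ρ % 11 = a % 11).card : ℤ) := fun a => if_neg (by omega)
  have := coeff_nonneg (c := fun j => n₀ * (rankCount 0 11 j : ℝ) + n₁ * rankCount 1 11 j +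
      n₂ * rankCount 2 11 j + n₃ * rankCount 3 11 j + n₄ * rankCount 4 11 j + n₅ * rankCount 5 11 j +
      m₀ * ((Finset.univ.filter fun ρ : Nat.Partition j => partitionCrank ρ % 11 = 0 % 11).card : ℕ) +
      m₁ * ((Finset.univ.filter fun ρ : Nat.Partition j => partitionCrank ρ % 11 = 1 % 11).card : ℕ))
    (NN.thetaMon (e₁ := e₁) (e₂ := e₂) (e₃ := e₃) (e₅ := e₅) h4 k)
    ((((((((hR 0).const_mul n₀).add ((hR 1).const_mul n₁)).add ((hR 2).const_mul n₂)).add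
      ((hR 3).const_mul n₃)).add ((hR 4).const_mul n₄)).add ((hR 5).const_mul n₅)).add
      (((hR 6).const_mul m₀).add ((hR 7).const_mul m₁))) (fun q hq hq2 => ?_) n
  · rw [hc, hc]
    exact_mod_cast this
  · have hq1 : q < 1 := by linarith
    obtain ⟨a0, a1, a2, a3, a4, a5, b0, b1⟩ := h q hq hq2
    have hr := fun (b : ℤ) (h : 0 ≤ b ∧ b < 11) => hasSum_rankCount hq hq2 h.1 h.2
    have hr' := fun (b : ℤ) (h : 0 ≤ b ∧ b < 11) => hasSum_crankCard hq hq2 h.1 h.2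
    refine ((((((((hr 0 (by norm_num)).mul_left (n₀ : ℝ)).add
      ((hr 1 (by norm_num)).mul_left (n₁ : ℝ))).add ((hr 2 (by norm_num)).mul_left (n₂ : ℝ))).add
      ((hr 3 (by norm_num)).mul_left (n₃ : ℝ))).add ((hr 4 (by norm_num)).mul_left (n₄ : ℝ))).add
      ((hr 5 (by norm_num)).mul_left (n₅ : ℝ))).add (((hr' 0 (by norm_num)).mul_left (m₀ : ℝ)).add
      ((hr' 1 (by norm_num)).mul_left (m₁ : ℝ)))).congr_eq (fun j => by ring) ?_
    have hs' : (n₀ + n₁ + n₂ + n₃ + n₄ + n₅ + m₀ + m₁ : ℝ) = 0 := by exact_mod_cast hs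
    have hi := hid q hq hq1
    have h1 : (-1 : ℝ) ^ (e₁ + e₃ + e₅) * (-1) ^ (e₁ + e₃ + e₅) = 1 := by
      rw [← mul_pow]; norm_num
    rw [thetaMon_eq he hk hq hq1, ← mul_assoc ((-1 : ℝ) ^ _), h1, one_mul] at hi
    push_cast at hi
    rw [a0, a1, a2, a3, a4, a5, b0, b1]
    linear_combination -1 / 11 * hi - (qI q q)⁻¹ / 11 * hs'

end inequalities

end

/-- Rank-crank inequalities for the residue 8 modulo 11. -/
theorem rank_crank_inequalities_residue_eight (n : ℕ) :
    ((rankCount 0 11 (11  *  n  +  8) : ℤ)  +  2 * (rankCount 2 11 (11  *  n  +  8) : ℤ)  +  3 * (rankCount 4 11 (11  *  n  +  8) : ℤ)  +  5 * crankCount 0 (11  *  n  +  8) ≥ 3 * (rankCount 1 11 (11  *  n  +  8) : ℤ)  +  3 * (rankCount 5 11 (11  *  n  +  8) : ℤ)  +  5 * crankCount 1 (11  *  n  +  8))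
    ∧ (2 * (rankCount 1 11 (11  *  n  +  8) : ℤ)  +  4 * (rankCount 3 11 (11  *  n  +  8) : ℤ)  +  2 * (rankCount 5 11 (11  *  n  +  8) : ℤ)  +  3 * crankCount 1 (11  *  n  +  8) ≥ (rankCount 0 11 (11  *  n  +  8) : ℤ)  +  2 * (rankCount 2 11 (11  *  n  +  8) : ℤ)  +  5 * (rankCount 4 11 (11  *  n  +  8) : ℤ)  +  3 * crankCount 0 (11  *  n  +  8))
    ∧ (2 * (rankCount 1 11 (11  *  n  +  8) : ℤ)  +  5 * (rankCount 2 11 (11  *  n  +  8) : ℤ)  +  2 * (rankCount 5 11 (11  *  n  +  8) : ℤ)  +  crankCount 1 (11  *  n  +  8) ≥ 3 * (rankCount 0 11 (11  *  n  +  8) : ℤ)  +  5 * (rankCount 3 11 (11  *  n  +  8) : ℤ)  +  (rankCount 4 11 (11  *  n  +  8) : ℤ)  +  crankCount 0 (11  *  n  +  8))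
    ∧ (7 * (rankCount 0 11 (11  *  n  +  8) : ℤ)  +  4 * (rankCount 1 11 (11  *  n  +  8) : ℤ)  +  5 * (rankCount 4 11 (11  *  n  +  8) : ℤ)  +  4 * (rankCount 5 11 (11  *  n  +  8) : ℤ) ≥ 8 * (rankCount 2 11 (11  *  n  +  8) : ℤ)  +  (rankCount 3 11 (11  *  n  +  8) : ℤ)  +  4 * crankCount 0 (11  *  n  +  8)  +  7 * crankCount 1 (11  *  n  +  8))
    ∧ (5 * (rankCount 0 11 (11  *  n  +  8) : ℤ)  +  6 * (rankCount 1 11 (11  *  n  +  8) : ℤ)  +  4 * (rankCount 3 11 (11  *  n  +  8) : ℤ)  +  2 * (rankCount 4 11 (11  *  n  +  8) : ℤ) ≥ (rankCount 2 11 (11  *  n  +  8) : ℤ)  +  5 * (rankCount 5 11 (11  *  n  +  8) : ℤ)  +  6 * crankCount 0 (11  *  n  +  8)  +  5 * crankCount 1 (11  *  n  +  8)) := by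
  refine ⟨?_, ?_, ?_, ?_, ?_⟩
  · have h := combination_nonneg (n₀ := 1) (n₁ := -3) (n₂ := 2) (n₃ := 0) (n₄ := 3) (n₅ := -3) (m₀ := 5) (m₁ := -5)
      (e₁ := 0) (e₂ := 3) (e₃ := 2) (e₄ := 4) (e₅ := 4) (k := 3) (by norm_num) (by norm_num)
      (by norm_num) (by norm_num) (fun q hq hq1 => by
        have := exceptional_identity_one hq hq1
        norm_num at this ⊢
        linarith) n
    linarith
  · have h := combination_nonneg (n₀ := -1) (n₁ := 2) (n₂ := -2) (n₃ := 4) (n₄ := -5) (n₅ := 2) (m₀ := -3) (m₁ := 3)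
      (e₁ := 0) (e₂ := 4) (e₃ := 4) (e₄ := 3) (e₅ := 2) (k := 2) (by norm_num) (by norm_num)
      (by norm_num) (by norm_num) (fun q hq hq1 => by
        have := exceptional_identity_two hq hq1
        norm_num at this ⊢
        linarith) n
    linarith
  · have h := combination_nonneg (n₀ := -3) (n₁ := 2) (n₂ := 5) (n₃ := -5) (n₄ := -1) (n₅ := 2) (m₀ := -1) (m₁ := 1)
      (e₁ := 0) (e₂ := 2) (e₃ := 4) (e₄ := 4) (e₅ := 3) (k := 3) (by norm_num) (by norm_num)
      (by norm_num) (by norm_num) (fun q hq hq1 => by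
        have := exceptional_identity_three hq hq1
        norm_num at this ⊢
        linarith) n
    linarith
  · have h := combination_nonneg (n₀ := 7) (n₁ := 4) (n₂ := -8) (n₃ := -1) (n₄ := 5) (n₅ := 4) (m₀ := -4) (m₁ := -7)
      (e₁ := 0) (e₂ := 1) (e₃ := 2) (e₄ := 5) (e₅ := 5) (k := 4) (by norm_num) (by norm_num)
      (by norm_num) (by norm_num) (fun q hq hq1 => by
        have := exceptional_identity_four hq hq1
        norm_num at this ⊢
        linarith) n
    linarith
  · have h := combination_nonneg (n₀ := 5) (n₁ := 6) (n₂ := -1) (n₃ := 4) (n₄ := 2) (n₅ := -5) (m₀ := -6) (m₁ := -5)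
      (e₁ := 3) (e₂ := 3) (e₃ := 3) (e₄ := 4) (e₅ := 0) (k := 0) (by norm_num) (by norm_num)
      (by norm_num) (by norm_num) (fun q hq hq1 => by
        have := exceptional_identity_five hq hq1
        norm_num at this ⊢
        linarith) n
    linarith
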